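/- The class of graphs that are planar and generically rigid in the plane coincides exactly with the class of graphs of pseudo-triangulations of planar point sets in general position. -/

import Mathlib

/-! ## Combinatorial plane graphs via rotation systems -/

/-- The permutation of darts of a simple graph reversing each dart. -/
def dartSymmPerm {V : Type} (G : SimpleGraph V) : Equiv.Perm G.Dart where
  toFun := SimpleGraph.Dart.symm
  invFun := SimpleGraph.Dart.symm
  left_inv d := SimpleGraph.Dart.symm_symm d
  right_inv d := SimpleGraph.Dart.symm_symm d

/-- The setoid on `α` whose classes are the cycles (orbits) of a permutation `σ`. -/
def faceSetoid {α : Type} (σ : Equiv.Perm α) : Setoid α :=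
  ⟨σ.SameCycle, ⟨fun x => Equiv.Perm.SameCycle.refl σ x,
    fun h => h.symm, fun h h' => h.trans h'⟩⟩

/-- A (topological, non-crossing) embedding of a connected graph `G` in the plane, encoded
combinatorially: a rotation system (the counterclockwise cyclic order of the darts around
each vertex), which is planar in the sense of Euler's formula (the number of orbits of the
face permutation `rot * symm` is the number of faces), together with a distinguished
outer (unbounded) face.  A *plane graph* is a graph `G` together with such a structure. -/
structure PlaneEmb {V : Type} (G : SimpleGraph V) where
  rot : Equiv.Perm G.Dart
  rot_fst : ∀ d : G.Dart, (rot d).fst = d.fst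
  rot_vertex : ∀ d d' : G.Dart, d.fst = d'.fst → ∃ n : ℕ, (rot ^ n) d = d'
  connected : G.Connected
  outer : Quotient (faceSetoid (rot * dartSymmPerm G))
  euler : Nat.card V + Nat.card (Quotient (faceSetoid (rot * dartSymmPerm G)))
      = Nat.card G.edgeSet + 2

namespace PlaneEmb

variable {V : Type} {G : SimpleGraph V}

/-- The faces of a plane graph: orbits of the face permutation. -/
abbrev Face (E : PlaneEmb G) : Type := Quotient (faceSetoid (E.rot * dartSymmPerm G))

/-- The face having the dart `d` on its contour. -/
def dartFace (E : PlaneEmb G) (d : G.Dart) : E.Face :=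
  Quotient.mk (faceSetoid (E.rot * dartSymmPerm G)) d

/-- Each dart `d` determines an *angle* of the plane graph, namely the angle at the vertex
`d.fst` between the edges of `d` and `rot d`; `E.angleFace d` is the face this angle lies in. -/
def angleFace (E : PlaneEmb G) (d : G.Dart) : E.Face :=
  Quotient.mk (faceSetoid (E.rot * dartSymmPerm G)) d.symm

end PlaneEmb

/-- A vertex is *pointed* (w.r.t. an assignment `big` of which angles are labelled big)
if some angle at it is labelled big. -/
def PointedVx {V : Type} {G : SimpleGraph V} (big : G.Dart → Prop) (v : V) : Prop :=
  ∃ d : G.Dart, big d ∧ d.fst = v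

/-- A *combinatorial pseudo-triangulation labelling* (CPT-labelling): every bounded face has
exactly three small angles, all angles of the unbounded face are big, and no vertex is
incident to more than one big angle. -/
structure IsCPTLabelling {V : Type} {G : SimpleGraph V} (E : PlaneEmb G)
    (big : G.Dart → Prop) : Prop where
  bounded_small : ∀ F : E.Face, F ≠ E.outer →
    Nat.card {d : G.Dart | E.angleFace d = F ∧ ¬ big d} = 3
  outer_big : ∀ d : G.Dart, E.angleFace d = E.outer → big d
  one_big : ∀ d d' : G.Dart, big d → big d' → d.fst = d'.fst → d = d'

/-- The generalized Laman property of a combinatorial pseudo-triangulation: any `x` non-pointed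
plus `y` pointed vertices, with `x + y ≥ 2`, induce at most `3x + 2y - 3` edges. -/
def GenLaman {V : Type} (G : SimpleGraph V) (big : G.Dart → Prop) : Prop :=
  ∀ S : Set V, 2 ≤ Nat.card S →
    (Nat.card ((G.induce S).edgeSet) : ℤ) ≤
      3 * Nat.card {v ∈ S | ¬ PointedVx big v} + 2 * Nat.card {v ∈ S | PointedVx big v} - 3

/-! ## Rigidity -/

/-- Dot product in the plane. -/
def dot2 (u w : ℝ × ℝ) : ℝ := u.1 * w.1 + u.2 * w.2

/-- Rotation by 90 degrees. -/
def rot90 (u : ℝ × ℝ) : ℝ × ℝ := (-u.2, u.1)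

/-- `q` is an infinitesimal motion of the bar-and-joint framework `(G, p)`. -/
def IsInfMotion {V : Type} (G : SimpleGraph V) (p q : V → ℝ × ℝ) : Prop :=
  ∀ u v : V, G.Adj u v → dot2 (p u - p v) (q u - q v) = 0

/-- Trivial infinitesimal motions: those coming from rigid motions of the plane
(infinitesimal rotations and translations). -/
def IsTrivialMotion {V : Type} (p q : V → ℝ × ℝ) : Prop :=
  ∃ (a : ℝ) (t : ℝ × ℝ), ∀ v : V, q v = a • rot90 (p v) + t

/-- The framework `(G, p)` is infinitesimally rigid: it has no non-trivial infinitesimal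
motions. -/
def InfRigid {V : Type} (G : SimpleGraph V) (p : V → ℝ × ℝ) : Prop :=
  ∀ q : V → ℝ × ℝ, IsInfMotion G p q → IsTrivialMotion p q

/-- A configuration of points is *generic* if its coordinates are algebraically
independent over `ℚ`. -/
def GenericConf {V : Type} (p : V → ℝ × ℝ) : Prop :=
  AlgebraicIndependent ℚ (fun x : V ⊕ V => Sum.elim (fun v => (p v).1) (fun v => (p v).2) x)

/-- A graph is *generically rigid in the plane* if every generic framework on it has no
non-trivial infinitesimal motions. -/
def GenRigid {V : Type} (G : SimpleGraph V) : Prop :=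
  ∀ p : V → ℝ × ℝ, GenericConf p → InfRigid G p

/-- A graph is *isostatic* (generically minimally rigid) if it is generically rigid and
removing any edge destroys generic rigidity. -/
def Isostatic {V : Type} (G : SimpleGraph V) : Prop :=
  GenRigid G ∧ ∀ e ∈ G.edgeSet, ¬ GenRigid (G.deleteEdges {e})

/-- Laman's condition: exactly `2n - 3` edges, and every `k ≥ 2` vertices span at most
`2k - 3` edges. -/
def LamanGraph {V : Type} (L : SimpleGraph V) : Prop :=
  (Nat.card L.edgeSet : ℤ) = 2 * Nat.card V - 3 ∧
  ∀ S : Set V, 2 ≤ Nat.card S →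
    (Nat.card ((L.induce S).edgeSet) : ℤ) ≤ 2 * Nat.card S - 3

/-! ## Geometry: straight-line drawings, angles, stretching -/

/-- The counterclockwise angle from the direction `u` to the direction `w`,
normalized to lie in `(0, 2π]` (a full turn for `w` pointing in the direction of `u`). -/
noncomputable def ccwAngle (u w : ℝ × ℝ) : ℝ :=
  if 0 < Complex.arg ((⟨w.1, w.2⟩ : ℂ) / (⟨u.1, u.2⟩ : ℂ)) then
    Complex.arg ((⟨w.1, w.2⟩ : ℂ) / (⟨u.1, u.2⟩ : ℂ))
  else Complex.arg ((⟨w.1, w.2⟩ : ℂ) / (⟨u.1, u.2⟩ : ℂ)) + 2 * Real.pi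

/-- The (counterclockwise) geometric angle, in the straight-line drawing `p`, of the angle of
the dart `d`, i.e. the angle at `d.fst` between the edge of `d` and the edge of `rot d`. -/
noncomputable def dartAngle {V : Type} {G : SimpleGraph V} (E : PlaneEmb G)
    (p : V → ℝ × ℝ) (d : G.Dart) : ℝ :=
  ccwAngle (p d.snd - p d.fst) (p (E.rot d).snd - p (E.rot d).fst)

/-- A straight-line drawing is non-crossing: distinct edges meet only in common endpoints,
and no vertex lies on an edge not incident to it. -/
def NonCrossing {V : Type} (G : SimpleGraph V) (p : V → ℝ × ℝ) : Prop :=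
  (∀ a b c d : V, G.Adj a b → G.Adj c d → ({a, b} : Set V) ≠ {c, d} →
    segment ℝ (p a) (p b) ∩ segment ℝ (p c) (p d) ⊆ p '' ({a, b} ∩ {c, d} : Set V)) ∧
  (∀ x a b : V, G.Adj a b → x ≠ a → x ≠ b → p x ∉ segment ℝ (p a) (p b))

/-- The points of the drawing are in general position: no three of them are collinear. -/
def GenPos {V : Type} (p : V → ℝ × ℝ) : Prop :=
  ∀ u v w : V, u ≠ v → u ≠ w → v ≠ w → ¬ Collinear ℝ ({p u, p v, p w} : Set (ℝ × ℝ))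

/-- The straight-line drawing `p` realizes the plane graph `(G, E)`: it is injective and
non-crossing, and around every (non-isolated) vertex the counterclockwise angles between
rotation-consecutive darts sum to `2π`, so the drawing induces the given rotation system. -/
def RealizesEmb {V : Type} [Fintype V] [DecidableEq V] (G : SimpleGraph V)
    [DecidableRel G.Adj] (E : PlaneEmb G) (p : V → ℝ × ℝ) : Prop :=
  Function.Injective p ∧ NonCrossing G p ∧
  ∀ v : V, (∃ d : G.Dart, d.fst = v) →
    ∑ d ∈ Finset.univ.filter (fun d : G.Dart => d.fst = v), dartAngle E p d = 2 * Real.pi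

/-- The drawing `p` *stretches* the angle labelling `big` of the plane graph `(G, E)`:
it realizes the embedding, has its (finitely many) vertices in general position, and every
angle labelled big is reflex (> 180°) while every angle labelled small is convex (< 180°).
If `big` is a CPT-labelling this makes `p` a pseudo-triangulation of its vertex set:
every bounded face is a pseudo-triangle and the convex hull edges are present. -/
def Stretches {V : Type} [Fintype V] [DecidableEq V] (G : SimpleGraph V)
    [DecidableRel G.Adj] (E : PlaneEmb G) (big : G.Dart → Prop) (p : V → ℝ × ℝ) : Prop :=
  RealizesEmb G E p ∧ GenPos p ∧
  ∀ d : G.Dart, (big d → Real.pi < dartAngle E p d) ∧ (¬ big d → dartAngle E p d < Real.pi)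

/-- The drawing `p` makes the plane graph `(G, E)` a pseudo-triangulation of its vertex set
(with the given embedding): for the labelling of the angles of the drawing as big (reflex)
or small (convex), every bounded face has exactly three small angles (is a pseudo-triangle)
and all outer angles are big (so the convex hull edges are present). -/
def StretchesToPT {V : Type} [Fintype V] [DecidableEq V] (G : SimpleGraph V)
    [DecidableRel G.Adj] (E : PlaneEmb G) (p : V → ℝ × ℝ) : Prop :=
  ∃ big : G.Dart → Prop, IsCPTLabelling E big ∧ Stretches G E big p

/-- A vertex `v` of a geometric straight-line drawing is *pointed* if all the edges at `v`
lie in a closed half-plane supported at `v`. -/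
def GeoPointed {V : Type} (G : SimpleGraph V) (p : V → ℝ × ℝ) (v : V) : Prop :=
  ∃ u : ℝ × ℝ, u ≠ 0 ∧ ∀ w : V, G.Adj v w → 0 ≤ dot2 u (p w - p v)

/-! ## Subgraphs, outer face, corners -/

/-- One step of dual connectivity avoiding the edge set `A`: the faces `F`, `F'` are the two
sides of some edge of `G` not belonging to `A`. -/
def FaceStep {V : Type} {G : SimpleGraph V} (E : PlaneEmb G) (A : Set (Sym2 V)) :
    E.Face → E.Face → Prop :=
  fun F F' => ∃ d : G.Dart, E.dartFace d = F ∧ E.dartFace d.symm = F' ∧ d.edge ∉ A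

/-- The face `F` of `G` is contained in the outer (unbounded) face of the plane subgraph of
`G` with edge set `A`: `F` can reach the outer face of `G` in the dual graph without
crossing the edges of `A`. -/
def InOuterOf {V : Type} {G : SimpleGraph V} (E : PlaneEmb G) (A : Set (Sym2 V))
    (F : E.Face) : Prop :=
  Relation.ReflTransGen (FaceStep E A) F E.outer

/-- `v` is a *corner* of the subgraph `H` of the combinatorial pseudo-triangulation
`(G, E, big)`: either `v` is pointed in `G` and its big angle is contained in the
outer face of `H`, or `v` is non-pointed in `G` and two consecutive (small) angles at `v`
are contained in the outer face of `H`. -/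
def IsCPTCorner {V : Type} {G : SimpleGraph V} (E : PlaneEmb G) (big : G.Dart → Prop)
    (H : G.Subgraph) (v : V) : Prop :=
  (v ∈ H.verts ∧ ∃ d : G.Dart, big d ∧ d.fst = v ∧ InOuterOf E H.edgeSet (E.angleFace d)) ∨
  (v ∈ H.verts ∧ ¬ PointedVx big v ∧ ∃ d : G.Dart, d.fst = v ∧
    InOuterOf E H.edgeSet (E.angleFace d) ∧ InOuterOf E H.edgeSet (E.angleFace (E.rot d)) ∧
    (E.rot d).edge ∉ H.edgeSet)

/-- A plane graph has *non-degenerate faces* if no edge appears twice on the contour cycle of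
a face, i.e. the edges incident to every face form a simple closed cycle. -/
def NonDegenerateFaces {V : Type} {G : SimpleGraph V} (E : PlaneEmb G) : Prop :=
  ∀ d : G.Dart, ¬ (E.rot * dartSymmPerm G).SameCycle d d.symm




open Classical in
/-- edges of `E` spanned by `X` -/
noncomputable def spn {V : Type} (E : Finset (Sym2 V)) (X : Finset V) : Finset (Sym2 V) :=
  E.filter (fun e => ∀ x ∈ e, x ∈ X)

noncomputable def ii {V : Type} (E : Finset (Sym2 V)) (X : Finset V) : ℕ := (spn E X).card

def Sparse {V : Type} (E : Finset (Sym2 V)) : Prop :=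
  (∀ e ∈ E, ¬ e.IsDiag) ∧ ∀ X : Finset V, 2 ≤ X.card → ii E X + 3 ≤ 2 * X.card

def Tight {V : Type} (E : Finset (Sym2 V)) (X : Finset V) : Prop :=
  2 ≤ X.card ∧ ii E X + 3 = 2 * X.card

def LamanSet {V : Type} [Fintype V] (E : Finset (Sym2 V)) : Prop :=
  Sparse E ∧ E.card + 3 = 2 * Fintype.card V

section lamanA
variable {V : Type} {E : Finset (Sym2 V)}

lemma mem_spn {X : Finset V} {a b : V} :
    s(a,b) ∈ spn E X ↔ s(a,b) ∈ E ∧ a ∈ X ∧ b ∈ X := by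
  simp [spn]

lemma mem_spn' {X : Finset V} {e : Sym2 V} :
    e ∈ spn E X ↔ e ∈ E ∧ ∀ x ∈ e, x ∈ X := by
  simp [spn]

lemma spn_mono {X Y : Finset V} (h : X ⊆ Y) : spn E X ⊆ spn E Y := by
  intro e he
  simp only [spn, Finset.mem_filter] at he ⊢
  exact ⟨he.1, fun x hx => h (he.2 x hx)⟩

lemma Sparse.ne (h : Sparse E) {a b : V} (hab : s(a,b) ∈ E) : a ≠ b := by
  intro e; exact h.1 _ hab (by simpa using e)

lemma Sparse.mono {E' : Finset (Sym2 V)} (h : Sparse E) (h' : E' ⊆ E) : Sparse E' := by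
  refine ⟨fun e he => h.1 e (h' he), fun X hX => ?_⟩
  have := h.2 X hX
  have h2 : ii E' X ≤ ii E X := by
    apply Finset.card_le_card
    intro e; rw [mem_spn', mem_spn']; exact fun h => ⟨h' h.1, h.2⟩
  omega

open Classical in
lemma tight_union_inter (hE : Sparse E) {X Y : Finset V} (hX : Tight E X) (hY : Tight E Y)
    (h2 : 2 ≤ (X ∩ Y).card) :
    Tight E (X ∪ Y) ∧ Tight E (X ∩ Y) ∧ ∀ a b, s(a,b) ∈ E → a ∈ X ∪ Y → b ∈ X ∪ Y →
      (a ∈ X ∧ b ∈ X) ∨ (a ∈ Y ∧ b ∈ Y) := by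
  have h1 : spn E X ∩ spn E Y = spn E (X ∩ Y) := by
    ext e; induction e with | _ a b => 
    simp only [Finset.mem_inter, mem_spn]; tauto
  have h3 : spn E X ∪ spn E Y ⊆ spn E (X ∪ Y) :=
    Finset.union_subset (spn_mono Finset.subset_union_left) (spn_mono Finset.subset_union_right)
  have h4 := Finset.card_union_add_card_inter (spn E X) (spn E Y)
  have h5 := Finset.card_union_add_card_inter X Y
  have h6 := Finset.card_le_card h3
  have h7 := hE.2 (X ∩ Y) h2
  have h8 : X.card ≤ (X ∪ Y).card := Finset.card_le_card Finset.subset_union_left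
  have h9 := hE.2 (X ∪ Y) (by have := hX.1; omega)
  have hx := hX.2
  have hy := hY.2
  rw [h1] at h4
  simp only [ii] at *
  refine ⟨⟨by have := hX.1; omega, by simp only [ii]; omega⟩, ⟨h2, by simp only [ii]; omega⟩, ?_⟩
  intro a b hab ha hb
  have h10 := Finset.eq_of_subset_of_card_le h3 (by omega)
  have : s(a,b) ∈ spn E X ∪ spn E Y := by rw [h10, mem_spn]; exact ⟨hab, ha, hb⟩
  rw [Finset.mem_union, mem_spn, mem_spn] at this
  tauto

open Classical in
lemma tight_pair (hE : Sparse E) {a b : V} (hab : s(a,b) ∈ E) : Tight E {a,b} := by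
  have hne := hE.ne hab
  have hc : ({a,b} : Finset V).card = 2 := Finset.card_pair hne
  have h1 := hE.2 {a,b} (by omega)
  have h2 : 0 < ii E {a,b} := Finset.card_pos.2 ⟨s(a,b), by simp [mem_spn, hab]⟩
  exact ⟨by omega, by omega⟩

def Blk (E : Finset (Sym2 V)) (u v w : V) (X : Finset V) : Prop :=
  Tight E X ∧ u ∈ X ∧ v ∈ X ∧ w ∉ X ∧ 3 ≤ X.card

def Contr (E : Finset (Sym2 V)) (X : Finset V) (a b c : V) : Prop :=
  (a ∈ X ∧ b ∈ X ∧ c ∈ X) ∧ (s(a,b) ∈ E ∧ s(b,c) ∈ E ∧ s(a,c) ∈ E) ∧ ∀ Y ⊆ X, ¬ Blk E a b c Y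

lemma tight_meet (hE : Sparse E) {y z : V} (hyz : s(y,z) ∈ E)
    {P Q : Finset V} (hP : Tight E P) (hQ : Tight E Q) (yP : y ∈ P)
    (zP : z ∉ P) (zQ : z ∈ Q) (yQ : y ∉ Q) {a b : V} (ha : a ∈ P) (ha' : a ∈ Q)
    (hb : b ∈ P) (hb' : b ∈ Q) : a = b := by
  classical
  by_contra hab
  have h2 : 2 ≤ (P ∩ Q).card := by
    rw [← Finset.card_pair hab]
    apply Finset.card_le_card
    intro t; simp; rintro (rfl|rfl) <;> tauto
  have := (tight_union_inter hE hP hQ h2).2.2 y z hyz (by simp [yP]) (by simp [zQ])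
  tauto

/-- existence of contractible edges -/
theorem thmC (hE : Sparse E)
    (tri : ∀ Y, Tight E Y → 3 ≤ Y.card → ∃ x y z, (x ∈ Y ∧ y ∈ Y ∧ z ∈ Y) ∧
      s(x,y) ∈ E ∧ s(y,z) ∈ E ∧ s(x,z) ∈ E) :
    ∀ (n : ℕ) (X : Finset V), X.card ≤ n → Tight E X → ∀ u v w, (u ∈ X ∧ v ∈ X ∧ w ∈ X) →
      (s(u,v) ∈ E ∧ s(v,w) ∈ E ∧ s(u,w) ∈ E) →
      ∃ a b c, Contr E X a b c ∧ ∃ P ⊆ X, Tight E P ∧ u ∈ P ∧ v ∈ P ∧ w ∉ P ∧ a ∈ P ∧ b ∈ P := by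
  classical
  intro n
  induction n with
  | zero => 
    intro X hX hT
    have := hT.1
    omega
  | succ n ih =>
    intro X hX hT u v w ⟨hu, hv, hw⟩ ⟨huv, hvw, huw⟩
    by_cases hC : Contr E X u v w
    · refine ⟨u, v, w, hC, {u,v}, ?_, tight_pair hE huv, by simp, by simp, ?_, by simp, by simp⟩
      · intro t; simp; rintro (rfl|rfl) <;> assumption
      · have := hE.ne hvw; have := hE.ne huw
        simp; tauto
    · have : ∃ Y ⊆ X, Blk E u v w Y := by
        by_contra hcon; push Not at hcon
        exact hC ⟨⟨hu,hv,hw⟩,⟨huv,hvw,huw⟩,hcon⟩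
      obtain ⟨Y0, hY0, hB0⟩ := this
      obtain ⟨Y, hYm, hYmax⟩ := Finset.exists_max_image
        (X.powerset.filter (fun Y => Blk E u v w Y)) Finset.card
        ⟨Y0, by simp [hY0, hB0]⟩
      simp only [Finset.mem_filter, Finset.mem_powerset, and_imp] at hYm hYmax
      obtain ⟨hYX, hB⟩ := hYm
      have hB' := hB
      obtain ⟨hYT, uY, vY, wY, hY3⟩ := hB'
      have hlt : Y.card < X.card := Finset.card_lt_card ⟨hYX, fun h => wY (h hw)⟩
      obtain ⟨x, y, z, ⟨hx, hy, hz⟩, hxy, hyz, hxz⟩ := tri Y hYT hY3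
      -- lifting a contractible edge of Y different from uv
      have key : ∀ a b c, Contr E Y a b c → s(a,b) ≠ s(u,v) → Contr E X a b c := by
        rintro a b c ⟨⟨ha, hb, hc⟩, he, hn⟩ hne
        refine ⟨⟨hYX ha, hYX hb, hYX hc⟩, he, ?_⟩
        rintro Z hZ ⟨hZT, aZ, bZ, cZ, hZ3⟩
        have hab := hE.ne he.1
        have hsub : {a,b} ⊆ Z ∩ Y := by
          intro t; simp; rintro (rfl|rfl) <;> tauto
        have hc2 : 2 ≤ (Z ∩ Y).card := by
          rw [← Finset.card_pair hab]; exact Finset.card_le_card hsub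
        obtain ⟨hU, hI, hcr⟩ := tight_union_inter hE hZT hYT hc2
        have hle : (Z ∩ Y).card ≤ 2 := by
          by_contra hcon
          exact hn (Z ∩ Y) Finset.inter_subset_right ⟨hI, by simp [aZ, ha], by simp [bZ, hb],
            by simp [cZ], by omega⟩
        have heq : {a,b} = Z ∩ Y := Finset.eq_of_subset_of_card_le hsub (by rw [Finset.card_pair hab]; exact hle)
        by_cases hwZ : w ∈ Z
        · have h1 := hcr u w huw (by simp [uY]) (by simp [hwZ])
          have h2 := hcr v w hvw (by simp [vY]) (by simp [hwZ])
          have h3 : u ∈ ({a,b} : Finset V) := by rw [heq]; simp; tauto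
          have h4 : v ∈ ({a,b} : Finset V) := by rw [heq]; simp; tauto
          have := hE.ne huv
          simp at h3 h4
          apply hne
          rw [Sym2.eq_iff]
          rcases h3 with rfl | rfl <;> rcases h4 with rfl | rfl <;> simp_all
        · have hBU : Blk E u v w (Z ∪ Y) := ⟨hU, by simp [uY], by simp [vY], by simp [hwZ, wY],
            hY3.trans (Finset.card_le_card Finset.subset_union_right)⟩
          have h1 := hYmax (Z ∪ Y) (Finset.union_subset hZ hYX) hBU
          have h5 := Finset.card_union_add_card_inter Z Y
          omega
      obtain ⟨a1, b1, c1, hC1, P1, hP1, hT1, xP1, yP1, zP1, aP1, bP1⟩ :=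
        ih Y (by omega) hYT x y z ⟨hx,hy,hz⟩ ⟨hxy,hyz,hxz⟩
      obtain ⟨a2, b2, c2, hC2, P2, hP2, hT2, xP2, zP2, yP2, aP2, bP2⟩ :=
        ih Y (by omega) hYT x z y ⟨hx,hz,hy⟩ ⟨hxz,by rwa [Sym2.eq_swap], hxy⟩
      by_cases h1 : s(a1,b1) = s(u,v)
      · by_cases h2 : s(a2,b2) = s(u,v)
        · exfalso
          have h3 := h1.trans h2.symm
          have hne := hE.ne hC1.2.1.1
          apply hne
          have : a1 ∈ P2 ∧ b1 ∈ P2 := by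
            rw [Sym2.eq_iff] at h3
            rcases h3 with ⟨rfl, rfl⟩ | ⟨rfl, rfl⟩ <;> tauto
          exact tight_meet hE hyz hT1 hT2 yP1 zP1 zP2 yP2 aP1 this.1 bP1 this.2
        · exact ⟨a2, b2, c2, key _ _ _ hC2 h2, Y, hYX, hYT, uY, vY, wY, hC2.1.1, hC2.1.2.1⟩
      · exact ⟨a1, b1, c1, key _ _ _ hC1 h1, Y, hYX, hYT, uY, vY, wY, hC1.1.1, hC1.1.2.1⟩

open Classical in
/-- The edge set of a triangle is sparse. -/
lemma sparse_tri {a b c : V} (hab : a ≠ b) (hbc : b ≠ c) (hac : a ≠ c) :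
    Sparse ({s(a,b), s(b,c), s(a,c)} : Finset (Sym2 V)) := by
  refine ⟨by simp [hab, hbc, hac], fun X hX => ?_⟩
  have h3 : ii ({s(a,b), s(b,c), s(a,c)} : Finset (Sym2 V)) X ≤ 3 :=
    (Finset.card_filter_le _ _).trans Finset.card_le_three
  by_cases hX3 : 3 ≤ X.card
  · omega
  have : ii ({s(a,b), s(b,c), s(a,c)} : Finset (Sym2 V)) X ≤ 1 := by
    apply Finset.card_le_one.2
    have hno : ¬ (a ∈ X ∧ b ∈ X ∧ c ∈ X) := by
      rintro ⟨h1, h2, h3⟩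
      apply hX3
      rw [← Finset.card_eq_three.2 ⟨a, b, c, hab, hac, hbc, rfl⟩]
      apply Finset.card_le_card
      intro t; simp; rintro (rfl|rfl|rfl) <;> assumption
    intro e he f hf
    simp only [spn, Finset.mem_filter, Finset.mem_insert, Finset.mem_singleton] at he hf
    obtain ⟨he, he'⟩ := he
    obtain ⟨hf, hf'⟩ := hf
    rcases he with rfl | rfl | rfl <;> rcases hf with rfl | rfl | rfl <;> simp at he' hf' ⊢ <;> tauto
  omega

open Classical in
lemma exchange [Fintype V] {G : Finset (Sym2 V)} {T : Finset (Sym2 V)} (hT : Sparse T) (hTG : T ⊆ G) :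
    ∀ (n : ℕ) (L : Finset (Sym2 V)), L ⊆ G → LamanSet L → (T \ L).card ≤ n →
    ∃ L', L' ⊆ G ∧ LamanSet L' ∧ T ⊆ L' := by
  intro n
  induction n with
  | zero =>
    intro L hL hLam h0
    exact ⟨L, hL, hLam, by simpa [Finset.sdiff_eq_empty_iff_subset] using h0⟩
  | succ n ih =>
    intro L hL hLam hn
    by_cases hsub : T ⊆ L
    · exact ⟨L, hL, hLam, hsub⟩
    obtain ⟨e, heT, heL⟩ := Finset.not_subset.1 hsub
    induction e with | _ a b =>
    have hab := hT.ne heT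
    have hV : Tight L Finset.univ := by
      constructor
      · rw [← Finset.card_pair hab]; exact Finset.card_le_card (Finset.subset_univ _)
      · have : spn L Finset.univ = L := by simp [spn]
        rw [ii, this, Finset.card_univ]; exact hLam.2
    obtain ⟨X, hXm, hXmin⟩ := Finset.exists_min_image
      (Finset.univ.filter (fun X : Finset V => Tight L X ∧ a ∈ X ∧ b ∈ X)) Finset.card
      ⟨Finset.univ, by simp [hV]⟩
    simp only [Finset.mem_filter, Finset.mem_univ, true_and, and_imp] at hXm hXmin
    obtain ⟨hXT, aX, bX⟩ := hXm
    have hmin : ∀ Y, Tight L Y → a ∈ Y → b ∈ Y → X ⊆ Y := by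
      intro Y hY aY bY
      have hc2 : 2 ≤ (X ∩ Y).card := by
        rw [← Finset.card_pair hab]; apply Finset.card_le_card
        intro t; simp; rintro (rfl|rfl) <;> tauto
      have h := (tight_union_inter hLam.1 hXT hY hc2).2.1
      have := hXmin _ h (by simp [aX, aY]) (by simp [bX, bY])
      have := Finset.eq_of_subset_of_card_le (Finset.inter_subset_left) this
      rw [← this]; exact Finset.inter_subset_right
    have hf : ∃ f ∈ spn L X, f ∉ T := by
      by_contra hcon; push Not at hcon
      have h1 : insert s(a,b) (spn L X) ⊆ spn T X := by
        intro f hf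
        rw [Finset.mem_insert] at hf
        rcases hf with rfl | hf
        · rw [mem_spn]; exact ⟨heT, aX, bX⟩
        · have := hcon f hf
          simp only [spn, Finset.mem_filter] at hf ⊢
          exact ⟨this, hf.2⟩
      have h2 := Finset.card_le_card h1
      rw [Finset.card_insert_of_notMem (by rw [mem_spn]; tauto)] at h2
      have h3 := hT.2 X hXT.1
      have h4 := hXT.2
      simp only [ii] at *
      omega
    obtain ⟨f, hfX, hfT⟩ := hf
    have hfL : f ∈ L := (mem_spn'.1 hfX).1
    have hfne : s(a,b) ∉ L.erase f := fun h => heL (Finset.mem_of_mem_erase h)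
    apply ih (insert s(a,b) (L.erase f))
    · intro g hg
      rw [Finset.mem_insert] at hg
      rcases hg with rfl | hg
      · exact hTG heT
      · exact hL (Finset.mem_of_mem_erase hg)
    · have hpos := Finset.card_pos.2 ⟨f, hfL⟩
      refine ⟨⟨?_, ?_⟩, ?_⟩
      · intro g hg
        rw [Finset.mem_insert] at hg
        rcases hg with rfl | hg
        · simpa using hab
        · exact hLam.1.1 _ (Finset.mem_of_mem_erase hg)
      · intro Y hY
        have hYs := hLam.1.2 Y hY
        have h1 : spn (insert s(a,b) (L.erase f)) Y ⊆ insert s(a,b) ((spn L Y).erase f) := by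
          intro g; simp only [spn, Finset.mem_filter, Finset.mem_insert, Finset.mem_erase]; tauto
        have hcc := Finset.card_le_card h1
        by_cases hin : a ∈ Y ∧ b ∈ Y
        · by_cases ht : Tight L Y
          · have hfY : f ∈ spn L Y := spn_mono (hmin Y ht hin.1 hin.2) hfX
            have h2 := Finset.card_insert_le s(a,b) ((spn L Y).erase f)
            have h3 := Finset.card_erase_of_mem hfY
            have h4 : 0 < (spn L Y).card := Finset.card_pos.2 ⟨f, hfY⟩
            simp only [ii] at *
            omega
          · have h2 := Finset.card_insert_le s(a,b) ((spn L Y).erase f)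
            have h3 := Finset.card_erase_le (s := spn L Y) (a := f)
            have : ii L Y + 3 ≠ 2 * Y.card := fun h => ht ⟨hY, h⟩
            simp only [ii] at *
            omega
        · have h1 : spn (insert s(a,b) (L.erase f)) Y ⊆ spn L Y := by
            intro g hg
            simp only [spn, Finset.mem_filter, Finset.mem_insert, Finset.mem_erase] at hg ⊢
            refine ⟨?_, hg.2⟩
            rcases hg.1 with rfl | h
            · exfalso; apply hin; have := hg.2; simp at this; exact this
            · exact h.2
          have h2 := Finset.card_le_card h1
          simp only [ii] at *
          omega
      · rw [Finset.card_insert_of_notMem hfne, Finset.card_erase_of_mem hfL]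
        have := hLam.2
        omega
    · have h1 : T \ insert s(a,b) (L.erase f) ⊆ (T \ L).erase s(a,b) := by
        intro g hg
        simp only [Finset.mem_sdiff, Finset.mem_insert, Finset.mem_erase] at hg ⊢
        refine ⟨by tauto, hg.1, fun h => ?_⟩
        apply hg.2; right; exact ⟨fun h' => hfT (h' ▸ hg.1), h⟩
      have h2 := Finset.card_le_card h1
      have h3 := Finset.card_erase_of_mem (s := T \ L) (a := s(a,b)) (by simp [heT, heL])
      omega

end lamanA

section contraction
variable {V : Type}

open Classical in
/-- contraction of `u` to `v` -/
noncomputable def cmap {u v : V} (h : v ≠ u) (x : V) : {x : V // x ≠ u} :=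
  if hx : x = u then ⟨v, h⟩ else ⟨x, hx⟩

lemma cmap_u {u v : V} (h : v ≠ u) : cmap h u = ⟨v, h⟩ := by simp [cmap]
lemma cmap_ne {u v : V} (h : v ≠ u) {x : V} (hx : x ≠ u) : cmap h x = ⟨x, hx⟩ := by simp [cmap, hx]
lemma cmap_eq {u v : V} (h : v ≠ u) {x y : V} (hxy : cmap h x = cmap h y) :
    x = y ∨ (x = u ∧ y = v) ∨ (x = v ∧ y = u) := by
  unfold cmap at hxy
  split_ifs at hxy <;> simp_all

open Classical in
noncomputable def cedges {u v : V} (h : v ≠ u) (w : V) (L : Finset (Sym2 V)) :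
    Finset (Sym2 {x : V // x ≠ u}) :=
  (L \ {s(u,v), s(u,w)}).image (Sym2.map (cmap h))

open Classical in
lemma laman_contract [Fintype V] {L : Finset (Sym2 V)} (hL : LamanSet L) {u v w : V} (h : v ≠ u)
    (hC : Contr L Finset.univ u v w) : LamanSet (cedges h w L) := by
  obtain ⟨-, ⟨huv, hvw, huw⟩, hB⟩ := hC
  have hS := hL.1
  have nvw := hS.ne hvw
  have nuw := hS.ne huw
  have hcommon : ∀ z, s(u,z) ∈ L → s(v,z) ∈ L → z = w := by
    intro z h1 h2
    by_contra hz
    have n1 := hS.ne h1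
    have n2 := hS.ne h2
    have hc : ({u,v,z} : Finset V).card = 3 := Finset.card_eq_three.2 ⟨u, v, z, h.symm, n1, n2, rfl⟩
    apply hB {u,v,z} (Finset.subset_univ _)
    refine ⟨⟨by omega, ?_⟩, by simp, by simp, by simp; tauto, by omega⟩
    have h3 := hS.2 {u,v,z} (by omega)
    have h4 : ({s(u,v), s(u,z), s(v,z)} : Finset (Sym2 V)) ⊆ spn L {u,v,z} := by
      intro e; simp only [Finset.mem_insert, Finset.mem_singleton]
      rintro (rfl|rfl|rfl) <;> rw [mem_spn] <;> simp [*]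
    have h5 := Finset.card_le_card h4
    have h6 : ({s(u,v), s(u,z), s(v,z)} : Finset (Sym2 V)).card = 3 := by
      rw [Finset.card_eq_three]
      refine ⟨_, _, _, ?_, ?_, ?_, rfl⟩ <;> simp <;> tauto
    simp only [ii] at *
    omega
  have hsubT : ({s(u,v), s(u,w)} : Finset (Sym2 V)) ⊆ L := by
    intro e; simp only [Finset.mem_insert, Finset.mem_singleton]
    rintro (rfl|rfl) <;> assumption
  have hc2 : ({s(u,v), s(u,w)} : Finset (Sym2 V)).card = 2 := by
    apply Finset.card_pair; simp; tauto
  have hinj : Set.InjOn (Sym2.map (cmap h)) (↑(L \ {s(u,v), s(u,w)}) : Set (Sym2 V)) := by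
    have aux : ∀ a b c d, s(a,b) ∈ L → s(c,d) ∈ L → s(a,b) ≠ s(u,v) → s(a,b) ≠ s(u,w) →
        s(c,d) ≠ s(u,v) → s(c,d) ≠ s(u,w) → cmap h a = cmap h c → cmap h b = cmap h d → 
        s(a,b) = s(c,d) := by
      intro a b c d hab hcd n1 n2 n3 n4 h1 h2
      have nab := hS.ne hab
      have ncd := hS.ne hcd
      have hab' : s(b,a) ∈ L := by rwa [Sym2.eq_swap]
      have hcd' : s(d,c) ∈ L := by rwa [Sym2.eq_swap]
      rcases cmap_eq h h1 with rfl | ⟨rfl, rfl⟩ | ⟨rfl, rfl⟩ <;>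
      rcases cmap_eq h h2 with rfl | ⟨rfl, rfl⟩ | ⟨rfl, rfl⟩
      · rfl
      · have := hcommon a hab' hcd'
        subst this; exact absurd Sym2.eq_swap n2
      · have := hcommon a hcd' hab'
        subst this; exact absurd Sym2.eq_swap n4
      · have := hcommon b hab hcd
        subst this; exact absurd rfl n2
      · exact absurd rfl nab
      · exact absurd rfl n1
      · have := hcommon b hcd hab
        subst this; exact absurd rfl n4
      · exact absurd rfl n3
      · exact absurd rfl nab
    intro e he f hf hef
    simp only [Finset.coe_sdiff, Finset.coe_insert, Finset.coe_singleton, Set.mem_sdiff,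
      Finset.mem_coe, Set.mem_insert_iff, Set.mem_singleton_iff, not_or] at he hf
    induction e with | _ a b =>
    induction f with | _ c d =>
    simp only [Sym2.map_mk, Sym2.eq_iff] at hef
    obtain ⟨he1, he2, he3⟩ := he
    obtain ⟨hf1, hf2, hf3⟩ := hf
    rcases hef with ⟨h1, h2⟩ | ⟨h1, h2⟩
    · exact aux _ _ _ _ he1 hf1 he2 he3 hf2 hf3 h1 h2
    · rw [Sym2.eq_swap (a := c)] at *
      exact aux _ _ _ _ he1 hf1 he2 he3 hf2 hf3 h1 h2
  have hcard : (cedges h w L).card + 2 = L.card := by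
    rw [cedges, Finset.card_image_of_injOn hinj, ← hc2]
    exact Finset.card_sdiff_add_card_eq_card hsubT
  have hV : Fintype.card {x : V // x ≠ u} + 1 = Fintype.card V := by
    rw [Fintype.card_subtype_compl]
    simp
    have : 0 < Fintype.card V := Fintype.card_pos_iff.2 ⟨u⟩
    omega
  refine ⟨⟨?_, ?_⟩, by have := hL.2; omega⟩
  · intro e he
    simp only [cedges, Finset.mem_image, Finset.mem_sdiff, Finset.mem_insert, Finset.mem_singleton, not_or] at he
    obtain ⟨f, ⟨hf, hf1, hf2⟩, rfl⟩ := he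
    induction f with | _ a b =>
    simp only [Sym2.map_mk, Sym2.mk_isDiag_iff]
    intro hab
    have nab := hS.ne hf
    rcases cmap_eq h hab with rfl | ⟨rfl, rfl⟩ | ⟨rfl, rfl⟩
    · exact nab rfl
    · exact hf1 rfl
    · exact hf1 Sym2.eq_swap
  · intro X' hX'
    -- preimage
    set X := Finset.univ.filter (fun x => cmap h x ∈ X') with hX
    have hle : ii (cedges h w L) X' ≤ (spn L X \ {s(u,v), s(u,w)}).card := by
      have : spn (cedges h w L) X' ⊆ (spn L X \ {s(u,v), s(u,w)}).image (Sym2.map (cmap h)) := by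
        intro e he
        simp only [mem_spn', cedges, Finset.mem_image] at he ⊢
        obtain ⟨⟨f, hf, rfl⟩, he⟩ := he
        refine ⟨f, ?_, rfl⟩
        rw [Finset.mem_sdiff] at hf ⊢
        refine ⟨?_, hf.2⟩
        rw [mem_spn']
        refine ⟨hf.1, fun x hx => ?_⟩
        simp only [hX, Finset.mem_filter, Finset.mem_univ, true_and]
        exact he _ (Sym2.mem_map.2 ⟨x, hx, rfl⟩)
      exact (Finset.card_le_card this).trans Finset.card_image_le
    have hXc : X.card = X'.card + if (⟨v, h⟩ : {x // x ≠ u}) ∈ X' then 1 else 0 := by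
      have : X = X'.map (Function.Embedding.subtype _) ∪ if (⟨v, h⟩ : {x // x ≠ u}) ∈ X' then {u} else ∅ := by
        ext x
        by_cases hxu : x = u
        · subst hxu
          split_ifs with hv <;> simp [hX, cmap_u, hv]
        · split_ifs with hv <;> simp [hX, cmap_ne h hxu, hxu]
      rw [this, Finset.card_union_of_disjoint]
      · rw [Finset.card_map]; split_ifs <;> simp
      · split_ifs <;> simp
    have hXs := hS.2 X (by omega)
    by_cases hv : (⟨v, h⟩ : {x // x ≠ u}) ∈ X'
    · rw [if_pos hv] at hXc
      have uX : u ∈ X := by simp [hX, cmap_u, hv]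
      have vX : v ∈ X := by simp [hX, cmap_ne h h, hv]
      by_cases hw : w ∈ X
      · have h1 : ({s(u,v), s(u,w)} : Finset (Sym2 V)) ⊆ spn L X := by
          intro e; simp only [Finset.mem_insert, Finset.mem_singleton]
          rintro (rfl|rfl) <;> rw [mem_spn] <;> tauto
        have h2 := Finset.card_sdiff_add_card_eq_card h1
        simp only [ii] at *
        omega
      · have h1 : ({s(u,v)} : Finset (Sym2 V)) ⊆ spn L X := by
          intro e; simp only [Finset.mem_singleton]
          rintro rfl; rw [mem_spn]; tauto
        have h2 := Finset.card_sdiff_add_card_eq_card h1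
        have h3 : spn L X \ {s(u,v), s(u,w)} ⊆ spn L X \ {s(u,v)} := by
          apply Finset.sdiff_subset_sdiff le_rfl; simp
        have h4 := Finset.card_le_card h3
        have h5 : ii L X + 3 ≠ 2 * X.card := by
          intro h6
          exact hB X (Finset.subset_univ _) ⟨⟨by omega, h6⟩, uX, vX, hw, by omega⟩
        simp only [ii, Finset.card_singleton] at *
        omega
    · rw [if_neg hv] at hXc
      have := Finset.card_le_card (Finset.sdiff_subset (s := spn L X) (t := {s(u,v), s(u,w)}))
      simp only [ii] at *
      omega

end contraction


/-- A plane map (with planarity encoded by exactness), possibly with parallel edges. -/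
structure PM (V D : Type) [Fintype D] where
  al : Equiv.Perm D
  ph : Equiv.Perm D
  vt : D → V
  out : D → Prop
  al_al : ∀ d, al (al d) = d
  vt_ph : ∀ d, vt (ph d) = vt (al d)
  trans : ∀ d e, vt d = vt e → ∀ P : D → Prop, (∀ x, P x → P (ph (al x))) → P d → P e
  conn : ∀ P : V → Prop, (∃ v, P v) → (∀ d, P (vt d) → P (vt (al d))) → ∀ v, P v
  surj : ∀ v, ∃ d, vt d = v
  exact : ∀ a : D → ℝ, (∀ d, a (al d) = - a d) →
    (∀ v, (open Classical in ∑ d, if vt d = v then a d else 0) = 0) →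
    ∃ g : D → ℝ, (∀ d, g (ph d) = g d) ∧ ∀ d, a d = g d - g (al d)
  out_ph : ∀ d, out (ph d) ↔ out d
  out_cyc : ∀ d e, out d → out e → ∀ P : D → Prop, (∀ x, P x → P (ph x)) → P d → P e
  out_ne : ∃ d, out d

namespace PM
variable {V D : Type} [Fintype D] (M : PM V D)

structure Simple : Prop where
  simple : ∀ d e, M.vt d = M.vt e → M.vt (M.al d) = M.vt (M.al e) → d = e
  noloop : ∀ d, M.vt d ≠ M.vt (M.al d)

def edge (d : D) : Sym2 V := s(M.vt d, M.vt (M.al d))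

open Classical in
noncomputable def edges : Finset (Sym2 V) := Finset.univ.image M.edge

lemma edge_al (d : D) : M.edge (M.al d) = M.edge d := by
  simp only [edge, M.al_al]; exact Sym2.eq_swap

lemma mem_edges {e : Sym2 V} : e ∈ M.edges ↔ ∃ d, M.edge d = e := by simp [edges]

lemma edge_mem (d : D) : M.edge d ∈ M.edges := M.mem_edges.2 ⟨d, rfl⟩

lemma exists_dart {a b : V} (h : s(a,b) ∈ M.edges) : ∃ d, M.vt d = a ∧ M.vt (M.al d) = b := by
  obtain ⟨d, hd⟩ := M.mem_edges.1 h
  simp only [edge, Sym2.eq_iff] at hd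
  rcases hd with h | h
  · exact ⟨d, h⟩
  · exact ⟨M.al d, h.2, by rw [M.al_al]; exact h.1⟩

variable {M}

lemma Simple.eq_of_edge (hs : M.Simple) {d e : D} (h : M.edge d = M.edge e) : d = e ∨ d = M.al e := by
  simp only [edge, Sym2.eq_iff] at h
  rcases h with h | h
  · left; exact hs.simple _ _ h.1 h.2
  · right; exact hs.simple _ _ h.1 (by rw [M.al_al]; exact h.2)

lemma Simple.al_ne (hs : M.Simple) (d : D) : M.al d ≠ d := by
  intro h; apply hs.noloop d; rw [h]

lemma closed_inv (f : Equiv.Perm D) (P : D → Prop) (h : ∀ x, P x → P (f x)) : ∀ x, P (f x) ↔ P x := by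
  intro x
  refine ⟨fun hx => ?_, h x⟩
  have h1 : ∀ n : ℕ, ∀ y, P y → P ((f ^ n) y) := by
    intro n; induction n with
    | zero => intro y hy; simpa using hy
    | succ n ih => intro y hy; rw [pow_succ', Equiv.Perm.mul_apply]; exact h _ (ih y hy)
  have h2 := h1 (orderOf f - 1) _ hx
  have h3 : (f ^ (orderOf f - 1)) (f x) = x := by
    rw [← Equiv.Perm.mul_apply, ← pow_succ, Nat.sub_add_cancel (orderOf_pos f), pow_orderOf_eq_one]
    rfl
  rwa [h3] at h2

/-- nonempty sets of darts closed under both permutations are everything -/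
lemma all_closed (P : D → Prop) (h1 : ∀ x, P x → P (M.ph x)) (h2 : ∀ x, P x → P (M.al x))
    {d : D} (hd : P d) : ∀ e, P e := by
  have key : ∀ x, P x → ∀ e, M.vt e = M.vt x → P e := fun x hx e he =>
    M.trans x e he.symm P (fun y hy => h1 _ (h2 _ hy)) hx
  have := M.conn (fun v => ∀ e, M.vt e = v → P e) ⟨M.vt d, key d hd⟩
    (fun x hx => key _ (h2 x (hx x rfl)))
  exact fun e => this _ e rfl

lemma deg2 {E : Finset (Sym2 V)} (hE : Sparse E) {Y : Finset V} (hY : Tight E Y) (h3 : 3 ≤ Y.card)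
    {y : V} (hy : y ∈ Y) (b : V) : ∃ t ∈ Y, t ≠ b ∧ s(y,t) ∈ E := by
  classical
  by_contra hcon
  push Not at hcon
  have h1 : spn E Y ⊆ insert s(y,b) (spn E (Y.erase y)) := by
    intro e he
    induction e with | _ p q =>
    rw [mem_spn] at he
    rw [Finset.mem_insert, mem_spn, Finset.mem_erase, Finset.mem_erase]
    by_cases hp : p = y
    · subst hp
      left
      by_contra hne
      exact hcon q he.2.2 (fun h => hne (by rw [h])) he.1
    · by_cases hq : q = y
      · subst hq
        left
        by_contra hne
        exact hcon p he.2.1 (fun h => hne (by rw [h]; exact Sym2.eq_swap)) (by rw [Sym2.eq_swap]; exact he.1)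
      · right; tauto
  have h2 := Finset.card_le_card h1
  have h4 := Finset.card_insert_le s(y,b) (spn E (Y.erase y))
  have h5 := Finset.card_erase_of_mem hy
  have h6 := hE.2 (Y.erase y) (by omega)
  have h7 := hY.2
  simp only [ii] at *
  omega

/-- successor of an `H`-dart in its region -/
lemma succ_dart (hs : M.Simple) {H : Finset (Sym2 V)} {d : D}
    (R : D → Prop) (hRph : ∀ x, R x → R (M.ph x)) (hRal : ∀ x, M.edge x ∉ H → R x → R (M.al x))
    (hR : R d) (hdeg : ∃ t, t ≠ M.vt d ∧ s(M.vt (M.al d), t) ∈ M.edges ∧ s(M.vt (M.al d), t) ∈ H) :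
    ∃ e, M.edge e ∈ H ∧ R e ∧ M.vt e = M.vt (M.al d) ∧ M.vt (M.al e) ≠ M.vt d := by
  by_contra hcon
  push Not at hcon
  have hcon' : ∀ e, M.edge e ∈ H → R e → M.vt e = M.vt (M.al d) → e = M.al d := by
    intro e h1 h2 h3
    exact hs.simple _ _ h3 (by rw [M.al_al]; exact hcon e h1 h2 h3)
  obtain ⟨t, ht, ht1, ht2⟩ := hdeg
  obtain ⟨f, hf1, hf2⟩ := M.exists_dart ht1
  have := M.trans (M.al d) f hf1.symm
    (fun x => x = M.al d ∨ (R x ∧ M.edge x ∉ H ∧ M.vt x = M.vt (M.al d))) ?_ (Or.inl rfl)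
  · rcases this with h | h
    · rw [h, M.al_al] at hf2; exact ht hf2.symm
    · apply h.2.1; rw [edge, hf1, hf2]; exact ht2
  · intro x hx
    have h1 : R (M.ph (M.al x)) ∧ M.vt (M.ph (M.al x)) = M.vt (M.al d) := by
      rcases hx with rfl | ⟨h1, h2, h3⟩
      · rw [M.al_al]; exact ⟨hRph _ hR, M.vt_ph d⟩
      · exact ⟨hRph _ (hRal _ h2 h1), by rw [M.vt_ph, M.al_al]; exact h3⟩
    by_cases h2 : M.edge (M.ph (M.al x)) ∈ H
    · left; exact hcon' _ h2 h1.1 h1.2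
    · right; exact ⟨h1.1, h2, h1.2⟩

/-- the region setoid: generated by `ph` and `al` off `H` -/
def regSetoid (M : PM V D) (H : Finset (Sym2 V)) : Setoid D :=
  Relation.EqvGen.setoid (fun x y => y = M.ph x ∨ (M.edge x ∉ H ∧ y = M.al x))

def Reg (M : PM V D) (H : Finset (Sym2 V)) : Type := Quotient (regSetoid M H)

def reg (M : PM V D) (H : Finset (Sym2 V)) (d : D) : Reg M H := Quotient.mk (regSetoid M H) d

lemma reg_ph (H : Finset (Sym2 V)) (d : D) : reg M H (M.ph d) = reg M H d :=
  (Quotient.sound (s := regSetoid M H) (Relation.EqvGen.rel (r := (fun x y => y = M.ph x ∨ (M.edge x ∉ H ∧ y = M.al x))) _ _ (Or.inl rfl))).symm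

lemma reg_al {H : Finset (Sym2 V)} {d : D} (h : M.edge d ∉ H) : reg M H (M.al d) = reg M H d :=
  (Quotient.sound (s := regSetoid M H) (Relation.EqvGen.rel (r := (fun x y => y = M.ph x ∨ (M.edge x ∉ H ∧ y = M.al x))) _ _ (Or.inr ⟨h, rfl⟩))).symm

noncomputable instance (H : Finset (Sym2 V)) : Fintype (Reg M H) := by
  classical
  unfold Reg; exact Fintype.ofFinite _

/-- a function constant along generators factors through regions -/
lemma reg_factor {H : Finset (Sym2 V)} (g : D → ℝ) (h1 : ∀ d, g (M.ph d) = g d)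
    (h2 : ∀ d, M.edge d ∉ H → g (M.al d) = g d) : ∃ g' : Reg M H → ℝ, ∀ d, g' (reg M H d) = g d := by
  refine ⟨Quotient.lift g ?_, fun d => rfl⟩
  intro a b hab
  induction (hab : Relation.EqvGen _ a b) with
  | rel x y h =>
    rcases h with rfl | ⟨h, rfl⟩
    · exact (h1 x).symm
    · exact (h2 x h).symm
  | refl x => rfl
  | symm x y _ ih => exact (ih).symm
  | trans x y z _ _ ih1 ih2 => exact ih1.trans ih2

open Classical in
/-- Euler type inequality -/
lemma reg_count (hs : M.Simple) {H : Finset (Sym2 V)} (hH : H ⊆ M.edges) {Y : Finset V} (hY : Y.Nonempty)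
    (hHY : ∀ d, M.edge d ∈ H → M.vt d ∈ Y) [Nonempty D] :
    H.card + 2 ≤ Y.card + Fintype.card (Reg M H) := by
  -- representatives
  have hrep : ∀ e : H, ∃ d, M.edge d = e := fun e => M.mem_edges.1 (hH e.2)
  choose δ hδ using hrep
  have hδ' : ∀ d, ∀ h : M.edge d ∈ H, d = δ ⟨M.edge d, h⟩ ∨ d = M.al (δ ⟨M.edge d, h⟩) := by
    intro d h
    exact hs.eq_of_edge (hδ ⟨M.edge d, h⟩).symm
  let A : (H → ℝ) →ₗ[ℝ] (D → ℝ) :=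
    { toFun := fun f d => if h : M.edge d ∈ H then
        (if d = δ ⟨M.edge d, h⟩ then f ⟨M.edge d, h⟩ else - f ⟨M.edge d, h⟩) else 0
      map_add' := by intro f g; ext d; simp only [Pi.add_apply]; split_ifs <;> ring
      map_smul' := by
        intro r f; ext d; simp only [Pi.smul_apply, smul_eq_mul, RingHom.id_apply]; split_ifs <;> ring }
  have hA : ∀ f d, A f d = if h : M.edge d ∈ H then
        (if d = δ ⟨M.edge d, h⟩ then f ⟨M.edge d, h⟩ else - f ⟨M.edge d, h⟩) else 0 := fun f d => rfl
  have hAanti : ∀ f d, A f (M.al d) = - A f d := by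
    intro f d
    rw [hA, hA]
    simp only [M.edge_al]
    by_cases h : M.edge d ∈ H
    · simp only [h, dite_true]
      rcases hδ' d h with h1 | h1
      · have : M.al d ≠ δ ⟨M.edge d, h⟩ := by rw [← h1]; exact hs.al_ne d
        rw [if_neg this, if_pos h1]
      · have h2 : M.al d = δ ⟨M.edge d, h⟩ := by
          have := congrArg M.al h1; rwa [M.al_al] at this
        have h3 : d ≠ δ ⟨M.edge d, h⟩ := by rw [← h2]; exact (hs.al_ne d).symm
        rw [if_pos h2, if_neg h3, neg_neg]
    · simp [h]
  have hAinj : Function.Injective A := by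
    intro f g hfg
    ext e
    have := congrFun hfg (δ e)
    rw [hA, hA] at this
    simpa [hδ] using this
  let B : (D → ℝ) →ₗ[ℝ] (Y → ℝ) :=
    { toFun := fun a y => ∑ d, if M.vt d = y then a d else 0
      map_add' := by
        intro a b; ext y; simp only [Pi.add_apply]; rw [← Finset.sum_add_distrib]
        apply Finset.sum_congr rfl; intro d _; split_ifs <;> ring
      map_smul' := by
        intro r f; ext d; simp only [Pi.smul_apply, smul_eq_mul, RingHom.id_apply]; rw [Finset.mul_sum]
        apply Finset.sum_congr rfl; intro d _; split_ifs <;> ring }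
  have hB : ∀ a y, B a y = ∑ d, if M.vt d = y then a d else 0 := fun a d => rfl
  let Sl : (Y → ℝ) →ₗ[ℝ] ℝ := ∑ y, LinearMap.proj y
  have hSl : ∀ f, Sl f = ∑ y, f y := by intro f; simp [Sl]
  obtain ⟨y0, hy0⟩ := hY
  have hSlr : LinearMap.range Sl = ⊤ := by
    rw [LinearMap.range_eq_top]
    intro r
    refine ⟨fun y => if y = ⟨y0, hy0⟩ then r else 0, ?_⟩
    rw [hSl]; simp
  have hBA : LinearMap.range (B ∘ₗ A) ≤ LinearMap.ker Sl := by
    rintro _ ⟨f, rfl⟩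
    rw [LinearMap.mem_ker, hSl]
    simp only [LinearMap.comp_apply, hB]
    rw [Finset.sum_comm]
    have h1 : ∀ d, (∑ y : Y, if M.vt d = y then A f d else 0) = A f d := by
      intro d
      by_cases h : M.edge d ∈ H
      · rw [Finset.sum_eq_single (⟨M.vt d, hHY d h⟩ : Y)]
        · simp
        · intro b _ hb; rw [if_neg]; intro h'; apply hb; ext; exact h'.symm
        · simp
      · have : A f d = 0 := by rw [hA]; simp [h]
        rw [this]; simp
    simp only [h1]
    have h2 : ∑ d, A f d = ∑ d, A f (M.al d) := (Equiv.sum_comp M.al (A f)).symm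
    simp only [hAanti, Finset.sum_neg_distrib] at h2
    linarith
  have d1 := LinearMap.finrank_range_add_finrank_ker (B ∘ₗ A)
  have d2 := LinearMap.finrank_range_add_finrank_ker Sl
  rw [hSlr, finrank_top] at d2
  simp only [Module.finrank_self, Module.finrank_fintype_fun_eq_card, Fintype.card_coe] at d1 d2
  have d3 := Submodule.finrank_mono hBA
  -- faces
  let C : (Reg M H → ℝ) →ₗ[ℝ] (D → ℝ) :=
    { toFun := fun g d => g (reg M H d) - g (reg M H (M.al d))
      map_add' := by intro f g; ext d; simp only [Pi.add_apply]; ring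
      map_smul' := by
        intro r f; ext d; simp only [Pi.smul_apply, smul_eq_mul, RingHom.id_apply]; ring }
  have hC : ∀ g d, C g d = g (reg M H d) - g (reg M H (M.al d)) := fun g d => rfl
  have d4 := LinearMap.finrank_range_add_finrank_ker C
  have d5 : 1 ≤ Module.finrank ℝ (LinearMap.ker C) := by
    have : (fun _ => 1 : Reg M H → ℝ) ∈ LinearMap.ker C := by
      rw [LinearMap.mem_ker]; ext d; rw [hC]; simp
    rw [Nat.one_le_iff_ne_zero]
    intro h0
    rw [Submodule.finrank_eq_zero] at h0
    rw [h0, Submodule.mem_bot] at this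
    obtain ⟨d⟩ := ‹Nonempty D›
    have := congrFun this (reg M H d)
    simp at this
  rw [Module.finrank_fintype_fun_eq_card] at d4
  have d6 : Submodule.map A (LinearMap.ker (B ∘ₗ A)) ≤ LinearMap.range C := by
    rintro _ ⟨f, hf, rfl⟩
    have hf' : B (A f) = 0 := hf
    obtain ⟨g, hg1, hg2⟩ := M.exact (A f) (hAanti f) (by
      intro v
      by_cases hv : v ∈ Y
      · exact congrFun hf' ⟨v, hv⟩
      · apply Finset.sum_eq_zero
        intro d _
        split_ifs with h
        · rw [hA, dif_neg]; intro h'; apply hv; rw [← h]; exact hHY d h'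
        · rfl)
    obtain ⟨g', hg'⟩ := reg_factor (M := M) (H := H) g hg1 (by
      intro d hd
      have := hg2 d
      rw [hA, dif_neg hd] at this
      linarith)
    refine ⟨g', ?_⟩
    ext d
    rw [hC, hg', hg', ← hg2]
  have d7 := Submodule.finrank_mono d6
  have d8 : Module.finrank ℝ (Submodule.map A (LinearMap.ker (B ∘ₗ A))) = Module.finrank ℝ (LinearMap.ker (B ∘ₗ A)) :=
    (LinearEquiv.finrank_eq (Submodule.equivMapOfInjective A hAinj _)).symm
  omega

open Classical in
lemma card_hd (hs : M.Simple) {H : Finset (Sym2 V)} (hH : H ⊆ M.edges) :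
    (Finset.univ.filter (fun d => M.edge d ∈ H)).card = 2 * H.card := by
  rw [Finset.card_eq_sum_card_fiberwise (f := M.edge) (t := H) (by intro d hd; simpa using hd)]
  rw [mul_comm, ← smul_eq_mul]
  apply Finset.sum_const_nat
  intro e he
  obtain ⟨d, rfl⟩ := M.mem_edges.1 (hH he)
  have : (Finset.univ.filter (fun d => M.edge d ∈ H)).filter (fun a => M.edge a = M.edge d) = {d, M.al d} := by
    ext x
    simp only [Finset.mem_filter, Finset.mem_univ, true_and, Finset.mem_insert, Finset.mem_singleton]
    constructor
    · intro h; exact hs.eq_of_edge h.2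
    · rintro (rfl | rfl)
      · exact ⟨he, rfl⟩
      · rw [M.edge_al]; exact ⟨he, rfl⟩
  rw [this, Finset.card_pair (hs.al_ne d).symm]

/-- region bounded by a triangle -/
def TriReg (M : PM V D) (H : Finset (Sym2 V)) (R : D → Prop) : Prop :=
  (∀ x, R x → R (M.ph x)) ∧ (∀ x, M.edge x ∉ H → R x → R (M.al x)) ∧
  ∃ d1 d2 d3, (R d1 ∧ R d2 ∧ R d3) ∧ (M.edge d1 ∈ H ∧ M.edge d2 ∈ H ∧ M.edge d3 ∈ H) ∧
    (M.vt (M.al d1) = M.vt d2 ∧ M.vt (M.al d2) = M.vt d3 ∧ M.vt (M.al d3) = M.vt d1) ∧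
    ∀ d, R d → M.edge d ∈ H → d = d1 ∨ d = d2 ∨ d = d3

open Classical in
lemma two_triReg (hs : M.Simple) {L : Finset (Sym2 V)} (hL : L ⊆ M.edges) (hLs : Sparse L)
    {Y : Finset V} (hY : Tight L Y) (hY3 : 3 ≤ Y.card) :
    ∃ R1 R2 : D → Prop, TriReg M (spn L Y) R1 ∧ TriReg M (spn L Y) R2 ∧ ∀ d, ¬ (R1 d ∧ R2 d) := by
  set H := spn L Y with hHdef
  have hHL : H ⊆ L := Finset.filter_subset _ _
  have hHY : ∀ d, M.edge d ∈ H → M.vt d ∈ Y ∧ M.vt (M.al d) ∈ Y := by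
    intro d hd; rw [edge, mem_spn] at hd; exact hd.2
  have hHc : H.card + 3 = 2 * Y.card := hY.2
  have hHpos : 0 < H.card := by omega
  obtain ⟨e0, he0⟩ := Finset.card_pos.1 hHpos
  obtain ⟨dd, hdd⟩ := M.mem_edges.1 (hL (hHL he0))
  have : Nonempty D := ⟨dd⟩
  have hcount := reg_count hs (hHL.trans hL) (Y := Y) (Finset.card_pos.1 (by omega)) (fun d hd => (hHY d hd).1)
  have hcd := card_hd hs (hHL.trans hL)
  set b : Reg M H → Finset D := fun R => (Finset.univ.filter (fun d => M.edge d ∈ H)).filter (fun d => reg M H d = R) with hb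
  have hsum : ∑ R, (b R).card = 2 * H.card := by
    rw [← hcd]
    exact (Finset.card_eq_sum_card_fiberwise (f := reg M H) (t := Finset.univ) (by intro d hd; simp)).symm
  have hcl : ∀ R : Reg M H, (∀ x, reg M H x = R → reg M H (M.ph x) = R) ∧ 
      (∀ x, M.edge x ∉ H → reg M H x = R → reg M H (M.al x) = R) := by
    intro R; exact ⟨fun x hx => by rw [reg_ph, hx], fun x h hx => by rw [reg_al h, hx]⟩
  have hsucc : ∀ d, M.edge d ∈ H → ∃ e, M.edge e ∈ H ∧ reg M H e = reg M H d ∧ M.vt e = M.vt (M.al d) ∧ M.vt (M.al e) ≠ M.vt d := by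
    intro d hd
    obtain ⟨t, ht1, ht2, ht3⟩ := deg2 hLs hY hY3 (hHY d hd).2 (M.vt d)
    exact succ_dart hs (fun x => reg M H x = reg M H d) (hcl _).1 (hcl _).2 rfl
      ⟨t, ht2, hL ht3, by rw [hHdef, mem_spn]; exact ⟨ht3, (hHY d hd).2, ht1⟩⟩
  have hne : ∀ R : Reg M H, ∃ d, M.edge d ∈ H ∧ reg M H d = R := by
    intro R
    induction R using Quotient.inductionOn with | _ d =>
    by_contra hcon
    push Not at hcon
    have := all_closed (M := M) (fun x => reg M H x = reg M H d) (hcl _).1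
      (fun x hx => (hcl _).2 x (fun h => hcon x h hx) hx) rfl dd
    exact hcon dd (hdd ▸ he0) this
  have hmem : ∀ R d, d ∈ b R ↔ M.edge d ∈ H ∧ reg M H d = R := by intro R d; simp [hb]
  have hstruct : ∀ R : Reg M H, 3 ≤ (b R).card ∧ ((b R).card = 3 → TriReg M H (fun d => reg M H d = R)) := by
    intro R
    obtain ⟨d1, h1, r1⟩ := hne R
    obtain ⟨d2, h2, r2, v2, n2⟩ := hsucc d1 h1
    obtain ⟨d3, h3, r3, v3, n3⟩ := hsucc d2 h2
    obtain ⟨d4, h4, r4, v4, n4⟩ := hsucc d3 h3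
    have n12 : d1 ≠ d2 := by rintro rfl; exact hs.noloop _ v2
    have n23 : d2 ≠ d3 := by rintro rfl; exact hs.noloop _ v3
    have n13 : d1 ≠ d3 := by rintro rfl; exact n2 v3.symm
    have hsub : ({d1, d2, d3} : Finset D) ⊆ b R := by
      intro x; simp only [Finset.mem_insert, Finset.mem_singleton, hmem]
      rintro (rfl | rfl | rfl)
      · exact ⟨h1, r1⟩
      · exact ⟨h2, r2.trans r1⟩
      · exact ⟨h3, r3.trans (r2.trans r1)⟩
    have hc3 : ({d1, d2, d3} : Finset D).card = 3 := Finset.card_eq_three.2 ⟨_, _, _, n12, n13, n23, rfl⟩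
    refine ⟨hc3 ▸ Finset.card_le_card hsub, fun h => ?_⟩
    have heq := Finset.eq_of_subset_of_card_le hsub (by omega)
    have hex : ∀ d, reg M H d = R → M.edge d ∈ H → d = d1 ∨ d = d2 ∨ d = d3 := by
      intro d hd hd'
      have : d ∈ b R := (hmem _ _).2 ⟨hd', hd⟩
      rw [← heq] at this; simpa using this
    refine ⟨(hcl R).1, (hcl R).2, d1, d2, d3, ⟨r1, r2.trans r1, r3.trans (r2.trans r1)⟩, ⟨h1, h2, h3⟩, ⟨v2.symm, v3.symm, ?_⟩, hex⟩
    rcases hex d4 (r4.trans (r3.trans (r2.trans r1))) h4 with h | h | h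
    · rw [← v4, h]
    · exfalso; rw [h] at v4; exact n3 v4.symm
    · exfalso; rw [h] at v4; exact hs.noloop _ v4
  -- counting
  have htwo : 2 ≤ (Finset.univ.filter (fun R : Reg M H => (b R).card = 3)).card := by
    have h1 : ∑ R : Reg M H, (4 : ℕ) ≤ ∑ R : Reg M H, ((b R).card + if (b R).card = 3 then 1 else 0) := by
      apply Finset.sum_le_sum
      intro R _
      have := (hstruct R).1
      split_ifs <;> omega
    rw [Finset.sum_add_distrib, hsum, Finset.sum_const, Finset.card_univ, ← Finset.card_filter] at h1
    simp only [smul_eq_mul] at h1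
    omega
  obtain ⟨R1, hR1, R2, hR2, hR12⟩ := Finset.one_lt_card.1 htwo
  simp only [Finset.mem_filter, Finset.mem_univ, true_and] at hR1 hR2
  refine ⟨_, _, (hstruct R1).2 hR1, (hstruct R2).2 hR2, ?_⟩
  rintro d ⟨h1, h2⟩
  exact hR12 (h1.symm.trans h2)

lemma exists_tri (hs : M.Simple) {L : Finset (Sym2 V)} (hL : L ⊆ M.edges) (hLs : Sparse L)
    (Y : Finset V) (hY : Tight L Y) (hY3 : 3 ≤ Y.card) :
    ∃ x y z, (x ∈ Y ∧ y ∈ Y ∧ z ∈ Y) ∧ s(x,y) ∈ L ∧ s(y,z) ∈ L ∧ s(x,z) ∈ L := by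
  obtain ⟨R1, _, ⟨_, _, d1, d2, d3, _, ⟨h1, h2, h3⟩, ⟨v1, v2, v3⟩, _⟩, _⟩ := two_triReg hs hL hLs hY hY3
  rw [edge, mem_spn] at h1 h2 h3
  rw [v1] at h1; rw [v2] at h2; rw [v3] at h3
  exact ⟨_, _, _, ⟨h1.2.1, h1.2.2, h2.2.2⟩, h1.1, h2.1, by rw [Sym2.eq_swap]; exact h3.1⟩

lemma pig1 {a b c p1 p2 p3 q : V} (h1 : p1 = a ∨ p1 = b ∨ p1 = c) (h2 : p2 = a ∨ p2 = b ∨ p2 = c)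
    (h3 : p3 = a ∨ p3 = b ∨ p3 = c) (hq : q = a ∨ q = b ∨ q = c) (n1 : p1 ≠ p2) (n2 : p2 ≠ p3)
    (n3 : p3 ≠ p1) : q = p1 ∨ q = p2 ∨ q = p3 := by
  rcases h1 with h1 | h1 | h1 <;> rcases h2 with h2 | h2 | h2 <;>
    first
    | exact absurd (h1.trans h2.symm) n1
    | (rcases h3 with h3 | h3 | h3 <;>
        first
        | exact absurd (h3.trans h1.symm) n3
        | exact absurd (h2.trans h3.symm) n2
        | (rw [h1, h2, h3]; tauto))

lemma pig2 {a b c p1 p2 p3 q1 q2 q3 : V} (h1 : p1 = a ∨ p1 = b ∨ p1 = c)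
    (h2 : p2 = a ∨ p2 = b ∨ p2 = c)
    (h3 : p3 = a ∨ p3 = b ∨ p3 = c) (h4 : q1 = a ∨ q1 = b ∨ q1 = c) (h5 : q2 = a ∨ q2 = b ∨ q2 = c)
    (h6 : q3 = a ∨ q3 = b ∨ q3 = c)
    (n1 : p1 ≠ p2) (n2 : p2 ≠ p3) (n3 : p3 ≠ p1) (n4 : q1 ≠ q2) (n5 : q2 ≠ q3) (n6 : q3 ≠ q1)
    (m1 : ¬(p1 = q1 ∧ p2 = q2)) (m2 : ¬(p1 = q2 ∧ p2 = q3)) (m3 : ¬(p1 = q3 ∧ p2 = q1)) :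
    (p1 = q2 ∧ p2 = q1 ∧ p3 = q3) ∨ (p1 = q3 ∧ p2 = q2 ∧ p3 = q1) ∨
      (p1 = q1 ∧ p2 = q3 ∧ p3 = q2) := by
  have k1 := pig1 h1 h2 h3 h4 n1 n2 n3
  have k2 := pig1 h1 h2 h3 h5 n1 n2 n3
  have k3 := pig1 h1 h2 h3 h6 n1 n2 n3
  clear h1 h2 h3 h4 h5 h6
  rcases k1 with rfl | rfl | rfl <;> rcases k2 with rfl | rfl | rfl <;>
    rcases k3 with rfl | rfl | rfl <;> simp_all

/-- a triangle not contained in a given one -/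
lemma exists_tri2 (hs : M.Simple) {L : Finset (Sym2 V)} (hL : L ⊆ M.edges) (hLs : Sparse L)
    (Y : Finset V) (hY : Tight L Y) (hY4 : 4 ≤ Y.card) (a b c : V) :
    ∃ x y z, (x ∈ Y ∧ y ∈ Y ∧ z ∈ Y) ∧ (s(x,y) ∈ L ∧ s(y,z) ∈ L ∧ s(x,z) ∈ L) ∧ (x ≠ a ∧ x ≠ b ∧ x ≠ c) := by
  classical
  obtain ⟨R1, R2, ⟨p1, q1, d1, d2, d3, ⟨r1, r2, r3⟩, ⟨h1, h2, h3⟩, ⟨v1, v2, v3⟩, u1⟩,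
    ⟨p2, q2, e1, e2, e3, ⟨r1', r2', r3'⟩, ⟨h1', h2', h3'⟩, ⟨v1', v2', v3'⟩, u2⟩, hdisj⟩ :=
      two_triReg hs hL hLs hY (by omega)
  have g1 := h1; have g2 := h2; have g3 := h3
  have g1' := h1'; have g2' := h2'; have g3' := h3'
  rw [edge, mem_spn] at g1 g2 g3 g1' g2' g3'
  rw [v1] at g1; rw [v2] at g2; rw [v3] at g3
  rw [v1'] at g1'; rw [v2'] at g2'; rw [v3'] at g3'
  have key : ∀ x y z, s(x,y) ∈ L ∧ x ∈ Y ∧ y ∈ Y → s(y,z) ∈ L ∧ y ∈ Y ∧ z ∈ Y → s(z,x) ∈ L ∧ z ∈ Y ∧ x ∈ Y → 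
      (x ≠ a ∧ x ≠ b ∧ x ≠ c) → ∃ x y z, (x ∈ Y ∧ y ∈ Y ∧ z ∈ Y) ∧ (s(x,y) ∈ L ∧ s(y,z) ∈ L ∧ s(x,z) ∈ L) ∧ (x ≠ a ∧ x ≠ b ∧ x ≠ c) := by
    intro x y z hx hy hz hne
    exact ⟨x, y, z, ⟨hx.2.1, hx.2.2, hz.2.1⟩, ⟨hx.1, hy.1, by rw [Sym2.eq_swap]; exact hz.1⟩, hne⟩
  by_contra hcon
  have k1 := fun hh => hcon (key _ _ _ g1 g2 g3 hh)
  have k2 := fun hh => hcon (key _ _ _ g2 g3 g1 hh)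
  have k3 := fun hh => hcon (key _ _ _ g3 g1 g2 hh)
  have k1' := fun hh => hcon (key _ _ _ g1' g2' g3' hh)
  have k2' := fun hh => hcon (key _ _ _ g2' g3' g1' hh)
  have k3' := fun hh => hcon (key _ _ _ g3' g1' g2' hh)
  clear hcon key
  have n1 := hs.noloop d1; have n2 := hs.noloop d2; have n3 := hs.noloop d3
  have n1' := hs.noloop e1; have n2' := hs.noloop e2; have n3' := hs.noloop e3
  rw [v1] at n1; rw [v2] at n2; rw [v3] at n3
  rw [v1'] at n1'; rw [v2'] at n2'; rw [v3'] at n3'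
  -- al of R1 darts are in R2
  have hsw : ∀ x y, M.vt x = M.vt (M.al y) → M.vt (M.al x) = M.vt y → x = M.al y := by
    intro x y h1 h2
    exact hs.simple _ _ h1 (by rw [M.al_al]; exact h2)
  have hdne : ∀ x y, R1 x → R2 y → x ≠ y := by
    rintro x y hx hy rfl; exact hdisj x ⟨hx, hy⟩
  have hdne' : ∀ x y, R1 x → R2 y → ¬ (M.vt x = M.vt y ∧ M.vt (M.al x) = M.vt (M.al y)) := 
    fun x y hx hy h => hdne x y hx hy (hs.simple _ _ h.1 h.2)
  have m11 := hdne' _ _ r1 r1'; have m12 := hdne' _ _ r1 r2'; have m13 := hdne' _ _ r1 r3'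
  have s1 : ∀ x, M.vt x = M.vt (M.al d1) → M.vt (M.al x) = M.vt d1 → x = M.al d1 := fun x => hsw x d1
  have s2 : ∀ x, M.vt x = M.vt (M.al d2) → M.vt (M.al x) = M.vt d2 → x = M.al d2 := fun x => hsw x d2
  have s3 : ∀ x, M.vt x = M.vt (M.al d3) → M.vt (M.al x) = M.vt d3 → x = M.al d3 := fun x => hsw x d3
  rw [v1, v1'] at m11; rw [v1, v2'] at m12; rw [v1, v3'] at m13
  simp only [v1] at s1; simp only [v2] at s2; simp only [v3] at s3
  have hsp : ∀ v, ¬ (v ≠ a ∧ v ≠ b ∧ v ≠ c) → v = a ∨ v = b ∨ v = c := by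
    intro v h; by_contra h'; push Not at h'; exact h h'
  have hcases := pig2 (hsp _ k1) (hsp _ k2) (hsp _ k3) (hsp _ k1') (hsp _ k2') (hsp _ k3') n1 n2 n3 n1' n2' n3' m11 m12 m13
  have hal : (M.al d1 = e1 ∨ M.al d1 = e2 ∨ M.al d1 = e3) ∧ (M.al d2 = e1 ∨ M.al d2 = e2 ∨ M.al d2 = e3) ∧
     (M.al d3 = e1 ∨ M.al d3 = e2 ∨ M.al d3 = e3) ∧ 
     (e1 = M.al d1 ∨ e1 = M.al d2 ∨ e1 = M.al d3) ∧ (e2 = M.al d1 ∨ e2 = M.al d2 ∨ e2 = M.al d3)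
     ∧ (e3 = M.al d1 ∨ e3 = M.al d2 ∨ e3 = M.al d3) := by
    rcases hcases with ⟨w1, w2, w3⟩ | ⟨w1, w2, w3⟩ | ⟨w1, w2, w3⟩
    · have t1 := s1 e1 (by rw [w2]) (by rw [v1', w1])
      have t2 := s2 e3 (by rw [w3]) (by rw [v3', w2])
      have t3 := s3 e2 (by rw [w1]) (by rw [v2', w3])
      simp [t1, t2, t3]
    · have t1 := s1 e2 (by rw [w2]) (by rw [v2', w1])
      have t2 := s2 e1 (by rw [w3]) (by rw [v1', w2])
      have t3 := s3 e3 (by rw [w1]) (by rw [v3', w3])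
      simp [t1, t2, t3]
    · have t1 := s1 e3 (by rw [w2]) (by rw [v3', w1])
      have t2 := s2 e2 (by rw [w3]) (by rw [v2', w2])
      have t3 := s3 e1 (by rw [w1]) (by rw [v1', w3])
      simp [t1, t2, t3]
  have hall := all_closed (M := M) (fun x => R1 x ∨ R2 x) (fun x hx => hx.imp (p1 x) (p2 x)) (by
    intro x hx
    by_cases hxH : M.edge x ∈ spn L Y
    · rcases hx with hx | hx
      · right
        rcases u1 x hx hxH with rfl | rfl | rfl
        · rcases hal.1 with h | h | h <;> rw [h] <;> assumption
        · rcases hal.2.1 with h | h | h <;> rw [h] <;> assumption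
        · rcases hal.2.2.1 with h | h | h <;> rw [h] <;> assumption
      · left
        rcases u2 x hx hxH with rfl | rfl | rfl
        · rcases hal.2.2.2.1 with h | h | h <;> rw [h, M.al_al] <;> assumption
        · rcases hal.2.2.2.2.1 with h | h | h <;> rw [h, M.al_al] <;> assumption
        · rcases hal.2.2.2.2.2 with h | h | h <;> rw [h, M.al_al] <;> assumption
    · exact hx.imp (q1 x hxH) (q2 x hxH)) (Or.inl r1)
  -- too few edges
  have hsub : spn L Y ⊆ {M.edge d1, M.edge d2, M.edge d3} := by
    intro e he
    obtain ⟨x, rfl⟩ := M.mem_edges.1 (hL (mem_spn'.1 he).1)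
    simp only [Finset.mem_insert, Finset.mem_singleton]
    rcases hall x with hx | hx
    · rcases u1 x hx he with rfl | rfl | rfl <;> simp
    · rcases u2 x hx he with rfl | rfl | rfl
      · rcases hal.2.2.2.1 with h | h | h <;> rw [h, M.edge_al] <;> simp
      · rcases hal.2.2.2.2.1 with h | h | h <;> rw [h, M.edge_al] <;> simp
      · rcases hal.2.2.2.2.2 with h | h | h <;> rw [h, M.edge_al] <;> simp
  have hc1 := (Finset.card_le_card hsub).trans Finset.card_le_three
  have hc2 := hY.2
  simp only [ii] at hc2
  omega

end PM


namespace PM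
variable {V D : Type} [Fintype D] {M : PM V D}

/-- oriented triangle of darts -/
structure Tri (M : PM V D) (d1 d2 d3 : D) : Prop where
  h1 : M.vt (M.al d1) = M.vt d2
  h2 : M.vt (M.al d2) = M.vt d3
  h3 : M.vt (M.al d3) = M.vt d1

lemma Tri.rot {d1 d2 d3 : D} (h : Tri M d1 d2 d3) : Tri M d2 d3 d1 := ⟨h.h2, h.h3, h.h1⟩
lemma Tri.rev {d1 d2 d3 : D} (h : Tri M d1 d2 d3) : Tri M (M.al d3) (M.al d2) (M.al d1) :=
  ⟨by rw [M.al_al, h.h2], by rw [M.al_al, h.h1], by rw [M.al_al, h.h3]⟩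

/-- `x` is one of the six darts of a triangle -/
def OnT (M : PM V D) (d1 d2 d3 x : D) : Prop :=
  x = d1 ∨ x = d2 ∨ x = d3 ∨ x = M.al d1 ∨ x = M.al d2 ∨ x = M.al d3

lemma onT_rot {d1 d2 d3 x : D} : OnT M d2 d3 d1 x ↔ OnT M d1 d2 d3 x := by
  unfold OnT; tauto
lemma onT_rev {d1 d2 d3 x : D} : OnT M (M.al d3) (M.al d2) (M.al d1) x ↔ OnT M d1 d2 d3 x := by
  unfold OnT; simp only [M.al_al]; tauto
lemma onT_al {d1 d2 d3 x : D} : OnT M d1 d2 d3 (M.al x) ↔ OnT M d1 d2 d3 x := by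
  have : ∀ y, M.al x = y ↔ x = M.al y := fun y => ⟨fun h => by rw [← h, M.al_al], fun h => by rw [h, M.al_al]⟩
  unfold OnT; simp only [this, M.al_al]; tauto

lemma Tri.onT_vt {d1 d2 d3 x : D} (h : Tri M d1 d2 d3) (hx : OnT M d1 d2 d3 x) :
    M.vt x = M.vt d1 ∨ M.vt x = M.vt d2 ∨ M.vt x = M.vt d3 := by
  rcases hx with rfl | rfl | rfl | rfl | rfl | rfl <;> simp [h.h1, h.h2, h.h3]

lemma Tri.ne (hs : M.Simple) {d1 d2 d3 : D} (h : Tri M d1 d2 d3) :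
    M.vt d1 ≠ M.vt d2 ∧ M.vt d2 ≠ M.vt d3 ∧ M.vt d3 ≠ M.vt d1 := by
  refine ⟨?_, ?_, ?_⟩
  · rw [← h.h1]; exact hs.noloop _
  · rw [← h.h2]; exact hs.noloop _
  · rw [← h.h3]; exact hs.noloop _

lemma Tri.onT_of_vt (hs : M.Simple) {d1 d2 d3 x : D} (h : Tri M d1 d2 d3)
    (h1 : M.vt x = M.vt d1 ∨ M.vt x = M.vt d2 ∨ M.vt x = M.vt d3)
    (h2 : M.vt (M.al x) = M.vt d1 ∨ M.vt (M.al x) = M.vt d2 ∨ M.vt (M.al x) = M.vt d3) :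
    OnT M d1 d2 d3 x := by
  have hn := hs.noloop x
  have hsw : ∀ y, M.vt x = M.vt (M.al y) → M.vt (M.al x) = M.vt y → x = M.al y := by
    intro y h1 h2
    exact hs.simple _ _ h1 (by rw [M.al_al]; exact h2)
  unfold OnT
  rcases h1 with h1 | h1 | h1 <;> rcases h2 with h2 | h2 | h2
  · exact absurd (h1.trans h2.symm) hn
  · left; exact hs.simple _ _ h1 (h2.trans h.h1.symm)
  · right; right; right; right; right; exact hsw _ (h1.trans h.h3.symm) h2
  · right; right; right; left; exact hsw _ (h1.trans h.h1.symm) h2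
  · exact absurd (h1.trans h2.symm) hn
  · right; left; exact hs.simple _ _ h1 (h2.trans h.h2.symm)
  · right; right; left; exact hs.simple _ _ h1 (h2.trans h.h3.symm)
  · right; right; right; right; left; exact hsw _ (h1.trans h.h2.symm) h2
  · exact absurd (h1.trans h2.symm) hn

/-- `Q` is a union of regions of the triangle -/
structure ClT (M : PM V D) (d1 d2 d3 : D) (Q : D → Prop) : Prop where
  ph : ∀ x, Q x → Q (M.ph x)
  al : ∀ x, ¬ OnT M d1 d2 d3 x → Q x → Q (M.al x)

lemma ClT.rot {d1 d2 d3 : D} {Q : D → Prop} (h : ClT M d1 d2 d3 Q) : ClT M d2 d3 d1 Q :=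
  ⟨h.ph, fun x hx => h.al x (fun h' => hx (onT_rot.2 h'))⟩
lemma ClT.rev {d1 d2 d3 : D} {Q : D → Prop} (h : ClT M d1 d2 d3 Q) :
    ClT M (M.al d3) (M.al d2) (M.al d1) Q :=
  ⟨h.ph, fun x hx => h.al x (fun h' => hx (onT_rev.2 h'))⟩
lemma ClT.compl {d1 d2 d3 : D} {Q : D → Prop} (h : ClT M d1 d2 d3 Q) : ClT M d1 d2 d3 (fun x => ¬ Q x) := by
  refine ⟨fun x hx h' => hx ((closed_inv M.ph Q h.ph x).1 h'), fun x hx hq h' => hq ?_⟩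
  have := h.al _ (fun h'' => hx (onT_al.1 h'')) h'
  rwa [M.al_al] at this

lemma Tri.at2 (hs : M.Simple) {d1 d2 d3 x : D} (h : Tri M d1 d2 d3) (hx : M.vt x = M.vt d2)
    (ho : OnT M d1 d2 d3 x) : x = d2 ∨ x = M.al d1 := by
  obtain ⟨n1, n2, n3⟩ := h.ne hs
  rcases ho with rfl | rfl | rfl | rfl | rfl | rfl
  · exact absurd hx n1
  · exact Or.inl rfl
  · exact absurd hx.symm n2
  · exact Or.inr rfl
  · rw [h.h2] at hx; exact absurd hx.symm n2
  · rw [h.h3] at hx; exact absurd hx n1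

lemma ClT.next (hs : M.Simple) {d1 d2 d3 : D} (h : Tri M d1 d2 d3) {Q : D → Prop}
    (hQ : ClT M d1 d2 d3 Q) (h1 : Q d1) : Q d2 := by
  by_contra h2
  have := M.trans (M.al d1) d2 h.h1
    (fun x => x = M.al d1 ∨ (Q x ∧ M.vt x = M.vt d2 ∧ x ≠ M.al d1)) ?_ (Or.inl rfl)
  · rcases this with h3 | h3
    · have := hs.noloop d1; obtain ⟨n1, n2, n3⟩ := h.ne hs
      have h4 := congrArg (fun x => M.vt (M.al x)) h3
      simp only [M.al_al, h.h2] at h4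
      exact n3 h4
    · exact h2 h3.1
  · intro x hx
    by_cases hxx : M.ph (M.al x) = M.al d1
    · exact Or.inl hxx
    right
    rcases hx with rfl | ⟨q, v, n⟩
    · rw [M.al_al] at *
      exact ⟨hQ.ph _ h1, by rw [M.vt_ph, h.h1], hxx⟩
    · refine ⟨hQ.ph _ (hQ.al x ?_ q), by rw [M.vt_ph, M.al_al, v], hxx⟩
      intro ho
      rcases h.at2 hs v ho with rfl | rfl
      · exact h2 q
      · exact n rfl

lemma ClT.all (hs : M.Simple) {d1 d2 d3 : D} (h : Tri M d1 d2 d3) {Q : D → Prop}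
    (hQ : ClT M d1 d2 d3 Q) (h1 : Q d1 ∨ Q d2 ∨ Q d3) : Q d1 ∧ Q d2 ∧ Q d3 := by
  have k1 := hQ.next hs h
  have k2 := hQ.rot.next hs h.rot
  have k3 := hQ.rot.rot.next hs h.rot.rot
  tauto

structure Side (M : PM V D) (d1 d2 d3 : D) (S : D → Prop) : Prop extends ClT M d1 d2 d3 S where
  m : S d1 ∧ S d2 ∧ S d3
  n : ¬ S (M.al d1) ∧ ¬ S (M.al d2) ∧ ¬ S (M.al d3)

lemma Side.rot {d1 d2 d3 : D} {Q : D → Prop} (h : Side M d1 d2 d3 Q) : Side M d2 d3 d1 Q :=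
  ⟨h.toClT.rot, by have := h.m; tauto, by have := h.n; tauto⟩

lemma Side.compl {d1 d2 d3 : D} {Q : D → Prop} (h : Side M d1 d2 d3 Q) :
    Side M (M.al d3) (M.al d2) (M.al d1) (fun x => ¬ Q x) :=
  ⟨h.toClT.compl.rev, by have := h.n; tauto, by have := h.m; simp only [M.al_al]; tauto⟩

lemma exists_side (hs : M.Simple) {d1 d2 d3 : D} (h : Tri M d1 d2 d3) : ∃ S, Side M d1 d2 d3 S := by
  classical
  obtain ⟨n1, n2, n3⟩ := h.ne hs
  have e12 : d1 ≠ d2 := fun e => n1 (by rw [e])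
  have e23 : d2 ≠ d3 := fun e => n2 (by rw [e])
  have e31 : d3 ≠ d1 := fun e => n3 (by rw [e])
  have hal : ∀ x y, M.al x = y ↔ x = M.al y := fun x y => ⟨fun h => by rw [← h, M.al_al], fun h => by rw [h, M.al_al]⟩
  have t1 : ∀ x y z, Tri M x y z → ¬ (x = M.al x) ∧ ¬ x = M.al y ∧ ¬ x = M.al z := by
    intro x y z h
    obtain ⟨n1, n2, n3⟩ := h.ne hs
    refine ⟨(hs.al_ne x).symm, fun e => ?_, fun e => ?_⟩
    · have := congrArg M.vt e; rw [h.h2] at this; exact n3 this.symm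
    · have := congrArg (fun t => M.vt (M.al t)) e; simp only [M.al_al, h.h1] at this; exact n2 this
  have a1 := t1 _ _ _ h
  have a2 := t1 _ _ _ h.rot
  have a3 := t1 _ _ _ h.rot.rot
  let f : D → ℝ := fun d => (if d = d1 then 1 else 0) + (if d = d2 then 1 else 0) + (if d = d3 then 1 else 0)
    - (if d = M.al d1 then 1 else 0) - (if d = M.al d2 then 1 else 0) - (if d = M.al d3 then 1 else 0)
  obtain ⟨g, hg1, hg2⟩ := M.exact f (by
      intro d
      simp only [f, hal, M.al_al]; ring) (by
      intro v
      have hsum : ∀ c : D, (∑ d, if M.vt d = v then (if d = c then (1:ℝ) else 0) else 0) = if M.vt c = v then 1 else 0 := by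
        intro c
        rw [Finset.sum_eq_single c]
        · simp
        · intro b _ hb; simp [hb]
        · simp
      have : ∀ d, (if M.vt d = v then f d else 0) = 
         (if M.vt d = v then (if d = d1 then (1:ℝ) else 0) else 0) + (if M.vt d = v then (if d = d2 then (1:ℝ) else 0) else 0)
         + (if M.vt d = v then (if d = d3 then (1:ℝ) else 0) else 0) - (if M.vt d = v then (if d = M.al d1 then (1:ℝ) else 0) else 0)
         - (if M.vt d = v then (if d = M.al d2 then (1:ℝ) else 0) else 0) - (if M.vt d = v then (if d = M.al d3 then (1:ℝ) else 0) else 0) := by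
        intro d; by_cases hv : M.vt d = v <;> simp [f, hv]
      simp only [this, Finset.sum_sub_distrib, Finset.sum_add_distrib, hsum, h.h1, h.h2, h.h3]
      ring)
  have hoff : ∀ x, ¬ OnT M d1 d2 d3 x → g (M.al x) = g x := by
    intro x hx
    have h0 : f x = 0 := by
      unfold OnT at hx; push Not at hx
      simp [f, hx]
    have := hg2 x
    linarith
  have hcl : ClT M d1 d2 d3 (fun x => g x = g d1) :=
    ⟨fun x hx => by rw [hg1, hx], fun x hx h => by rw [hoff x hx, h]⟩
  have hm := hcl.all hs h (Or.inl rfl)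
  have f1 : f d1 = 1 := by simp [f, a1, e12, e31.symm]
  have f2 : f d2 = 1 := by simp [f, a2, e23, e12.symm]
  have f3 : f d3 = 1 := by simp [f, a3, e31, e23.symm]
  refine ⟨fun x => g x = g d1, hcl, hm, ?_⟩
  have g1 := hg2 d1; have g2 := hg2 d2; have g3 := hg2 d3
  refine ⟨?_, ?_, ?_⟩ <;> intro hc <;> linarith [hm.1, hm.2.1, hm.2.2]

open Classical in
/-- number of darts -/
noncomputable def cnt (S : D → Prop) : ℕ := (Finset.univ.filter S).card

lemma cnt_compl (S : D → Prop) : cnt S + cnt (fun x => ¬ S x) = Fintype.card D := by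
  classical
  unfold cnt
  rw [← Finset.card_univ]
  convert Finset.card_filter_add_card_filter_not (s := Finset.univ) S

lemma cnt_le {S T : D → Prop} (h : ∀ x, S x → T x) : cnt S ≤ cnt T := by
  classical
  unfold cnt
  apply Finset.card_le_card
  intro x; simp; exact h x

lemma cnt_lt {S T : D → Prop} (h : ∀ x, S x → T x) {y : D} (hy : T y) (hy' : ¬ S y) : cnt S < cnt T := by
  classical
  unfold cnt
  apply Finset.card_lt_card
  refine ⟨fun x => by simp; exact h x, fun h' => hy' ?_⟩
  have := @h' y (by simpa using hy)
  simpa using this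

lemma Side.face (hs : M.Simple) {d1 d2 d3 : D} (h : Tri M d1 d2 d3) {S : D → Prop} (hS : Side M d1 d2 d3 S)
    (hc : cnt S ≤ 3) : (∀ x, S x ↔ x = d1 ∨ x = d2 ∨ x = d3) ∧ M.ph d1 = d2 ∧ M.ph d2 = d3 ∧ M.ph d3 = d1 := by
  classical
  obtain ⟨n1, n2, n3⟩ := h.ne hs
  have e12 : d1 ≠ d2 := fun e => n1 (by rw [e])
  have e23 : d2 ≠ d3 := fun e => n2 (by rw [e])
  have e31 : d3 ≠ d1 := fun e => n3 (by rw [e])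
  have hsub : ({d1, d2, d3} : Finset D) ⊆ Finset.univ.filter S := by
    intro x; simp; have := hS.m; rintro (rfl|rfl|rfl) <;> tauto
  have heq := Finset.eq_of_subset_of_card_le hsub (by
    rw [Finset.card_eq_three.2 ⟨d1, d2, d3, e12, e31.symm, e23, rfl⟩]
    unfold cnt at hc; convert hc)
  have hch : ∀ x, S x ↔ x = d1 ∨ x = d2 ∨ x = d3 := by
    intro x
    have := Finset.ext_iff.1 heq x
    simp at this; exact this.symm
  refine ⟨hch, ?_, ?_, ?_⟩
  · have h1 := (hch _).1 (hS.ph _ hS.m.1)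
    have h2 := M.vt_ph d1
    rw [h.h1] at h2
    rcases h1 with h1 | h1 | h1 <;> rw [h1] at h2 ⊢
    · exact absurd h2 n1
    · exact absurd h2.symm n2
  · have h1 := (hch _).1 (hS.ph _ hS.m.2.1)
    have h2 := M.vt_ph d2
    rw [h.h2] at h2
    rcases h1 with h1 | h1 | h1 <;> rw [h1] at h2 ⊢
    · exact absurd h2.symm n3
    · exact absurd h2 n2
  · have h1 := (hch _).1 (hS.ph _ hS.m.2.2)
    have h2 := M.vt_ph d3
    rw [h.h3] at h2
    rcases h1 with h1 | h1 | h1 <;> rw [h1] at h2 ⊢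
    · exact absurd h2.symm n1
    · exact absurd h2 n3

/-- facial triangle -/
def Fac (M : PM V D) (d1 d2 d3 : D) : Prop := M.ph d1 = d2 ∧ M.ph d2 = d3 ∧ M.ph d3 = d1

def OutTri (M : PM V D) : Prop := ∃ d1 d2 d3, Tri M d1 d2 d3 ∧ Fac M d1 d2 d3 ∧ M.out d1

def OkS (M : PM V D) (S : D → Prop) : Prop := (∀ x, S x → ¬ M.out x) ∨ ¬ OutTri M

/-- interior vertices of a side -/
lemma side_int {d1 d2 d3 : D} {S : D → Prop} (hS : ClT M d1 d2 d3 S) (h : Tri M d1 d2 d3) {x y : D}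
    (hx : S x) (hxy : M.vt x = M.vt y)
    (hn : ¬ (M.vt x = M.vt d1 ∨ M.vt x = M.vt d2 ∨ M.vt x = M.vt d3)) : S y := by
  have := M.trans x y hxy (fun t => S t ∧ M.vt t = M.vt x) ?_ ⟨hx, rfl⟩
  · exact this.1
  · rintro t ⟨h1, h2⟩
    refine ⟨hS.ph _ (hS.al t (fun ho => hn ?_) h1), by rw [M.vt_ph, M.al_al, h2]⟩
    rw [← h2]; exact h.onT_vt ho

/-- the minimal side: all triangles with an interior vertex are facial -/
lemma min_side (hs : M.Simple) {d1 d2 d3 : D} {S : D → Prop} (h : Tri M d1 d2 d3) (hS : Side M d1 d2 d3 S)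
    (hmin : ∀ e1 e2 e3 S', Tri M e1 e2 e3 → Side M e1 e2 e3 S' → OkS M S' → 3 < cnt S' → cnt S ≤ cnt S')
    (hok : OkS M S) {e1 e2 e3 : D} (he : Tri M e1 e2 e3) (he1 : S e1)
    (hn : ¬ (M.vt e1 = M.vt d1 ∨ M.vt e1 = M.vt d2 ∨ M.vt e1 = M.vt d3)) :
    (Fac M e1 e2 e3 ∧ ¬ M.out e1) ∨ (Fac M (M.al e3) (M.al e2) (M.al e1) ∧ ¬ M.out (M.al e1)) := by
  obtain ⟨S1, hS1⟩ := exists_side hs he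
  -- darts at x
  have he3 : S (M.al e3) := side_int hS.toClT h he1 he.h3.symm hn
  have hno : ∀ x, M.vt x = M.vt e1 → ¬ OnT M d1 d2 d3 x := by
    intro x hx ho; apply hn; rw [← hx]; exact h.onT_vt ho
  have he1' : S (M.al e1) := hS.al _ (hno _ rfl) he1
  have he3' : S e3 := by
    have := hS.al _ (hno _ he.h3) he3
    rwa [M.al_al] at this
  -- darts of T'' outside S are on T
  have hdar : ∀ x, OnT M e1 e2 e3 x → ¬ S x → OnT M d1 d2 d3 x := by
    have hvS : ∀ x y, M.vt x = M.vt y → S x → ¬ S y → (M.vt x = M.vt d1 ∨ M.vt x = M.vt d2 ∨ M.vt x = M.vt d3) := by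
      intro x y hxy hx hy
      by_contra hc
      exact hy (side_int hS.toClT h hx hxy hc)
    have h2 : ¬ S e2 → OnT M d1 d2 d3 e2 := by
      intro hns
      by_contra hno2
      have hns' : ¬ S (M.al e2) := fun h' => hns (by
        have := hS.al _ (fun ho => hno2 (onT_al.1 ho)) h'
        rwa [M.al_al] at this)
      apply hno2
      apply h.onT_of_vt hs
      · have := hvS _ _ he.h1 he1' hns; rwa [he.h1] at this
      · have := hvS _ _ he.h2.symm he3' hns'; rwa [← he.h2] at this
    intro x hx hns
    rcases hx with rfl | rfl | rfl | rfl | rfl | rfl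
    · exact absurd he1 hns
    · exact h2 hns
    · exact absurd he3' hns
    · exact absurd he1' hns
    · by_cases h3 : S e2
      · by_contra hc
        exact hns (hS.al _ (fun ho => hc (onT_al.2 ho)) h3)
      · exact onT_al.2 (h2 h3)
    · exact absurd he3 hns
  have hcl : ∀ Q, ClT M e1 e2 e3 Q → ClT M d1 d2 d3 (fun x => ¬ S x ∧ Q x) := by
    intro Q hQ
    refine ⟨fun x hx => ⟨hS.toClT.compl.ph _ hx.1, hQ.ph _ hx.2⟩, fun x hx hq => ⟨hS.toClT.compl.al _ hx hq.1, hQ.al _ ?_ hq.2⟩⟩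
    exact fun ho => hx (hdar x ho hq.1)
  have hcon : ∀ Q, ClT M e1 e2 e3 Q → (∃ x, ¬ S x ∧ Q x) → Q (M.al d1) := by
    rintro Q hQ ⟨x, hx⟩
    have hc := hcl Q hQ
    by_cases hsome : (fun x => ¬ S x ∧ Q x) (M.al d3) ∨ (fun x => ¬ S x ∧ Q x) (M.al d2) ∨ (fun x => ¬ S x ∧ Q x) (M.al d1)
    · exact (hc.rev.all hs h.rev hsome).2.2.2
    · exfalso
      have := all_closed (M := M) _ hc.ph (fun y hy => by
        by_cases ho : OnT M d1 d2 d3 y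
        · exfalso
          apply hsome
          have := hS.m
          rcases ho with rfl | rfl | rfl | rfl | rfl | rfl
          · exact absurd this.1 hy.1
          · exact absurd this.2.1 hy.1
          · exact absurd this.2.2 hy.1
          · exact Or.inr (Or.inr hy)
          · exact Or.inr (Or.inl hy)
          · exact Or.inl hy
        · exact hc.al _ ho hy) hx d1
      exact this.1 hS.m.1
  have hor : (∀ x, S1 x → S x) ∨ (∀ x, ¬ S1 x → S x) := by
    by_contra hc
    push Not at hc
    obtain ⟨⟨x, hx, hx'⟩, ⟨y, hy, hy'⟩⟩ := hc
    exact hcon _ hS1.toClT.compl ⟨y, hy', hy⟩ (hcon _ hS1.toClT ⟨x, hx', hx⟩)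
  have hok' : ∀ S', (∀ x, S' x → S x) → OkS M S' := fun S' hsub => hok.imp (fun h x hx => h x (hsub x hx)) id
  have hout : ∀ f1 f2 f3, Tri M f1 f2 f3 → Fac M f1 f2 f3 → S f1 → ¬ M.out f1 := by
    intro f1 f2 f3 ht hf hSf ho
    rcases hok with h' | h'
    · exact h' _ hSf ho
    · exact h' ⟨f1, f2, f3, ht, hf, ho⟩
  rcases hor with hsub | hsub
  · left
    have hlt := cnt_lt hsub he1' hS1.n.1
    have hle : cnt S1 ≤ 3 := by
      by_contra hc
      have := hmin _ _ _ _ he hS1 (hok' _ hsub) (by omega)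
      omega
    have hf := (hS1.face hs he hle).2
    exact ⟨hf, hout _ _ _ he hf he1⟩
  · right
    have hlt := cnt_lt hsub he1 (not_not.2 hS1.m.1)
    have hle : cnt (fun x => ¬ S1 x) ≤ 3 := by
      by_contra hc
      have := hmin _ _ _ _ he.rev hS1.compl (hok' _ hsub) (by omega)
      omega
    have hf := (hS1.compl.face hs he.rev hle).2
    refine ⟨hf, hout _ _ _ he.rev.rot.rot ⟨hf.2.2, hf.1, hf.2.1⟩ he1'⟩

/-- a contractible edge with facial triangles -/
structure Good [Fintype V] (M : PM V D) (L : Finset (Sym2 V)) (d0 d1 d2 : D) : Prop where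
  fac : Fac M d0 d1 d2
  nout : ¬ M.out d0
  tri : Tri M d0 d1 d2
  contr : Contr L Finset.univ (M.vt d0) (M.vt d1) (M.vt d2)
  cases : (∀ e f, M.vt e = M.vt d0 → M.vt f = M.vt d1 → M.vt (M.al e) = M.vt (M.al f) → M.vt (M.al e) = M.vt d2) ∨
    (∃ x y, Fac M (M.al d0) x y ∧ Tri M (M.al d0) x y ∧ ¬ M.out (M.al d0) ∧ M.vt y ≠ M.vt d2 ∧
      ∀ e f, M.vt e = M.vt d0 → M.vt f = M.vt d1 → M.vt (M.al e) = M.vt (M.al f) →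
       M.vt (M.al e) = M.vt d2 ∨ M.vt (M.al e) = M.vt y)

lemma Contr.symm {E : Finset (Sym2 V)} {X : Finset V} {a b c : V} (h : Contr E X a b c) : Contr E X b a c := by
  obtain ⟨⟨h1, h2, h3⟩, ⟨h4, h5, h6⟩, h7⟩ := h
  refine ⟨⟨h2, h1, h3⟩, ⟨by rwa [Sym2.eq_swap], h6, h5⟩, fun Y hY hB => h7 Y hY ?_⟩
  exact ⟨hB.1, hB.2.2.1, hB.2.1, hB.2.2.2⟩

/-- from a contractible edge where all triangles through it are facial -/
lemma good_of [Fintype V] (hs : M.Simple) {L : Finset (Sym2 V)} (hL : L ⊆ M.edges) {a b c : V}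
    (hC : Contr L Finset.univ a b c)
    (hfac : ∀ e1 e2 e3, Tri M e1 e2 e3 → M.vt e1 = a → M.vt e2 = b →
      (Fac M e1 e2 e3 ∧ ¬ M.out e1) ∨ (Fac M (M.al e3) (M.al e2) (M.al e1) ∧ ¬ M.out (M.al e1))) :
    ∃ d0 d1 d2, Good M L d0 d1 d2 := by
  obtain ⟨-, ⟨hab, hbc, hac⟩, -⟩ := id hC
  obtain ⟨e1, e1a, e1b⟩ := M.exists_dart (hL hab)
  obtain ⟨e2, e2b, e2c⟩ := M.exists_dart (hL hbc)
  obtain ⟨f3, f3a, f3c⟩ := M.exists_dart (hL hac)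
  have tri_of : ∀ e f, M.vt e = a → M.vt f = b → M.vt (M.al e) = M.vt (M.al f) → Tri M e1 f (M.al e) := by
    intro e f h1 h2 h3
    exact ⟨by rw [e1b, h2], by rw [h3], by rw [M.al_al, h1, e1a]⟩
  have hT : Tri M e1 e2 (M.al f3) := tri_of f3 e2 f3a e2b (by rw [f3c, e2c])
  have hw : M.vt (M.al f3) = c := f3c
  rcases hfac _ _ _ hT e1a e2b with ⟨hF, ho⟩ | ⟨hF, ho⟩
  · refine ⟨e1, e2, M.al f3, hF, ho, hT, by rw [e1a, e2b, f3c]; exact hC, ?_⟩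
    by_cases hz : ∃ e f, M.vt e = M.vt e1 ∧ M.vt f = M.vt e2 ∧ M.vt (M.al e) = M.vt (M.al f) ∧ M.vt (M.al e) ≠ M.vt (M.al f3)
    · right
      have step : ∀ e f, M.vt e = M.vt e1 → M.vt f = M.vt e2 → M.vt (M.al e) = M.vt (M.al f) → M.vt (M.al e) ≠ M.vt (M.al f3) →
         Fac M (M.al e1) e (M.al f) ∧ Tri M (M.al e1) e (M.al f) ∧ ¬ M.out (M.al e1) := by
        intro e f h1 h2 h3 h4
        rw [e1a] at h1; rw [e2b] at h2
        have ht := tri_of e f h1 h2 h3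
        rcases hfac _ _ _ ht e1a h2 with ⟨hF', _⟩ | ⟨hF', ho'⟩
        · exfalso
          apply h4
          have : f = e2 := by rw [← hF'.1, ← hF.1]
          rw [h3, this, e2c, f3c]
        · have htr := ht.rev
          rw [M.al_al] at hF' htr
          exact ⟨⟨hF'.2.2, hF'.1, hF'.2.1⟩, htr.rot.rot, ho'⟩
      obtain ⟨e, f, h1, h2, h3, h4⟩ := hz
      obtain ⟨k1, k2, k3⟩ := step e f h1 h2 h3 h4
      refine ⟨e, M.al f, k1, k2, k3, by rw [← h3]; exact h4, ?_⟩
      intro e' f' h1' h2' h3'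
      by_cases h4' : M.vt (M.al e') = M.vt (M.al f3)
      · exact Or.inl h4'
      · right
        obtain ⟨k1', k2', k3'⟩ := step e' f' h1' h2' h3' h4'
        have : e' = e := by rw [← k1'.1, ← k1.1]
        rw [this, h3]
    · left
      intro e f h1 h2 h3
      by_contra h4
      exact hz ⟨e, f, h1, h2, h3, h4⟩
  · have hT' := hT.rev.rot.rot
    rw [M.al_al] at hT' hF
    refine ⟨M.al e1, f3, M.al e2, ⟨hF.2.2, hF.1, hF.2.1⟩, ho, hT', by rw [e1b, f3a, e2c]; exact Contr.symm hC, ?_⟩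
    by_cases hz : ∃ e f, M.vt e = M.vt (M.al e1) ∧ M.vt f = M.vt f3 ∧ M.vt (M.al e) = M.vt (M.al f) ∧ M.vt (M.al e) ≠ M.vt (M.al e2)
    · right
      have step : ∀ e f, M.vt e = M.vt (M.al e1) → M.vt f = M.vt f3 → M.vt (M.al e) = M.vt (M.al f) → M.vt (M.al e) ≠ M.vt (M.al e2) →
         Fac M e1 e (M.al f) ∧ Tri M e1 e (M.al f) ∧ ¬ M.out e1 := by
        intro e f h1 h2 h3 h4
        rw [e1b] at h1; rw [f3a] at h2
        have ht := tri_of f e h2 h1 h3.symm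
        rcases hfac _ _ _ ht e1a h1 with ⟨hF', ho'⟩ | ⟨hF', _⟩
        · exact ⟨hF', ht, ho'⟩
        · exfalso
          apply h4
          rw [M.al_al] at hF'
          have : f = f3 := by rw [← hF'.2.2, ← hF.2.2]
          rw [h3, this, e2c, f3c]
      obtain ⟨e, f, h1, h2, h3, h4⟩ := hz
      obtain ⟨k1, k2, k3⟩ := step e f h1 h2 h3 h4
      refine ⟨e, M.al f, by rw [M.al_al]; exact k1, by rw [M.al_al]; exact k2, by rw [M.al_al]; exact k3, by rw [← h3]; exact h4, ?_⟩
      intro e' f' h1' h2' h3'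
      by_cases h4' : M.vt (M.al e') = M.vt (M.al e2)
      · exact Or.inl h4'
      · right
        obtain ⟨k1', k2', k3'⟩ := step e' f' h1' h2' h3' h4'
        have : e' = e := by rw [← k1'.1, ← k1.1]
        rw [this, h3]
    · left
      intro e f h1 h2 h3
      by_contra h4
      exact hz ⟨e, f, h1, h2, h3, h4⟩

open Classical in
/-- vertex set of a side is tight -/
lemma side_tight [Fintype V] (hs : M.Simple) {L : Finset (Sym2 V)} (hL : L ⊆ M.edges) (hLam : LamanSet L)
    {d1 d2 d3 : D} {S : D → Prop} (h : Tri M d1 d2 d3) (hS : Side M d1 d2 d3 S)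
    (hT : M.edge d1 ∈ L ∧ M.edge d2 ∈ L ∧ M.edge d3 ∈ L) :
    Tight L (Finset.univ.filter (fun v => ∃ d, S d ∧ M.vt d = v)) := by
  obtain ⟨n1, n2, n3⟩ := h.ne hs
  set A := Finset.univ.filter (fun v => ∃ d, S d ∧ M.vt d = v) with hA
  set B := Finset.univ.filter (fun v => ∃ d, ¬ S d ∧ M.vt d = v) with hB
  have mA : ∀ v, v ∈ A ↔ ∃ d, S d ∧ M.vt d = v := by intro v; simp [hA]
  have mB : ∀ v, v ∈ B ↔ ∃ d, ¬ S d ∧ M.vt d = v := by intro v; simp [hB]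
  have hAB : A ∪ B = Finset.univ := by
    ext v
    simp only [Finset.mem_union, mA, mB, Finset.mem_univ, iff_true]
    obtain ⟨d, hd⟩ := M.surj v
    by_cases hc : S d
    · exact Or.inl ⟨d, hc, hd⟩
    · exact Or.inr ⟨d, hc, hd⟩
  have hTV : ({M.vt d1, M.vt d2, M.vt d3} : Finset V) = A ∩ B := by
    ext v
    simp only [Finset.mem_inter, mA, mB, Finset.mem_insert, Finset.mem_singleton]
    constructor
    · rintro (rfl | rfl | rfl)
      · exact ⟨⟨d1, hS.m.1, rfl⟩, ⟨M.al d3, hS.n.2.2, h.h3⟩⟩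
      · exact ⟨⟨d2, hS.m.2.1, rfl⟩, ⟨M.al d1, hS.n.1, h.h1⟩⟩
      · exact ⟨⟨d3, hS.m.2.2, rfl⟩, ⟨M.al d2, hS.n.2.1, h.h2⟩⟩
    · rintro ⟨⟨x, hx, rfl⟩, ⟨y, hy, hxy⟩⟩
      by_contra hc
      exact hy (side_int hS.toClT h hx hxy.symm hc)
  have hT3 : ({M.vt d1, M.vt d2, M.vt d3} : Finset V).card = 3 := Finset.card_eq_three.2 ⟨_, _, _, n1, n3.symm, n2, rfl⟩
  have hc := Finset.card_union_add_card_inter A B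
  rw [hAB, ← hTV, hT3, Finset.card_univ] at hc
  have hI : spn L A ∩ spn L B = spn L {M.vt d1, M.vt d2, M.vt d3} := by
    rw [hTV]
    ext e; induction e with | _ a b => 
    simp only [Finset.mem_inter, mem_spn]; tauto
  have hU : spn L A ∪ spn L B = L := by
    ext e
    constructor
    · intro he
      rcases Finset.mem_union.1 he with he | he
      · exact (mem_spn'.1 he).1
      · exact (mem_spn'.1 he).1
    · intro he
      obtain ⟨d, rfl⟩ := M.mem_edges.1 (hL he)
      rw [Finset.mem_union, edge, mem_spn, mem_spn, mA, mB, mA, mB]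
      rw [edge] at he
      by_cases ho : OnT M d1 d2 d3 d
      · left
        refine ⟨he, ?_, ?_⟩
        · rw [← mA]
          have := h.onT_vt ho
          have h2 : M.vt d ∈ A ∩ B := by rw [← hTV]; simpa using this
          exact (Finset.mem_inter.1 h2).1
        · rw [← mA]
          have := h.onT_vt (onT_al.2 ho)
          have h2 : M.vt (M.al d) ∈ A ∩ B := by rw [← hTV]; simpa using this
          exact (Finset.mem_inter.1 h2).1
      · by_cases hc : S d
        · left; exact ⟨he, ⟨d, hc, rfl⟩, ⟨_, hS.al _ ho hc, rfl⟩⟩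
        · right; exact ⟨he, ⟨d, hc, rfl⟩, ⟨_, hS.toClT.compl.al _ ho hc, rfl⟩⟩
  have hi := Finset.card_union_add_card_inter (spn L A) (spn L B)
  rw [hU, hI] at hi
  have hi3 : 3 ≤ (spn L {M.vt d1, M.vt d2, M.vt d3}).card := by
    have hsub : ({M.edge d1, M.edge d2, M.edge d3} : Finset (Sym2 V)) ⊆ spn L {M.vt d1, M.vt d2, M.vt d3} := by
      intro e; simp only [Finset.mem_insert, Finset.mem_singleton]
      rintro (rfl | rfl | rfl) <;> simp only [edge, h.h1, h.h2, h.h3] at hT ⊢ <;> rw [mem_spn] <;> simp [hT]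
    refine le_trans (le_of_eq ?_) (Finset.card_le_card hsub)
    symm
    rw [Finset.card_eq_three]
    refine ⟨_, _, _, ?_, ?_, ?_, rfl⟩ <;> simp only [edge, h.h1, h.h2, h.h3] <;> simp <;> tauto
  have hA2 : 3 ≤ A.card := by
    rw [← hT3]; apply Finset.card_le_card; rw [hTV]; exact Finset.inter_subset_left
  have hB2 : 3 ≤ B.card := by
    rw [← hT3]; apply Finset.card_le_card; rw [hTV]; exact Finset.inter_subset_right
  have sA := hLam.1.2 A (by omega)
  have sB := hLam.1.2 B (by omega)
  have := hLam.2
  refine ⟨by omega, ?_⟩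
  simp only [ii] at *
  omega

end PM


namespace PM
variable {V D : Type} [Fintype D] {M : PM V D}

lemma card_darts [Fintype V] (hs : M.Simple) {L : Finset (Sym2 V)} (hL : L ⊆ M.edges) :
    2 * L.card ≤ Fintype.card D := by
  classical
  rw [← card_hd hs hL, ← Finset.card_univ]
  exact Finset.card_le_card (Finset.filter_subset _ _)

lemma card_darts' (hs : M.Simple) : Fintype.card D = 2 * M.edges.card := by
  classical
  rw [← card_hd hs (Finset.Subset.refl M.edges), ← Finset.card_univ]
  congr 1
  ext d; simp [M.edge_mem]

lemma cnt_three {S : D → Prop} {a b c : D} (h : ∀ x, S x → x = a ∨ x = b ∨ x = c) : cnt S ≤ 3 := by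
  classical
  unfold cnt
  refine le_trans (Finset.card_le_card (t := {a,b,c}) ?_) Finset.card_le_three
  intro x; simp; exact h x

lemma fac_side (hs : M.Simple) {d1 d2 d3 : D} (h : Tri M d1 d2 d3) (hf : Fac M d1 d2 d3) :
    Side M d1 d2 d3 (fun x => x = d1 ∨ x = d2 ∨ x = d3) := by
  obtain ⟨n1, n2, n3⟩ := h.ne hs
  have key : ∀ a b, M.al a = b → M.vt (M.al a) = M.vt b := fun a b h => by rw [h]
  refine ⟨⟨?_, ?_⟩, ⟨Or.inl rfl, Or.inr (Or.inl rfl), Or.inr (Or.inr rfl)⟩, ?_, ?_, ?_⟩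
  · rintro x (rfl | rfl | rfl)
    · right; left; exact hf.1
    · right; right; exact hf.2.1
    · left; exact hf.2.2
  · rintro x hx (h | h | h) <;> exact absurd (by unfold OnT; tauto) hx
  all_goals
    rintro (h' | h' | h')
    all_goals first
      | exact hs.al_ne _ h'
      | (have e1 := congrArg M.vt h'
         have e2 := congrArg (fun t => M.vt (M.al t)) h'
         simp only [M.al_al, h.h1, h.h2, h.h3] at e1 e2
         first
          | exact n1 e1
          | exact n2 e1
          | exact n3 e1
          | exact n1 e1.symm
          | exact n2 e1.symm
          | exact n3 e1.symm
          | exact n1 e2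
          | exact n2 e2
          | exact n3 e2
          | exact n1 e2.symm
          | exact n2 e2.symm
          | exact n3 e2.symm)

lemma tri_of_edges {L : Finset (Sym2 V)} (hL : L ⊆ M.edges) {x y z : V}
    (h : s(x,y) ∈ L ∧ s(y,z) ∈ L ∧ s(x,z) ∈ L) : ∃ d1 d2 d3, Tri M d1 d2 d3 ∧ M.vt d1 = x ∧ M.vt d2 = y ∧ M.vt d3 = z := by
  obtain ⟨d1, a1, b1⟩ := M.exists_dart (hL h.1)
  obtain ⟨d2, a2, b2⟩ := M.exists_dart (hL h.2.1)
  obtain ⟨d3, a3, b3⟩ := M.exists_dart (a := z) (b := x) (hL (by rw [Sym2.eq_swap]; exact h.2.2))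
  exact ⟨d1, d2, d3, ⟨by rw [b1, a2], by rw [b2, a3], by rw [b3, a1]⟩, a1, a2, a3⟩

lemma exists_interior (hs : M.Simple) {d1 d2 d3 : D} (h : Tri M d1 d2 d3) {S : D → Prop}
    (hS : Side M d1 d2 d3 S) (hc : 3 < cnt S) :
    ∃ x, S x ∧ ¬ (M.vt x = M.vt d1 ∨ M.vt x = M.vt d2 ∨ M.vt x = M.vt d3) := by
  by_contra hcon
  push Not at hcon
  have : cnt S ≤ 3 := by
    apply cnt_three (a := d1) (b := d2) (c := d3)
    intro x hx
    have hon : OnT M d1 d2 d3 x := by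
      by_contra hno
      exact hno (h.onT_of_vt hs (hcon x hx) (hcon _ (hS.al _ hno hx)))
    have := hS.n
    rcases hon with h | h | h | h | h | h
    · exact Or.inl h
    · exact Or.inr (Or.inl h)
    · exact Or.inr (Or.inr h)
    · rw [h] at hx; exact absurd hx this.1
    · rw [h] at hx; exact absurd hx this.2.1
    · rw [h] at hx; exact absurd hx this.2.2
  omega

lemma laman_tight_univ [Fintype V] {L : Finset (Sym2 V)} (hL : LamanSet L) (h2 : 2 ≤ Fintype.card V) :
    Tight L Finset.univ := by
  refine ⟨by simpa using h2, ?_⟩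
  have : spn L Finset.univ = L := by
    ext e; simp [mem_spn']
  rw [ii, this]; simpa using hL.2

/-- a minimal side exists -/
lemma exists_min [Fintype V] (hs : M.Simple) {L : Finset (Sym2 V)} (hL : L ⊆ M.edges) (hLam : LamanSet L)
    (h4 : 4 ≤ Fintype.card V) : ∃ d1 d2 d3 S, Tri M d1 d2 d3 ∧ Side M d1 d2 d3 S ∧ OkS M S ∧ 3 < cnt S ∧
     ∀ e1 e2 e3 S', Tri M e1 e2 e3 → Side M e1 e2 e3 S' → OkS M S' → 3 < cnt S' → cnt S ≤ cnt S' := by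
  classical
  have hD := card_darts hs hL
  have hl2 := hLam.2
  have hex : ∃ n, ∃ d1 d2 d3 S, Tri M d1 d2 d3 ∧ Side M d1 d2 d3 S ∧ OkS M S ∧ 3 < cnt S ∧ cnt S = n := by
    by_cases ho : OutTri M
    · obtain ⟨d1, d2, d3, ht, hf, hout⟩ := ho
      have hside := fac_side hs ht hf
      have hc := cnt_compl (fun x => x = d1 ∨ x = d2 ∨ x = d3)
      have hc3 := cnt_three (S := fun x => x = d1 ∨ x = d2 ∨ x = d3) (fun x hx => hx)
      refine ⟨_, _, _, _, _, ht.rev, hside.compl, ?_, ?_, rfl⟩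
      · left
        intro x hx hox
        exact hx (M.out_cyc d1 x hout hox _ hside.ph (Or.inl rfl))
      · omega
    · obtain ⟨x, y, z, _, he⟩ := exists_tri hs hL hLam.1 Finset.univ (laman_tight_univ hLam (by omega)) (by simp; omega)
      obtain ⟨d1, d2, d3, ht, _⟩ := tri_of_edges hL he
      obtain ⟨S, hS⟩ := exists_side hs ht
      have hc := cnt_compl S
      by_cases h3 : 3 < cnt S
      · exact ⟨_, _, _, _, _, ht, hS, Or.inr ho, h3, rfl⟩
      · exact ⟨_, _, _, _, _, ht.rev, hS.compl, Or.inr ho, by omega, rfl⟩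
  obtain ⟨d1, d2, d3, S, h1, h2, h3, h5, h6⟩ := Nat.find_spec hex
  refine ⟨d1, d2, d3, S, h1, h2, h3, h5, fun e1 e2 e3 S' k1 k2 k3 k4 => ?_⟩
  rw [h6]
  exact Nat.find_min' hex ⟨_, _, _, _, k1, k2, k3, k4, rfl⟩

lemma exists_good4 [Fintype V] (hs : M.Simple) {L0 : Finset (Sym2 V)} (hL0 : L0 ⊆ M.edges) (hLam0 : LamanSet L0)
    (h4 : 4 ≤ Fintype.card V) : ∃ L ⊆ M.edges, LamanSet L ∧ ∃ d0 d1 d2, Good M L d0 d1 d2 := by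
  classical
  obtain ⟨d1, d2, d3, S, ht, hS, hok, h3, hmin⟩ := exists_min hs hL0 hLam0 h4
  obtain ⟨n1, n2, n3⟩ := ht.ne hs
  obtain ⟨L, hL, hLam, hTL⟩ := exchange (G := M.edges) (sparse_tri n1 n2 (Ne.symm n3)) (by
    intro e he
    simp only [Finset.mem_insert, Finset.mem_singleton] at he
    rcases he with rfl | rfl | rfl
    · rw [← ht.h1]; exact M.edge_mem _
    · rw [← ht.h2]; exact M.edge_mem _
    · rw [← ht.h3, Sym2.eq_swap]; exact M.edge_mem _) _ L0 hL0 hLam0 le_rfl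
  refine ⟨L, hL, hLam, ?_⟩
  have hTedge : M.edge d1 ∈ L ∧ M.edge d2 ∈ L ∧ M.edge d3 ∈ L := by
    simp only [edge, ht.h1, ht.h2, ht.h3]
    refine ⟨hTL (by simp), hTL (by simp), ?_⟩
    rw [Sym2.eq_swap]; exact hTL (by simp)
  have htight := side_tight hs hL hLam ht hS hTedge
  set Y : Finset V := Finset.univ.filter (fun v => ∃ d, S d ∧ M.vt d = v) with hY
  have memY : ∀ v, v ∈ Y ↔ ∃ d, S d ∧ M.vt d = v := by intro v; simp [hY]
  obtain ⟨x0, hx0, hx0'⟩ := exists_interior hs ht hS h3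
  push Not at hx0'
  have hY4 : 4 ≤ Y.card := by
    have : ({M.vt x0, M.vt d1, M.vt d2, M.vt d3} : Finset V).card = 4 := by
      rw [Finset.card_insert_of_notMem (by simp [hx0'.1, hx0'.2]), Finset.card_insert_of_notMem (by simp [n1, Ne.symm n3]),
        Finset.card_pair n2]
    rw [← this]
    apply Finset.card_le_card
    intro t ht'
    simp only [Finset.mem_insert, Finset.mem_singleton] at ht'
    rw [memY]
    rcases ht' with rfl | rfl | rfl | rfl
    · exact ⟨_, hx0, rfl⟩
    · exact ⟨_, hS.m.1, rfl⟩
    · exact ⟨_, hS.m.2.1, rfl⟩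
    · exact ⟨_, hS.m.2.2, rfl⟩
  obtain ⟨u, v, w, ⟨huY, hvY, hwY⟩, ⟨huv, hvw, huw⟩, hun⟩ := exists_tri2 hs hL hLam.1 Y htight hY4 (M.vt d1) (M.vt d2) (M.vt d3)
  have htri := fun Z hZ hZ3 => exists_tri hs hL hLam.1 Z hZ hZ3
  obtain ⟨a1, b1, c1, hC1, P1, hP1, hP1t, u1, v1, w1, aP1, bP1⟩ :=
    thmC hLam.1 htri _ Y le_rfl htight u v w ⟨huY, hvY, hwY⟩ ⟨huv, hvw, huw⟩
  obtain ⟨a2, b2, c2, hC2, P2, hP2, hP2t, u2, w2, v2, aP2, bP2⟩ :=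
    thmC hLam.1 htri _ Y le_rfl htight u w v ⟨huY, hwY, hvY⟩ ⟨huw, by rw [Sym2.eq_swap]; exact hvw, huv⟩
  have hmeet : ∀ t, t ∈ P1 → t ∈ P2 → t = u := fun t h1 h2 =>
    tight_meet hLam.1 hvw hP1t hP2t v1 w1 w2 v2 h1 h2 u1 u2
  let InT : V → Prop := fun t => t = M.vt d1 ∨ t = M.vt d2 ∨ t = M.vt d3
  have hab : ∃ a b c, Contr L Y a b c ∧ ¬ InT a := by
    by_contra hcon
    push Not at hcon
    have k1 := hcon _ _ _ hC1
    have k2 := hcon _ _ _ (Contr.symm hC1)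
    have k3 := hcon _ _ _ hC2
    have k4 := hcon _ _ _ (Contr.symm hC2)
    have m1 := hLam.1.ne hC1.2.1.1
    have m2 := hLam.1.ne hC2.2.1.1
    have hu : ¬ InT u := by
      rintro (h | h | h)
      · exact hun.1 h
      · exact hun.2.1 h
      · exact hun.2.2 h
    have q : ∀ t, InT t → t ∈ P1 → t ∈ P2 → False := fun t h1 h2 h3 => by
      have := hmeet t h2 h3
      rw [this] at h1; exact hu h1
    -- two pairs in a three-element set meet
    have hh : a1 = a2 ∨ a1 = b2 ∨ b1 = a2 ∨ b1 = b2 := by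
      by_contra hno
      push Not at hno
      obtain ⟨z1, z2, z3, z4⟩ := hno
      rcases pig1 k1 k2 k3 k4 m1 z3 (Ne.symm z1) with h | h | h
      · exact z2 h.symm
      · exact z4 h.symm
      · exact m2 h.symm
    rcases hh with h | h | h | h
    · exact q a1 k1 aP1 (by rw [h]; exact aP2)
    · exact q a1 k1 aP1 (by rw [h]; exact bP2)
    · exact q b1 k2 bP1 (by rw [h]; exact aP2)
    · exact q b1 k2 bP1 (by rw [h]; exact bP2)
  obtain ⟨a, b, c, hC, haT⟩ := hab
  obtain ⟨⟨haY, hbY, hcY⟩, ⟨hab, hbc, hac⟩, hblk⟩ := hC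
  have hSa : ∀ d, M.vt d = a → S d := by
    intro d hd
    obtain ⟨e, he, hea⟩ := (memY a).1 haY
    exact side_int hS.toClT ht he (by rw [hea, hd]) (by rw [hea]; exact haT)
  have hnb : ∀ t, s(a,t) ∈ L → t ∈ Y := by
    intro t htL
    obtain ⟨d, hd1, hd2⟩ := M.exists_dart (hL htL)
    rw [memY]
    refine ⟨M.al d, hS.al _ ?_ (hSa d hd1), hd2⟩
    intro ho
    have := ht.onT_vt ho
    rw [hd1] at this; exact haT this
  apply good_of hs hL (a := a) (b := b) (c := c)
  · refine ⟨⟨Finset.mem_univ _, Finset.mem_univ _, Finset.mem_univ _⟩, ⟨hab, hbc, hac⟩, ?_⟩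
    rintro Z - ⟨hZ, aZ, bZ, cZ, hZ3⟩
    obtain ⟨t, htZ, htb, htL⟩ := deg2 hLam.1 hZ hZ3 aZ b
    have hta : t ≠ a := (hLam.1.ne htL).symm
    -- intersection is tight
    have hI : {a, b, t} ⊆ Z ∩ Y := by
      intro q hq
      simp only [Finset.mem_insert, Finset.mem_singleton] at hq
      rw [Finset.mem_inter]
      rcases hq with rfl | rfl | rfl
      · exact ⟨aZ, haY⟩
      · exact ⟨bZ, hbY⟩
      · exact ⟨htZ, hnb _ htL⟩
    have hI3 : 3 ≤ (Z ∩ Y).card := by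
      have : ({a, b, t} : Finset V).card = 3 := by
        rw [Finset.card_eq_three]; exact ⟨a, b, t, hLam.1.ne hab, Ne.symm hta, Ne.symm htb, rfl⟩
      rw [← this]; exact Finset.card_le_card hI
    have := (tight_union_inter hLam.1 hZ htight (by omega)).2.1
    refine hblk (Z ∩ Y) Finset.inter_subset_right ⟨this, ?_, ?_, ?_, hI3⟩
    · exact hI (by simp)
    · exact hI (by simp)
    · intro h; exact cZ (Finset.mem_inter.1 h).1
  · intro e1 e2 e3 he h1 h2
    exact min_side hs ht hS hmin hok he (hSa e1 h1) (by rw [h1]; exact haT)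

lemma exists_good3 [Fintype V] (hs : M.Simple) {L : Finset (Sym2 V)} (hL : L ⊆ M.edges) (hLam : LamanSet L)
    (h3 : Fintype.card V = 3) : ∃ d0 d1 d2, Good M L d0 d1 d2 := by
  classical
  obtain ⟨x, y, z, _, he⟩ := exists_tri hs hL hLam.1 Finset.univ (laman_tight_univ hLam (by omega)) (by simp; omega)
  apply good_of hs hL (a := x) (b := y) (c := z)
  · refine ⟨⟨Finset.mem_univ _, Finset.mem_univ _, Finset.mem_univ _⟩, he, ?_⟩
    rintro Z - ⟨_, _, _, hz, hZ3⟩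
    have : Z = Finset.univ := by
      apply Finset.eq_univ_of_card
      have := Finset.card_le_univ Z
      omega
    rw [this] at hz; exact hz (Finset.mem_univ _)
  · intro e1 e2 e3 ht _ _
    have hedges : M.edges.card ≤ 3 := by
      have h1 : M.edges ⊆ (Finset.univ : Finset (Sym2 V)).filter (fun e => ¬ e.IsDiag) := by
        intro e he
        obtain ⟨d, rfl⟩ := M.mem_edges.1 he
        simp only [edge, Finset.mem_filter, Finset.mem_univ, true_and, Sym2.mk_isDiag_iff]
        exact hs.noloop d
      refine (Finset.card_le_card h1).trans ?_
      have := Sym2.card_subtype_not_diag (α := V)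
      rw [Fintype.card_subtype] at this
      rw [this, h3]; decide
    have hD := card_darts' hs
    obtain ⟨S, hS⟩ := exists_side hs ht
    have m1 : 3 ≤ cnt S := by
      by_contra hlt
      have hf := (hS.face hs ht (by omega)).1
      have : cnt S = 3 := by
        have n := ht.ne hs
        unfold cnt
        rw [Finset.card_eq_three]
        refine ⟨e1, e2, e3, fun e => n.1 (by rw [e]), fun e => n.2.2 (by rw [e]), fun e => n.2.1 (by rw [e]), ?_⟩
        ext t; simp [hf]
      omega
    have m2 : 3 ≤ cnt (fun x => ¬ S x) := by
      by_contra hlt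
      have hf := (hS.compl.face hs ht.rev (by omega)).1
      have : cnt (fun x => ¬ S x) = 3 := by
        have n := ht.rev.ne hs
        unfold cnt
        rw [Finset.card_eq_three]
        refine ⟨M.al e3, M.al e2, M.al e1, fun e => n.1 (by rw [e]), fun e => n.2.2 (by rw [e]), fun e => n.2.1 (by rw [e]), ?_⟩
        ext t; simp [hf]
      omega
    have hc := cnt_compl S
    have f1 := hS.face hs ht (by omega)
    have f2 := hS.compl.face hs ht.rev (by omega)
    by_cases ho : M.out e1
    · right
      refine ⟨f2.2, fun ho' => hS.n.1 (M.out_cyc _ _ ho ho' S hS.ph hS.m.1)⟩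
    · left; exact ⟨f1.2, ho⟩

theorem exists_good [Fintype V] (hs : M.Simple) {L0 : Finset (Sym2 V)} (hL0 : L0 ⊆ M.edges) (hLam0 : LamanSet L0)
    (h3 : 3 ≤ Fintype.card V) : ∃ L ⊆ M.edges, LamanSet L ∧ ∃ d0 d1 d2, Good M L d0 d1 d2 := by
  by_cases h4 : 4 ≤ Fintype.card V
  · exact exists_good4 hs hL0 hLam0 h4
  · exact ⟨L0, hL0, hLam0, exists_good3 hs hL0 hLam0 (by omega)⟩

end PM


namespace PM
variable {V D : Type} [Fintype D] {M : PM V D}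

open Classical in
lemma sum_subtype_if (p : D → Prop) [Fintype {d // p d}] (f : D → ℝ) :
    ∑ d : {d // p d}, f d.1 = ∑ d, if p d then f d else 0 := by
  rw [← Finset.sum_filter, ← Finset.sum_subtype (p := p)]
  intro x; simp

/-- the contraction of an edge -/
theorem op0 (M : PM V D) {d0 c : D} (hc : c = M.al d0) {u v : V} (hu : M.vt d0 = u) (hv : M.vt c = v) (h : v ≠ u)
    (h1 : M.ph d0 ≠ c) (h2 : M.ph c ≠ d0) (hno : ¬ M.out d0)
    [Fintype {d // d ≠ d0 ∧ d ≠ c}] :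
    ∃ M0 : PM {x : V // x ≠ u} {d // d ≠ d0 ∧ d ≠ c},
      (∀ d, (M0.al d).1 = M.al d.1) ∧
      (∀ d, M0.vt d = cmap h (M.vt d.1)) ∧
      (∀ d, M0.out d ↔ M.out d.1) ∧
      (∀ d, M.ph d.1 = d0 → (M0.ph d).1 = M.ph d0) ∧
      (∀ d, M.ph d.1 = c → (M0.ph d).1 = M.ph c) ∧
      (∀ d, M.ph d.1 ≠ d0 → M.ph d.1 ≠ c → (M0.ph d).1 = M.ph d.1) := by
  classical
  have hca : M.al c = d0 := by rw [hc, M.al_al]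
  have hcd : c ≠ d0 := by intro e; apply h; rw [← hv, ← hu, e]
  have hp1 : M.ph d0 ≠ d0 := by
    intro e; have := M.vt_ph d0; rw [e, hu] at this; apply h; rw [← hv, this, hc]
  have hp2 : M.ph c ≠ c := by
    intro e; have := M.vt_ph c; rw [e, hca, hu, hv] at this; exact h this
  have hp3 : M.ph d0 ≠ M.ph c := fun e => hcd (M.ph.injective e).symm
  set f : Equiv.Perm D := Equiv.swap d0 (M.ph d0) * Equiv.swap c (M.ph c) * M.ph with hf
  have f1 : ∀ x, M.ph x = d0 → f x = M.ph d0 := by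
    intro x hx
    simp only [hf, Equiv.Perm.mul_apply, hx]
    rw [Equiv.swap_apply_of_ne_of_ne hcd.symm h2.symm, Equiv.swap_apply_left]
  have f2 : ∀ x, M.ph x = c → f x = M.ph c := by
    intro x hx
    simp only [hf, Equiv.Perm.mul_apply, hx]
    rw [Equiv.swap_apply_left, Equiv.swap_apply_of_ne_of_ne h2 hp3.symm]
  have f3 : ∀ x, x ≠ d0 → x ≠ c → M.ph x ≠ d0 → M.ph x ≠ c → f x = M.ph x := by
    intro x a1 a2 a3 a4
    simp only [hf, Equiv.Perm.mul_apply]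
    rw [Equiv.swap_apply_of_ne_of_ne a4 (fun e => a2 (M.ph.injective e)), Equiv.swap_apply_of_ne_of_ne a3 (fun e => a1 (M.ph.injective e))]
  have f4 : f d0 = d0 := by
    simp only [hf, Equiv.Perm.mul_apply]
    rw [Equiv.swap_apply_of_ne_of_ne h1 hp3, Equiv.swap_apply_right]
  have f5 : f c = c := by
    simp only [hf, Equiv.Perm.mul_apply]
    rw [Equiv.swap_apply_right, Equiv.swap_apply_of_ne_of_ne hcd h1.symm]
  have hfk : ∀ x, (f x ≠ d0 ∧ f x ≠ c) ↔ (x ≠ d0 ∧ x ≠ c) := by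
    intro x
    have e1 : f x = d0 ↔ x = d0 := ⟨fun e => f.injective (e.trans f4.symm), fun e => e ▸ f4⟩
    have e2 : f x = c ↔ x = c := ⟨fun e => f.injective (e.trans f5.symm), fun e => by rw [e]; exact f5⟩
    rw [ne_eq, ne_eq, e1, e2]
  have hak : ∀ x, (M.al x ≠ d0 ∧ M.al x ≠ c) ↔ (x ≠ d0 ∧ x ≠ c) := by
    intro x
    have e1 : M.al x = d0 ↔ x = c := ⟨fun e => by rw [hc, ← e, M.al_al], fun e => by rw [e]; exact hca⟩
    have e2 : M.al x = c ↔ x = d0 := ⟨fun e => M.al.injective (e.trans hc), fun e => by rw [e, hc]⟩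
    rw [ne_eq, ne_eq, e1, e2]; tauto
  have hdp1 : M.ph d0 ≠ d0 ∧ M.ph d0 ≠ c := ⟨hp1, h1⟩
  have hdp2 : M.ph c ≠ d0 ∧ M.ph c ≠ c := ⟨h2, hp2⟩
  have cu : cmap h u = cmap h v := by rw [cmap_u, cmap_ne h h]
  let al' : Equiv.Perm {d // d ≠ d0 ∧ d ≠ c} := M.al.subtypePerm hak
  let ph' : Equiv.Perm {d // d ≠ d0 ∧ d ≠ c} := f.subtypePerm hfk
  have pal : ∀ x, (al' x).1 = M.al x.1 := fun x => rfl
  have pph : ∀ x, (ph' x).1 = f x.1 := fun x => rfl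
  have fcases : ∀ x, x ≠ d0 → x ≠ c → (M.ph x = d0 ∧ f x = M.ph d0) ∨ (M.ph x = c ∧ f x = M.ph c) ∨
      (M.ph x ≠ d0 ∧ M.ph x ≠ c ∧ f x = M.ph x) := by
    intro x a1 a2
    by_cases b1 : M.ph x = d0
    · exact Or.inl ⟨b1, f1 x b1⟩
    · by_cases b2 : M.ph x = c
      · exact Or.inr (Or.inl ⟨b2, f2 x b2⟩)
      · exact Or.inr (Or.inr ⟨b1, b2, f3 x a1 a2 b1 b2⟩)
  have s1 : ∀ x, cmap h (M.vt (f x)) = cmap h (M.vt (M.al x)) ∨ x = d0 ∨ x = c := by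
    intro x
    by_cases a1 : x = d0
    · exact Or.inr (Or.inl a1)
    by_cases a2 : x = c
    · exact Or.inr (Or.inr a2)
    left
    rcases fcases x a1 a2 with ⟨b, e⟩ | ⟨b, e⟩ | ⟨_, _, e⟩
    · rw [e, ← M.vt_ph x, b, M.vt_ph d0, ← hc, hv, hu, cu]
    · rw [e, ← M.vt_ph x, b, M.vt_ph c, hca, hv, hu, cu]
    · rw [e, M.vt_ph]
  -- orbits of the rotation at the merged vertex
  have key : ∀ P : {d // d ≠ d0 ∧ d ≠ c} → Prop, (∀ x, P x → P (ph' (al' x))) →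
      ∀ x : {d // d ≠ d0 ∧ d ≠ c}, P x → ∀ Q : D → Prop, Q = (fun t => (∃ ht, P ⟨t, ht⟩) ∨ (t = d0 ∧ P ⟨M.ph c, hdp2⟩) ∨ (t = c ∧ P ⟨M.ph d0, hdp1⟩)) →
      ∀ t, Q t → Q (M.ph (M.al t)) := by
    intro P hP x hx Q hQ t ht
    rw [hQ] at ht ⊢
    rcases ht with ⟨ht, hPt⟩ | ⟨ht, hPt⟩ | ⟨ht, hPt⟩
    · have h3 := hP _ hPt
      have hat := (hak t).2 ht
      rcases fcases (M.al t) hat.1 hat.2 with ⟨b, e⟩ | ⟨b, e⟩ | ⟨b1, b2, e⟩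
      · right; left
        -- ph (al t) = d0; new successor is ph d0
        refine ⟨b, ?_⟩
        have e2 : ph' (al' ⟨t, ht⟩) = ⟨M.ph d0, hdp1⟩ := Subtype.ext e
        rw [e2] at h3
        -- ph d0 lies at v, move on until reaching c, then ph c
        have := M.trans (M.ph d0) c (by rw [M.vt_ph, ← hc])
          (fun s => (∃ hs, P ⟨s, hs⟩ ∧ M.vt s = v) ∨ P ⟨M.ph c, hdp2⟩) ?_ (Or.inl ⟨hdp1, h3, by rw [M.vt_ph, ← hc, hv]⟩)
        · rcases this with ⟨hs, _⟩ | h5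
          · exact absurd rfl hs.2
          · exact h5
        · rintro s (⟨hs, hPs, hvs⟩ | hh)
          · have has := (hak s).2 hs
            have h6 := hP _ hPs
            rcases fcases (M.al s) has.1 has.2 with ⟨b', e'⟩ | ⟨b', e'⟩ | ⟨b1, b2, e'⟩
            · exfalso
              have := M.vt_ph (M.al s)
              rw [b', M.al_al, hvs, hu] at this; exact h this.symm
            · right
              have e3 : ph' (al' ⟨s, hs⟩) = ⟨M.ph c, hdp2⟩ := Subtype.ext e'
              rwa [e3] at h6
            · left
              have e3 : ph' (al' ⟨s, hs⟩) = ⟨M.ph (M.al s), ⟨b1, b2⟩⟩ := Subtype.ext e'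
              rw [e3] at h6
              exact ⟨_, h6, by rw [M.vt_ph, M.al_al, hvs]⟩
          · exact Or.inr hh
      · right; right
        refine ⟨b, ?_⟩
        have e2 : ph' (al' ⟨t, ht⟩) = ⟨M.ph c, hdp2⟩ := Subtype.ext e
        rw [e2] at h3
        have := M.trans (M.ph c) d0 (by rw [M.vt_ph, hca])
          (fun s => (∃ hs, P ⟨s, hs⟩ ∧ M.vt s = u) ∨ P ⟨M.ph d0, hdp1⟩) ?_ (Or.inl ⟨hdp2, h3, by rw [M.vt_ph, hca, hu]⟩)
        · rcases this with ⟨hs, _⟩ | h5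
          · exact absurd rfl hs.1
          · exact h5
        · rintro s (⟨hs, hPs, hvs⟩ | hh)
          · have has := (hak s).2 hs
            have h6 := hP _ hPs
            rcases fcases (M.al s) has.1 has.2 with ⟨b', e'⟩ | ⟨b', e'⟩ | ⟨b1, b2, e'⟩
            · right
              have e3 : ph' (al' ⟨s, hs⟩) = ⟨M.ph d0, hdp1⟩ := Subtype.ext e'
              rwa [e3] at h6
            · exfalso
              have := M.vt_ph (M.al s)
              rw [b', M.al_al, hvs, hv] at this; exact h this
            · left
              have e3 : ph' (al' ⟨s, hs⟩) = ⟨M.ph (M.al s), ⟨b1, b2⟩⟩ := Subtype.ext e'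
              rw [e3] at h6
              exact ⟨_, h6, by rw [M.vt_ph, M.al_al, hvs]⟩
          · exact Or.inr hh
      · left
        have e2 : ph' (al' ⟨t, ht⟩) = ⟨M.ph (M.al t), ⟨b1, b2⟩⟩ := Subtype.ext e
        rw [e2] at h3
        exact ⟨_, h3⟩
    · left; rw [ht, ← hc]; exact ⟨hdp2, hPt⟩
    · left; rw [ht, hca]; exact ⟨hdp1, hPt⟩
  refine ⟨⟨al', ph', fun d => cmap h (M.vt d.1), fun d => M.out d.1, ?_, ?_, ?_, ?_, ?_, ?_, ?_, ?_, ?_⟩,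
    pal, fun d => rfl, fun d => Iff.rfl, fun d => f1 _, fun d => f2 _, fun d => f3 _ d.2.1 d.2.2⟩
  · intro d; apply Subtype.ext; rw [pal, pal, M.al_al]
  · intro d
    rcases s1 d.1 with e | e | e
    · exact e
    · exact absurd e d.2.1
    · exact absurd e d.2.2
  · intro d e hde P hP hPd
    have k := key P hP d hPd _ rfl
    have fin : ∀ t : {d // d ≠ d0 ∧ d ≠ c}, ((∃ ht, P ⟨t.1, ht⟩) ∨ (t.1 = d0 ∧ P ⟨M.ph c, hdp2⟩) ∨ (t.1 = c ∧ P ⟨M.ph d0, hdp1⟩)) → P t := by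
      rintro t (⟨_, h⟩ | h | h)
      · exact h
      · exact absurd h.1 t.2.1
      · exact absurd h.1 t.2.2
    rcases cmap_eq h hde with e1 | ⟨e1, e2⟩ | ⟨e1, e2⟩
    · exact fin e (M.trans d.1 e.1 e1 _ k (Or.inl ⟨d.2, hPd⟩))
    · -- d at u, e at v
      have q := M.trans d.1 d0 (by rw [e1, hu]) _ k (Or.inl ⟨d.2, hPd⟩)
      have q2 : P ⟨M.ph c, hdp2⟩ := by
        rcases q with ⟨ht, _⟩ | q | q
        · exact absurd rfl ht.1
        · exact q.2
        · exact absurd q.1.symm hcd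
      -- pred of d0 at u
      have q3 : P ⟨M.ph d0, hdp1⟩ := by
        have := M.trans (M.ph c) d0 (by rw [M.vt_ph, hca])
          (fun s => (∃ hs, P ⟨s, hs⟩ ∧ M.vt s = u) ∨ P ⟨M.ph d0, hdp1⟩) ?_ (Or.inl ⟨hdp2, q2, by rw [M.vt_ph, hca, hu]⟩)
        · rcases this with ⟨hs, _⟩ | h5
          · exact absurd rfl hs.1
          · exact h5
        · rintro s (⟨hs, hPs, hvs⟩ | hh)
          · have has := (hak s).2 hs
            have h6 := hP _ hPs
            rcases fcases (M.al s) has.1 has.2 with ⟨b', e'⟩ | ⟨b', e'⟩ | ⟨b1, b2, e'⟩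
            · right
              have e3 : ph' (al' ⟨s, hs⟩) = ⟨M.ph d0, hdp1⟩ := Subtype.ext e'
              rwa [e3] at h6
            · exfalso
              have := M.vt_ph (M.al s)
              rw [b', M.al_al, hvs, hv] at this; exact h this
            · left
              have e3 : ph' (al' ⟨s, hs⟩) = ⟨M.ph (M.al s), ⟨b1, b2⟩⟩ := Subtype.ext e'
              rw [e3] at h6
              exact ⟨_, h6, by rw [M.vt_ph, M.al_al, hvs]⟩
          · exact Or.inr hh
      exact fin e (M.trans c e.1 (by rw [e2, hv]) _ k (Or.inr (Or.inr ⟨rfl, q3⟩)))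
    · have q := M.trans d.1 c (by rw [e1, hv]) _ k (Or.inl ⟨d.2, hPd⟩)
      have q2 : P ⟨M.ph d0, hdp1⟩ := by
        rcases q with ⟨ht, _⟩ | q | q
        · exact absurd rfl ht.2
        · exact absurd q.1 hcd
        · exact q.2
      have q3 : P ⟨M.ph c, hdp2⟩ := by
        have := M.trans (M.ph d0) c (by rw [M.vt_ph, ← hc])
          (fun s => (∃ hs, P ⟨s, hs⟩ ∧ M.vt s = v) ∨ P ⟨M.ph c, hdp2⟩) ?_ (Or.inl ⟨hdp1, q2, by rw [M.vt_ph, ← hc, hv]⟩)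
        · rcases this with ⟨hs, _⟩ | h5
          · exact absurd rfl hs.2
          · exact h5
        · rintro s (⟨hs, hPs, hvs⟩ | hh)
          · have has := (hak s).2 hs
            have h6 := hP _ hPs
            rcases fcases (M.al s) has.1 has.2 with ⟨b', e'⟩ | ⟨b', e'⟩ | ⟨b1, b2, e'⟩
            · exfalso
              have := M.vt_ph (M.al s)
              rw [b', M.al_al, hvs, hu] at this; exact h this.symm
            · right
              have e3 : ph' (al' ⟨s, hs⟩) = ⟨M.ph c, hdp2⟩ := Subtype.ext e'
              rwa [e3] at h6
            · left
              have e3 : ph' (al' ⟨s, hs⟩) = ⟨M.ph (M.al s), ⟨b1, b2⟩⟩ := Subtype.ext e'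
              rw [e3] at h6
              exact ⟨_, h6, by rw [M.vt_ph, M.al_al, hvs]⟩
          · exact Or.inr hh
      exact fin e (M.trans d0 e.1 (by rw [e2, hu]) _ k (Or.inr (Or.inl ⟨rfl, q3⟩)))
  · intro P ⟨x, hx⟩ hP
    have := M.conn (fun y => P (cmap h y)) ⟨x.1, by rw [cmap_ne h x.2]; exact hx⟩ ?_
    · intro y; have := this y.1; rwa [cmap_ne h y.2] at this
    · intro d hd
      by_cases a1 : d = d0
      · rw [a1, hu, cu] at hd; rw [a1, ← hc, hv]; exact hd
      by_cases a2 : d = c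
      · rw [a2, hv, ← cu] at hd; rw [a2, hca, hu]; exact hd
      exact hP ⟨d, a1, a2⟩ hd
  · intro x
    by_cases hx : x.1 = v
    · exact ⟨⟨M.ph d0, hdp1⟩, by simp only [M.vt_ph, ← hc, hv]; rw [cmap_ne h h]; exact Subtype.ext hx.symm⟩
    · obtain ⟨d, hd⟩ := M.surj x.1
      refine ⟨⟨d, ?_, ?_⟩, ?_⟩
      · rintro rfl; exact x.2 (hd ▸ hu)
      · rintro rfl; exact hx (by rw [← hd, hv])
      · simp only [hd]; rw [cmap_ne h x.2]
  · intro a ha hsum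
    set A : D → ℝ := fun d => if hd : d ≠ d0 ∧ d ≠ c then a ⟨d, hd⟩ else 0 with hA
    have Ad : ∀ d, A d.1 = a d := by intro d; simp only [hA]; rw [dif_pos d.2]
    have A0 : A d0 = 0 := by simp [hA]
    have Ac : A c = 0 := by simp [hA]
    set su : ℝ := ∑ d, if M.vt d = u then A d else 0 with hsu
    set sv : ℝ := ∑ d, if M.vt d = v then A d else 0 with hsv
    have hsum' : ∀ y : {x // x ≠ u}, ∑ d, (if cmap h (M.vt d) = y then A d else 0) = 0 := by
      intro y
      have T : ∑ d : {d // d ≠ d0 ∧ d ≠ c}, (fun t => if cmap h (M.vt t) = y then A t else 0) d.1 = 0 := by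
        refine Eq.trans ?_ (hsum y)
        refine Finset.sum_congr rfl (fun d _ => ?_)
        simp only [Ad]
        congr
      have T2 := sum_subtype_if (fun d => d ≠ d0 ∧ d ≠ c) (fun t => if cmap h (M.vt t) = y then A t else 0)
      refine Eq.trans ?_ (T2.symm.trans T)
      apply Finset.sum_congr rfl
      intro d _
      by_cases hd : d ≠ d0 ∧ d ≠ c
      · rw [if_pos hd]
      · rw [if_neg hd]; simp [hA, hd]
    have huv : su + sv = 0 := by
      rw [← hsum' ⟨v, h⟩, hsu, hsv, ← Finset.sum_add_distrib]
      apply Finset.sum_congr rfl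
      intro d _
      by_cases e1 : M.vt d = u
      · rw [if_pos e1, if_neg (by rw [e1]; exact h.symm), if_pos (by rw [e1, cmap_u])]; ring
      · rw [if_neg e1, cmap_ne h e1]
        by_cases e2 : M.vt d = v
        · rw [if_pos e2, if_pos (Subtype.ext e2)]; ring
        · rw [if_neg e2, if_neg (fun e => e2 (congrArg Subtype.val e))]; ring
    set A' : D → ℝ := fun d => A d - (if d = d0 then su else 0) + (if d = c then su else 0) with hA'
    suffices hss : (∀ d, A' (M.al d) = - A' d) ∧ (∀ x, (open Classical in ∑ d, if M.vt d = x then A' d else 0) = 0) by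
      obtain ⟨g, hg1, hg2⟩ := M.exact A' hss.1 hss.2
      refine ⟨fun d => g d.1, ?_, ?_⟩
      · intro d
        show g (ph' d).1 = g d.1
        rw [pph]
        rcases fcases d.1 d.2.1 d.2.2 with ⟨b, e⟩ | ⟨b, e⟩ | ⟨_, _, e⟩
        · have q := hg1 d.1; rw [b] at q; rw [e, hg1]; exact q
        · have q := hg1 d.1; rw [b] at q; rw [e, hg1]; exact q
        · rw [e, hg1]
      · intro d
        show a d = g d.1 - g (al' d).1
        rw [pal, ← hg2 d.1, hA', ← Ad d]
        simp [d.2.1, d.2.2]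
    constructor
    · intro d
      simp only [hA']
      have e1 : M.al d = d0 ↔ d = c := ⟨fun e => by rw [hc, ← e, M.al_al], fun e => by rw [e]; exact hca⟩
      have e2 : M.al d = c ↔ d = d0 := ⟨fun e => M.al.injective (e.trans hc), fun e => by rw [e, hc]⟩
      have e3 : A (M.al d) = - A d := by
        by_cases hd : d ≠ d0 ∧ d ≠ c
        · have := ha ⟨d, hd⟩
          rw [← Ad, ← Ad, pal] at this; exact this
        · have hd' : ¬ (M.al d ≠ d0 ∧ M.al d ≠ c) := by rw [hak]; exact hd
          simp only [hA]; rw [dif_neg hd, dif_neg hd']; simp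
      simp only [e1, e2, e3]; ring
    · intro x
      have e : ∀ d, (if M.vt d = x then A' d else 0) = (if M.vt d = x then A d else 0) -
          (if d = d0 then (if u = x then su else 0) else 0) + (if d = c then (if v = x then su else 0) else 0) := by
        intro d
        simp only [hA']
        by_cases b1 : d = d0
        · subst b1; rw [hu]; by_cases b2 : u = x <;> simp [b2, hcd.symm]
        · by_cases b3 : d = c
          · rw [b3, hv]; by_cases b2 : v = x <;> simp [b2, hcd]
          · simp [b1, b3]
      simp only [e, Finset.sum_add_distrib, Finset.sum_sub_distrib, Finset.sum_ite_eq', Finset.mem_univ, if_true]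
      by_cases b1 : u = x
      · subst b1; rw [if_pos rfl, if_neg h, ← hsu]; ring
      · rw [if_neg b1]
        by_cases b2 : v = x
        · subst b2; rw [if_pos rfl, ← hsv]; linarith
        · rw [if_neg b2]
          have := hsum' ⟨x, Ne.symm b1⟩
          have e2 : ∀ d, (if cmap h (M.vt d) = ⟨x, Ne.symm b1⟩ then A d else 0) = (if M.vt d = x then A d else 0) := by
            intro d
            by_cases e1 : M.vt d = u
            · rw [e1, cmap_u, if_neg b1, if_neg (fun e => b2 (congrArg Subtype.val e))]
            · rw [cmap_ne h e1]; simp only [Subtype.mk.injEq]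
          simp only [e2] at this
          rw [this]; ring
  · intro d
    rw [pph]
    rcases fcases d.1 d.2.1 d.2.2 with ⟨b, e⟩ | ⟨b, e⟩ | ⟨_, _, e⟩
    · have q := M.out_ph d.1; rw [b] at q; rw [e, M.out_ph]; exact q
    · have q := M.out_ph d.1; rw [b] at q; rw [e, M.out_ph]; exact q
    · rw [e, M.out_ph]
  · intro d e hd he P hP hPd
    have := M.out_cyc d.1 e.1 hd he (fun t => (∃ ht, P ⟨t, ht⟩) ∨ (t = d0 ∧ P ⟨M.ph d0, hdp1⟩) ∨ (t = c ∧ P ⟨M.ph c, hdp2⟩)) ?_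
      (Or.inl ⟨d.2, hPd⟩)
    · rcases this with ⟨_, h⟩ | h | h
      · exact h
      · exact absurd h.1 e.2.1
      · exact absurd h.1 e.2.2
    · rintro t (⟨ht, hPt⟩ | ⟨ht, hPt⟩ | ⟨ht, hPt⟩)
      · have h3 := hP _ hPt
        rcases fcases t ht.1 ht.2 with ⟨b, e⟩ | ⟨b, e⟩ | ⟨b1, b2, e⟩
        · have e2 : ph' ⟨t, ht⟩ = ⟨M.ph d0, hdp1⟩ := Subtype.ext e
          rw [e2] at h3; exact Or.inr (Or.inl ⟨b, h3⟩)
        · have e2 : ph' ⟨t, ht⟩ = ⟨M.ph c, hdp2⟩ := Subtype.ext e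
          rw [e2] at h3; exact Or.inr (Or.inr ⟨b, h3⟩)
        · have e2 : ph' ⟨t, ht⟩ = ⟨M.ph t, ⟨b1, b2⟩⟩ := Subtype.ext e
          rw [e2] at h3; exact Or.inl ⟨_, h3⟩
      · rw [ht]; exact Or.inl ⟨hdp1, hPt⟩
      · rw [ht]; exact Or.inl ⟨hdp2, hPt⟩
  · obtain ⟨d, hd⟩ := M.out_ne
    have a1 : d ≠ d0 := by rintro rfl; exact hno hd
    by_cases a2 : d = c
    · exact ⟨⟨M.ph c, hdp2⟩, by rw [a2] at hd; exact (M.out_ph c).2 hd⟩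
    · exact ⟨⟨d, a1, a2⟩, hd⟩

end PM


namespace PM
variable {V D : Type} [Fintype D] {M : PM V D}

/-- removal of one edge of a digon -/
theorem opR (M : PM V D) {x y x' y' : D} (hx' : x' = M.al x) (hy' : y' = M.al y)
    (hxy : M.ph x = y) (hyx : M.ph y = x) (hne : M.vt x ≠ M.vt y)
    (hd : x' ≠ y) (hno : ¬ M.out x) [Fintype {d // d ≠ x ∧ d ≠ y}] :
    ∃ M1 : PM V {d // d ≠ x ∧ d ≠ y},
      (∀ d, d.1 = x' → (M1.al d).1 = y') ∧
      (∀ d, d.1 = y' → (M1.al d).1 = x') ∧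
      (∀ d, d.1 ≠ x' → d.1 ≠ y' → (M1.al d).1 = M.al d.1) ∧
      (∀ d, M1.vt d = M.vt d.1) ∧
      (∀ d, M1.out d ↔ M.out d.1) ∧
      (∀ d, (M1.ph d).1 = M.ph d.1) := by
  classical
  have n1 : x ≠ y := fun e => hne (by rw [e])
  have ax : M.al x' = x := by rw [hx', M.al_al]
  have ay : M.al y' = y := by rw [hy', M.al_al]
  have vy : M.vt y = M.vt x' := by rw [← hxy, M.vt_ph, hx']
  have vx : M.vt x = M.vt y' := by rw [← hyx, M.vt_ph, hy']
  have n2 : x' ≠ x := fun e => hne (by rw [vy, e])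
  have n3 : y' ≠ y := fun e => hne (by rw [vx, e])
  have n4 : y' ≠ x := fun e => hd (by rw [hx', ← e, ay])
  have n5 : x' ≠ y' := fun e => n1 (by rw [← ax, ← ay, e])
  set f : Equiv.Perm D := Equiv.swap x y' * M.al * Equiv.swap x y' with hf
  have f1 : f x' = y' := by
    simp only [hf, Equiv.Perm.mul_apply]
    rw [Equiv.swap_apply_of_ne_of_ne n2 n5, ax, Equiv.swap_apply_left]
  have f2 : f y' = x' := by
    simp only [hf, Equiv.Perm.mul_apply]
    rw [Equiv.swap_apply_right, ← hx', Equiv.swap_apply_of_ne_of_ne n2 n5]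
  have f3 : f x = y := by
    simp only [hf, Equiv.Perm.mul_apply]
    rw [Equiv.swap_apply_left, ay, Equiv.swap_apply_of_ne_of_ne n1.symm n3.symm]
  have f4 : f y = x := by
    simp only [hf, Equiv.Perm.mul_apply]
    rw [Equiv.swap_apply_of_ne_of_ne n1.symm n3.symm, ← hy', Equiv.swap_apply_right]
  have f5 : ∀ d, d ≠ x → d ≠ y → d ≠ x' → d ≠ y' → f d = M.al d := by
    intro d a1 a2 a3 a4
    simp only [hf, Equiv.Perm.mul_apply]
    rw [Equiv.swap_apply_of_ne_of_ne a1 a4, Equiv.swap_apply_of_ne_of_ne]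
    · intro e; apply a3; rw [hx', ← e, M.al_al]
    · rw [hy']; intro e; exact a2 (M.al.injective e)
  have hfk : ∀ d, (f d ≠ x ∧ f d ≠ y) ↔ (d ≠ x ∧ d ≠ y) := by
    intro d
    have e1 : f d = x ↔ d = y := ⟨fun e => f.injective (e.trans f4.symm), fun e => e ▸ f4⟩
    have e2 : f d = y ↔ d = x := ⟨fun e => f.injective (e.trans f3.symm), fun e => e ▸ f3⟩
    rw [ne_eq, ne_eq, e1, e2]; exact and_comm
  have hpk : ∀ d, (M.ph d ≠ x ∧ M.ph d ≠ y) ↔ (d ≠ x ∧ d ≠ y) := by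
    intro d
    have e1 : M.ph d = x ↔ d = y := ⟨fun e => M.ph.injective (e.trans hyx.symm), fun e => e ▸ hyx⟩
    have e2 : M.ph d = y ↔ d = x := ⟨fun e => M.ph.injective (e.trans hxy.symm), fun e => e ▸ hxy⟩
    rw [ne_eq, ne_eq, e1, e2]; exact and_comm
  have kx : x' ≠ x ∧ x' ≠ y := ⟨n2, hd⟩
  have ky : y' ≠ x ∧ y' ≠ y := ⟨n4, n3⟩
  let al' : Equiv.Perm {d // d ≠ x ∧ d ≠ y} := f.subtypePerm hfk
  let ph' : Equiv.Perm {d // d ≠ x ∧ d ≠ y} := M.ph.subtypePerm hpk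
  have pal : ∀ d, (al' d).1 = f d.1 := fun _ => rfl
  have pph : ∀ d, (ph' d).1 = M.ph d.1 := fun _ => rfl
  have g1 : ∀ d : {d // d ≠ x ∧ d ≠ y}, d.1 = x' → (al' d).1 = y' := fun d e => by rw [pal, e, f1]
  have g2 : ∀ d : {d // d ≠ x ∧ d ≠ y}, d.1 = y' → (al' d).1 = x' := fun d e => by rw [pal, e, f2]
  have g3 : ∀ d : {d // d ≠ x ∧ d ≠ y}, d.1 ≠ x' → d.1 ≠ y' → (al' d).1 = M.al d.1 :=
    fun d e e' => by rw [pal, f5 _ d.2.1 d.2.2 e e']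
  have vf : ∀ d : {d // d ≠ x ∧ d ≠ y}, M.vt (al' d).1 = M.vt (M.al d.1) := by
    intro d
    by_cases b1 : d.1 = x'
    · rw [g1 d b1, b1, ax, vx]
    by_cases b2 : d.1 = y'
    · rw [g2 d b2, b2, ay, vy]
    rw [g3 d b1 b2]
  refine ⟨⟨al', ph', fun d => M.vt d.1, fun d => M.out d.1, ?_, ?_, ?_, ?_, ?_, ?_, ?_, ?_, ?_⟩,
    g1, g2, g3, fun d => rfl, fun d => Iff.rfl, pph⟩
  · intro d
    apply Subtype.ext
    by_cases b1 : d.1 = x'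
    · rw [g2 _ (g1 d b1), b1]
    by_cases b2 : d.1 = y'
    · rw [g1 _ (g2 d b2), b2]
    rw [g3 (al' d), g3 d b1 b2, M.al_al]
    · rw [g3 d b1 b2, hx']; intro e; exact d.2.1 (M.al.injective e)
    · rw [g3 d b1 b2, hy']; intro e; exact d.2.2 (M.al.injective e)
  · intro d
    show M.vt (ph' d).1 = M.vt (al' d).1
    rw [vf, pph, M.vt_ph]
  · intro d e hde P hP hPd
    have := M.trans d.1 e.1 hde (fun t => (∃ ht, P ⟨t, ht⟩) ∨ (t = y ∧ P ⟨x', kx⟩) ∨ (t = x ∧ P ⟨y', ky⟩)) ?_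
      (Or.inl ⟨d.2, hPd⟩)
    · rcases this with ⟨_, h⟩ | h | h
      · exact h
      · exact absurd h.1 e.2.2
      · exact absurd h.1 e.2.1
    · rintro t (⟨ht, hPt⟩ | ⟨ht, hPt⟩ | ⟨ht, hPt⟩)
      · by_cases b1 : t = x'
        · subst b1; right; left; rw [ax]; exact ⟨hxy, hPt⟩
        by_cases b2 : t = y'
        · subst b2; right; right; rw [ay]; exact ⟨hyx, hPt⟩
        left
        have h3 := hP _ hPt
        have e2 : (ph' (al' ⟨t, ht⟩)).1 = M.ph (M.al t) := by rw [pph, g3 _ b1 b2]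
        rw [← e2]; exact ⟨(ph' (al' ⟨t, ht⟩)).2, h3⟩
      · left
        have h3 := hP _ hPt
        have e2 : (ph' (al' ⟨x', kx⟩)).1 = M.ph (M.al t) := by rw [pph, g1 _ rfl, ht, hy']
        rw [← e2]; exact ⟨(ph' (al' ⟨x', kx⟩)).2, h3⟩
      · left
        have h3 := hP _ hPt
        have e2 : (ph' (al' ⟨y', ky⟩)).1 = M.ph (M.al t) := by rw [pph, g2 _ rfl, ht, hx']
        rw [← e2]; exact ⟨(ph' (al' ⟨y', ky⟩)).2, h3⟩
  · intro P hne' hP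
    apply M.conn P hne'
    intro d hPd
    by_cases b1 : d = x
    · rw [b1, ← hx', ← vy]
      have := hP ⟨y', ky⟩ (by rw [← vx, ← b1]; exact hPd)
      rw [g2 _ rfl, ← vy] at this; exact this
    by_cases b2 : d = y
    · rw [b2, ← hy', ← vx]
      have := hP ⟨x', kx⟩ (by rw [← vy, ← b2]; exact hPd)
      rw [g1 _ rfl, ← vx] at this; exact this
    have := hP ⟨d, b1, b2⟩ hPd
    rw [vf] at this; exact this
  · intro z
    obtain ⟨d, hdz⟩ := M.surj z
    by_cases b1 : d = x
    · exact ⟨⟨y', ky⟩, by show M.vt y' = z; rw [← vx, ← b1, hdz]⟩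
    by_cases b2 : d = y
    · exact ⟨⟨x', kx⟩, by show M.vt x' = z; rw [← vy, ← b2, hdz]⟩
    exact ⟨⟨d, b1, b2⟩, hdz⟩
  · intro a ha hsum
    set K : ℝ := a ⟨y', ky⟩ with hK
    have hK' : a ⟨x', kx⟩ = - K := by
      have := ha ⟨y', ky⟩
      have e : al' ⟨y', ky⟩ = ⟨x', kx⟩ := Subtype.ext (g2 _ rfl)
      rw [e] at this; exact this
    set B : D → ℝ := fun d => if hd : d ≠ x ∧ d ≠ y then a ⟨d, hd⟩ else 0 with hB
    have Bd : ∀ d, B d.1 = a d := by intro d; simp only [hB]; rw [dif_pos d.2]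
    set A : D → ℝ := fun d => B d + (if d = x then K else 0) - (if d = y' then K else 0) with hA
    have Ax : A x = K := by simp [hA, hB, n4.symm]
    have Ay : A y = 0 := by simp [hA, hB, n3.symm, n1.symm]
    have Ax' : A x' = -K := by
      have := Bd ⟨x', kx⟩
      simp only [hA]; rw [if_neg n2, if_neg n5, this, hK']; ring
    have Ay' : A y' = 0 := by
      have := Bd ⟨y', ky⟩
      simp only [hA]; rw [if_neg n4, if_pos trivial, this]; ring
    have Ao : ∀ d, ∀ h : d ≠ x ∧ d ≠ y, d ≠ y' → A d = a ⟨d, h⟩ := by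
      intro d h b
      have := Bd ⟨d, h⟩
      simp only [hA]; rw [if_neg h.1, if_neg b, this]; ring
    suffices hss : (∀ d, A (M.al d) = - A d) ∧ (∀ z, (open Classical in ∑ d, if M.vt d = z then A d else 0) = 0) by
      obtain ⟨g, hg1, hg2⟩ := M.exact A hss.1 hss.2
      have q0 : g x = g y := by rw [← hyx, hg1]
      have q1 := hg2 y
      have q2 := hg2 x
      rw [Ay, ← hy'] at q1
      rw [Ax, ← hx'] at q2
      refine ⟨fun d => g d.1, ?_, ?_⟩
      · intro d
        show g (ph' d).1 = g d.1
        rw [pph, hg1]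
      · intro d
        show a d = g d.1 - g (al' d).1
        by_cases b1 : d.1 = x'
        · rw [g1 d b1, b1]
          have e : d = ⟨x', kx⟩ := Subtype.ext b1
          rw [e, hK']; linarith
        by_cases b2 : d.1 = y'
        · rw [g2 d b2, b2]
          have e : d = ⟨y', ky⟩ := Subtype.ext b2
          rw [e]; linarith
        rw [g3 d b1 b2, ← hg2 d.1, Ao d.1 d.2 b2]
    constructor
    · intro d
      by_cases c1 : d = x
      · rw [c1, ← hx', Ax, Ax']
      by_cases c2 : d = y
      · rw [c2, ← hy', Ay, Ay']; ring
      by_cases c3 : d = x'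
      · rw [c3, ax, Ax, Ax']; ring
      by_cases c4 : d = y'
      · rw [c4, ay, Ay, Ay']; ring
      have e1 : M.al d ≠ x := by intro e; apply c3; rw [hx', ← e, M.al_al]
      have e2 : M.al d ≠ y := by intro e; apply c4; rw [hy', ← e, M.al_al]
      have e3 : M.al d ≠ y' := by rw [hy']; intro e; exact c2 (M.al.injective e)
      rw [Ao _ ⟨e1, e2⟩ e3, Ao d ⟨c1, c2⟩ c4, ← ha ⟨d, c1, c2⟩]
      congr 1
      exact Subtype.ext (g3 ⟨d, c1, c2⟩ c3 c4).symm
    · intro z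
      have T : ∑ d : {d // d ≠ x ∧ d ≠ y}, (fun t => if M.vt t = z then B t else 0) d.1 = 0 := by
        refine Eq.trans ?_ (hsum z)
        refine Finset.sum_congr rfl (fun d _ => ?_)
        simp only [Bd]
      have T2 := sum_subtype_if (fun d => d ≠ x ∧ d ≠ y) (fun t => if M.vt t = z then B t else 0)
      have T3 : ∑ d, (if M.vt d = z then B d else 0) = 0 := by
        refine Eq.trans ?_ (T2.symm.trans T)
        apply Finset.sum_congr rfl
        intro d _
        by_cases hd : d ≠ x ∧ d ≠ y
        · rw [if_pos hd]
        · rw [if_neg hd]; simp [hB, hd]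
      have e : ∀ d, (if M.vt d = z then A d else 0) = (if M.vt d = z then B d else 0) +
          (if d = x then (if M.vt x = z then K else 0) else 0) - (if d = y' then (if M.vt x = z then K else 0) else 0) := by
        intro d
        simp only [hA]
        by_cases b1 : d = x
        · subst b1; by_cases b2 : M.vt d = z <;> simp [b2, n4.symm]
        · by_cases b3 : d = y'
          · rw [b3, ← vx]; by_cases b2 : M.vt x = z <;> simp [b2, n4]
          · simp [b1, b3]
      simp only [e, Finset.sum_add_distrib, Finset.sum_sub_distrib, Finset.sum_ite_eq', Finset.mem_univ, if_true]
      rw [T3]; ring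
  · intro d
    exact M.out_ph d.1
  · intro d e hd' he P hP hPd
    have := M.out_cyc d.1 e.1 hd' he (fun t => (∃ ht, P ⟨t, ht⟩)) ?_ ⟨d.2, hPd⟩
    · exact this.2
    · rintro t ⟨ht, hPt⟩
      exact ⟨(hpk t).2 ht, hP _ hPt⟩
  · obtain ⟨d, hd'⟩ := M.out_ne
    have a1 : d ≠ x := by rintro rfl; exact hno hd'
    have a2 : d ≠ y := by rintro rfl; apply hno; rw [← hyx]; exact (M.out_ph d).2 hd'
    exact ⟨⟨d, a1, a2⟩, hd'⟩

end PM


/-- orientation determinant -/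
def oo {V : Type} (p : V → ℝ × ℝ) (x y z : V) : ℝ :=
  ((p y).1 - (p x).1) * ((p z).2 - (p x).2) - ((p y).2 - (p x).2) * ((p z).1 - (p x).1)

lemma oo_rot {V : Type} (p : V → ℝ × ℝ) (x y z : V) : oo p x y z = oo p y z x := by
  unfold oo; ring

lemma oo_swap {V : Type} (p : V → ℝ × ℝ) (x y z : V) : oo p x z y = - oo p x y z := by
  unfold oo; ring

/-- positive turn from angle `a` to angle `b`, both in `[0,2π)` -/
def PP (a b : ℝ) : Prop := (0 < b - a ∧ b - a < Real.pi) ∨ b - a < - Real.pi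

lemma sin_pos_PP {a b : ℝ} (ha : 0 ≤ a) (ha' : a < 2 * Real.pi) (hb : 0 ≤ b) (hb' : b < 2 * Real.pi) :
    0 < Real.sin (b - a) ↔ PP a b := by
  have hpi := Real.pi_pos
  unfold PP
  constructor
  · intro h
    by_contra hc
    rw [not_or, not_and_or] at hc
    obtain ⟨h1, h2⟩ := hc
    have h3 : Real.sin (b - a) ≤ 0 := by
      rcases h1 with h1 | h1
      · exact Real.sin_nonpos_of_nonpos_of_neg_pi_le (by linarith) (by linarith)
      · have : Real.sin (b - a) = Real.sin (b - a - 2 * Real.pi) := (Real.sin_sub_two_pi _).symm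
        rw [this]
        exact Real.sin_nonpos_of_nonpos_of_neg_pi_le (by linarith) (by linarith)
    linarith
  · rintro (⟨h1, h2⟩ | h)
    · exact Real.sin_pos_of_pos_of_lt_pi h1 h2
    · have : Real.sin (b - a) = Real.sin (b - a + 2 * Real.pi) := (Real.sin_add_two_pi _).symm
      rw [this]
      exact Real.sin_pos_of_pos_of_lt_pi (by linarith) (by linarith)

theorem geo {V : Type} [Fintype V] (q : V → ℝ × ℝ) {u v w : V} (huv : u ≠ v) (hq : q u = q v)
    (hwu : w ≠ u) (hwv : w ≠ v)
    (hgp : ∀ x y, x ≠ u → x ≠ v → y ≠ u → y ≠ v → x ≠ y → oo q u x y ≠ 0)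
    (hinj : ∀ x, x ≠ u → x ≠ v → q x ≠ q u) :
    ∃ θ : V → ℝ, θ w = 0 ∧ (∀ x, 0 ≤ θ x ∧ θ x < 2 * Real.pi) ∧
      (∀ x y, x ≠ u → x ≠ v → y ≠ u → y ≠ v → (0 < oo q u x y ↔ PP (θ x) (θ y))) ∧
      ∀ lo hi : ℝ, 0 ≤ lo → lo < hi → hi ≤ Real.pi → ∃ τ, lo < τ ∧ τ < hi ∧
        (∀ x, τ ≠ θ x ∧ θ x - τ ≠ Real.pi ∧ θ x - τ ≠ -Real.pi) ∧ ∃ p : V → ℝ × ℝ,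
        (∀ x, x ≠ v → p x = q x) ∧
        (∀ x y z, 0 < oo q x y z → 0 < oo p x y z) ∧
        (∀ x, x ≠ u → x ≠ v → (0 < oo p u v x ↔ PP τ (θ x)) ∧ oo p u v x ≠ 0) := by
  classical
  have hpi := Real.pi_pos
  set z : V → ℂ := fun x => ⟨(q x).1 - (q u).1, (q x).2 - (q u).2⟩ with hz
  have hz0 : ∀ x, x ≠ u → x ≠ v → 0 < ‖z x‖ := by
    intro x h1 h2
    rw [norm_pos_iff]
    intro h
    apply hinj x h1 h2
    have e1 := congrArg Complex.re h
    have e2 := congrArg Complex.im h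
    simp only [hz, Complex.zero_re, Complex.zero_im] at e1 e2
    exact Prod.ext (by linarith) (by linarith)
  set θ : V → ℝ := fun x => toIcoMod Real.two_pi_pos 0 (Complex.arg (z x) - Complex.arg (z w)) with hθ
  have hθ1 : ∀ x, 0 ≤ θ x ∧ θ x < 2 * Real.pi := by
    intro x
    have := toIcoMod_mem_Ico Real.two_pi_pos 0 (Complex.arg (z x) - Complex.arg (z w))
    simpa using this
  have hθ2 : ∀ x, ∃ k : ℤ, Complex.arg (z x) = θ x + Complex.arg (z w) + k * (2 * Real.pi) := by
    intro x
    refine ⟨toIcoDiv Real.two_pi_pos 0 (Complex.arg (z x) - Complex.arg (z w)), ?_⟩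
    have := toIcoMod_add_toIcoDiv_zsmul Real.two_pi_pos 0 (Complex.arg (z x) - Complex.arg (z w))
    rw [zsmul_eq_mul] at this
    simp only [hθ]; linarith
  have hre : ∀ x, (q x).1 - (q u).1 = ‖z x‖ * Real.cos (θ x + Complex.arg (z w)) := by
    intro x
    obtain ⟨k, hk⟩ := hθ2 x
    have := Complex.norm_mul_cos_arg (z x)
    rw [hk, Real.cos_add_int_mul_two_pi] at this
    rw [this]
  have him : ∀ x, (q x).2 - (q u).2 = ‖z x‖ * Real.sin (θ x + Complex.arg (z w)) := by
    intro x
    obtain ⟨k, hk⟩ := hθ2 x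
    have := Complex.norm_mul_sin_arg (z x)
    rw [hk, Real.sin_add_int_mul_two_pi] at this
    rw [this]
  have hsub : ∀ a b c : ℝ, Real.cos (a + c) * Real.sin (b + c) - Real.sin (a + c) * Real.cos (b + c) = Real.sin (b - a) := by
    intro a b c
    have : b - a = (b + c) - (a + c) := by ring
    rw [this, Real.sin_sub]; ring
  have hcr : ∀ x y, oo q u x y = ‖z x‖ * ‖z y‖ * Real.sin (θ y - θ x) := by
    intro x y
    unfold oo
    rw [hre, him, hre, him, ← hsub (θ x) (θ y) (Complex.arg (z w))]; ring
  refine ⟨θ, ?_, hθ1, ?_, ?_⟩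
  · simp [hθ]
  · intro x y h1 h2 h3 h4
    rw [hcr, ← sin_pos_PP (hθ1 x).1 (hθ1 x).2 (hθ1 y).1 (hθ1 y).2]
    have := mul_pos (hz0 x h1 h2) (hz0 y h3 h4)
    exact mul_pos_iff_of_pos_left this
  intro lo hi hlo hlh hhi
  have hfin : ((Set.range θ) ∪ (Set.range (fun x => θ x - Real.pi)) ∪ (Set.range (fun x => θ x + Real.pi))).Finite :=
    ((Set.finite_range _).union (Set.finite_range _)).union (Set.finite_range _)
  obtain ⟨τ, hτ, hτ'⟩ := ((Set.Ioo_infinite hlh).sdiff hfin).nonempty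
  simp only [Set.mem_union, Set.mem_range, not_or, not_exists] at hτ'
  have hav : ∀ x, τ ≠ θ x ∧ θ x - τ ≠ Real.pi ∧ θ x - τ ≠ -Real.pi := by
    intro x
    refine ⟨fun e => hτ'.1.1 x e.symm, fun e => hτ'.1.2 x (by linarith), fun e => hτ'.2 x (by linarith)⟩
  refine ⟨τ, hτ.1, hτ.2, hav, ?_⟩
  set P : ℝ → V → ℝ × ℝ := fun ε x => if x = v then ((q x).1 + ε * Real.cos (τ + Complex.arg (z w)), (q x).2 + ε * Real.sin (τ + Complex.arg (z w))) else q x with hP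
  have P0 : P 0 = q := by
    funext x
    simp only [hP]
    by_cases h : x = v
    · rw [if_pos h]; simp
    · rw [if_neg h]
  have Pc : ∀ x, Continuous (fun ε => P ε x) := by
    intro x
    simp only [hP]
    by_cases h : x = v
    · simp only [if_pos h]; fun_prop
    · simp only [if_neg h]; fun_prop
  have hev : ∀ x y w', ∀ᶠ ε in nhds (0 : ℝ), 0 < oo q x y w' → 0 < oo (P ε) x y w' := by
    intro x y w'
    by_cases h : 0 < oo q x y w'
    · have hc : Continuous (fun ε => oo (P ε) x y w') := by
        unfold oo
        have := Pc x; have := Pc y; have := Pc w'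
        fun_prop
      have h2 : 0 < oo (P 0) x y w' := by rw [P0]; exact h
      filter_upwards [hc.continuousAt.eventually (lt_mem_nhds h2)] with ε he _ using he
    · exact Filter.Eventually.of_forall (fun _ h' => absurd h' h)
  have hall : ∀ᶠ ε in nhds (0 : ℝ), ∀ x y w', 0 < oo q x y w' → 0 < oo (P ε) x y w' := by
    rw [Filter.eventually_all]; intro x
    rw [Filter.eventually_all]; intro y
    rw [Filter.eventually_all]; intro w'
    exact hev x y w'
  have hall2 : ∀ᶠ ε in nhdsWithin (0 : ℝ) (Set.Ioi 0), (∀ x y w', 0 < oo q x y w' → 0 < oo (P ε) x y w') ∧ 0 < ε :=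
    (Filter.Eventually.filter_mono nhdsWithin_le_nhds hall).and self_mem_nhdsWithin
  obtain ⟨ε, h1, hε⟩ := hall2.exists
  refine ⟨P ε, fun x hx => by simp only [hP]; rw [if_neg hx], h1, ?_⟩
  intro x hxu hxv
  have hc : oo (P ε) u v x = ε * ‖z x‖ * Real.sin (θ x - τ) := by
    unfold oo
    simp only [hP]
    rw [if_neg huv, if_neg hxv, if_pos trivial, ← hq]
    simp only []
    have e1 := hre x
    have e2 := him x
    have e3 := hsub τ (θ x) (Complex.arg (z w))
    rw [e1, e2, ← e3]; ring
  rw [hc]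
  have hpos := mul_pos hε (hz0 x hxu hxv)
  constructor
  · rw [← sin_pos_PP (by linarith [hτ.1]) (by linarith [hτ.2]) (hθ1 x).1 (hθ1 x).2]
    exact mul_pos_iff_of_pos_left hpos
  · intro h
    rcases mul_eq_zero.1 h with h | h
    · exact hpos.ne' h
    · obtain ⟨a1, a2, a3⟩ := hav x
      have b1 := hθ1 x
      have c1 : τ < Real.pi := by linarith [hτ.2]
      have c2 : 0 < τ := by linarith [hτ.1]
      rw [Real.sin_eq_zero_iff] at h
      obtain ⟨n, hn⟩ := h
      have d1 : (n : ℝ) * Real.pi < 2 * Real.pi := by rw [hn]; linarith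
      have d2 : (-1 : ℝ) * Real.pi < n * Real.pi := by rw [hn]; linarith
      have d1' : (n : ℝ) < 2 := lt_of_mul_lt_mul_right d1 hpi.le
      have d2' : (-1 : ℝ) < n := lt_of_mul_lt_mul_right d2 hpi.le
      have d3 : n < 2 := by exact_mod_cast d1'
      have d4 : -1 < n := by exact_mod_cast d2'
      have : n = 0 ∨ n = 1 := by omega
      rcases this with rfl | rfl
      · apply a1; push_cast at hn; linarith
      · apply a2; push_cast at hn; linarith


/-- counterclockwise order of three directions around `x` -/
def C3 {V : Type} (p : V → ℝ × ℝ) (x a b c : V) : Prop :=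
  (0 < oo p x a b ∧ 0 < oo p x b c) ∨ (0 < oo p x b c ∧ 0 < oo p x c a) ∨
    (0 < oo p x c a ∧ 0 < oo p x a b)

lemma C3.rot {V : Type} {p : V → ℝ × ℝ} {x a b c : V} (h : C3 p x a b c) : C3 p x b c a := by
  rcases h with h | h | h
  · exact Or.inr (Or.inr h)
  · exact Or.inl h
  · exact Or.inr (Or.inl h)

/-- reachability under iteration -/
def Cyc {D : Type} (f : D → D) (x y : D) : Prop := ∀ P : D → Prop, (∀ t, P t → P (f t)) → P x → P y

lemma Cyc.refl {D : Type} (f : D → D) (x : D) : Cyc f x x := fun _ _ h => h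
lemma Cyc.trans {D : Type} {f : D → D} {x y z : D} (h : Cyc f x y) (h' : Cyc f y z) : Cyc f x z :=
  fun P hP hx => h' P hP (h P hP hx)
lemma Cyc.step {D : Type} {f : D → D} {x y : D} (h : Cyc f x y) : Cyc f x (f y) :=
  fun P hP hx => hP _ (h P hP hx)

lemma Cyc.symm {D : Type} [Finite D] {f : Equiv.Perm D} {x y : D} (h : Cyc f x y) : Cyc f y x := by
  have hx : ∃ n : ℕ, (f ^ n) x = y := by
    refine h (fun t => ∃ n : ℕ, (f ^ n) x = t) ?_ ⟨0, rfl⟩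
    rintro t ⟨n, rfl⟩
    exact ⟨n + 1, by rw [pow_succ']; rfl⟩
  have hs : f.SameCycle y x := by
    obtain ⟨n, hn⟩ := hx
    exact Equiv.Perm.SameCycle.symm ⟨n, by rw [zpow_natCast]; exact hn⟩
  obtain ⟨m, hm⟩ := hs.exists_nat_pow_eq
  intro P hP hy
  have : ∀ k : ℕ, P ((f ^ k) y) := by
    intro k
    induction k with
    | zero => exact hy
    | succ k ih => rw [pow_succ']; exact hP _ ih
  rw [← hm]; exact this m

namespace PM
variable {V D : Type} [Fintype D]

def hd (M : PM V D) (d : D) : V := M.vt (M.al d)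
def sg (M : PM V D) (d : D) : D := M.ph (M.al d)
def small (M : PM V D) (p : V → ℝ × ℝ) (d : D) : Prop := 0 < oo p (M.hd d) (M.vt d) (M.hd (M.ph d))

lemma vt_ph' (M : PM V D) (d : D) : M.vt (M.ph d) = M.hd d := M.vt_ph d
lemma vt_sg (M : PM V D) (d : D) : M.vt (M.sg d) = M.vt d := by
  unfold sg; rw [M.vt_ph, M.al_al]
lemma vt_al (M : PM V D) (d : D) : M.vt (M.al d) = M.hd d := rfl
lemma hd_al (M : PM V D) (d : D) : M.hd (M.al d) = M.vt d := by unfold hd; rw [M.al_al]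

structure WReal (M : PM V D) (p : V → ℝ × ℝ) : Prop where
  inj : Function.Injective p
  gp : ∀ x y z, x ≠ y → x ≠ z → y ≠ z → oo p x y z ≠ 0
  nc : ∀ d e, M.vt d ≠ M.vt e → M.vt d ≠ M.hd e → M.hd d ≠ M.vt e → M.hd d ≠ M.hd e →
    ¬ (oo p (M.vt d) (M.hd d) (M.vt e) * oo p (M.vt d) (M.hd d) (M.hd e) < 0 ∧
       oo p (M.vt e) (M.hd e) (M.vt d) * oo p (M.vt e) (M.hd e) (M.hd d) < 0)
  ord : ∀ d e, M.vt d = M.vt e → M.hd d ≠ M.hd e → M.hd (M.sg d) ≠ M.hd e → M.hd (M.sg d) ≠ M.hd d →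
    C3 p (M.vt d) (M.hd d) (M.hd (M.sg d)) (M.hd e)
  cnt : ∀ d, ¬ M.out d → M.ph (M.ph d) ≠ d → Nat.card {e | Cyc M.ph d e ∧ M.small p e} = 3
  outs : ∀ d, M.out d → ¬ M.small p d

/-- adding a parallel edge -/
theorem WReal.addDigon {M : PM V D} {x y x' y' : D} (hx' : x' = M.al x) (hy' : y' = M.al y)
    (hxy : M.ph x = y) (hyx : M.ph y = x) (hne : M.vt x ≠ M.vt y)
    (hd' : x' ≠ y) (hno : ¬ M.out x) [Fintype {d // d ≠ x ∧ d ≠ y}]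
    {M1 : PM V {d // d ≠ x ∧ d ≠ y}}
    (g1 : ∀ d, d.1 = x' → (M1.al d).1 = y')
    (g2 : ∀ d, d.1 = y' → (M1.al d).1 = x')
    (g3 : ∀ d, d.1 ≠ x' → d.1 ≠ y' → (M1.al d).1 = M.al d.1)
    (gv : ∀ d, M1.vt d = M.vt d.1)
    (go : ∀ d, M1.out d ↔ M.out d.1)
    (gp : ∀ d, (M1.ph d).1 = M.ph d.1) {p : V → ℝ × ℝ} (h : M1.WReal p) : M.WReal p := by
  have n1 : x ≠ y := fun e => hne (by rw [e])
  have ax : M.al x' = x := by rw [hx', M.al_al]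
  have ay : M.al y' = y := by rw [hy', M.al_al]
  have vy : M.vt y = M.vt x' := by rw [← hxy, M.vt_ph, hx']
  have vx : M.vt x = M.vt y' := by rw [← hyx, M.vt_ph, hy']
  have n2 : x' ≠ x := fun e => hne (by rw [vy, e])
  have n3 : y' ≠ y := fun e => hne (by rw [vx, e])
  have n4 : y' ≠ x := fun e => hd' (by rw [hx', ← e, ay])
  have n5 : x' ≠ y' := fun e => n1 (by rw [← ax, ← ay, e])
  have kx : x' ≠ x ∧ x' ≠ y := ⟨n2, hd'⟩
  have ky : y' ≠ x ∧ y' ≠ y := ⟨n4, n3⟩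
  have hhd : ∀ d, M1.hd d = M.hd d.1 := by
    intro d
    unfold hd
    rw [gv]
    by_cases b1 : d.1 = x'
    · rw [g1 d b1, b1, ax, vx]
    by_cases b2 : d.1 = y'
    · rw [g2 d b2, b2, ay, vy]
    rw [g3 d b1 b2]
  have hx1 : M.hd x = M.hd y' := by unfold hd; rw [← hx', ay, vy]
  have hy1 : M.hd y = M.hd x' := by unfold hd; rw [← hy', ax, vx]
  have rep : ∀ d, ∃ d' : {d // d ≠ x ∧ d ≠ y}, M1.vt d' = M.vt d ∧ M1.hd d' = M.hd d := by
    intro d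
    by_cases b1 : d = x
    · exact ⟨⟨y', ky⟩, by rw [gv, b1, vx], by rw [hhd, b1, hx1]⟩
    by_cases b2 : d = y
    · exact ⟨⟨x', kx⟩, by rw [gv, b2, vy], by rw [hhd, b2, hy1]⟩
    exact ⟨⟨d, b1, b2⟩, gv _, hhd _⟩
  have rep2 : ∀ d, M.hd (M.sg d) ≠ M.hd d → ∃ d' : {d // d ≠ x ∧ d ≠ y}, M1.vt d' = M.vt d ∧ M1.hd d' = M.hd d ∧
      M1.hd (M1.sg d') = M.hd (M.sg d) := by
    intro d hdd
    by_cases b1 : d = x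
    · refine ⟨⟨y', ky⟩, by rw [gv, b1, vx], by rw [hhd, b1, hx1], ?_⟩
      rw [hhd]; unfold sg; rw [gp, g2 _ rfl, b1, hx']
    by_cases b2 : d = y
    · refine ⟨⟨x', kx⟩, by rw [gv, b2, vy], by rw [hhd, b2, hy1], ?_⟩
      rw [hhd]; unfold sg; rw [gp, g1 _ rfl, b2, hy']
    refine ⟨⟨d, b1, b2⟩, gv _, hhd _, ?_⟩
    rw [hhd]; unfold sg; rw [gp, g3]
    · intro e
      apply hdd
      show M.hd (M.ph (M.al d)) = M.hd d
      have e' : d = x' := e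
      rw [e', ax, hxy, hy1]
    · intro e
      apply hdd
      show M.hd (M.ph (M.al d)) = M.hd d
      have e' : d = y' := e
      rw [e', ay, hyx, hx1]
  have hsm : ∀ d, M1.small p d ↔ M.small p d.1 := by
    intro d; unfold small; rw [hhd, hhd, gv, gp]
  have hpk : ∀ d, (d ≠ x ∧ d ≠ y) → (M.ph d ≠ x ∧ M.ph d ≠ y) := by
    intro d hd
    exact ⟨fun e => hd.2 (M.ph.injective (e.trans hyx.symm)), fun e => hd.1 (M.ph.injective (e.trans hxy.symm))⟩
  refine ⟨h.inj, h.gp, ?_, ?_, ?_, ?_⟩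
  · intro d e
    obtain ⟨d', a1, a2⟩ := rep d
    obtain ⟨e', b1, b2⟩ := rep e
    rw [← a1, ← a2, ← b1, ← b2]
    exact h.nc d' e'
  · intro d e h1 h2 h3 h4
    obtain ⟨d', a1, a2, a3⟩ := rep2 d h4
    obtain ⟨e', b1, b2⟩ := rep e
    rw [← a1, ← a2, ← a3, ← b2]
    exact h.ord d' e' (by rw [a1, b1, h1]) (by rw [a2, b2]; exact h2) (by rw [a3, b2]; exact h3) (by rw [a3, a2]; exact h4)
  · intro d ho hp
    by_cases b1 : d = x
    · exfalso; apply hp; rw [b1, hxy, hyx]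
    by_cases b2 : d = y
    · exfalso; apply hp; rw [b2, hyx, hxy]
    have hcy : ∀ e : {d // d ≠ x ∧ d ≠ y}, Cyc M1.ph ⟨d, b1, b2⟩ e ↔ Cyc M.ph d e.1 := by
      intro e
      constructor
      · intro hc P hP hd
        exact hc (fun t => P t.1) (fun t ht => by rw [gp]; exact hP _ ht) hd
      · intro hc P hP hd
        have := hc (fun t => ∃ ht, P ⟨t, ht⟩) ?_ ⟨⟨b1, b2⟩, hd⟩
        · exact this.2
        · rintro t ⟨ht, hPt⟩
          have h3 := hP _ hPt
          have e2 : M1.ph ⟨t, ht⟩ = ⟨M.ph t, hpk t ht⟩ := Subtype.ext (gp _)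
          rw [e2] at h3; exact ⟨_, h3⟩
    have hk : ∀ e, Cyc M.ph d e → e ≠ x ∧ e ≠ y := fun e he => he (fun t => t ≠ x ∧ t ≠ y) hpk ⟨b1, b2⟩
    rw [← h.cnt ⟨d, b1, b2⟩ (by rw [go]; exact ho) (fun e => hp (by rw [← gp ⟨d, b1, b2⟩, ← gp, e]))]
    have himg : {e | Cyc M.ph d e ∧ M.small p e} = Subtype.val '' {e | Cyc M1.ph ⟨d, b1, b2⟩ e ∧ M1.small p e} := by
      ext e
      constructor
      · rintro ⟨h1, h2⟩
        exact ⟨⟨e, hk e h1⟩, ⟨(hcy _).2 h1, (hsm _).2 h2⟩, rfl⟩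
      · rintro ⟨e', ⟨h1, h2⟩, rfl⟩
        exact ⟨(hcy _).1 h1, (hsm _).1 h2⟩
    rw [himg, Nat.card_image_of_injective Subtype.val_injective]
  · intro d ho
    have a1 : d ≠ x := by rintro rfl; exact hno ho
    have a2 : d ≠ y := by rintro rfl; apply hno; rw [← hyx]; exact (M.out_ph d).2 ho
    rw [← hsm ⟨d, a1, a2⟩]
    exact h.outs _ ((go _).2 ho)

end PM


def CC (a b c : ℝ) : Prop := (PP a b ∧ PP b c) ∨ (PP b c ∧ PP c a) ∨ (PP c a ∧ PP a b)

lemma CC.rot {a b c : ℝ} (h : CC a b c) : CC b c a := by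
  rcases h with h | h | h
  · exact Or.inr (Or.inr h)
  · exact Or.inl h
  · exact Or.inr (Or.inl h)

def GG (a b : ℝ) : Prop := PP a b ∨ PP b a
lemma GG.symm {a b : ℝ} (h : GG a b) : GG b a := Or.symm h
lemma GG.ne {a b : ℝ} (h : GG a b) : a ≠ b := by
  have := Real.pi_pos
  rintro rfl
  rcases h with h | h <;> rcases h with ⟨h, h2⟩ | h <;> linarith
lemma PP.asymm {a b : ℝ} (h : PP a b) (h' : PP b a) : False := by
  have := Real.pi_pos
  rcases h with ⟨h, h2⟩ | h <;> rcases h' with ⟨h', h3⟩ | h' <;> linarith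

lemma CC_of_lt {a b c : ℝ} (h0 : 0 ≤ a) (h1 : a < b) (h2 : b < c) (h3 : c < 2 * Real.pi)
    (g1 : GG a b) (g2 : GG b c) (g3 : GG c a) : CC a b c := by
  have hpi := Real.pi_pos
  have n1 : PP b a → Real.pi < b - a := by rintro (⟨h, h'⟩ | h) <;> linarith
  have n2 : PP c b → Real.pi < c - b := by rintro (⟨h, h'⟩ | h) <;> linarith
  have n3 : PP a c → c - a < Real.pi := by rintro (⟨h, h'⟩ | h) <;> linarith
  unfold CC
  rcases g1 with g1 | g1
  · rcases g2 with g2 | g2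
    · exact Or.inl ⟨g1, g2⟩
    · rcases g3 with g3 | g3
      · exact Or.inr (Or.inr ⟨g3, g1⟩)
      · linarith [n2 g2, n3 g3]
  · rcases g2 with g2 | g2
    · rcases g3 with g3 | g3
      · exact Or.inr (Or.inl ⟨g2, g3⟩)
      · linarith [n1 g1, n3 g3]
    · linarith [n1 g1, n2 g2]

lemma lt_of_CC {a b c : ℝ} (ha : 0 ≤ a) (ha' : a < 2 * Real.pi) (hb : 0 ≤ b) (hb' : b < 2 * Real.pi)
    (hc : 0 ≤ c) (hc' : c < 2 * Real.pi) (h : CC a b c) : (a < b ∧ b < c) ∨ (b < c ∧ c < a) ∨ (c < a ∧ a < b) := by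
  have hpi := Real.pi_pos
  have n : ∀ x y, PP x y → (x < y ∧ y - x < Real.pi) ∨ y - x < - Real.pi := by
    rintro x y (h | h)
    · left; exact ⟨by linarith [h.1], h.2⟩
    · right; exact h
  rcases h with ⟨h, h'⟩ | ⟨h, h'⟩ | ⟨h, h'⟩
  all_goals
    rcases n _ _ h with ⟨k, k1⟩ | k <;> rcases n _ _ h' with ⟨k', k1'⟩ | k'
    all_goals
      by_contra hcon
      simp only [not_or, not_and_or, not_lt] at hcon
      obtain ⟨e1, e2, e3⟩ := hcon
      rcases e1 with e1 | e1 <;> rcases e2 with e2 | e2 <;> rcases e3 with e3 | e3 <;> linarith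

/-- the perturbed configuration -/
structure Pt {V : Type} (p q : V → ℝ × ℝ) {u v : V} (h : v ≠ u) (θ : V → ℝ) (τ : ℝ) : Prop where
  t0 : 0 < τ
  t1 : τ < Real.pi
  rng : ∀ x, 0 ≤ θ x ∧ θ x < 2 * Real.pi
  av : ∀ x, τ ≠ θ x ∧ θ x - τ ≠ Real.pi ∧ θ x - τ ≠ -Real.pi
  quv : q u = q v
  qgp : ∀ x y z, cmap h x ≠ cmap h y → cmap h x ≠ cmap h z → cmap h y ≠ cmap h z → oo q x y z ≠ 0
  qu : ∀ x y, x ≠ u → x ≠ v → y ≠ u → y ≠ v → (0 < oo q u x y ↔ PP (θ x) (θ y))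
  keep : ∀ x y z, 0 < oo q x y z → 0 < oo p x y z
  su : ∀ x, x ≠ u → x ≠ v → (0 < oo p u v x ↔ PP τ (θ x)) ∧ oo p u v x ≠ 0

namespace Pt
variable {V : Type} {p q : V → ℝ × ℝ} {u v : V} {h : v ≠ u} {θ : V → ℝ} {τ : ℝ}

lemma keepiff (P : Pt p q h θ τ) {x y z : V} (h1 : cmap h x ≠ cmap h y) (h2 : cmap h x ≠ cmap h z) (h3 : cmap h y ≠ cmap h z) :
    0 < oo p x y z ↔ 0 < oo q x y z := by
  refine ⟨fun hp => ?_, P.keep x y z⟩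
  rcases lt_or_gt_of_ne (P.qgp x y z h1 h2 h3) with hh | hh
  · have h4 : 0 < oo q x z y := by rw [oo_swap]; linarith
    have h5 := P.keep _ _ _ h4
    rw [oo_swap] at h5; linarith
  · exact hh

lemma pgp0 (P : Pt p q h θ τ) {x y z : V} (h1 : cmap h x ≠ cmap h y) (h2 : cmap h x ≠ cmap h z) (h3 : cmap h y ≠ cmap h z) :
    oo p x y z ≠ 0 := by
  rcases lt_or_gt_of_ne (P.qgp x y z h1 h2 h3) with hh | hh
  · have h4 : 0 < oo q x z y := by rw [oo_swap]; linarith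
    have h5 := P.keep _ _ _ h4
    rw [oo_swap] at h5; linarith
  · exact (P.keep _ _ _ hh).ne'

lemma C3keep (P : Pt p q h θ τ) {x a b c : V} (hC : C3 q x a b c) : C3 p x a b c := by
  have := P.keep
  rcases hC with hC | hC | hC
  · exact Or.inl ⟨this _ _ _ hC.1, this _ _ _ hC.2⟩
  · exact Or.inr (Or.inl ⟨this _ _ _ hC.1, this _ _ _ hC.2⟩)
  · exact Or.inr (Or.inr ⟨this _ _ _ hC.1, this _ _ _ hC.2⟩)

lemma cne {x y : V} (hxy : x ≠ y) (h1 : ¬ (x = u ∧ y = v)) (h2 : ¬ (x = v ∧ y = u)) : cmap h x ≠ cmap h y := by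
  intro e
  rcases cmap_eq h e with e | e | e
  · exact hxy e
  · exact h1 e
  · exact h2 e

lemma cne' {x y : V} (hxy : x ≠ y) (h1 : x ≠ u) (h2 : x ≠ v) : cmap h x ≠ cmap h y :=
  cne hxy (fun e => h1 e.1) (fun e => h2 e.1)

lemma cnes {x y : V} (hxy : x ≠ y) (h1 : x ≠ u) (h2 : x ≠ v) : cmap h y ≠ cmap h x :=
  (cne' hxy h1 h2).symm

lemma oov (P : Pt p q h θ τ) (x y : V) : oo q v x y = oo q u x y := by
  unfold oo; rw [P.quv]

lemma GG0 (P : Pt p q h θ τ) {x y : V} (h1 : x ≠ u) (h2 : x ≠ v) (h3 : y ≠ u) (h4 : y ≠ v) (hxy : x ≠ y) : GG (θ x) (θ y) := by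
  have := P.qgp u x y (cnes h1 h1 h2) (cnes h3 h3 h4) (cne' hxy h1 h2)
  rcases lt_or_gt_of_ne this with hh | hh
  · right; rw [← P.qu y x h3 h4 h1 h2, oo_swap]; linarith
  · left; rwa [← P.qu x y h1 h2 h3 h4]

lemma GGt (P : Pt p q h θ τ) (x : V) : GG τ (θ x) := by
  obtain ⟨a1, a2, a3⟩ := P.av x
  obtain ⟨r1, r2⟩ := P.rng x
  have := P.t0; have := P.t1
  unfold GG PP
  rcases lt_or_gt_of_ne a1 with b | b
  · rcases lt_or_gt_of_ne a2 with b' | b'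
    · left; left; constructor <;> linarith
    · right; right; linarith
  · right; left; constructor <;> linarith

lemma PPpi (P : Pt p q h θ τ) (x : V) : PP (τ + Real.pi) (θ x) ↔ ¬ PP τ (θ x) := by
  obtain ⟨a1, a2, a3⟩ := P.av x
  obtain ⟨r1, r2⟩ := P.rng x
  have := P.t0; have := P.t1
  unfold PP
  constructor
  · rintro (⟨b, b2⟩ | b) (⟨b', b3⟩ | b') <;> linarith
  · intro b
    rcases lt_or_gt_of_ne a1 with c | c
    · rcases lt_or_gt_of_ne a2 with b' | b'
      · exact absurd (Or.inl ⟨by linarith, by linarith⟩) b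
      · left; constructor <;> linarith
    · right; linarith

lemma PPpi' (P : Pt p q h θ τ) (x : V) : PP (θ x) (τ + Real.pi) ↔ PP τ (θ x) := by
  obtain ⟨a1, a2, a3⟩ := P.av x
  obtain ⟨r1, r2⟩ := P.rng x
  have := P.t0; have := P.t1
  unfold PP
  constructor
  · rintro (⟨b, b2⟩ | b)
    · rcases lt_or_gt_of_ne a1 with c | c
      · left; constructor <;> linarith
      · linarith
    · linarith
  · rintro (⟨b, b2⟩ | b)
    · left; constructor <;> linarith
    · linarith

lemma GGt' (P : Pt p q h θ τ) (x : V) : GG (τ + Real.pi) (θ x) := by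
  by_cases hh : PP τ (θ x)
  · right; exact (P.PPpi' x).2 hh
  · left; exact (P.PPpi x).2 hh

lemma nPP (P : Pt p q h θ τ) (x : V) : PP (θ x) τ ↔ ¬ PP τ (θ x) := by
  constructor
  · intro a b; exact a.asymm b
  · intro a; rcases P.GGt x with b | b
    · exact absurd b a
    · exact b

section
open Classical

noncomputable def Tu (v : V) (θ : V → ℝ) (τ : ℝ) (x : V) : ℝ := if x = v then τ else θ x
noncomputable def Tv (u : V) (θ : V → ℝ) (τ : ℝ) (x : V) : ℝ := if x = u then τ + Real.pi else θ x

lemma pu (P : Pt p q h θ τ) {x y : V} (hx : x ≠ u) (hy : y ≠ u) (hxy : x ≠ y) :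
    0 < oo p u x y ↔ PP (Tu v θ τ x) (Tu v θ τ y) := by
  unfold Tu
  by_cases hxv : x = v
  · have hyv : y ≠ v := fun e => hxy (hxv.trans e.symm)
    rw [if_pos hxv, if_neg hyv, hxv]; exact (P.su y hy hyv).1
  · rw [if_neg hxv]
    by_cases hyv : y = v
    · rw [if_pos hyv, hyv, oo_swap, P.nPP, ← (P.su x hx hxv).1]
      have := (P.su x hx hxv).2
      rw [not_lt]
      constructor
      · intro; linarith
      · intro hh; rcases lt_or_eq_of_le hh with h' | h'
        · linarith
        · exact absurd h' this
    · rw [if_neg hyv, P.keepiff (cnes hx hx hxv) (cnes hy hy hyv) (cne' hxy hx hxv)]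
      exact P.qu x y hx hxv hy hyv

lemma pv (P : Pt p q h θ τ) {x y : V} (hx : x ≠ v) (hy : y ≠ v) (hxy : x ≠ y) :
    0 < oo p v x y ↔ PP (Tv u θ τ x) (Tv u θ τ y) := by
  unfold Tv
  by_cases hxv : x = u
  · have hyv : y ≠ u := fun e => hxy (hxv.trans e.symm)
    rw [if_pos hxv, if_neg hyv, hxv, P.PPpi, ← (P.su y hyv hy).1]
    have := (P.su y hyv hy).2
    have e : oo p v u y = - oo p u v y := by unfold oo; ring
    rw [not_lt, e]
    constructor
    · intro; linarith
    · intro hh; rcases lt_or_eq_of_le hh with h' | h'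
      · linarith
      · exact absurd h' this
  · rw [if_neg hxv]
    by_cases hyv : y = u
    · rw [if_pos hyv, hyv, P.PPpi', ← (P.su x hxv hx).1]
      rw [oo_rot p u v x]
    · rw [if_neg hyv, P.keepiff (cnes hx hxv hx) (cnes hy hyv hy) (cne' hxy hxv hx), P.oov]
      exact P.qu x y hxv hx hyv hy

lemma C3u (P : Pt p q h θ τ) {x y z : V} (hx : x ≠ u) (hy : y ≠ u) (hz : z ≠ u) (h1 : x ≠ y) (h2 : y ≠ z) (h3 : z ≠ x)
    (hC : CC (Tu v θ τ x) (Tu v θ τ y) (Tu v θ τ z)) : C3 p u x y z := by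
  unfold CC at hC
  rw [← P.pu hx hy h1, ← P.pu hy hz h2, ← P.pu hz hx h3] at hC
  exact hC

lemma C3v (P : Pt p q h θ τ) {x y z : V} (hx : x ≠ v) (hy : y ≠ v) (hz : z ≠ v) (h1 : x ≠ y) (h2 : y ≠ z) (h3 : z ≠ x)
    (hC : CC (Tv u θ τ x) (Tv u θ τ y) (Tv u θ τ z)) : C3 p v x y z := by
  unfold CC at hC
  rw [← P.pv hx hy h1, ← P.pv hy hz h2, ← P.pv hz hx h3] at hC
  exact hC
end

lemma CCq (P : Pt p q h θ τ) {x y z : V} (hx : x ≠ u) (hx' : x ≠ v) (hy : y ≠ u) (hy' : y ≠ v) (hz : z ≠ u) (hz' : z ≠ v)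
    (hC : C3 q u x y z) : CC (θ x) (θ y) (θ z) := by
  unfold C3 at hC
  rw [P.qu x y hx hx' hy hy', P.qu y z hy hy' hz hz', P.qu z x hz hz' hx hx'] at hC
  exact hC

lemma ltq (P : Pt p q h θ τ) {x y z : V} (hx : x ≠ u) (hx' : x ≠ v) (hy : y ≠ u) (hy' : y ≠ v) (hz : z ≠ u) (hz' : z ≠ v)
    (hC : C3 q u x y z) (h0 : θ z = 0) : θ x < θ y := by
  have k := lt_of_CC (P.rng x).1 (P.rng x).2 (P.rng y).1 (P.rng y).2 (P.rng z).1 (P.rng z).2 (P.CCq hx hx' hy hy' hz hz' hC)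
  have := P.rng x; have := P.rng y
  rcases k with ⟨h, h2⟩ | ⟨h, h2⟩ | ⟨h, h2⟩ <;> linarith

lemma pgp (P : Pt p q h θ τ) {x y z : V} (h1 : x ≠ y) (h2 : x ≠ z) (h3 : y ≠ z) : oo p x y z ≠ 0 := by
  have key : ∀ a, a ≠ u → a ≠ v → oo p u v a ≠ 0 ∧ oo p v u a ≠ 0 := by
    intro a ha ha'
    refine ⟨(P.su a ha ha').2, ?_⟩
    have e : oo p v u a = - oo p u v a := by unfold oo; ring
    rw [e]; exact neg_ne_zero.2 (P.su a ha ha').2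
  have k2 : ∀ a b c, a ≠ b → a ≠ c → b ≠ c → cmap h a = cmap h b → oo p a b c ≠ 0 := by
    intro a b c ab ac bc e
    rcases cmap_eq h e with e | ⟨e1, e2⟩ | ⟨e1, e2⟩
    · exact absurd e ab
    · subst e1 e2; exact (key c ac.symm bc.symm).1
    · subst e1 e2; exact (key c bc.symm ac.symm).2
  by_cases c1 : cmap h x = cmap h y
  · exact k2 x y z h1 h2 h3 c1
  by_cases c2 : cmap h y = cmap h z
  · rw [oo_rot]; exact k2 y z x h3 h1.symm h2.symm c2
  by_cases c3 : cmap h x = cmap h z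
  · rw [oo_rot, oo_rot]; exact k2 z x y h2.symm h3.symm h1 c3.symm
  exact P.pgp0 c1 c3 c2

end Pt


/-- combinatorial data of a contracted edge, with the angles of the contracted drawing -/
structure Lb {V D : Type} [Fintype D] (M : PM V D) (q : V → ℝ × ℝ) {u v : V} (h : v ≠ u) (θ : V → ℝ) (w : V)
    (d0 c d1 d2 bl af : D) : Prop where
  hs : M.Simple
  w0 : θ w = 0
  f0 : M.ph d0 = d1
  f1 : M.ph d1 = d2
  f2 : M.ph d2 = d0
  ec : c = M.al d0
  eaf : M.ph c = af
  ebl : M.ph (M.al bl) = c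
  vu : M.vt d0 = u
  vv : M.vt d1 = v
  vw : M.vt d2 = w
  qord : ∀ d e, d ≠ d0 → d ≠ c → e ≠ d0 → e ≠ c → M.sg d ≠ d0 → M.sg d ≠ c → M.vt d = M.vt e →
    cmap h (M.hd d) ≠ cmap h (M.hd e) → cmap h (M.hd (M.sg d)) ≠ cmap h (M.hd e) →
    cmap h (M.hd (M.sg d)) ≠ cmap h (M.hd d) → C3 q (M.vt d) (M.hd d) (M.hd (M.sg d)) (M.hd e)
  qnc : ∀ d e, d ≠ d0 → d ≠ c → e ≠ d0 → e ≠ c → cmap h (M.vt d) ≠ cmap h (M.vt e) →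
    cmap h (M.vt d) ≠ cmap h (M.hd e) → cmap h (M.hd d) ≠ cmap h (M.vt e) → cmap h (M.hd d) ≠ cmap h (M.hd e) →
    ¬ (oo q (M.vt d) (M.hd d) (M.vt e) * oo q (M.vt d) (M.hd d) (M.hd e) < 0 ∧
       oo q (M.vt e) (M.hd e) (M.vt d) * oo q (M.vt e) (M.hd e) (M.hd d) < 0)

namespace Lb
variable {V D : Type} [Fintype D] {M : PM V D} {p q : V → ℝ × ℝ} {u v : V} {h : v ≠ u} {θ : V → ℝ} {τ : ℝ} {w : V}
  {d0 c d1 d2 bl af : D}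

section
variable (B : Lb M q h θ w d0 c d1 d2 bl af)
include B

lemma ac : M.al c = d0 := by rw [B.ec, M.al_al]
lemma hd0 : M.hd d0 = v := by rw [← M.vt_ph', B.f0, B.vv]
lemma hd1 : M.hd d1 = w := by rw [← M.vt_ph', B.f1, B.vw]
lemma hd2 : M.hd d2 = u := by rw [← M.vt_ph', B.f2, B.vu]
lemma vc : M.vt c = v := by rw [B.ec]; exact B.hd0
lemma hc : M.hd c = u := by unfold PM.hd; rw [B.ac, B.vu]
lemma nl (d : D) : M.hd d ≠ M.vt d := fun e => B.hs.noloop d e.symm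
lemma wv : w ≠ v := by rw [← B.hd1, ← B.vv]; exact B.nl _
lemma wu : w ≠ u := by rw [← B.vw, ← B.hd2]; exact (B.nl _).symm
lemma sm {d e : D} (h1 : M.vt d = M.vt e) (h2 : M.hd d = M.hd e) : d = e := B.hs.simple d e h1 h2
lemma vaf : M.vt af = u := by rw [← B.eaf, M.vt_ph']; exact B.hc
lemma vbl : M.vt bl = v := by
  have := M.vt_ph' (M.al bl); rw [B.ebl, M.hd_al, B.vc] at this; exact this.symm
lemma va2 : M.vt (M.al d2) = u := B.hd2
lemma ha2 : M.hd (M.al d2) = w := by rw [M.hd_al, B.vw]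
lemma s2 : M.sg (M.al d2) = d0 := by unfold PM.sg; rw [M.al_al, B.f2]
lemma s0 : M.sg d0 = af := by unfold PM.sg; rw [← B.ec, B.eaf]
lemma sc : M.sg c = d1 := by unfold PM.sg; rw [B.ac, B.f0]
lemma sbl : M.sg bl = c := B.ebl
omit B in
lemma sinj {d e : D} (hh : M.sg d = M.sg e) : d = e := M.al.injective (M.ph.injective hh)
lemma nd0 {d : D} (hd : M.vt d = u) (hne : M.hd d ≠ v) : d ≠ d0 := by
  rintro rfl; exact hne B.hd0
lemma hv_of {d : D} (hd : M.vt d = u) (hne : d ≠ d0) : M.hd d ≠ v :=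
  fun e => hne (B.sm (by rw [hd, B.vu]) (by rw [e, B.hd0]))
lemma hu_of {d : D} (hd : M.vt d = v) (hne : d ≠ c) : M.hd d ≠ u :=
  fun e => hne (B.sm (by rw [hd, B.vc]) (by rw [e, B.hc]))
lemma nu {d : D} (hd : M.vt d = u) : M.hd d ≠ u := fun e => B.nl d (by rw [e, hd])
lemma nv {d : D} (hd : M.vt d = v) : M.hd d ≠ v := fun e => B.nl d (by rw [e, hd])
lemma nc {d : D} (hd : M.vt d = u) : d ≠ c := by
  rintro rfl; exact h (by rw [← B.vc, hd])
lemma n0 {d : D} (hd : M.vt d = v) : d ≠ d0 := by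
  rintro rfl; exact h (by rw [← hd, B.vu])
omit B in
/-- if `σ d = d` then `d` is the only dart at its vertex -/
lemma only {d e : D} (hh : M.sg d = d) (he : M.vt d = M.vt e) : e = d :=
  M.trans d e he (fun x => x = d) (by rintro x rfl; exact hh) rfl
omit B in
lemma only2 {d d' e : D} (hh : M.sg d = d') (hh' : M.sg d' = d) (he : M.vt d = M.vt e) : e = d ∨ e = d' :=
  M.trans d e he (fun x => x = d ∨ x = d') (by
    rintro x (rfl | rfl)
    · right; exact hh
    · left; exact hh') (Or.inl rfl)
lemma a20 : M.al d2 ≠ d0 := fun e => B.wv (by rw [← B.ha2, e, B.hd0])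
lemma d1c : d1 ≠ c := fun e => B.wu (by rw [← B.hd1, e, B.hc])
lemma sgu {d : D} (hd : M.vt d = u) : M.vt (M.sg d) = u := by rw [M.vt_sg, hd]
lemma sgv {d : D} (hd : M.vt d = v) : M.vt (M.sg d) = v := by rw [M.vt_sg, hd]
lemma sne_u {d : D} (hd : M.vt d = u) : M.sg d ≠ d := fun e => by
  have h1 := only e (hd.trans B.va2.symm)
  have h2 := only e (hd.trans B.vu.symm)
  exact B.a20 (h1.trans h2.symm)
lemma sne_v {d : D} (hd : M.vt d = v) : M.sg d ≠ d := fun e => by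
  have h1 := only e (hd.trans B.vv.symm)
  have h2 := only e (hd.trans B.vc.symm)
  exact B.d1c (h1.trans h2.symm)

lemma A1 (P : Pt p q h θ τ) {d : D} (hd : M.vt d = u) (h0 : d ≠ d0) (h2 : d ≠ M.al d2) (h3 : M.sg d ≠ M.al d2) :
    θ (M.hd d) < θ (M.hd (M.sg d)) := by
  have e0 : M.sg d ≠ d0 := fun e => h2 (sinj (e.trans B.s2.symm))
  have hw : M.hd d ≠ w := fun e => h2 (B.sm (by rw [hd, B.va2]) (by rw [e, B.ha2]))
  have hw' : M.hd (M.sg d) ≠ w := fun e => h3 (B.sm (by rw [M.vt_sg, hd, B.va2]) (by rw [e, B.ha2]))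
  have hdd : M.hd (M.sg d) ≠ M.hd d := fun e => B.sne_u hd (B.sm (M.vt_sg d) e)
  have k1 := B.nu hd; have k2 := B.hv_of hd h0
  have k3 := B.nu (B.sgu hd); have k4 := B.hv_of (B.sgu hd) e0
  have := B.qord d (M.al d2) h0 (B.nc hd) B.a20 (B.nc B.va2) e0 (B.nc (B.sgu hd)) (by rw [hd, B.va2])
    (by rw [B.ha2]; exact Pt.cne' hw k1 k2) (by rw [B.ha2]; exact Pt.cne' hw' k3 k4) (Pt.cne' hdd k3 k4)
  rw [hd, B.ha2] at this
  exact P.ltq k1 k2 k3 k4 B.wu B.wv this B.w0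

lemma pos (P : Pt p q h θ τ) {x : V} (h1 : x ≠ u) (h2 : x ≠ v) (h3 : x ≠ w) : 0 < θ x := by
  have := (P.GG0 h1 h2 B.wu B.wv h3).ne
  rw [B.w0] at this
  exact lt_of_le_of_ne (P.rng x).1 this.symm
omit B in
lemma npi (B : Lb M q h θ w d0 c d1 d2 bl af) (P : Pt p q h θ τ) {x : V} (h1 : x ≠ u) (h2 : x ≠ v) (h3 : x ≠ w) : θ x ≠ Real.pi := by
  have := (P.GG0 h1 h2 B.wu B.wv h3)
  have hpi := Real.pi_pos
  rw [B.w0] at this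
  intro e
  rw [e] at this
  rcases this with (⟨a, b⟩ | a) | (⟨a, b⟩ | a) <;> linarith

end
open Classical in
noncomputable def a0 (M : PM V D) (θ : V → ℝ) (d2 af : D) : ℝ := if af = M.al d2 then 2 * Real.pi else θ (M.hd af)

section
variable (B : Lb M q h θ w d0 c d1 d2 bl af)
include B

lemma A2 (P : Pt p q h θ τ) {d : D} (hd : M.vt d = u) (h0 : d ≠ d0) (h2 : d ≠ M.al d2) : a0 M θ d2 af ≤ θ (M.hd d) := by
  have := M.trans af d (by rw [B.vaf, hd]) (fun x => M.vt x = u ∧ (x = M.al d2 ∨ x = d0 ∨ a0 M θ d2 af ≤ θ (M.hd x))) ?_ ?_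
  · rcases this.2 with k | k | k
    · exact absurd k h2
    · exact absurd k h0
    · exact k
  · rintro x ⟨hx, hx'⟩
    refine ⟨B.sgu hx, ?_⟩
    change M.sg x = _ ∨ M.sg x = _ ∨ _ ≤ θ (M.hd (M.sg x))
    have haf : af = M.al d2 ∨ af = d0 ∨ a0 M θ d2 af ≤ θ (M.hd af) := by
      unfold a0
      by_cases e : af = M.al d2
      · exact Or.inl e
      · right; right; rw [if_neg e]
    by_cases e1 : x = M.al d2
    · right; left; rw [e1, B.s2]
    by_cases e2 : x = d0
    · rw [e2, B.s0]; exact haf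
    by_cases e3 : M.sg x = M.al d2
    · exact Or.inl e3
    right; right
    rcases hx' with k | k | k
    · exact absurd k e1
    · exact absurd k e2
    · exact k.trans (B.A1 P hx e2 e1 e3).le
  · refine ⟨B.vaf, ?_⟩
    unfold a0
    by_cases e : af = M.al d2
    · exact Or.inl e
    · right; right; rw [if_neg e]

lemma B1 (P : Pt p q h θ τ) {d : D} (hd : M.vt d = v) (h0 : d ≠ c) (h2 : d ≠ bl) : θ (M.hd d) < θ (M.hd (M.sg d)) := by
  have ec : M.sg d ≠ c := fun e => h2 (sinj (e.trans B.sbl.symm))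
  have e1 : M.sg d ≠ d1 := fun e => h0 (sinj (e.trans B.sc.symm))
  have k1 := B.nv hd; have k2 := B.hu_of hd h0
  have k3 := B.nv (B.sgv hd); have k4 := B.hu_of (B.sgv hd) ec
  have hw' : M.hd (M.sg d) ≠ w := fun e => e1 (B.sm (by rw [M.vt_sg, hd, B.vv]) (by rw [e, B.hd1]))
  by_cases e : d = d1
  · have : M.hd d = w := by rw [e, B.hd1]
    rw [this, B.w0]
    exact B.pos P k4 k3 hw'
  have hw : M.hd d ≠ w := fun e' => e (B.sm (by rw [hd, B.vv]) (by rw [e', B.hd1]))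
  have hdd : M.hd (M.sg d) ≠ M.hd d := fun e => B.sne_v hd (B.sm (M.vt_sg d) e)
  have := B.qord d d1 (B.n0 hd) h0 (B.n0 B.vv) B.d1c (B.n0 (B.sgv hd)) ec (by rw [hd, B.vv])
    (by rw [B.hd1]; exact Pt.cne' hw k2 k1) (by rw [B.hd1]; exact Pt.cne' hw' k4 k3) (Pt.cne' hdd k4 k3)
  rw [hd, B.hd1] at this
  have this' : C3 q u (M.hd d) (M.hd (M.sg d)) w := by
    unfold C3 at this ⊢
    rw [P.oov, P.oov, P.oov] at this; exact this
  exact P.ltq k2 k1 k4 k3 B.wu B.wv this' B.w0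

lemma B2 (P : Pt p q h θ τ) {d : D} (hd : M.vt d = v) (h0 : d ≠ c) : θ (M.hd d) ≤ θ (M.hd bl) := by
  by_contra hc
  rw [not_le] at hc
  have := M.trans d bl (by rw [B.vbl, hd]) (fun x => M.vt x = v ∧ x ≠ c ∧ θ (M.hd bl) < θ (M.hd x)) ?_ ⟨hd, h0, hc⟩
  · exact lt_irrefl _ this.2.2
  · rintro x ⟨hx, hx1, hx2⟩
    have e1 : x ≠ bl := by rintro rfl; exact lt_irrefl _ hx2
    exact ⟨B.sgv hx, fun e => e1 (sinj (e.trans B.sbl.symm)), hx2.trans (B.B1 P hx hx1 e1)⟩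

end

/-- requirements on the perturbation angle -/
structure T1 (M : PM V D) (θ : V → ℝ) (τ : ℝ) (d2 bl af : D) : Prop where
  l1 : τ < a0 M θ d2 af
  l2 : θ (M.hd bl) < τ + Real.pi
  l3 : θ (M.hd bl) ≤ a0 M θ d2 af

omit [Fintype D] in
lemma GGu (P : Pt p q h θ τ) {x y : V} (hx : x ≠ u) (hy : y ≠ u) (hxy : x ≠ y) : GG (Pt.Tu v θ τ x) (Pt.Tu v θ τ y) := by
  unfold Pt.Tu
  by_cases h1 : x = v
  · have h2 : y ≠ v := fun e => hxy (h1.trans e.symm)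
    rw [if_pos h1, if_neg h2]; exact P.GGt y
  · by_cases h2 : y = v
    · rw [if_neg h1, if_pos h2]; exact (P.GGt x).symm
    · rw [if_neg h1, if_neg h2]; exact P.GG0 hx h1 hy h2 hxy

omit [Fintype D] in
lemma GGv (P : Pt p q h θ τ) {x y : V} (hx : x ≠ v) (hy : y ≠ v) (hxy : x ≠ y) : GG (Pt.Tv u θ τ x) (Pt.Tv u θ τ y) := by
  unfold Pt.Tv
  by_cases h1 : x = u
  · have h2 : y ≠ u := fun e => hxy (h1.trans e.symm)
    rw [if_pos h1, if_neg h2]; exact P.GGt' y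
  · by_cases h2 : y = u
    · rw [if_neg h1, if_pos h2]; exact (P.GGt' x).symm
    · rw [if_neg h1, if_neg h2]; exact P.GG0 h1 hx h2 hy hxy

section
variable (B : Lb M q h θ w d0 c d1 d2 bl af) (P : Pt p q h θ τ) (T : T1 M θ τ d2 bl af)
include B P T

lemma ordu {d e : D} (hd : M.vt d = u) (he : M.vt e = u) (h1 : M.hd d ≠ M.hd e) (h2 : M.hd (M.sg d) ≠ M.hd e)
    (h3 : M.hd (M.sg d) ≠ M.hd d) : C3 p u (M.hd d) (M.hd (M.sg d)) (M.hd e) := by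
  have k1 := B.nu hd; have k2 := B.nu he; have k3 := B.nu (B.sgu hd)
  have t0 := P.t0; have t1 := P.t1; have hpi := Real.pi_pos
  have hTv : Pt.Tu v θ τ (M.hd d0) = τ := by unfold Pt.Tu; rw [if_pos B.hd0]
  have hT : ∀ x, M.vt x = u → x ≠ d0 → Pt.Tu v θ τ (M.hd x) = θ (M.hd x) := by
    intro x hx hx'; unfold Pt.Tu; rw [if_neg (B.hv_of hx hx')]
  have hT2 : Pt.Tu v θ τ (M.hd (M.al d2)) = 0 := by rw [hT _ B.va2 B.a20, B.ha2, B.w0]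
  have hlow : ∀ x, M.vt x = u → x ≠ d0 → x ≠ M.al d2 → τ < Pt.Tu v θ τ (M.hd x) := by
    intro x hx hx1 hx2; rw [hT x hx hx1]; exact T.l1.trans_le (B.A2 P hx hx1 hx2)
  have hup : ∀ x, M.vt x = u → Pt.Tu v θ τ (M.hd x) < 2 * Real.pi := by
    intro x hx
    by_cases hx' : x = d0
    · rw [hx', hTv]; linarith
    · rw [hT x hx hx']; exact (P.rng _).2
  have g1 := GGu P k1 k2 h1
  have g2 := GGu P k3 k2 h2
  have g3 := GGu P k3 k1 h3
  have e1 : d ≠ e := fun e => h1 (by rw [e])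
  have e2 : M.sg d ≠ e := fun e => h2 (by rw [e])
  have e3 : M.sg d ≠ d := fun e => h3 (by rw [e])
  have fin : CC (Pt.Tu v θ τ (M.hd d)) (Pt.Tu v θ τ (M.hd (M.sg d))) (Pt.Tu v θ τ (M.hd e)) → C3 p u (M.hd d) (M.hd (M.sg d)) (M.hd e) :=
    P.C3u k1 k3 k2 h3.symm h2 h1.symm
  by_cases c1 : d = d0
  · apply fin
    have es : M.sg d = af := by rw [c1, B.s0]
    have haf : af ≠ M.al d2 := by
      intro ea
      rcases only2 (c1 ▸ es.trans ea) B.s2 (by rw [B.vu, he] : M.vt d0 = M.vt e) with k | k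
      · exact e1 (c1.trans k.symm)
      · exact e2 ((es.trans ea).trans k.symm)
    have haf0 : af ≠ d0 := fun k => e3 (by rw [es, k, c1])
    have la := hlow af B.vaf haf0 haf
    have eT : Pt.Tu v θ τ (M.hd d) = τ := by rw [c1, hTv]
    rw [es] at g2 g3 e2 ⊢
    by_cases c2 : e = M.al d2
    · rw [eT] at g3 ⊢
      have : Pt.Tu v θ τ (M.hd e) = 0 := by rw [c2, hT2]
      rw [eT] at g1
      have := CC_of_lt (by rw [this]) (by rw [this]; exact t0) la (hup af B.vaf) g1.symm g3.symm g2
      exact this.rot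
    · have l2 : Pt.Tu v θ τ (M.hd af) ≤ Pt.Tu v θ τ (M.hd e) := by
        rw [hT af B.vaf haf0, hT e he (fun k => e1 (c1.trans k.symm))]
        have := B.A2 P he (fun k => e1 (c1.trans k.symm)) c2
        unfold a0 at this; rw [if_neg haf] at this; exact this
      have l3 := lt_of_le_of_ne l2 g2.ne
      rw [eT] at g1 g3 ⊢
      exact CC_of_lt t0.le la l3 (hup e he) g3.symm g2 g1.symm
  by_cases c2 : M.sg d = d0
  · apply fin
    have : d = M.al d2 := sinj (c2.trans B.s2.symm)
    rw [c2, hTv] at g2 g3 ⊢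
    have z : Pt.Tu v θ τ (M.hd d) = 0 := by rw [this, hT2]
    have := hlow e he (fun k => e2 (c2.trans k.symm)) (fun k => e1 (this.trans k.symm))
    exact CC_of_lt z.symm.le (by rw [z]; exact t0) this (hup e he) g3.symm g2 g1.symm
  by_cases c3 : e = d0
  · apply fin
    have hda : d ≠ M.al d2 := fun k => c2 (by rw [k, B.s2])
    have ez : Pt.Tu v θ τ (M.hd e) = τ := by rw [c3, hTv]
    have l1 : Pt.Tu v θ τ (M.hd e) < Pt.Tu v θ τ (M.hd d) := by rw [ez]; exact hlow d hd c1 hda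
    by_cases c4 : M.sg d = M.al d2
    · have z : Pt.Tu v θ τ (M.hd (M.sg d)) = 0 := by rw [c4, hT2]
      exact (CC_of_lt (by rw [z]) (by rw [z, ez]; exact t0) l1 (hup d hd) g2 g1.symm g3.symm).rot.rot
    · have l2 := B.A1 P hd c1 hda c4
      rw [← hT d hd c1, ← hT _ (B.sgu hd) c2] at l2
      exact (CC_of_lt (by rw [ez]; exact t0.le) l1 l2 (hup _ (B.sgu hd)) g1.symm g3.symm g2).rot
  apply P.C3keep
  have := B.qord d e c1 (B.nc hd) c3 (B.nc he) c2 (B.nc (B.sgu hd)) (by rw [hd, he])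
    (Pt.cne' h1 k1 (B.hv_of hd c1)) (Pt.cne' h2 k3 (B.hv_of (B.sgu hd) c2)) (Pt.cne' h3 k3 (B.hv_of (B.sgu hd) c2))
  rw [hd] at this; exact this

lemma ordv {d e : D} (hd : M.vt d = v) (he : M.vt e = v) (h1 : M.hd d ≠ M.hd e) (h2 : M.hd (M.sg d) ≠ M.hd e)
    (h3 : M.hd (M.sg d) ≠ M.hd d) : C3 p v (M.hd d) (M.hd (M.sg d)) (M.hd e) := by
  have k1 := B.nv hd; have k2 := B.nv he; have k3 := B.nv (B.sgv hd)
  have t0 := P.t0; have t1 := P.t1; have hpi := Real.pi_pos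
  have hTv : Pt.Tv u θ τ (M.hd c) = τ + Real.pi := by unfold Pt.Tv; rw [if_pos B.hc]
  have hT : ∀ x, M.vt x = v → x ≠ c → Pt.Tv u θ τ (M.hd x) = θ (M.hd x) := by
    intro x hx hx'; unfold Pt.Tv; rw [if_neg (B.hu_of hx hx')]
  have hhi : ∀ x, M.vt x = v → x ≠ c → Pt.Tv u θ τ (M.hd x) < τ + Real.pi := by
    intro x hx hx1; rw [hT x hx hx1]; exact (B.B2 P hx hx1).trans_lt T.l2
  have hlo : ∀ x, M.vt x = v → x ≠ c → 0 ≤ Pt.Tv u θ τ (M.hd x) := by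
    intro x hx hx1; rw [hT x hx hx1]; exact (P.rng _).1
  have g1 := GGv P k1 k2 h1
  have g2 := GGv P k3 k2 h2
  have g3 := GGv P k3 k1 h3
  have e1 : d ≠ e := fun e => h1 (by rw [e])
  have e2 : M.sg d ≠ e := fun e => h2 (by rw [e])
  have e3 : M.sg d ≠ d := fun e => h3 (by rw [e])
  have fin : CC (Pt.Tv u θ τ (M.hd d)) (Pt.Tv u θ τ (M.hd (M.sg d))) (Pt.Tv u θ τ (M.hd e)) → C3 p v (M.hd d) (M.hd (M.sg d)) (M.hd e) :=
    P.C3v k1 k3 k2 h3.symm h2 h1.symm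
  by_cases c1 : d = c
  · apply fin
    have ed : Pt.Tv u θ τ (M.hd d) = τ + Real.pi := by rw [c1, hTv]
    have ec : e ≠ c := fun k => e1 (c1.trans k.symm)
    have z : Pt.Tv u θ τ (M.hd (M.sg d)) = 0 := by rw [c1, B.sc, hT _ B.vv B.d1c, B.hd1, B.w0]
    have l1 : 0 < Pt.Tv u θ τ (M.hd e) := by
      refine lt_of_le_of_ne (hlo e he ec) ?_
      rw [← z]; exact g2.ne
    refine (CC_of_lt (a := Pt.Tv u θ τ (M.hd (M.sg d))) (b := Pt.Tv u θ τ (M.hd e)) (c := Pt.Tv u θ τ (M.hd d)) z.symm.le (by rw [z]; exact l1) ?_ ?_ g2 g1.symm g3.symm).rot.rot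
    · rw [ed]; exact hhi e he ec
    · rw [ed]; linarith
  by_cases c2 : M.sg d = c
  · apply fin
    have ed : d = bl := sinj (c2.trans B.sbl.symm)
    have ec : e ≠ c := fun k => e2 (c2.trans k.symm)
    have l1 : Pt.Tv u θ τ (M.hd e) < Pt.Tv u θ τ (M.hd d) := by
      refine lt_of_le_of_ne ?_ g1.symm.ne
      rw [hT e he ec, hT d hd c1, ed]; exact B.B2 P he ec
    have es : Pt.Tv u θ τ (M.hd (M.sg d)) = τ + Real.pi := by rw [c2, hTv]
    exact (CC_of_lt (hlo e he ec) l1 (by rw [es]; exact hhi d hd c1) (by rw [es]; linarith) g1.symm g3.symm g2).rot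
  by_cases c3 : e = c
  · apply fin
    have ez : Pt.Tv u θ τ (M.hd e) = τ + Real.pi := by rw [c3, hTv]
    have l1 := B.B1 P hd c1 (fun k => c2 (by rw [k, B.sbl]))
    rw [← hT d hd c1, ← hT _ (B.sgv hd) c2] at l1
    exact CC_of_lt (hlo d hd c1) l1 (by rw [ez]; exact hhi _ (B.sgv hd) c2) (by rw [ez]; linarith) g3.symm g2 g1.symm
  apply P.C3keep
  have := B.qord d e (B.n0 hd) c1 (B.n0 he) c3 (B.n0 (B.sgv hd)) c2 (by rw [hd, he])
    (Pt.cne' h1 (B.hu_of hd c1) k1) (Pt.cne' h2 (B.hu_of (B.sgv hd) c2) k3) (Pt.cne' h3 (B.hu_of (B.sgv hd) c2) k3)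
  rw [hd] at this; exact this

end
end Lb


/-- crossing predicate -/
def X4 {V : Type} (p : V → ℝ × ℝ) (a b x y : V) : Prop :=
  oo p a b x * oo p a b y < 0 ∧ oo p x y a * oo p x y b < 0

lemma oo_swap' {V : Type} (p : V → ℝ × ℝ) (x y z : V) : oo p y x z = - oo p x y z := by
  unfold oo; ring

lemma X4.s1 {V : Type} {p : V → ℝ × ℝ} {a b x y : V} (h : X4 p a b x y) : X4 p x y a b := ⟨h.2, h.1⟩
lemma X4.s2 {V : Type} {p : V → ℝ × ℝ} {a b x y : V} (h : X4 p a b x y) : X4 p b a x y := by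
  refine ⟨?_, by linarith [h.2]⟩
  rw [oo_swap' p a b x, oo_swap' p a b y]; linarith [h.1]
lemma X4.s3 {V : Type} {p : V → ℝ × ℝ} {a b x y : V} (h : X4 p a b x y) : X4 p a b y x := h.s1.s2.s1

namespace Lb
variable {V D : Type} [Fintype D] {M : PM V D} {p q : V → ℝ × ℝ} {u v : V} {h : v ≠ u} {θ : V → ℝ} {τ : ℝ} {w : V}
  {d0 c d1 d2 bl af : D}

omit [Fintype D] in
lemma sgn_mul (P : Pt p q h θ τ) {x y z t : V} (h1 : cmap h x ≠ cmap h y) (h2 : cmap h x ≠ cmap h z)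
    (h3 : cmap h y ≠ cmap h z) (h4 : cmap h x ≠ cmap h t) (h5 : cmap h y ≠ cmap h t)
    (hm : oo p x y z * oo p x y t < 0) : oo q x y z * oo q x y t < 0 := by
  have a1 := P.keepiff h1 h2 h3
  have a2 := P.keepiff h1 h4 h5
  have b1 := P.qgp _ _ _ h1 h2 h3
  have b2 := P.qgp _ _ _ h1 h4 h5
  rcases mul_neg_iff.1 hm with ⟨k1, k2⟩ | ⟨k1, k2⟩
  · have : ¬ 0 < oo q x y t := fun e => by linarith [a2.2 e]
    exact mul_neg_of_pos_of_neg (a1.1 k1) (lt_of_le_of_ne (not_lt.1 this) b2)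
  · have : ¬ 0 < oo q x y z := fun e => by linarith [a1.2 e]
    exact mul_neg_of_neg_of_pos (lt_of_le_of_ne (not_lt.1 this) b1) (a2.1 k2)

omit [Fintype D] in
lemma same_side (P : Pt p q h θ τ) {x y : V} (h1 : x ≠ u) (h2 : x ≠ v) (h3 : y ≠ u) (h4 : y ≠ v) (hxy : x ≠ y) :
    0 < oo p x y u ↔ 0 < oo p x y v := by
  rw [P.keepiff (Pt.cne' hxy h1 h2) (Pt.cne' h1 h1 h2) (Pt.cne' h3 h3 h4), P.keepiff (Pt.cne' hxy h1 h2) (Pt.cne' h2 h1 h2) (Pt.cne' h4 h3 h4)]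
  unfold oo; rw [P.quv]

omit [Fintype D] in
lemma nX_uv (P : Pt p q h θ τ) {x y : V} (h1 : x ≠ u) (h2 : x ≠ v) (h3 : y ≠ u) (h4 : y ≠ v) (hxy : x ≠ y) : ¬ X4 p u v x y := by
  intro hX
  have := same_side P h1 h2 h3 h4 hxy
  rcases mul_neg_iff.1 hX.2 with ⟨k1, k2⟩ | ⟨k1, k2⟩
  · linarith [this.1 k1]
  · linarith [this.2 k2]

section
variable (B : Lb M q h θ w d0 c d1 d2 bl af) (P : Pt p q h θ τ) (T : T1 M θ τ d2 bl af)
include B P T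

lemma nX_ux {d e : D} (hd : M.vt d = u) (he : M.vt e = v) (h1 : d ≠ d0) (h2 : e ≠ c) (hxy : M.hd d ≠ M.hd e) :
    ¬ X4 p u (M.hd d) v (M.hd e) := by
  have k1 := B.nu hd; have k2 := B.hv_of hd h1
  have k3 := B.nv he; have k4 := B.hu_of he h2
  have t0 := P.t0; have t1 := P.t1; have hpi := Real.pi_pos
  have l1 := T.l1; have l2 := T.l2; have l3 := T.l3
  have b2 := B.B2 P he h2
  have ha : θ (M.hd d) = 0 ∨ a0 M θ d2 af ≤ θ (M.hd d) := by
    by_cases e : d = M.al d2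
    · left; rw [e, B.ha2, B.w0]
    · right; exact B.A2 P hd h1 e
  obtain ⟨r1, r2⟩ := P.rng (M.hd d)
  obtain ⟨r3, r4⟩ := P.rng (M.hd e)
  have o1 : 0 < oo p u (M.hd d) v ↔ PP (θ (M.hd d)) τ := by
    have := P.pu k1 h k2
    unfold Pt.Tu at this; rw [if_neg k2, if_pos rfl] at this; exact this
  have o2 : 0 < oo p u (M.hd d) (M.hd e) ↔ PP (θ (M.hd d)) (θ (M.hd e)) := by
    have := P.pu k1 k4 hxy
    unfold Pt.Tu at this; rw [if_neg k2, if_neg k3] at this; exact this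
  have o3 : 0 < oo p v (M.hd e) u ↔ PP τ (θ (M.hd e)) := by
    have := P.pv k3 h.symm k4
    unfold Pt.Tv at this; rw [if_neg k4, if_pos rfl, P.PPpi'] at this; exact this
  have o4 : 0 < oo p v (M.hd e) (M.hd d) ↔ PP (θ (M.hd e)) (θ (M.hd d)) := by
    have := P.pv k3 k2 hxy.symm
    unfold Pt.Tv at this; rw [if_neg k4, if_neg k1] at this; exact this
  have g := P.GG0 k1 k2 k4 k3 hxy
  have gt := P.GGt (M.hd e)
  generalize θ (M.hd d) = x at *
  generalize θ (M.hd e) = y at *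
  generalize θ (M.hd bl) = b at *
  generalize a0 M θ d2 af = a at *
  rintro ⟨X1, X2⟩
  rcases mul_neg_iff.1 X1 with ⟨m1, m2⟩ | ⟨m1, m2⟩
  · have n1 := o1.1 m1
    have n2 : ¬ PP x y := fun e => by linarith [o2.2 e]
    have n3 : PP y x := g.resolve_left n2
    have n4 := o4.2 n3
    have n5 : ¬ PP τ y := by
      intro e; have := o3.2 e
      have := mul_pos this n4
      linarith
    have n6 := gt.resolve_left n5
    unfold PP at n1 n3 n6
    rcases ha with ha | ha
    · rcases n3 with ⟨n3, n3'⟩ | n3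
      · linarith
      · rcases n6 with ⟨n6, n6'⟩ | n6 <;> linarith
    · rcases n1 with ⟨n1, n1'⟩ | n1
      · linarith
      · rcases n3 with ⟨n3, n3'⟩ | n3
        · rcases n6 with ⟨n6, n6'⟩ | n6 <;> linarith
        · linarith
  · have n1 : ¬ PP x τ := fun e => by linarith [o1.2 e]
    have n2 := o2.1 m2
    have n4 : ¬ PP y x := fun e => n2.asymm e
    have n3 : PP τ y := by
      by_contra hne
      have q1 : oo p v (M.hd e) u ≤ 0 := not_lt.1 (fun k => hne (o3.1 k))
      have q2 : oo p v (M.hd e) (M.hd d) ≤ 0 := not_lt.1 (fun k => n4 (o4.1 k))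
      have := mul_nonneg_of_nonpos_of_nonpos q1 q2
      linarith
    unfold PP at n1 n2 n3
    rw [not_or, not_and_or] at n1
    obtain ⟨p1, p2⟩ := n1
    rcases n2 with ⟨n2, n2'⟩ | n2 <;> rcases n3 with ⟨n3, n3'⟩ | n3 <;> rcases ha with ha | ha <;> rcases p1 with p1 | p1 <;> linarith

lemma nX {d e : D} (h1 : M.vt d ≠ M.vt e) (h2 : M.vt d ≠ M.hd e) (h3 : M.hd d ≠ M.vt e) (h4 : M.hd d ≠ M.hd e) :
    ¬ X4 p (M.vt d) (M.hd d) (M.vt e) (M.hd e) := by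
  -- edges through both u and v
  have key0 : ∀ e, M.vt e ≠ u → M.vt e ≠ v → M.hd e ≠ u → M.hd e ≠ v → ¬ X4 p u v (M.vt e) (M.hd e) :=
    fun e a1 a2 a3 a4 => nX_uv P a1 a2 a3 a4 (B.nl e).symm
  by_cases c1 : d = d0
  · subst c1
    rw [B.vu, B.hd0] at *
    exact key0 e h1.symm h3.symm h2.symm h4.symm
  by_cases c2 : d = c
  · subst c2
    rw [B.vc, B.hc] at *
    exact fun hX => key0 e h3.symm h1.symm h4.symm h2.symm hX.s2
  by_cases c3 : e = d0
  · subst c3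
    rw [B.vu, B.hd0] at *
    exact fun hX => key0 d h1 h2 h3 h4 hX.s1
  by_cases c4 : e = c
  · subst c4
    rw [B.vc, B.hc] at *
    exact fun hX => key0 d h2 h1 h4 h3 hX.s1.s2
  have al0 : ∀ x, x ≠ c → M.al x ≠ d0 := fun x hx k => hx (by rw [B.ec, ← k, M.al_al])
  have alc : ∀ x, x ≠ d0 → M.al x ≠ c := fun x hx k => hx (by rw [← B.ac, ← k, M.al_al])
  -- pairs
  have pr : ∀ d e, d ≠ d0 → d ≠ c → e ≠ d0 → e ≠ c → M.vt d = u → M.vt e = v → M.hd d ≠ M.hd e → ¬ X4 p (M.vt d) (M.hd d) (M.vt e) (M.hd e) := by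
    intro d e a1 a2 a3 a4 a5 a6 a7
    rw [a5, a6]; exact B.nX_ux P T a5 a6 a1 a4 a7
  have pr2 : ∀ d e, d ≠ d0 → d ≠ c → e ≠ d0 → e ≠ c → M.hd d ≠ M.hd e → cmap h (M.vt d) = cmap h (M.vt e) → M.vt d ≠ M.vt e →
     ¬ X4 p (M.vt d) (M.hd d) (M.vt e) (M.hd e) := by
    intro d e a1 a2 a3 a4 a5 a6 a7
    rcases cmap_eq h a6 with k | ⟨k1, k2⟩ | ⟨k1, k2⟩
    · exact absurd k a7
    · exact pr d e a1 a2 a3 a4 k1 k2 a5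
    · exact fun hX => pr e d a3 a4 a1 a2 k2 k1 a5.symm hX.s1
  have hda : M.hd (M.al d) = M.vt d := M.hd_al d
  have hea : M.hd (M.al e) = M.vt e := M.hd_al e
  by_cases m1 : cmap h (M.vt d) = cmap h (M.vt e)
  · exact pr2 d e c1 c2 c3 c4 h4 m1 h1
  by_cases m2 : cmap h (M.vt d) = cmap h (M.hd e)
  · have := pr2 d (M.al e) c1 c2 (al0 e c4) (alc e c3) (by rw [hea]; exact h3) m2 h2
    rw [hea] at this; exact fun hX => this hX.s3
  by_cases m3 : cmap h (M.hd d) = cmap h (M.vt e)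
  · have := pr2 (M.al d) e (al0 d c2) (alc d c1) c3 c4 (by rw [hda]; exact h2) m3 h3
    rw [hda] at this; exact fun hX => this hX.s2
  by_cases m4 : cmap h (M.hd d) = cmap h (M.hd e)
  · have := pr2 (M.al d) (M.al e) (al0 d c2) (alc d c1) (al0 e c4) (alc e c3) (by rw [hda, hea]; exact h1) m4 h4
    rw [hda, hea] at this; exact fun hX => this hX.s2.s3
  have nn : ∀ x, x ≠ d0 → x ≠ c → cmap h (M.vt x) ≠ cmap h (M.hd x) := by
    intro x x1 x2 k
    rcases cmap_eq h k with k | ⟨k1, k2⟩ | ⟨k1, k2⟩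
    · exact B.nl x k.symm
    · exact x1 (B.sm (by rw [k1, B.vu]) (by rw [k2, B.hd0]))
    · exact x2 (B.sm (by rw [k1, B.vc]) (by rw [k2, B.hc]))
  intro hX
  exact B.qnc d e c1 c2 c3 c4 m1 m2 m3 m4 ⟨sgn_mul P (nn d c1 c2) m1 m3 m2 m4 hX.1,
    sgn_mul P (nn e c3 c4) (Ne.symm m1) (Ne.symm m2) (Ne.symm m3) (Ne.symm m4) hX.2⟩

omit T in
/-- order at a vertex different from `u`, `v` -/
lemma ordt (K : ∀ e f, M.vt e = u → M.vt f = v → M.hd e = M.hd f → ∃ a, M.vt a = M.hd e ∧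
      ((M.hd a = u ∧ M.hd (M.sg a) = v) ∨ (M.hd a = v ∧ M.hd (M.sg a) = u)) ∧ 0 < oo p (M.vt a) (M.hd a) (M.hd (M.sg a)))
    {d e : D} (hu : M.vt d ≠ u) (hv : M.vt d ≠ v) (he : M.vt d = M.vt e) (h1 : M.hd d ≠ M.hd e) (h2 : M.hd (M.sg d) ≠ M.hd e)
    (h3 : M.hd (M.sg d) ≠ M.hd d) : C3 p (M.vt d) (M.hd d) (M.hd (M.sg d)) (M.hd e) := by
  have vs := M.vt_sg d
  by_cases hall : cmap h (M.hd d) ≠ cmap h (M.hd e) ∧ cmap h (M.hd (M.sg d)) ≠ cmap h (M.hd e) ∧ cmap h (M.hd (M.sg d)) ≠ cmap h (M.hd d)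
  · apply P.C3keep
    have n0 : ∀ x, M.vt x = M.vt d → x ≠ d0 := by rintro x hx rfl; exact hu (by rw [← hx, B.vu])
    have nc : ∀ x, M.vt x = M.vt d → x ≠ c := by rintro x hx rfl; exact hv (by rw [← hx, B.vc])
    exact B.qord d e (n0 d rfl) (nc d rfl) (n0 e he.symm) (nc e he.symm) (n0 _ vs) (nc _ vs) he hall.1 hall.2.1 hall.2.2
  have hex : ∃ y z, M.vt y = M.vt d ∧ M.vt z = M.vt d ∧ M.hd y = u ∧ M.hd z = v := by
    have aux : ∀ y z, M.vt y = M.vt d → M.vt z = M.vt d → M.hd y ≠ M.hd z → cmap h (M.hd y) = cmap h (M.hd z) →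
        ∃ y z, M.vt y = M.vt d ∧ M.vt z = M.vt d ∧ M.hd y = u ∧ M.hd z = v := by
      intro y z a1 a2 a3 a4
      rcases cmap_eq h a4 with k | ⟨k1, k2⟩ | ⟨k1, k2⟩
      · exact absurd k a3
      · exact ⟨y, z, a1, a2, k1, k2⟩
      · exact ⟨z, y, a2, a1, k2, k1⟩
    rw [not_and_or, not_and_or, not_not, not_not, not_not] at hall
    rcases hall with k | k | k
    · exact aux d e rfl he.symm h1 k
    · exact aux _ e vs he.symm h2 k
    · exact aux _ d vs rfl h3 k
  obtain ⟨y, z, y1, z1, y2, z2⟩ := hex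
  obtain ⟨a, a1, a2, a3⟩ := K (M.al y) (M.al z) (by rw [M.vt_al, y2]) (by rw [M.vt_al, z2]) (by rw [M.hd_al, M.hd_al, y1, z1])
  rw [M.hd_al, y1] at a1
  have vsa : M.vt (M.sg a) = M.vt d := by rw [M.vt_sg, a1]
  -- any dart into u or v is a or σ a
  have cl : ∀ x, M.vt x = M.vt d → x ≠ a → x ≠ M.sg a → M.hd x ≠ u ∧ M.hd x ≠ v := by
    intro x hx n1 n2
    constructor
    · intro k
      rcases a2 with ⟨b1, b2⟩ | ⟨b1, b2⟩
      · exact n1 (B.sm (by rw [hx, a1]) (by rw [k, b1]))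
      · exact n2 (B.sm (by rw [hx, vsa]) (by rw [k, b2]))
    · intro k
      rcases a2 with ⟨b1, b2⟩ | ⟨b1, b2⟩
      · exact n2 (B.sm (by rw [hx, vsa]) (by rw [k, b2]))
      · exact n1 (B.sm (by rw [hx, a1]) (by rw [k, b1]))
  have tri : ∀ x, M.vt x = M.vt d → x ≠ a → x ≠ M.sg a → C3 p (M.vt d) (M.hd a) (M.hd (M.sg a)) (M.hd x) := by
    intro x hx n1 n2
    obtain ⟨x1, x2⟩ := cl x hx n1 n2
    have nx : M.hd x ≠ M.vt d := by rw [← hx]; exact B.nl x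
    have ss := same_side P x1 x2 hu hv nx
    rw [a1] at a3
    unfold C3
    have hor : 0 < oo p (M.vt d) (M.hd (M.sg a)) (M.hd x) ∨ 0 < oo p (M.vt d) (M.hd x) (M.hd a) := by
      have s1 : 0 < oo p (M.vt d) (M.hd x) (M.hd a) ∨ 0 < oo p (M.vt d) (M.hd a) (M.hd x) := by
        have ne : M.hd a ≠ M.vt d := by rw [← a1]; exact B.nl a
        have nxa : M.hd x ≠ M.hd a := by
          intro k; exact n1 (B.sm (by rw [hx, a1]) k)
        rcases lt_or_gt_of_ne (P.pgp nx.symm ne.symm nxa) with k | k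
        · right; rw [oo_swap]; linarith
        · left; exact k
      rcases s1 with s1 | s1
      · right; exact s1
      · left
        have s2 : 0 < oo p (M.hd x) (M.vt d) (M.hd a) := by rw [oo_rot]; exact s1
        have s3 : 0 < oo p (M.hd x) (M.vt d) (M.hd (M.sg a)) := by
          rcases a2 with ⟨b1, b2⟩ | ⟨b1, b2⟩
          · rw [b1] at s2; rw [b2]; exact ss.1 s2
          · rw [b1] at s2; rw [b2]; exact ss.2 s2
        rw [oo_rot] at s3; exact s3
    rcases hor with k | k
    · exact Or.inl ⟨a3, k⟩
    · exact Or.inr (Or.inr ⟨k, a3⟩)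
  have e1 : d ≠ e := fun e => h1 (by rw [e])
  have e2 : M.sg d ≠ e := fun e => h2 (by rw [e])
  have e3 : M.sg d ≠ d := fun e => h3 (by rw [e])
  by_cases c1 : d = a
  · have := tri e he.symm (fun k => e1 (c1.trans k.symm)) (fun k => e2 (by rw [c1, k]))
    rw [← c1] at this; exact this
  have c1' : M.sg d ≠ M.sg a := fun k => c1 (sinj k)
  by_cases c2 : M.sg d = a
  · have c3 : d ≠ M.sg a := by
      intro k
      rcases only2 (d := d) (d' := a) c2 k.symm he with l | l
      · exact e1 l.symm
      · exact e2 (c2.trans l.symm)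
    by_cases c4 : e = M.sg a
    · have := tri d rfl c1 c3
      rw [← c4, ← c2] at this
      exact this.rot.rot
    · exfalso
      obtain ⟨x1, x2⟩ := cl d rfl c1 c3
      obtain ⟨x3, x4⟩ := cl e he.symm (fun k => e2 (c2.trans k.symm)) c4
      exact hall ⟨Pt.cne' h1 x1 x2, Pt.cnes h2.symm x3 x4, Pt.cnes h3.symm x1 x2⟩
  · obtain ⟨s1, s2⟩ := cl (M.sg d) vs c2 c1'
    by_cases c3 : d = M.sg a
    · by_cases c4 : e = a
      · have := tri _ vs c2 c1'
        rw [← c4] at this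
        rw [← c4] at c3
        rw [← c3] at this
        exact this.rot
      · exfalso
        obtain ⟨x3, x4⟩ := cl e he.symm c4 (fun k => e1 (c3.trans k.symm))
        exact hall ⟨Pt.cnes h1.symm x3 x4, Pt.cne' h2 s1 s2, Pt.cne' h3 s1 s2⟩
    · exfalso
      obtain ⟨x1, x2⟩ := cl d rfl c1 c3
      exact hall ⟨Pt.cne' h1 x1 x2, Pt.cne' h2 s1 s2, Pt.cne' h3 s1 s2⟩

end
end Lb


namespace PM
variable {V D : Type} [Fintype D]

lemma Cyc_tri {M : PM V D} {a b c : D} (h : Fac M a b c) (e : D) : Cyc M.ph a e ↔ e = a ∨ e = b ∨ e = c := by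
  obtain ⟨h1, h2, h3⟩ := h
  constructor
  · intro hC
    refine hC (fun t => t = a ∨ t = b ∨ t = c) ?_ (Or.inl rfl)
    rintro t (rfl | rfl | rfl)
    · right; left; exact h1
    · right; right; exact h2
    · left; exact h3
  · have s1 : Cyc M.ph a b := by rw [← h1]; exact (Cyc.refl _ _).step
    have s2 : Cyc M.ph a c := by rw [← h2]; exact s1.step
    rintro (rfl | rfl | rfl)
    · exact Cyc.refl _ _
    · exact s1
    · exact s2

lemma card_tri {M : PM V D} {p : V → ℝ × ℝ} {a b c : D} (h : Fac M a b c) (n1 : a ≠ b) (n2 : a ≠ c) (n3 : b ≠ c)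
    (s1 : M.small p a) (s2 : M.small p b) (s3 : M.small p c) {d : D} (hd : d = a ∨ d = b ∨ d = c) :
    Nat.card {e | Cyc M.ph d e ∧ M.small p e} = 3 := by
  have key : ∀ {a b c : D} (_ : Fac M a b c) (_ : a ≠ b) (_ : a ≠ c) (_ : b ≠ c)
    (_ : M.small p a) (_ : M.small p b) (_ : M.small p c), Nat.card {e | Cyc M.ph a e ∧ M.small p e} = 3 := by
    intro a b c h n1 n2 n3 s1 s2 s3
    have : {e | Cyc M.ph a e ∧ M.small p e} = ({a, b, c} : Set D) := by
      ext e
      simp only [Set.mem_setOf_eq, Set.mem_insert_iff, Set.mem_singleton_iff, Cyc_tri h]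
      constructor
      · exact fun k => k.1
      · intro k
        refine ⟨k, ?_⟩
        rcases k with rfl | rfl | rfl
        · exact s1
        · exact s2
        · exact s3
    rw [this]
    show Set.ncard _ = 3
    rw [Set.ncard_eq_three]
    exact ⟨a, b, c, n1, n2, n3, rfl⟩
  rcases hd with rfl | rfl | rfl
  · exact key h n1 n2 n3 s1 s2 s3
  · exact key ⟨h.2.1, h.2.2, h.1⟩ n3 n1.symm n2.symm s2 s3 s1
  · exact key ⟨h.2.2, h.1, h.2.1⟩ n2.symm n3.symm n1 s3 s1 s2

/-- orbits after deleting an edge -/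
lemma Cyc_del {M : PM V D} {d0 c : D} (h1 : M.ph d0 ≠ c) (h2 : M.ph c ≠ d0) (h3 : M.ph d0 ≠ d0) (h4 : M.ph c ≠ c)
    (f : {d // d ≠ d0 ∧ d ≠ c} → {d // d ≠ d0 ∧ d ≠ c})
    (g4 : ∀ d, M.ph d.1 = d0 → (f d).1 = M.ph d0)
    (g5 : ∀ d, M.ph d.1 = c → (f d).1 = M.ph c)
    (g6 : ∀ d, M.ph d.1 ≠ d0 → M.ph d.1 ≠ c → (f d).1 = M.ph d.1) (d e : {d // d ≠ d0 ∧ d ≠ c}) :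
    Cyc f d e ↔ Cyc M.ph d.1 e.1 := by
  constructor
  · intro hC P hP hd
    refine hC (fun t => P t.1) ?_ hd
    intro t ht
    have h1 := hP _ ht
    by_cases c1 : M.ph t.1 = d0
    · rw [g4 t c1, ← c1]; exact hP _ h1
    by_cases c2 : M.ph t.1 = c
    · rw [g5 t c2, ← c2]; exact hP _ h1
    rw [g6 t c1 c2]; exact h1
  · intro hC P hP hd
    have := hC (fun t => (∀ ht, P ⟨t, ht⟩) ∧ (t = d0 → P ⟨M.ph d0, h3, h1⟩) ∧ (t = c → P ⟨M.ph c, h2, h4⟩)) ?_ ?_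
    · exact this.1 e.2
    · rintro t ⟨a1, a2, a3⟩
      by_cases b1 : t = d0
      · have := a2 b1
        subst b1
        exact ⟨fun _ => this, fun e => absurd e h3, fun e => absurd e h1⟩
      by_cases b2 : t = c
      · have := a3 b2
        subst b2
        exact ⟨fun _ => this, fun e => absurd e h2, fun e => absurd e h4⟩
      have h5 := hP _ (a1 ⟨b1, b2⟩)
      refine ⟨fun ht => ?_, fun e => ?_, fun e => ?_⟩
      · have : f ⟨t, b1, b2⟩ = ⟨M.ph t, ht⟩ := Subtype.ext (g6 _ ht.1 ht.2)
        rw [← this]; exact h5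
      · have : f ⟨t, b1, b2⟩ = ⟨M.ph d0, h3, h1⟩ := Subtype.ext (g4 _ e)
        rw [← this]; exact h5
      · have : f ⟨t, b1, b2⟩ = ⟨M.ph c, h2, h4⟩ := Subtype.ext (g5 _ e)
        rw [← this]; exact h5
    · exact ⟨fun _ => hd, fun e => absurd e d.2.1, fun e => absurd e d.2.2⟩

end PM

namespace Lb
variable {V D : Type} [Fintype D] {M : PM V D} {p q : V → ℝ × ℝ} {u v : V} {h : v ≠ u} {θ : V → ℝ} {τ : ℝ} {w : V}
  {d0 c d1 d2 bl af : D}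
variable (B : Lb M q h θ w d0 c d1 d2 bl af) (P : Pt p q h θ τ)
include B P

lemma cne_edge {x : D} (x1 : x ≠ d0) (x2 : x ≠ c) : cmap h (M.vt x) ≠ cmap h (M.hd x) := by
  intro k
  rcases cmap_eq h k with k | ⟨k1, k2⟩ | ⟨k1, k2⟩
  · exact B.nl x k.symm
  · exact x1 (B.sm (by rw [k1, B.vu]) (by rw [k2, B.hd0]))
  · exact x2 (B.sm (by rw [k1, B.vc]) (by rw [k2, B.hc]))

lemma smalliff {ax : D} (K : ∀ e f, M.vt e = u → M.vt f = v → M.hd e = M.hd f → ∃ a, (a = M.al d1 ∨ a = ax) ∧ M.vt a = M.hd e ∧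
      ((M.hd a = u ∧ M.hd (M.sg a) = v) ∨ (M.hd a = v ∧ M.hd (M.sg a) = u)) ∧ 0 < oo p (M.vt a) (M.hd a) (M.hd (M.sg a)))
    {e : D} (h0 : e ≠ d0) (hc : e ≠ c) (h0' : M.ph e ≠ d0) (hc' : M.ph e ≠ c) (h1 : e ≠ d1) (hx : M.al e ≠ ax) :
    M.small p e ↔ 0 < oo q (M.hd e) (M.vt e) (M.hd (M.ph e)) := by
  have m1 := B.cne_edge P h0 hc
  have m2 := B.cne_edge P h0' hc'
  rw [M.vt_ph'] at m2
  unfold PM.small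
  have nn : ∀ a, (a = M.al d1 ∨ a = ax) → a ≠ M.al e := by
    rintro a (k | k) k'
    · exact h1 (M.al.injective (k'.symm.trans k))
    · exact hx (k'.symm.trans k)
  by_cases m3 : cmap h (M.vt e) = cmap h (M.hd (M.ph e))
  · rcases cmap_eq h m3 with k | ⟨k1, k2⟩ | ⟨k1, k2⟩
    · rw [← k]
      have z : ∀ p : V → ℝ × ℝ, oo p (M.hd e) (M.vt e) (M.vt e) = 0 := by intro p; unfold oo; ring
      rw [z, z]
    · obtain ⟨a, a1, a2, a3, a4⟩ := K e (M.al (M.ph e)) k1 k2 (by rw [M.hd_al, M.vt_ph'])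
      have z : oo q (M.hd e) (M.vt e) (M.hd (M.ph e)) = 0 := by rw [k1, k2]; unfold oo; rw [P.quv]; ring
      rw [z]; rw [a2] at a4
      rcases a3 with ⟨b1, b2⟩ | ⟨b1, b2⟩
      · exact absurd (B.sm a2 (by rw [b1, M.hd_al, k1])) (nn a a1)
      · rw [b1, b2] at a4
        rw [k1, k2, oo_swap]
        constructor <;> intro <;> linarith
    · obtain ⟨a, a1, a2, a3, a4⟩ := K (M.al (M.ph e)) e k2 k1 (by rw [M.hd_al, M.vt_ph'])
      have z : oo q (M.hd e) (M.vt e) (M.hd (M.ph e)) = 0 := by rw [k1, k2]; unfold oo; rw [P.quv]; ring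
      rw [M.hd_al, M.vt_ph'] at a2
      rw [z]; rw [a2] at a4
      rcases a3 with ⟨b1, b2⟩ | ⟨b1, b2⟩
      · rw [b1, b2] at a4
        rw [k1, k2, oo_swap]
        constructor <;> intro <;> linarith
      · exact absurd (B.sm a2 (by rw [b1, M.hd_al, k1])) (nn a a1)
  · exact P.keepiff (Ne.symm m1) m2 m3

lemma uvw_neg : oo p u v w < 0 := by
  have := P.su w B.wu B.wv
  rw [B.w0] at this
  refine lt_of_le_of_ne (not_lt.1 fun k => ?_) this.2
  have t0 := P.t0; have t1 := P.t1
  rcases this.1.1 k with ⟨k, k'⟩ | k <;> linarith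

lemma small_tri : M.small p d0 ∧ M.small p d1 ∧ M.small p d2 := by
  have := B.uvw_neg P
  unfold PM.small
  rw [B.f0, B.f1, B.f2, B.hd0, B.hd1, B.hd2, B.vu, B.vv, B.vw]
  have e : oo p v u w = - oo p u v w := by unfold oo; ring
  have e2 : oo p w v u = - oo p u v w := by unfold oo; ring
  have e3 : oo p u w v = - oo p u v w := by unfold oo; ring
  rw [e, e2, e3]
  exact ⟨by linarith, by linarith, by linarith⟩

end Lb


lemma choice1 {β a a' : ℝ} (h0 : 0 ≤ β) (h1 : β ≠ Real.pi) (h2 : β < a) (h3 : a ≤ 2 * Real.pi) (h4 : a - β ≠ Real.pi)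
    (h5 : (a' = a ∧ a < 2 * Real.pi) ∨ (a = 2 * Real.pi ∧ a' = 0)) :
    ∃ lo hi : ℝ, 0 ≤ lo ∧ lo < hi ∧ hi ≤ Real.pi ∧ ∀ τ, lo < τ → τ < hi → τ < a ∧ β < τ + Real.pi ∧
      (PP β a' ↔ PP τ β ∨ PP τ a') ∧ ¬ (PP τ β ∧ PP τ a') := by
  have hpi := Real.pi_pos
  rcases lt_or_gt_of_ne h1 with b | b
  · rcases lt_or_gt_of_ne h4 with g | g
    · refine ⟨β, min Real.pi a, h0, lt_min b h2, min_le_left _ _, fun τ t1 t2 => ?_⟩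
      have t3 := t2.trans_le (min_le_left _ _)
      have t4 := t2.trans_le (min_le_right _ _)
      have n1 : ¬ PP τ β := by rintro (⟨k, k'⟩ | k) <;> linarith
      refine ⟨t4, by linarith, ?_, fun k => n1 k.1⟩
      rcases h5 with ⟨e, e'⟩ | ⟨e, e'⟩
      · rw [e]
        exact ⟨fun _ => Or.inr (Or.inl ⟨by linarith, by linarith⟩), fun _ => Or.inl ⟨by linarith, by linarith⟩⟩
      · linarith
    · refine ⟨β, min Real.pi (a - Real.pi), h0, lt_min b (by linarith), min_le_left _ _, fun τ t1 t2 => ?_⟩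
      have t3 := t2.trans_le (min_le_left _ _)
      have t4 := t2.trans_le (min_le_right _ _)
      have n1 : ¬ PP τ β := by rintro (⟨k, k'⟩ | k) <;> linarith
      have n2 : ¬ PP τ a' := by
        rcases h5 with ⟨e, e'⟩ | ⟨e, e'⟩
        · rw [e]; rintro (⟨k, k'⟩ | k) <;> linarith
        · rw [e']; rintro (⟨k, k'⟩ | k) <;> linarith
      have n3 : ¬ PP β a' := by
        rcases h5 with ⟨e, e'⟩ | ⟨e, e'⟩
        · rw [e]; rintro (⟨k, k'⟩ | k) <;> linarith
        · rw [e']; rintro (⟨k, k'⟩ | k) <;> linarith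
      refine ⟨by linarith, by linarith, ?_, fun k => n1 k.1⟩
      exact ⟨fun k => absurd k n3, fun k => k.elim (fun k => absurd k n1) (fun k => absurd k n2)⟩
  · refine ⟨β - Real.pi, a - Real.pi, by linarith, by linarith, by linarith, fun τ t1 t2 => ?_⟩
    have n1 : PP τ β := Or.inl ⟨by linarith, by linarith⟩
    have n2 : ¬ PP τ a' := by
      rcases h5 with ⟨e, e'⟩ | ⟨e, e'⟩
      · rw [e]; rintro (⟨k, k'⟩ | k) <;> linarith
      · rw [e']; rintro (⟨k, k'⟩ | k) <;> linarith
    have n3 : PP β a' := by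
      rcases h5 with ⟨e, e'⟩ | ⟨e, e'⟩
      · rw [e]; left; constructor <;> linarith
      · rw [e']; right; linarith
    exact ⟨by linarith, by linarith, ⟨fun _ => Or.inl n1, fun _ => n3⟩, fun k => n2 k.2⟩

namespace Lb
variable {V D : Type} [Fintype D] {M : PM V D} {p q : V → ℝ × ℝ} {u v : V} {h : v ≠ u} {θ : V → ℝ} {τ : ℝ} {w : V}
  {d0 c d1 d2 bl af : D}
variable (B : Lb M q h θ w d0 c d1 d2 bl af) (P : Pt p q h θ τ)
include B P

lemma af0 : af ≠ d0 := fun e => B.sne_u B.vu (by rw [B.s0, e])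
lemma blc : bl ≠ c := fun e => B.sne_v B.vbl (by rw [B.sbl, e])

lemma small_c : M.small p c ↔ PP τ (θ (M.hd af)) := by
  unfold PM.small
  rw [B.hc, B.vc, B.eaf]
  exact (P.su _ (B.nu B.vaf) (B.hv_of B.vaf (B.af0 P))).1

lemma small_ep : M.small p (M.al bl) ↔ PP τ (θ (M.hd bl)) := by
  unfold PM.small
  rw [B.ebl, M.hd_al, B.vbl, B.hc, M.vt_al]
  have k3 := B.nv B.vbl; have k4 := B.hu_of B.vbl (B.blc P)
  have := P.pv k3 h.symm k4
  unfold Pt.Tv at this; rw [if_neg k4, if_pos rfl, P.PPpi'] at this; exact this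

lemma small0_ep : 0 < oo q (M.hd (M.al bl)) (M.vt (M.al bl)) (M.hd (M.ph c)) ↔ PP (θ (M.hd bl)) (θ (M.hd af)) := by
  rw [B.eaf, M.hd_al, B.vbl, M.vt_al, P.oov]
  exact P.qu _ _ (B.hu_of B.vbl (B.blc P)) (B.nv B.vbl) (B.nu B.vaf) (B.hv_of B.vaf (B.af0 P))

end Lb

namespace PM
variable {V D : Type} [Fintype D]

/-- counting small angles through a bijection -/
lemma cnt_via {M : PM V D} {p : V → ℝ × ℝ} {D0 : Type} (val : D0 → D) (hval : Function.Injective val) (π : Equiv.Perm D)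
    (d : D) (S : Set D0) (hS : Nat.card S = 3) (h : ∀ e, (Cyc M.ph d e ∧ M.small p e) ↔ ∃ e0 ∈ S, π (val e0) = e) :
    Nat.card {e | Cyc M.ph d e ∧ M.small p e} = 3 := by
  have : {e | Cyc M.ph d e ∧ M.small p e} = (fun x => π (val x)) '' S := by
    ext e; rw [Set.mem_setOf_eq, h]; rfl
  rw [this]
  exact (Nat.card_image_of_injective (f := fun x => π (val x)) (π.injective.comp hval) S).trans hS

theorem lift [Fintype V] {M : PM V D} (hs : M.Simple) {L : Finset (Sym2 V)} {d0 d1 d2 : D} (G : Good M L d0 d1 d2)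
    {c : D} (ec : c = M.al d0) {u v : V} (hu : M.vt d0 = u) (hv : M.vt c = v) (h : v ≠ u)
    [Fintype {d // d ≠ d0 ∧ d ≠ c}] {M0 : PM {x : V // x ≠ u} {d // d ≠ d0 ∧ d ≠ c}}
    (g1 : ∀ d, (M0.al d).1 = M.al d.1)
    (g2 : ∀ d, M0.vt d = cmap h (M.vt d.1))
    (g3 : ∀ d, M0.out d ↔ M.out d.1)
    (g4 : ∀ d, M.ph d.1 = d0 → (M0.ph d).1 = M.ph d0)
    (g5 : ∀ d, M.ph d.1 = c → (M0.ph d).1 = M.ph c)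
    (g6 : ∀ d, M.ph d.1 ≠ d0 → M.ph d.1 ≠ c → (M0.ph d).1 = M.ph d.1)
    {p' : {x : V // x ≠ u} → ℝ × ℝ} (W : M0.WReal p') : ∃ p, M.WReal p := by
  classical
  obtain ⟨f0, f1, f2⟩ := G.fac
  set w := M.vt d2 with hw
  set q : V → ℝ × ℝ := fun x => p' (cmap h x) with hq
  set af := M.ph c with haf
  set bl := M.al (M.ph.symm c) with hbl
  have ac : M.al c = d0 := by rw [ec, M.al_al]
  have ebl : M.ph (M.al bl) = c := by rw [hbl, M.al_al, Equiv.apply_symm_apply]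
  have vv : M.vt d1 = v := by rw [← f0, M.vt_ph, ← ec, hv]
  have hd0 : ∀ e : {d // d ≠ d0 ∧ d ≠ c}, M0.hd e = cmap h (M.hd e.1) := by
    intro e; unfold hd; rw [g2, g1]
  have hsg : ∀ e : {d // d ≠ d0 ∧ d ≠ c}, M.sg e.1 ≠ d0 → M.sg e.1 ≠ c → (M0.sg e).1 = M.sg e.1 := by
    intro e h1 h2; unfold sg; rw [g6, g1]
    · rw [g1]; exact h1
    · rw [g1]; exact h2
  have qord : ∀ d e, d ≠ d0 → d ≠ c → e ≠ d0 → e ≠ c → M.sg d ≠ d0 → M.sg d ≠ c → M.vt d = M.vt e →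
    cmap h (M.hd d) ≠ cmap h (M.hd e) → cmap h (M.hd (M.sg d)) ≠ cmap h (M.hd e) →
    cmap h (M.hd (M.sg d)) ≠ cmap h (M.hd d) → C3 q (M.vt d) (M.hd d) (M.hd (M.sg d)) (M.hd e) := by
    intro d e a1 a2 a3 a4 a5 a6 a7 a8 a9 a10
    have := W.ord ⟨d, a1, a2⟩ ⟨e, a3, a4⟩ (by rw [g2, g2, a7]) (by rw [hd0, hd0]; exact a8)
      (by rw [hd0, hd0, hsg _ a5 a6]; exact a9) (by rw [hd0, hd0, hsg _ a5 a6]; exact a10)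
    rw [hd0, hd0, hd0, g2, hsg _ a5 a6] at this
    exact this
  have qnc : ∀ d e, d ≠ d0 → d ≠ c → e ≠ d0 → e ≠ c → cmap h (M.vt d) ≠ cmap h (M.vt e) →
    cmap h (M.vt d) ≠ cmap h (M.hd e) → cmap h (M.hd d) ≠ cmap h (M.vt e) → cmap h (M.hd d) ≠ cmap h (M.hd e) →
    ¬ (oo q (M.vt d) (M.hd d) (M.vt e) * oo q (M.vt d) (M.hd d) (M.hd e) < 0 ∧
       oo q (M.vt e) (M.hd e) (M.vt d) * oo q (M.vt e) (M.hd e) (M.hd d) < 0) := by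
    intro d e a1 a2 a3 a4 a5 a6 a7 a8
    have := W.nc ⟨d, a1, a2⟩ ⟨e, a3, a4⟩ (by rw [g2, g2]; exact a5) (by rw [g2, hd0]; exact a6)
      (by rw [g2, hd0]; exact a7) (by rw [hd0, hd0]; exact a8)
    rw [hd0, hd0, g2, g2] at this
    exact this
  have qgp : ∀ x y z, cmap h x ≠ cmap h y → cmap h x ≠ cmap h z → cmap h y ≠ cmap h z → oo q x y z ≠ 0 :=
    fun x y z h1 h2 h3 => W.gp _ _ _ h1 h2 h3
  have quv : q u = q v := by simp only [hq]; rw [cmap_u, cmap_ne h h]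
  have hd1 : M.vt (M.al d1) = w := by rw [← M.vt_ph, f1]
  have hd2 : M.vt (M.al d2) = u := by rw [← M.vt_ph, f2, hu]
  have hwv : w ≠ v := by rw [← hd1, ← vv]; exact (hs.noloop d1).symm
  have hwu : w ≠ u := by rw [← hd2]; exact hs.noloop d2
  obtain ⟨θ, w0, rng, qu, mk0⟩ := geo q h.symm quv hwu hwv
    (fun x y a1 a2 a3 a4 a5 => qgp u x y (Pt.cnes a1 a1 a2) (Pt.cnes a3 a3 a4) (Pt.cne' a5 a1 a2))
    (fun x a1 a2 e => Pt.cne' (h := h) a1 a1 a2 (W.inj e))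
  have mk : ∀ lo hi : ℝ, 0 ≤ lo → lo < hi → hi ≤ Real.pi → ∃ τ p, lo < τ ∧ τ < hi ∧ Pt p q h θ τ := by
    intro lo hi a1 a2 a3
    obtain ⟨τ, t1, t2, av, p, _, keep, su⟩ := mk0 lo hi a1 a2 a3
    exact ⟨τ, p, t1, t2, by linarith, by linarith, rng, av, quv, qgp, qu, keep, su⟩
  have B : Lb M q h θ w d0 c d1 d2 bl af := ⟨hs, w0, f0, f1, f2, ec, rfl, ebl, hu, vv, rfl, qord, qnc⟩
  obtain ⟨τ', pp', _, _, P'⟩ := mk 0 Real.pi le_rfl Real.pi_pos le_rfl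
  have hpi := Real.pi_pos
  -- small angles of the contracted drawing
  have small0 : ∀ e : {d // d ≠ d0 ∧ d ≠ c}, M0.small p' e ↔ 0 < oo q (M.hd e.1) (M.vt e.1) (M.hd (M0.ph e).1) := by
    intro e; unfold small; rw [hd0, hd0, g2]; exact Iff.rfl
  have hp1 : M.ph d0 ≠ c := by rw [f0]; exact B.d1c
  have hp2 : M.ph c ≠ d0 := B.af0 P'
  have hp3 : M.ph d0 ≠ d0 := by rw [f0]; exact B.n0 vv
  have hp4 : M.ph c ≠ c := B.nc B.vaf
  have hcyc := Cyc_del hp1 hp2 hp3 hp4 M0.ph g4 g5 g6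
  have n01 : d0 ≠ d1 := (B.n0 vv).symm
  have n12 : d1 ≠ d2 := fun e => hwv (by rw [hw, ← e, vv])
  have n02 : d0 ≠ d2 := fun e => hwu (by rw [hw, ← e, hu])
  have nd2c : d2 ≠ c := fun e => hwv (by rw [hw, e, B.vc])
  -- final assembly
  have fin : ∀ {p τ} (ax : D), Pt p q h θ τ → Lb.T1 M θ τ d2 bl af →
    (∀ e f, M.vt e = u → M.vt f = v → M.hd e = M.hd f → ∃ a, (a = M.al d1 ∨ a = ax) ∧ M.vt a = M.hd e ∧
      ((M.hd a = u ∧ M.hd (M.sg a) = v) ∨ (M.hd a = v ∧ M.hd (M.sg a) = u)) ∧ 0 < oo p (M.vt a) (M.hd a) (M.hd (M.sg a))) →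
    (∀ d, d ≠ d0 → d ≠ d1 → d ≠ d2 → ¬ M.out d → M.ph (M.ph d) ≠ d → Nat.card {e | Cyc M.ph d e ∧ M.small p e} = 3) →
    (∀ d, d ≠ d0 → d ≠ d1 → d ≠ d2 → M.out d → ¬ M.small p d) → M.WReal p := by
    intro p τ ax P T K hcnt hout
    have K' : ∀ e f, M.vt e = u → M.vt f = v → M.hd e = M.hd f → ∃ a, M.vt a = M.hd e ∧
      ((M.hd a = u ∧ M.hd (M.sg a) = v) ∨ (M.hd a = v ∧ M.hd (M.sg a) = u)) ∧ 0 < oo p (M.vt a) (M.hd a) (M.hd (M.sg a)) := by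
      intro e f a1 a2 a3
      obtain ⟨a, _, b⟩ := K e f a1 a2 a3
      exact ⟨a, b⟩
    obtain ⟨s0, s1, s2⟩ := B.small_tri P
    refine ⟨?_, fun x y z => P.pgp, ?_, ?_, ?_, ?_⟩
    · intro x y hxy
      by_contra hne
      have hz : ∃ z, z ≠ x ∧ z ≠ y := by
        by_cases a1 : u ≠ x ∧ u ≠ y
        · exact ⟨u, a1⟩
        by_cases a2 : v ≠ x ∧ v ≠ y
        · exact ⟨v, a2⟩
        refine ⟨w, ?_, ?_⟩
        · rintro rfl
          apply hne
          have b1 : u = y := by by_contra k; exact a1 ⟨hwu.symm, k⟩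
          have b2 : v = y := by by_contra k; exact a2 ⟨hwv.symm, k⟩
          exact absurd (b2.trans b1.symm) h
        · rintro rfl
          have b1 : u = x := by by_contra k; exact a1 ⟨k, hwu.symm⟩
          have b2 : v = x := by by_contra k; exact a2 ⟨k, hwv.symm⟩
          exact absurd (b2.trans b1.symm) h
      obtain ⟨z, z1, z2⟩ := hz
      apply P.pgp hne z1.symm z2.symm
      unfold oo; rw [hxy]; ring
    · intro d e a1 a2 a3 a4
      exact B.nX P T a1 a2 a3 a4
    · intro d e a1 a2 a3 a4
      by_cases c1 : M.vt d = u
      · rw [c1]; exact B.ordu P T c1 (a1 ▸ c1) a2 a3 a4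
      by_cases c2 : M.vt d = v
      · rw [c2]; exact B.ordv P T c2 (a1 ▸ c2) a2 a3 a4
      exact B.ordt P K' c1 c2 a1 a2 a3 a4
    · intro d ho hp
      by_cases c1 : d = d0 ∨ d = d1 ∨ d = d2
      · exact card_tri ⟨f0, f1, f2⟩ n01 n02 n12 s0 s1 s2 c1
      · rw [not_or, not_or] at c1
        exact hcnt d c1.1 c1.2.1 c1.2.2 ho hp
    · intro d ho
      refine hout d ?_ ?_ ?_ ho
      · rintro rfl; exact G.nout ho
      · rintro rfl; rw [← f0, M.out_ph] at ho; exact G.nout ho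
      · rintro rfl; rw [← f1, M.out_ph, ← f0, M.out_ph] at ho; exact G.nout ho
  -- the dart at w
  have Kw : ∀ {p τ}, Pt p q h θ τ → M.vt (M.al d1) = w ∧
      ((M.hd (M.al d1) = u ∧ M.hd (M.sg (M.al d1)) = v) ∨ (M.hd (M.al d1) = v ∧ M.hd (M.sg (M.al d1)) = u)) ∧
       0 < oo p (M.vt (M.al d1)) (M.hd (M.al d1)) (M.hd (M.sg (M.al d1))) := by
    intro p τ P
    have e1 : M.sg (M.al d1) = d2 := by unfold sg; rw [M.al_al, f1]
    rw [e1, B.hd2, M.hd_al, vv, hd1]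
    refine ⟨rfl, Or.inr ⟨rfl, rfl⟩, ?_⟩
    have := B.uvw_neg P
    have e2 : oo p w v u = - oo p u v w := by unfold oo; ring
    linarith
  have orb : ∀ d, d ≠ d0 → d ≠ d1 → d ≠ d2 → ∀ e, Cyc M.ph d e → e ≠ d0 ∧ e ≠ d1 ∧ e ≠ d2 := by
    intro d a1 a2 a3 e hC
    refine hC (fun t => t ≠ d0 ∧ t ≠ d1 ∧ t ≠ d2) ?_ ⟨a1, a2, a3⟩
    rintro t ⟨b1, b2, b3⟩
    exact ⟨fun e => b3 (M.ph.injective (e.trans f2.symm)), fun e => b1 (M.ph.injective (e.trans f0.symm)),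
      fun e => b2 (M.ph.injective (e.trans f1.symm))⟩
  have nph : ∀ d, d ≠ d2 → M.ph d ≠ d0 := fun d hd e => hd (M.ph.injective (e.trans f2.symm))
  have hblep : ∀ d, M.ph d = c → d = M.al bl := fun d hd => M.ph.injective (hd.trans ebl.symm)
  rcases G.cases with hcs | ⟨x, y, ⟨fx, fy, fz⟩, -, nox, nyw, hcs⟩
  · -- Case 1
    have common : ∀ e f, M.vt e = u → M.vt f = v → M.hd e = M.hd f → M.hd e = w :=
      fun e f a1 a2 a3 => hcs e f (a1.trans hu.symm) (a2.trans vv.symm) a3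
    have b1 := B.hu_of B.vbl (B.blc P')
    have b2 := B.nv B.vbl
    have b3 := B.nu B.vaf
    have b4 := B.hv_of B.vaf (B.af0 P')
    have hbw : M.hd bl = w → bl = d1 := fun e => B.sm (by rw [B.vbl, vv]) (by rw [e, B.hd1])
    have haw : M.hd af = w → af = M.al d2 := fun e => B.sm (by rw [B.vaf, B.va2]) (by rw [e, B.ha2])
    have hβπ : θ (M.hd bl) ≠ Real.pi := by
      by_cases e : M.hd bl = w
      · rw [e, w0]; exact hpi.ne
      · exact B.npi P' b1 b2 e
    have ha2π : Lb.a0 M θ d2 af ≤ 2 * Real.pi := by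
      unfold Lb.a0; split_ifs
      · exact le_rfl
      · exact (rng _).2.le
    have h5 : (θ (M.hd af) = Lb.a0 M θ d2 af ∧ Lb.a0 M θ d2 af < 2 * Real.pi) ∨ (Lb.a0 M θ d2 af = 2 * Real.pi ∧ θ (M.hd af) = 0) := by
      unfold Lb.a0
      by_cases e : af = M.al d2
      · right; rw [if_pos e, e, B.ha2]; exact ⟨rfl, w0⟩
      · left; rw [if_neg e]; exact ⟨rfl, (rng _).2⟩
    have hlt : θ (M.hd bl) < Lb.a0 M θ d2 af := by
      unfold Lb.a0
      by_cases e : af = M.al d2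
      · rw [if_pos e]; exact (rng _).2
      rw [if_neg e]
      have e' : M.hd af ≠ w := fun k => e (haw k)
      by_cases e2 : M.hd bl = w
      · rw [e2, w0]; exact B.pos P' b3 b4 e'
      have hne : M.hd bl ≠ M.hd af := fun k => e' (common af bl B.vaf B.vbl k.symm)
      have hbk : bl ≠ d0 ∧ bl ≠ c := ⟨B.n0 B.vbl, B.blc P'⟩
      have hs0 : (M0.sg ⟨bl, hbk⟩).1 = af := by
        unfold sg; rw [g5]; rw [g1]; exact ebl
      have := W.ord ⟨bl, hbk⟩ ⟨d1, n01.symm, B.d1c⟩ (by rw [g2, g2]; exact congrArg _ (B.vbl.trans vv.symm))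
        (by rw [hd0, hd0, B.hd1]; exact Pt.cne' e2 b1 b2) (by rw [hd0, hd0, hs0, B.hd1]; exact Pt.cne' e' b3 b4)
        (by rw [hd0, hd0, hs0]; exact Pt.cnes hne b1 b2)
      rw [hd0, hd0, hd0, hs0, g2, B.hd1] at this
      have t : C3 q v (M.hd bl) (M.hd af) w := by
        have : C3 q (M.vt bl) (M.hd bl) (M.hd af) w := this
        rw [B.vbl] at this; exact this
      have t' : C3 q u (M.hd bl) (M.hd af) w := by
        unfold C3 at t ⊢; rw [P'.oov, P'.oov, P'.oov] at t; exact t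
      exact P'.ltq b1 b2 b3 b4 hwu hwv t' w0
    have h4 : Lb.a0 M θ d2 af - θ (M.hd bl) ≠ Real.pi := by
      intro k
      rcases h5 with ⟨e1, e2⟩ | ⟨e1, e2⟩
      · have hne : M.hd bl ≠ M.hd af := by
          intro k'; rw [k', e1] at hlt; exact lt_irrefl _ hlt
        have := P'.GG0 b1 b2 b3 b4 hne
        rw [e1] at this
        rcases this with (⟨k1, k2⟩ | k1) | (⟨k1, k2⟩ | k1) <;> linarith
      · apply hβπ; linarith
    obtain ⟨lo, hi, l1, l2, l3, hτ⟩ := choice1 (rng _).1 hβπ hlt ha2π h4 h5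
    obtain ⟨τ, p, t1, t2, P⟩ := mk lo hi l1 l2 l3
    obtain ⟨k1, k2, k3, k4⟩ := hτ τ t1 t2
    have hK : ∀ e f, M.vt e = u → M.vt f = v → M.hd e = M.hd f → ∃ a, (a = M.al d1 ∨ a = M.al d1) ∧ M.vt a = M.hd e ∧
      ((M.hd a = u ∧ M.hd (M.sg a) = v) ∨ (M.hd a = v ∧ M.hd (M.sg a) = u)) ∧ 0 < oo p (M.vt a) (M.hd a) (M.hd (M.sg a)) := by
      intro e f a1 a2 a3
      refine ⟨M.al d1, Or.inl rfl, ?_⟩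
      rw [common e f a1 a2 a3]; exact Kw P
    rw [← B.small_ep P, ← B.small_c P] at k3 k4
    rw [← B.small0_ep P] at k3
    set ep := M.al bl with hep
    have epn : ep ≠ d0 ∧ ep ≠ c := by
      constructor
      · intro e; rw [e] at ebl; exact hp1 ebl
      · intro e; rw [e] at ebl; exact hp4 ebl
    have sm1 : ∀ e (he : e ≠ d0 ∧ e ≠ c), e ≠ d1 → e ≠ d2 → e ≠ ep → (M.small p e ↔ M0.small p' ⟨e, he⟩) := by
      intro e he a1 a2 a3
      have c1 := nph e a2
      have c2 : M.ph e ≠ c := fun k => a3 (hblep e k)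
      rw [small0, g6 _ c1 c2]
      exact B.smalliff P hK he.1 he.2 c1 c2 a1 (fun k => a1 (M.al.injective k))
    have sm2 : M0.small p' ⟨ep, epn⟩ ↔ M.small p ep ∨ M.small p c := by
      rw [small0, g5 _ ebl]; exact k3
    refine ⟨p, fin (M.al d1) P ⟨k1, k2, hlt.le⟩ hK ?_ ?_⟩
    · -- counts
      have main : ∀ d, d ≠ d0 → d ≠ d1 → d ≠ d2 → d ≠ c → ¬ M.out d → M.ph (M.ph d) ≠ d → Nat.card {e | Cyc M.ph d e ∧ M.small p e} = 3 := by
        intro d a0 a1 a2 ac' ho hpp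
        have hdd : M0.ph (M0.ph ⟨d, a0, ac'⟩) ≠ ⟨d, a0, ac'⟩ := by
          intro k
          have k' : (M0.ph (M0.ph ⟨d, a0, ac'⟩)).1 = d := by rw [k]
          -- closing up forces a triangle
          have tri : ∀ s, M.ph af = s → M.ph s = c → M.out c := by
            intro s s1 s2
            have hse : s = ep := hblep s s2
            have hcm : M.hd af = M.hd bl := by rw [← M.vt_ph', s1, hse, hep]; rfl
            have hww := common af bl B.vaf B.vbl hcm
            have ea : af = M.al d2 := haw hww
            have eb : bl = d1 := hbw (hcm ▸ hww)
            have hall := all_closed (M := M) (d := d0) (fun t => t = d0 ∨ t = d1 ∨ t = d2 ∨ t = c ∨ t = M.al d1 ∨ t = M.al d2)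
              (by
                rintro t (rfl | rfl | rfl | rfl | rfl | rfl)
                · exact Or.inr (Or.inl f0)
                · exact Or.inr (Or.inr (Or.inl f1))
                · exact Or.inl f2
                · right; right; right; right; right; exact ea
                · right; right; right; left; rw [← eb]; exact ebl
                · right; right; right; right; left; rw [← ea, s1, hse, hep, eb])
              (by
                rintro t (rfl | rfl | rfl | rfl | rfl | rfl)
                · right; right; right; left; exact ec.symm
                · right; right; right; right; left; rfl
                · right; right; right; right; right; rfl
                · left; exact ac
                · right; left; exact M.al_al _
                · right; right; left; exact M.al_al _) (Or.inl rfl)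
            have o1 : ¬ M.out d1 := by rw [← f0, M.out_ph]; exact G.nout
            have o2 : ¬ M.out d2 := by rw [← f1, M.out_ph]; exact o1
            have oa : M.out (M.al d2) → M.out c := by rw [← ea]; exact fun k => (M.out_ph c).1 k
            have ob : M.out (M.al d1) → M.out c := by rw [← eb]; intro k; rw [← ebl]; exact (M.out_ph _).2 k
            obtain ⟨t, ht⟩ := M.out_ne
            rcases hall t with rfl | rfl | rfl | rfl | rfl | rfl
            · exact absurd ht G.nout
            · exact absurd ht o1
            · exact absurd ht o2
            · exact ht
            · exact ob ht
            · exact oa ht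
          have hd2' := nph d a2
          by_cases c1 : M.ph d = c
          · have e1 := g5 ⟨d, a0, ac'⟩ c1
            have c3 : M.ph (M0.ph ⟨d, a0, ac'⟩).1 = M.ph af := by rw [e1]
            have aft : af ≠ d2 := fun k => hwu (by rw [hw, ← k, B.vaf])
            have c4 : M.ph af ≠ c := by
              intro k0
              have e2 := g5 (M0.ph ⟨d, a0, ac'⟩) (by rw [c3]; exact k0)
              apply hpp
              rw [c1]; exact (hblep af k0).trans (hblep d c1).symm
            have e2 := g6 (M0.ph ⟨d, a0, ac'⟩) (by rw [c3]; exact nph _ aft) (by rw [c3]; exact c4)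
            rw [k', c3] at e2
            have := tri d e2.symm c1
            apply ho; rw [← M.out_ph, c1]; exact this
          · have e1 := g6 ⟨d, a0, ac'⟩ hd2' c1
            have c3 : M.ph (M0.ph ⟨d, a0, ac'⟩).1 = M.ph (M.ph d) := by rw [e1]
            have c5 : M.ph d ≠ d2 := fun k => a1 (M.ph.injective (k.trans f1.symm))
            by_cases c4 : M.ph (M.ph d) = c
            · have e2 := g5 (M0.ph ⟨d, a0, ac'⟩) (by rw [c3]; exact c4)
              rw [k'] at e2
              have e2' : d = af := e2
              have := tri (M.ph d) (by rw [e2']) c4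
              apply ho; rw [e2']; exact (M.out_ph c).2 this
            · have e2 := g6 (M0.ph ⟨d, a0, ac'⟩) (by rw [c3]; exact nph _ c5) (by rw [c3]; exact c4)
              rw [k', c3] at e2
              exact hpp e2.symm
        have hc3 := W.cnt ⟨d, a0, ac'⟩ (by rw [g3]; exact ho) hdd
        have hep_c : Cyc M.ph d c ↔ Cyc M.ph d ep := by
          have : Cyc M.ph ep c := by have := (Cyc.refl M.ph ep).step; rw [ebl] at this; exact this
          exact ⟨fun k => k.trans this.symm, fun k => k.trans this⟩
        by_cases sc : M.small p c
        · have sep : ¬ M.small p ep := fun k => k4 ⟨k, sc⟩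
          refine cnt_via Subtype.val Subtype.val_injective (Equiv.swap ep c) d _ hc3 ?_
          intro e
          constructor
          · rintro ⟨e1, e2⟩
            by_cases q1 : e = c
            · exact ⟨⟨ep, epn⟩, ⟨(hcyc _ _).2 (hep_c.1 (q1 ▸ e1)), sm2.2 (Or.inr sc)⟩, by rw [q1]; exact Equiv.swap_apply_left _ _⟩
            · obtain ⟨o0, o1, o2⟩ := orb d a0 a1 a2 e e1
              have q2 : e ≠ ep := by rintro rfl; exact sep e2
              exact ⟨⟨e, o0, q1⟩, ⟨(hcyc _ _).2 e1, (sm1 e _ o1 o2 q2).1 e2⟩, Equiv.swap_apply_of_ne_of_ne q2 q1⟩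
          · rintro ⟨e0, ⟨e1, e2⟩, rfl⟩
            rw [hcyc] at e1
            by_cases q1 : e0.1 = ep
            · rw [q1, Equiv.swap_apply_left]
              exact ⟨hep_c.2 (q1 ▸ e1), sc⟩
            · rw [Equiv.swap_apply_of_ne_of_ne q1 e0.2.2]
              obtain ⟨o0, o1, o2⟩ := orb d a0 a1 a2 _ e1
              exact ⟨e1, (sm1 e0.1 e0.2 o1 o2 q1).2 e2⟩
        · refine cnt_via Subtype.val Subtype.val_injective (Equiv.refl D) d _ hc3 ?_
          have sm3 : ∀ e (he : e ≠ d0 ∧ e ≠ c), e ≠ d1 → e ≠ d2 → (M.small p e ↔ M0.small p' ⟨e, he⟩) := by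
            intro e he o1 o2
            by_cases q1 : e = ep
            · subst q1; rw [sm2]; exact ⟨Or.inl, fun k => k.resolve_right sc⟩
            · exact sm1 e he o1 o2 q1
          intro e
          constructor
          · rintro ⟨e1, e2⟩
            obtain ⟨o0, o1, o2⟩ := orb d a0 a1 a2 e e1
            have q1 : e ≠ c := by rintro rfl; exact sc e2
            exact ⟨⟨e, o0, q1⟩, ⟨(hcyc _ _).2 e1, (sm3 e _ o1 o2).1 e2⟩, rfl⟩
          · rintro ⟨e0, ⟨e1, e2⟩, rfl⟩
            rw [hcyc] at e1
            obtain ⟨o0, o1, o2⟩ := orb d a0 a1 a2 _ e1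
            exact ⟨e1, (sm3 e0.1 e0.2 o1 o2).2 e2⟩
      intro d a0 a1 a2 ho hpp
      by_cases ac' : d = c
      · have hca : ∀ e, Cyc M.ph d e ↔ Cyc M.ph af e := by
          intro e
          have : Cyc M.ph d af := by rw [haf, ← ac']; exact (Cyc.refl M.ph d).step
          exact ⟨fun k => this.symm.trans k, fun k => this.trans k⟩
        have := main af (B.af0 P) (fun k => h (by rw [← vv, ← k, B.vaf])) (fun k => hwu (by rw [hw, ← k, B.vaf])) hp4
          (by rw [haf, M.out_ph, ← ac']; exact ho)
          (fun k => hpp (by rw [ac']; apply M.ph.injective; exact k))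
        simp only [hca]; exact this
      · exact main d a0 a1 a2 ac' ho hpp
    · intro d a0 a1 a2 ho
      have hcep : M.out c ↔ M.out ep := by rw [← ebl, M.out_ph]
      have hboth : M.out ep → ¬ (M.small p ep ∨ M.small p c) := by
        intro k; rw [← sm2]; exact W.outs _ ((g3 _).2 k)
      by_cases q1 : d = c
      · subst q1; exact fun k => hboth (hcep.1 ho) (Or.inr k)
      by_cases q2 : d = ep
      · subst q2; exact fun k => hboth ho (Or.inl k)
      rw [sm1 d ⟨a0, q1⟩ a1 a2 q2]
      exact W.outs _ ((g3 _).2 ho)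
  · -- Case 2
    rw [← ec] at fx fz nox
    have eafx : af = x := fx
    have vy : M.vt y = M.hd x := by rw [← fy, M.vt_ph']
    have ebly : M.al bl = y := (hblep y fz).symm
    have ebl' : bl = M.al y := by rw [← ebly, M.al_al]
    have hbz : M.hd bl = M.vt y := by rw [ebl', M.hd_al]
    have haz : M.hd af = M.vt y := by rw [eafx, vy]
    have haf2 : af ≠ M.al d2 := fun k => nyw (by rw [← haz, k, M.hd_al])
    have ea0 : Lb.a0 M θ d2 af = θ (M.vt y) := by unfold Lb.a0; rw [if_neg haf2, haz]
    have z1 : M.vt y ≠ u := by rw [← haz]; exact B.nu B.vaf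
    have z2 : M.vt y ≠ v := by rw [← hbz]; exact B.nv B.vbl
    have zpos := B.pos P' z1 z2 nyw
    have zlt := (rng (M.vt y)).2
    obtain ⟨τ, p, t1, t2, P⟩ := mk (max 0 (θ (M.vt y) - Real.pi)) (min (θ (M.vt y)) Real.pi) (le_max_left _ _)
      (max_lt (lt_min zpos hpi) (lt_min (by linarith) (by linarith))) (min_le_right _ _)
    have t3 := (le_max_right _ _).trans_lt t1
    have t4 := t2.trans_le (min_le_left _ _)
    have huvz : 0 < oo p u v (M.vt y) := (P.su _ z1 z2).1.2 (Or.inl ⟨by linarith, by linarith⟩)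
    have vx : M.vt x = u := by rw [← eafx, B.vaf]
    have hdy : M.hd y = v := by rw [← M.vt_ph', fz, B.vc]
    have hsx : M.sg (M.al x) = y := by unfold sg; rw [M.al_al, fy]
    have hK : ∀ e f, M.vt e = u → M.vt f = v → M.hd e = M.hd f → ∃ a, (a = M.al d1 ∨ a = M.al x) ∧ M.vt a = M.hd e ∧
      ((M.hd a = u ∧ M.hd (M.sg a) = v) ∨ (M.hd a = v ∧ M.hd (M.sg a) = u)) ∧ 0 < oo p (M.vt a) (M.hd a) (M.hd (M.sg a)) := by
      intro e f a1 a2 a3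
      rcases hcs e f (a1.trans hu.symm) (a2.trans vv.symm) a3 with k | k
      · refine ⟨M.al d1, Or.inl rfl, ?_⟩
        have k' : M.hd e = w := k
        rw [k']; exact Kw P
      · refine ⟨M.al x, Or.inr rfl, ?_⟩
        have k' : M.hd e = M.vt y := k
        rw [k', hsx, M.vt_al, M.hd_al, hdy, vx, ← vy]
        refine ⟨rfl, Or.inl ⟨rfl, rfl⟩, ?_⟩
        rw [oo_rot]; exact huvz
    have s1 : M.small p c := by unfold small; rw [B.hc, B.vc, fx, ← vy]; exact huvz
    have s2 : M.small p x := by unfold small; rw [← vy, vx, fy, hdy, oo_rot]; exact huvz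
    have s3 : M.small p y := by unfold small; rw [hdy, fz, B.hc, oo_rot, oo_rot]; exact huvz
    have ncx : c ≠ x := fun k => h (by rw [← B.vc, k, vx])
    have ncy : c ≠ y := fun k => z2 (by rw [← k, B.vc])
    have nxy : x ≠ y := fun k => z1 (by rw [← k, vx])
    have orb2 : ∀ d, d ≠ c → d ≠ x → d ≠ y → ∀ e, Cyc M.ph d e → e ≠ c ∧ e ≠ x ∧ e ≠ y := by
      intro d a1 a2 a3 e hC
      refine hC (fun t => t ≠ c ∧ t ≠ x ∧ t ≠ y) ?_ ⟨a1, a2, a3⟩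
      rintro t ⟨b1, b2, b3⟩
      exact ⟨fun e => b3 (M.ph.injective (e.trans fz.symm)), fun e => b1 (M.ph.injective (e.trans fx.symm)),
        fun e => b2 (M.ph.injective (e.trans fy.symm))⟩
    have nphc : ∀ d, d ≠ y → M.ph d ≠ c := fun d hd e => hd (M.ph.injective (e.trans fz.symm))
    have sm1 : ∀ e (he : e ≠ d0 ∧ e ≠ c), e ≠ d1 → e ≠ d2 → e ≠ x → e ≠ y → (M.small p e ↔ M0.small p' ⟨e, he⟩) := by
      intro e he a1 a2 a3 a4
      rw [small0, g6 _ (nph e a2) (nphc e a4)]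
      exact B.smalliff P hK he.1 he.2 (nph e a2) (nphc e a4) a1 (fun k => a3 (M.al.injective k))
    refine ⟨p, fin (M.al x) P ⟨by rw [ea0]; exact t4, by rw [hbz]; linarith, by rw [ea0, hbz]⟩ hK ?_ ?_⟩
    · intro d a0 a1 a2 ho hpp
      by_cases c1 : d = c ∨ d = x ∨ d = y
      · exact card_tri ⟨fx, fy, fz⟩ ncx ncy nxy s1 s2 s3 c1
      · rw [not_or, not_or] at c1
        obtain ⟨b1, b2, b3⟩ := c1
        have c5 : M.ph d ≠ d2 := fun k => a1 (M.ph.injective (k.trans f1.symm))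
        have c6 : M.ph d ≠ y := fun k => b2 (M.ph.injective (k.trans fy.symm))
        have e1 := g6 ⟨d, a0, b1⟩ (nph d a2) (nphc d b3)
        have hdd : M0.ph (M0.ph ⟨d, a0, b1⟩) ≠ ⟨d, a0, b1⟩ := by
          intro k
          have k' : (M0.ph (M0.ph ⟨d, a0, b1⟩)).1 = d := by rw [k]
          rw [g6 _ (by rw [e1]; exact nph _ c5) (by rw [e1]; exact nphc _ c6), e1] at k'
          exact hpp k'
        have hc3 := W.cnt ⟨d, a0, b1⟩ (by rw [g3]; exact ho) hdd
        refine cnt_via Subtype.val Subtype.val_injective (Equiv.refl D) d _ hc3 ?_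
        intro e
        constructor
        · rintro ⟨e1, e2⟩
          obtain ⟨o0, o1, o2⟩ := orb d a0 a1 a2 e e1
          obtain ⟨o3, o4, o5⟩ := orb2 d b1 b2 b3 e e1
          exact ⟨⟨e, o0, o3⟩, ⟨(hcyc _ _).2 e1, (sm1 e _ o1 o2 o4 o5).1 e2⟩, rfl⟩
        · rintro ⟨e0, ⟨e1, e2⟩, rfl⟩
          rw [hcyc] at e1
          obtain ⟨o0, o1, o2⟩ := orb d a0 a1 a2 _ e1
          obtain ⟨o3, o4, o5⟩ := orb2 d b1 b2 b3 _ e1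
          exact ⟨e1, (sm1 e0.1 e0.2 o1 o2 o4 o5).2 e2⟩
    · intro d a0 a1 a2 ho
      have q1 : d ≠ c := by rintro rfl; exact nox ho
      have ox : ¬ M.out x := by rw [← fx, M.out_ph]; exact nox
      have q2 : d ≠ x := by rintro rfl; exact ox ho
      have q3 : d ≠ y := by rintro rfl; rw [← fy, M.out_ph] at ho; exact ox ho
      rw [sm1 d ⟨a0, q1⟩ a1 a2 q2 q3]
      exact W.outs _ ((g3 _).2 ho)

end PM


namespace PM
variable {V D : Type} [Fintype D]

lemma opR' (M : PM V D) {x y : D}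
    (hxy : M.ph x = y) (hyx : M.ph y = x) (hne : M.vt x ≠ M.vt y)
    (hd' : M.al x ≠ y) (hno : ¬ M.out x) [Fintype {d // d ≠ x ∧ d ≠ y}] :
    ∃ M1 : PM V {d // d ≠ x ∧ d ≠ y},
      (∀ d, d.1 ≠ M.al x → d.1 ≠ M.al y → (M1.al d).1 = M.al d.1) ∧
      (∀ d, M1.vt d = M.vt d.1) ∧ (∀ d, M1.hd d = M.hd d.1) ∧
      (∀ d, ∃ d', M1.vt d' = M.vt d ∧ M1.hd d' = M.hd d) ∧
      (∀ d, M1.out d ↔ M.out d.1) ∧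
      (∀ d, (M1.ph d).1 = M.ph d.1) ∧ ∀ p, M1.WReal p → M.WReal p := by
  obtain ⟨M1, g1, g2, g3, gv, go, gp⟩ := M.opR rfl rfl hxy hyx hne hd' hno
  have vy : M.vt y = M.vt (M.al x) := by rw [← hxy, M.vt_ph]
  have vx : M.vt x = M.vt (M.al y) := by rw [← hyx, M.vt_ph]
  have n2 : M.al x ≠ x := fun e => hne (by rw [vy, e])
  have n3 : M.al y ≠ y := fun e => hne (by rw [vx, e])
  have n4 : M.al y ≠ x := fun e => hd' (by rw [← e, M.al_al])
  have hhd : ∀ d, M1.hd d = M.hd d.1 := by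
    intro d
    unfold hd
    rw [gv]
    by_cases b1 : d.1 = M.al x
    · rw [g1 d b1, b1, M.al_al, vx]
    by_cases b2 : d.1 = M.al y
    · rw [g2 d b2, b2, M.al_al, vy]
    rw [g3 d b1 b2]
  refine ⟨M1, g3, gv, hhd, ?_, go, gp, fun p h => h.addDigon rfl rfl hxy hyx hne hd' hno g1 g2 g3 gv go gp⟩
  intro d
  by_cases b1 : d = x
  · exact ⟨⟨M.al y, n4, n3⟩, by rw [gv, b1, vx], by rw [hhd, b1, M.hd_al, vy]; rfl⟩
  by_cases b2 : d = y
  · exact ⟨⟨M.al x, n2, hd'⟩, by rw [gv, b2, vy], by rw [hhd, b2, M.hd_al, vx]; rfl⟩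
  exact ⟨⟨d, b1, b2⟩, gv _, hhd _⟩

/-- the contracted map is simple and contains the contracted Laman set -/
lemma simple_contr [Fintype V] {M : PM V D} (hs : M.Simple) {L : Finset (Sym2 V)} (hL : L ⊆ M.edges)
    {d0 : D} {u v : V} (hu : M.vt d0 = u) (hv : M.hd d0 = v) (h : v ≠ u) {D' : Type} [Fintype D']
    (N : PM {x : V // x ≠ u} D') (val : D' → D) (hval : Function.Injective val)
    (nv : ∀ d, N.vt d = cmap h (M.vt (val d))) (nh : ∀ d, N.hd d = cmap h (M.hd (val d)))
    (n0 : ∀ d, val d ≠ d0 ∧ val d ≠ M.al d0)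
    (rep : ∀ d, d ≠ d0 → d ≠ M.al d0 → ∃ d', N.vt d' = cmap h (M.vt d) ∧ N.hd d' = cmap h (M.hd d))
    (com : ∀ e f, M.vt e = u → M.vt f = v → M.hd e = M.hd f →
      (∀ d, val d ≠ M.al e) ∧ (∀ d, val d ≠ f) ∨ (∀ d, val d ≠ e) ∧ (∀ d, val d ≠ M.al f)) (w : V) :
    N.Simple ∧ cedges h w L ⊆ N.edges := by
  classical
  have nl : ∀ d, M.vt d ≠ M.hd d := hs.noloop
  have e0 : ∀ d, M.vt d = u → M.hd d = v → d = d0 := fun d a b =>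
    hs.simple _ _ (a.trans hu.symm) (b.trans hv.symm)
  have e1 : ∀ d, M.vt d = v → M.hd d = u → d = M.al d0 := fun d a b =>
    hs.simple _ _ (a.trans hv.symm) (by rw [M.al_al]; exact b.trans hu.symm)
  refine ⟨⟨?_, ?_⟩, ?_⟩
  · intro d e k1 k2
    change N.hd d = N.hd e at k2
    rw [nv, nv] at k1; rw [nh, nh] at k2
    have key : ∀ d e, M.vt (val d) = u → M.vt (val e) = v → cmap h (M.hd (val d)) = cmap h (M.hd (val e)) → False := by
      intro d e a b k2
      rcases cmap_eq h k2 with j | ⟨j, j'⟩ | ⟨j, j'⟩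
      · rcases com _ _ a b j with q | q
        · exact q.2 e rfl
        · exact q.1 d rfl
      · exact nl _ (a.trans j.symm)
      · exact (n0 d).1 (e0 _ a j)
    have key2 : ∀ d e, M.hd (val d) = u → M.hd (val e) = v → M.vt (val d) = M.vt (val e) → False := by
      intro d e a b k2
      rcases com (M.al (val d)) (M.al (val e)) a b (by rw [M.hd_al, M.hd_al, k2]) with q | q
      · exact q.1 d (M.al_al _).symm
      · exact q.2 e (M.al_al _).symm
    rcases cmap_eq h k1 with j | ⟨j, j'⟩ | ⟨j, j'⟩
    · rcases cmap_eq h k2 with i | ⟨i, i'⟩ | ⟨i, i'⟩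
      · exact hval (hs.simple _ _ j i)
      · exact (key2 d e i i' j).elim
      · exact (key2 e d i' i j.symm).elim
    · exact (key d e j j' k2).elim
    · exact (key e d j' j k2.symm).elim
  · intro d k
    change N.vt d = N.hd d at k
    rw [nv, nh] at k
    rcases cmap_eq h k with j | ⟨j, j'⟩ | ⟨j, j'⟩
    · exact nl _ j
    · exact (n0 d).1 (e0 _ j j')
    · exact (n0 d).2 (e1 _ j j')
  · intro e he
    unfold cedges at he
    obtain ⟨f, hf, rfl⟩ := Finset.mem_image.1 he
    rw [Finset.mem_sdiff] at hf
    obtain ⟨d, rfl⟩ := M.mem_edges.1 (hL hf.1)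
    have a0 : d ≠ d0 := by
      rintro rfl
      apply hf.2; unfold edge; rw [hu]; change s(u, M.hd d) ∈ _; rw [hv]; simp
    have a1 : d ≠ M.al d0 := by
      rintro rfl
      apply hf.2; rw [edge_al]; unfold edge; rw [hu]; change s(u, M.hd d0) ∈ _; rw [hv]; simp
    obtain ⟨d', k1, k2⟩ := rep d a0 a1
    rw [N.mem_edges]
    refine ⟨d', ?_⟩
    unfold edge
    change s(N.vt d', N.hd d') = Sym2.map (cmap h) s(M.vt d, M.hd d)
    rw [Sym2.map_mk, k1, k2]

theorem realize (n : ℕ) : ∀ {V D : Type} [Fintype V] [Fintype D] (M : PM V D), M.Simple → ∀ L : Finset (Sym2 V),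
    L ⊆ M.edges → LamanSet L → Fintype.card V = n → ∃ p, M.WReal p := by
  induction n with
  | zero =>
    intro V D _ _ M hs L hL hLam hn
    have := hLam.2; omega
  | succ n ih =>
    intro V D _ _ M hs L hL hLam hn
    classical
    have hn2 := hLam.2
    by_cases h3 : 3 ≤ Fintype.card V
    swap
    · have hn' : Fintype.card V = 2 := by omega
      have two : ∀ x y z : V, x ≠ y → x ≠ z → y ≠ z → False := by
        intro x y z h1 h2 h3
        have := Finset.card_le_univ ({x, y, z} : Finset V)
        rw [Finset.card_eq_three.2 ⟨x, y, z, h1, h2, h3, rfl⟩] at this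
        omega
      have hda : ∀ d, M.ph d = M.al d := by
        intro d
        refine hs.simple _ _ (M.vt_ph d) ?_
        by_contra hne
        rw [M.al_al] at hne
        have := hs.noloop (M.ph d)
        rw [M.vt_ph] at this
        exact two _ _ _ (hs.noloop d) (Ne.symm hne) this
      obtain ⟨a, b, hab, -⟩ := Finset.card_eq_two.1 ((Finset.card_univ (α := V)).trans hn')
      refine ⟨fun x => if x = a then (0, 0) else (1, 0), ?_, ?_, ?_, ?_, ?_, ?_⟩
      · intro x y hxy
        by_contra hne
        by_cases h1 : x = a <;> by_cases h2 : y = a <;> simp [h1, h2] at hxy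
        · exact hne (h1.trans h2.symm)
        · exact two x y a hne h1 h2
      · intro x y z h1 h2 h3; exact (two x y z h1 h2 h3).elim
      · intro d e h1 h2 h3 h4
        exact (two _ _ _ (hs.noloop d) h1 h3).elim
      · intro d e h1 h2 h3 h4
        exact (h4 (by unfold sg; rw [hda, M.al_al])).elim
      · intro d _ h; exact absurd (by rw [hda, hda, M.al_al]) h
      · intro d _ h
        unfold small at h
        rw [hda, M.hd_al] at h
        have z : ∀ (q : V → ℝ × ℝ) x y, oo q x y y = 0 := by intro q x y; unfold oo; ring
        rw [z] at h; exact lt_irrefl _ h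
    · obtain ⟨L, hL, hLam, d0, d1, d2, G⟩ := exists_good hs hL hLam h3
      obtain ⟨f0, f1, f2⟩ := G.fac
      obtain ⟨t0, t1, t2⟩ := G.tri
      obtain ⟨m1, m2, m3⟩ := G.tri.ne hs
      have h : M.vt d1 ≠ M.vt d0 := m1.symm
      have hca : M.al d0 ≠ d2 := fun e => m2 (by rw [← t0, e])
      have o1 : ¬ M.out d1 := by rw [← f0, M.out_ph]; exact G.nout
      have c1 : d1 ≠ M.al d0 := by
        rintro rfl; apply m3; rw [← t1, M.al_al]
      obtain ⟨M0, g1, g2, g3, g4, g5, g6⟩ := M.op0 (c := M.al d0) rfl rfl t0 h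
        (by rw [f0]; exact c1) (fun e => hca (M.ph.injective (e.trans f2.symm))) G.nout
      suffices hh : ∃ p, M0.WReal p by
        obtain ⟨p', W⟩ := hh
        exact lift hs G rfl rfl t0 h g1 g2 g3 g4 g5 g6 W
      have gh : ∀ d, M0.hd d = cmap h (M.hd d.1) := by
        intro e; unfold hd; rw [g2, g1]
      have hcard : Fintype.card {x : V // x ≠ M.vt d0} = n := by
        rw [Fintype.card_subtype_compl, Fintype.card_subtype_eq]; omega
      have hLam' := laman_contract hLam h G.contr
      have k1 : d1 ≠ d0 ∧ d1 ≠ M.al d0 := ⟨fun e => m1 (by rw [e]), c1⟩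
      have k2 : d2 ≠ d0 ∧ d2 ≠ M.al d0 := ⟨fun e => m3 (by rw [e]), hca.symm⟩
      have q1 : M0.ph ⟨d1, k1⟩ = ⟨d2, k2⟩ := Subtype.ext (by
        rw [g6 _ (by rw [f1]; exact k2.1) (by rw [f1]; exact k2.2), f1])
      have q2 : M0.ph ⟨d2, k2⟩ = ⟨d1, k1⟩ := Subtype.ext (by rw [g4 _ f2, f0])
      have cne : ∀ {x y}, x ≠ M.vt d0 → y ≠ M.vt d0 → x ≠ y → cmap h x ≠ cmap h y := by
        intro x y a b hxy e
        rw [cmap_ne h a, cmap_ne h b] at e; exact hxy (Subtype.ext_iff.1 e)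
      obtain ⟨M1, r1, r2, r3, r4, r5, r6, r7⟩ := M0.opR' q1 q2 (by rw [g2, g2]; exact cne h m3 m2)
        (fun e => by
          have e' : M.al d1 = d2 := by rw [← g1 ⟨d1, k1⟩, e]
          apply h; rw [← t2, ← e', M.al_al]) (by rw [g3]; exact o1)
      have ud : ∀ e, M.vt e = M.vt d0 → M.hd e = M.vt d2 → e = M.al d2 := fun e a b =>
        hs.simple _ _ (a.trans t2.symm) (by rw [M.al_al]; exact b)
      have vd : ∀ e, M.vt e = M.vt d1 → M.hd e = M.vt d2 → e = d1 := fun e a b =>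
        hs.simple _ _ a (b.trans t1.symm)
      have rep0 : ∀ d, d ≠ d0 → d ≠ M.al d0 → ∃ d', M0.vt d' = cmap h (M.vt d) ∧ M0.hd d' = cmap h (M.hd d) :=
        fun d a b => ⟨⟨d, a, b⟩, g2 _, gh _⟩
      have rep1 : ∀ d, d ≠ d0 → d ≠ M.al d0 → ∃ d', M1.vt d' = cmap h (M.vt d) ∧ M1.hd d' = cmap h (M.hd d) := by
        intro d a b
        obtain ⟨d', a1, a2⟩ := rep0 d a b
        obtain ⟨d'', b1, b2⟩ := r4 d'
        exact ⟨d'', b1.trans a1, b2.trans a2⟩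
      have vne1 : ∀ d : {d : {d // d ≠ d0 ∧ d ≠ M.al d0} // d ≠ ⟨d1, k1⟩ ∧ d ≠ ⟨d2, k2⟩}, d.1.1 ≠ d1 ∧ d.1.1 ≠ d2 := fun d =>
        ⟨fun e => d.2.1 (Subtype.ext e), fun e => d.2.2 (Subtype.ext e)⟩
      rcases G.cases with hcs | ⟨x, y, ⟨fx, fy, fz⟩, ⟨tx, ty, tz⟩, nox, nyw, hcs⟩
      · obtain ⟨S, C⟩ := simple_contr hs hL rfl t0 h M1 (fun d => d.1.1)
          (fun a b e => Subtype.ext (Subtype.ext e)) (fun d => by rw [r2, g2]) (fun d => by rw [r3, gh])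
          (fun d => d.1.2) rep1 (by
            intro e f a b k
            have i := hcs e f a b k
            left
            constructor
            · intro d; rw [ud e a i, M.al_al]; exact (vne1 d).2
            · intro d; rw [vd f b (k.symm.trans i)]; exact (vne1 d).1) (M.vt d2)
        obtain ⟨p, hp⟩ := ih M1 S _ C hLam' hcard
        exact ⟨p, r7 p hp⟩
      · rw [M.al_al] at tx
        -- x : u → t, y : t → v
        have xy : M.hd x = M.vt y := ty
        have yv : M.hd y = M.vt d1 := tz.trans t0
        have nty : M.vt y ≠ M.vt d0 := by rw [tx, ← xy]; exact (hs.noloop x).symm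
        have ntv : M.vt y ≠ M.vt d1 := by rw [← yv]; exact hs.noloop y
        have kx : x ≠ d0 ∧ x ≠ M.al d0 := ⟨fun e => ntv (by rw [← xy, e]; exact t0), fun e => h (by rw [← t0, ← e, tx])⟩
        have ky : y ≠ d0 ∧ y ≠ M.al d0 := ⟨fun e => nty (by rw [e]), fun e => ntv (by rw [← t0, e])⟩
        have x1 : x ≠ d1 := fun e => h (by rw [← e, tx])
        have x2 : x ≠ d2 := fun e => m3 (by rw [← e, tx])
        have y1 : y ≠ d1 := fun e => ntv (by rw [e])
        have y2 : y ≠ d2 := fun e => nyw (by rw [e])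
        let X : {d : {d // d ≠ d0 ∧ d ≠ M.al d0} // d ≠ ⟨d1, k1⟩ ∧ d ≠ ⟨d2, k2⟩} :=
          ⟨⟨x, kx⟩, fun e => x1 (Subtype.ext_iff.1 e), fun e => x2 (Subtype.ext_iff.1 e)⟩
        let Y : {d : {d // d ≠ d0 ∧ d ≠ M.al d0} // d ≠ ⟨d1, k1⟩ ∧ d ≠ ⟨d2, k2⟩} :=
          ⟨⟨y, ky⟩, fun e => y1 (Subtype.ext_iff.1 e), fun e => y2 (Subtype.ext_iff.1 e)⟩
        have s1 : M1.ph X = Y := Subtype.ext (Subtype.ext (by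
          rw [r6 X, g6 _ (by rw [fy]; exact ky.1) (by rw [fy]; exact ky.2), fy]))
        have s2 : M1.ph Y = X := Subtype.ext (Subtype.ext (by
          rw [r6 Y, g5 _ fz, fx]))
        have s3 : M1.vt X ≠ M1.vt Y := by
          rw [r2, r2, g2, g2]
          show cmap h (M.vt x) ≠ cmap h (M.vt y)
          rw [← tx, cmap_u]; intro e
          rw [cmap_ne h nty] at e; exact ntv (Subtype.ext_iff.1 e).symm
        have xa1 : x ≠ M.al d1 := fun e => h (by
          have : M.hd x = M.vt d1 := by rw [e, M.hd_al]
          exact (ntv (xy.symm.trans this)).elim)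
        have xa2 : x ≠ M.al d2 := fun e => nyw (by rw [← xy, e, M.hd_al])
        have s4 : M1.al X ≠ Y := by
          intro e
          have e1 := r1 X (fun k => xa1 (by rw [← g1 ⟨d1, k1⟩, ← k])) (fun k => xa2 (by rw [← g1 ⟨d2, k2⟩, ← k]))
          have e2 : M.al x = y := by
            have := congrArg Subtype.val e1
            rw [g1, e] at this; exact this.symm
          apply h; rw [← yv, ← e2, M.hd_al, tx]
        have ox : ¬ M.out x := by rw [← fx, M.out_ph]; exact nox
        obtain ⟨M2, z1, z2, z3, z4, z5, z6, z7⟩ := M1.opR' s1 s2 s3 s4 (by rw [r5, g3]; exact ox)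
        obtain ⟨S, C⟩ := simple_contr hs hL rfl t0 h M2 (fun d => d.1.1.1)
          (fun a b e => Subtype.ext (Subtype.ext (Subtype.ext e))) (fun d => by rw [z2, r2, g2]) (fun d => by rw [z3, r3, gh])
          (fun d => d.1.1.2) (by
            intro d a b
            obtain ⟨d', a1, a2⟩ := rep1 d a b
            obtain ⟨d'', b1, b2⟩ := z4 d'
            exact ⟨d'', b1.trans a1, b2.trans a2⟩) (by
            intro e f a b k
            rcases hcs e f a b k with i | i
            · left
              constructor
              · intro d; rw [ud e a i, M.al_al]; exact (vne1 d.1).2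
              · intro d; rw [vd f b (k.symm.trans i)]; exact (vne1 d.1).1
            · right
              have ex : e = x := hs.simple _ _ (a.trans tx) (i.trans xy.symm)
              have fy' : f = M.al y := hs.simple _ _ (b.trans yv.symm) (by rw [M.al_al]; exact k.symm.trans i)
              constructor
              · intro d j; exact d.2.1 (Subtype.ext (Subtype.ext (j.trans ex)))
              · intro d j; exact d.2.2 (Subtype.ext (Subtype.ext (j.trans (by rw [fy', M.al_al]))))) (M.vt d2)
        obtain ⟨p, hp⟩ := ih M2 S _ C hLam' hcard
        exact ⟨p, r7 p (z7 p hp)⟩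

end PM


namespace PlaneEmb
variable {V : Type} {G : SimpleGraph V} (E : PlaneEmb G)

/-- the face permutation -/
abbrev phi : Equiv.Perm G.Dart := E.rot * dartSymmPerm G

lemma phi_apply (d : G.Dart) : E.phi d = E.rot d.symm := rfl

lemma dartFace_eq {d e : G.Dart} : E.dartFace d = E.dartFace e ↔ E.phi.SameCycle d e :=
  ⟨fun h => Quotient.exact h, fun h => Quotient.sound h⟩

lemma dartFace_phi (d : G.Dart) : E.dartFace (E.phi d) = E.dartFace d :=
  E.dartFace_eq.2 ⟨-1, by simp⟩

lemma conn_ind (hG : G.Connected) (P : V → Prop) {u : V} (hu : P u) (h : ∀ a b, G.Adj a b → P a → P b) : ∀ v, P v := by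
  intro v
  obtain ⟨w⟩ := hG.preconnected u v
  induction w with
  | nil => exact hu
  | cons hab _ ih => exact ih (h _ _ hab hu)

lemma rot_closed (P : G.Dart → Prop) (h : ∀ x, P x → P (E.rot x)) {d e : G.Dart} (hde : d.fst = e.fst) (hd : P d) : P e := by
  obtain ⟨n, rfl⟩ := E.rot_vertex d e hde
  clear hde
  induction n with
  | zero => exact hd
  | succ n ih => rw [pow_succ']; exact h _ ih

lemma all_dart (P : G.Dart → Prop) (h1 : ∀ x, P x → P (E.rot x)) (h2 : ∀ x, P x → P x.symm)
    {d : G.Dart} (hd : P d) : ∀ e, P e := by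
  have key := conn_ind E.connected (fun v => ∀ e : G.Dart, e.fst = v → P e) (u := d.fst)
    (fun e he => E.rot_closed P h1 he.symm hd)
    (fun a b hab ha e he => E.rot_closed P h1 (d := (⟨(a, b), hab⟩ : G.Dart).symm) he.symm (h2 _ (ha _ rfl)))
  exact fun e => key _ e rfl

include E in
lemma has_dart (v : V) : ∃ d : G.Dart, d.fst = v := by
  obtain ⟨d0, -⟩ := Quotient.exists_rep E.outer
  exact conn_ind E.connected (fun v => ∃ d : G.Dart, d.fst = v) (u := d0.fst) ⟨d0, rfl⟩
    (fun a b hab _ => ⟨⟨(b, a), hab.symm⟩, rfl⟩) v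

variable [Fintype V] [DecidableEq V] [DecidableRel G.Adj]

noncomputable instance : Fintype E.Face := Fintype.ofFinite _

/-- face coboundary -/
noncomputable def delta : (E.Face → ℝ) →ₗ[ℝ] (G.Dart → ℝ) where
  toFun g d := g (E.dartFace d) - g (E.dartFace d.symm)
  map_add' g h := by ext d; simp only [Pi.add_apply]; ring
  map_smul' c g := by ext d; simp only [Pi.smul_apply, smul_eq_mul, RingHom.id_apply]; ring

/-- vertex boundary -/
noncomputable def bdry (G : SimpleGraph V) [DecidableRel G.Adj] : (G.Dart → ℝ) →ₗ[ℝ] (V → ℝ) where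
  toFun a v := ∑ d, if d.fst = v then a d else 0
  map_add' a b := by ext v; simp only [Pi.add_apply, ← Finset.sum_add_distrib]; congr! 1; split_ifs <;> simp
  map_smul' c a := by
    ext v; simp only [Pi.smul_apply, smul_eq_mul, RingHom.id_apply, Finset.mul_sum]; congr! 1; split_ifs <;> simp

/-- antisymmetric functions -/
def asym (G : SimpleGraph V) : Submodule ℝ (G.Dart → ℝ) where
  carrier := {a | ∀ d, a d.symm = - a d}
  add_mem' ha hb d := by simp only [Pi.add_apply, ha d, hb d]; ring
  zero_mem' d := by simp
  smul_mem' c a ha d := by simp only [Pi.smul_apply, ha d, smul_eq_mul]; ring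

lemma asym_dim (G : SimpleGraph V) [DecidableRel G.Adj] : Module.finrank ℝ (asym G) ≤ Nat.card G.edgeSet := by
  classical
  have hc : ∀ e : G.edgeSet, ∃ d : G.Dart, d.edge = e.1 := by
    rintro ⟨e, he⟩
    induction e with | _ a b => exact ⟨⟨(a, b), he⟩, rfl⟩
  choose c hc using hc
  let f : asym G →ₗ[ℝ] (G.edgeSet → ℝ) := 
    { toFun := fun a e => a.1 (c e), map_add' := fun a b => rfl, map_smul' := fun a b => rfl }
  have hf : Function.Injective f := by
    rw [← LinearMap.ker_eq_bot, LinearMap.ker_eq_bot']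
    intro a ha
    ext d
    have h1 : a.1 (c ⟨d.edge, d.edge_mem⟩) = 0 := congrFun ha ⟨d.edge, d.edge_mem⟩
    have h2 := hc ⟨d.edge, d.edge_mem⟩
    rcases (SimpleGraph.dart_edge_eq_iff _ _).1 h2 with h | h
    · rw [h] at h1; exact h1
    · rw [h] at h1
      have := a.2 d
      rw [h1] at this
      show a.1 d = 0
      linarith
  have := LinearMap.finrank_le_finrank_of_injective hf
  rwa [Module.finrank_fintype_fun_eq_card, ← Nat.card_eq_fintype_card] at this

omit [Fintype V] [DecidableEq V] in
lemma fin1 {M : Type} [AddCommGroup M] [Module ℝ M] (x : M) : Module.finrank ℝ (Submodule.span ℝ {x}) ≤ 1 := by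
  have := finrank_span_le_card (R := ℝ) ({x} : Set M)
  simpa using this

lemma bdry_dim (hG : G.Connected) (v0 : V) : Fintype.card V ≤ Module.finrank ℝ ((asym G).map (bdry G)) + 1 := by
  classical
  set R := (asym G).map (bdry G)
  have key := conn_ind hG (fun v => (Pi.single v 1 : V → ℝ) ∈ R ⊔ Submodule.span ℝ {(Pi.single v0 1 : V → ℝ)}) (u := v0)
    (Submodule.mem_sup_right (Submodule.mem_span_singleton_self _)) (by
      intro a b hab ha
      have : (Pi.single b 1 - Pi.single a 1 : V → ℝ) ∈ R := by
        let d : G.Dart := ⟨(a, b), hab⟩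
        have hne : d ≠ d.symm := fun e => G.ne_of_adj hab (congrArg (fun d : G.Dart => d.fst) e)
        refine ⟨Pi.single d.symm 1 - Pi.single d 1, ?_, ?_⟩
        · intro e
          have i1 : e.symm = d ↔ e = d.symm := ⟨fun h => by rw [← h, SimpleGraph.Dart.symm_symm], fun h => by rw [h, SimpleGraph.Dart.symm_symm]⟩
          have i2 : e.symm = d.symm ↔ e = d := SimpleGraph.Dart.symm_involutive.injective.eq_iff
          simp only [Pi.sub_apply, Pi.single_apply, i1, i2]; ring
        · ext v
          show (∑ e : G.Dart, if e.fst = v then (Pi.single d.symm 1 - Pi.single d 1 : G.Dart → ℝ) e else 0) = _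
          have : ∀ e : G.Dart, (if e.fst = v then (Pi.single d.symm 1 - Pi.single d 1 : G.Dart → ℝ) e else 0)
            = (if e = d.symm then (if v = b then 1 else 0) else 0) - (if e = d then (if v = a then 1 else 0) else 0) := by
            intro e
            simp only [Pi.sub_apply, Pi.single_apply]
            by_cases h1 : e = d
            · have : e.fst = a := by rw [h1]
              rw [if_neg (fun k => hne (h1.symm.trans k)), if_neg (fun k => hne (h1.symm.trans k)), this, if_pos h1, if_pos h1]
              by_cases k : a = v
              · simp [k]
              · simp [k, Ne.symm k]
            by_cases h2 : e = d.symm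
            · have : e.fst = b := by rw [h2]; rfl
              rw [this, if_pos h2, if_pos h2, if_neg h1, if_neg h1]
              by_cases k : b = v
              · simp [k]
              · simp [k, Ne.symm k]
            simp [h1, h2]
          simp only [this]
          rw [Finset.sum_sub_distrib, Finset.sum_ite_eq' Finset.univ d.symm, Finset.sum_ite_eq' Finset.univ d]
          simp [Pi.single_apply]
      have h2 := Submodule.add_mem _ (Submodule.mem_sup_left (T := Submodule.span ℝ {(Pi.single v0 1 : V → ℝ)}) this) ha
      rwa [sub_add_cancel] at h2)
  have htop : R ⊔ Submodule.span ℝ {(Pi.single v0 1 : V → ℝ)} = ⊤ := by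
    rw [eq_top_iff]
    rintro f -
    rw [← Finset.univ_sum_single f]
    refine Submodule.sum_mem _ fun v _ => ?_
    have : (Pi.single v (f v) : V → ℝ) = f v • Pi.single v 1 := by rw [← Pi.single_smul, smul_eq_mul, mul_one]
    rw [this]; exact Submodule.smul_mem _ _ (key v)
  have h1 := Submodule.finrank_add_le_finrank_add_finrank R (Submodule.span ℝ {(Pi.single v0 1 : V → ℝ)})
  rw [htop, finrank_top, Module.finrank_fintype_fun_eq_card] at h1
  have h2 := fin1 (Pi.single v0 1 : V → ℝ)
  omega

theorem emb_exact {a : G.Dart → ℝ} (ha : ∀ d, a d.symm = - a d) (hv : ∀ v, (∑ d : G.Dart, if d.fst = v then a d else 0) = 0) :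
    ∃ g : E.Face → ℝ, ∀ d, a d = g (E.dartFace d) - g (E.dartFace d.symm) := by
  obtain ⟨d0, -⟩ := Quotient.exists_rep E.outer
  set Z := asym G ⊓ LinearMap.ker (bdry G)
  have hle : LinearMap.range E.delta ≤ Z := by
    rintro _ ⟨g, rfl⟩
    refine ⟨fun d => ?_, ?_⟩
    · show g (E.dartFace d.symm) - g (E.dartFace d.symm.symm) = - (g (E.dartFace d) - g (E.dartFace d.symm))
      rw [SimpleGraph.Dart.symm_symm]; ring
    · show bdry G _ = 0
      ext v
      show (∑ d : G.Dart, if d.fst = v then (g (E.dartFace d) - g (E.dartFace d.symm)) else 0) = 0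
      have e1 : ∀ d : G.Dart, E.dartFace d.symm = E.dartFace (E.rot d) := by
        intro d; rw [← E.dartFace_phi d.symm, phi_apply, SimpleGraph.Dart.symm_symm]
      have : ∀ d : G.Dart, (if d.fst = v then (g (E.dartFace d) - g (E.dartFace d.symm)) else 0) =
        (fun d : G.Dart => if d.fst = v then g (E.dartFace d) else 0) d - (fun d : G.Dart => if d.fst = v then g (E.dartFace d) else 0) (E.rot d) := by
        intro d
        simp only [E.rot_fst, e1]; split_ifs <;> simp
      rw [Finset.sum_congr rfl (fun d _ => this d), Finset.sum_sub_distrib, Equiv.sum_comp E.rot (fun d : G.Dart => if d.fst = v then g (E.dartFace d) else 0), sub_self]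
  have hker : Module.finrank ℝ (LinearMap.ker E.delta) ≤ 1 := by
    have : LinearMap.ker E.delta ≤ Submodule.span ℝ {(1 : E.Face → ℝ)} := by
      intro g hg
      rw [Submodule.mem_span_singleton]
      refine ⟨g (E.dartFace d0), ?_⟩
      have hg' : ∀ d, g (E.dartFace d) - g (E.dartFace d.symm) = 0 := fun d => congrFun hg d
      have := E.all_dart (fun d => g (E.dartFace d) = g (E.dartFace d0)) (fun x hx => by
        have := hg' x
        rw [← E.dartFace_phi x.symm, phi_apply, SimpleGraph.Dart.symm_symm] at this
        linarith) (fun x hx => by have := hg' x; linarith) (d := d0) rfl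
      ext F
      obtain ⟨d, rfl⟩ := Quotient.exists_rep F
      simp only [Pi.smul_apply, Pi.one_apply, smul_eq_mul, mul_one]
      exact (this d).symm
    exact (Submodule.finrank_mono this).trans (fin1 _)
  have h1 := LinearMap.finrank_range_add_finrank_ker E.delta
  rw [Module.finrank_fintype_fun_eq_card, ← Nat.card_eq_fintype_card] at h1
  have h2 := LinearMap.finrank_range_add_finrank_ker ((bdry G).domRestrict (asym G))
  have h3 : Module.finrank ℝ (LinearMap.ker ((bdry G).domRestrict (asym G))) = Module.finrank ℝ Z := by
    have : Z = (LinearMap.ker ((bdry G).domRestrict (asym G))).map (asym G).subtype := by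
      rw [LinearMap.ker_domRestrict, Submodule.map_comap_subtype]
    rw [this]
    exact (LinearEquiv.finrank_eq (Submodule.equivMapOfInjective _ (Submodule.subtype_injective _) _))
  rw [LinearMap.range_domRestrict, h3] at h2
  have h4 := asym_dim G
  have h5 := bdry_dim E.connected d0.fst
  have h6 := E.euler
  rw [Nat.card_eq_fintype_card (α := V)] at h6
  have h7 : LinearMap.range E.delta = Z := by
    apply Submodule.eq_of_le_of_finrank_le hle
    have : Nat.card E.Face = Nat.card (Quotient (faceSetoid (E.rot * dartSymmPerm G))) := rfl
    omega
  have h8 : a ∈ LinearMap.range E.delta := by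
    rw [h7]; exact ⟨ha, funext hv⟩
  obtain ⟨g, rfl⟩ := h8
  exact ⟨g, fun d => rfl⟩

/-- the plane map of an embedding -/
noncomputable def toPM : PM V G.Dart where
  al := dartSymmPerm G
  ph := E.phi
  vt d := d.fst
  out d := E.dartFace d = E.outer
  al_al d := SimpleGraph.Dart.symm_symm d
  vt_ph d := E.rot_fst _
  trans d e h P hP hd := E.rot_closed P (fun x hx => by
    have := hP x hx
    rwa [phi_apply, show (dartSymmPerm G x).symm = x from SimpleGraph.Dart.symm_symm x] at this) h hd
  conn P := by
    rintro ⟨v, hv⟩ h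
    exact conn_ind E.connected P hv (fun a b hab => h ⟨(a, b), hab⟩)
  surj := E.has_dart
  exact a ha hv := by
    obtain ⟨g, hg⟩ := E.emb_exact (a := a) ha (fun v => by
      refine Eq.trans (Finset.sum_congr rfl fun d _ => ?_) (hv v); congr!)
    exact ⟨fun d => g (E.dartFace d), fun d => congrArg g (E.dartFace_phi d), hg⟩
  out_ph d := by rw [E.dartFace_phi]
  out_cyc d e hd he P hP hPd := by
    obtain ⟨n, rfl⟩ := (E.dartFace_eq.1 (hd.trans he.symm)).exists_nat_pow_eq
    clear hd he
    induction n with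
    | zero => exact hPd
    | succ n ih => rw [pow_succ']; exact hP _ ih
  out_ne := Quotient.exists_rep E.outer

lemma toPM_simple : E.toPM.Simple :=
  ⟨fun d e h1 h2 => SimpleGraph.Dart.ext _ _ (Prod.ext h1 h2), fun d => d.adj.ne⟩

end PlaneEmb


/-- plane vectors as complex numbers -/
def toC (u : ℝ × ℝ) : ℂ := ⟨u.1, u.2⟩

lemma toC_ne {u : ℝ × ℝ} (h : u ≠ 0) : toC u ≠ 0 := by
  intro e
  apply h
  have e1 := congrArg Complex.re e
  have e2 := congrArg Complex.im e
  exact Prod.ext e1 e2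

def crs (u w : ℝ × ℝ) : ℝ := u.1 * w.2 - u.2 * w.1

lemma ccw_rng (u w : ℝ × ℝ) : 0 < ccwAngle u w ∧ ccwAngle u w ≤ 2 * Real.pi := by
  have hpi := Real.pi_pos
  unfold ccwAngle
  set z := (⟨w.1, w.2⟩ : ℂ) / ⟨u.1, u.2⟩
  have h1 := Complex.neg_pi_lt_arg z
  have h2 := Complex.arg_le_pi z
  split_ifs with h
  · exact ⟨h, by linarith⟩
  · exact ⟨by linarith, by linarith⟩

lemma ccw_exp {u w : ℝ × ℝ} (hu : u ≠ 0) :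
    toC w = toC u * (‖toC w / toC u‖ : ℝ) * Complex.exp ((ccwAngle u w : ℝ) * Complex.I) := by
  have h1 := toC_ne hu
  have h3 : Complex.exp ((ccwAngle u w : ℝ) * Complex.I) = Complex.exp ((Complex.arg (toC w / toC u) : ℝ) * Complex.I) := by
    unfold ccwAngle
    change Complex.exp (((if 0 < Complex.arg (toC w / toC u) then Complex.arg (toC w / toC u) else Complex.arg (toC w / toC u) + 2 * Real.pi : ℝ) : ℂ) * Complex.I) = _
    split_ifs with h
    · rfl
    · push_cast
      rw [add_mul, Complex.exp_add, Complex.exp_two_pi_mul_I, mul_one]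
  rw [h3, mul_assoc, Complex.norm_mul_exp_arg_mul_I]
  field_simp

/-- trigonometric description of the counterclockwise angle -/
lemma ccw_trig {u w : ℝ × ℝ} (hu : u ≠ 0) (hw : w ≠ 0) : ∃ r : ℝ, 0 < r ∧
    r * Real.cos (ccwAngle u w) = dot2 u w ∧ r * Real.sin (ccwAngle u w) = crs u w := by
  have h1 := toC_ne hu
  have h2 := toC_ne hw
  have h := ccw_exp (w := w) hu
  set s := ‖toC w / toC u‖ with hs
  have hs0 : 0 < s := norm_pos_iff.2 (div_ne_zero h2 h1)
  rw [Complex.exp_mul_I, ← Complex.ofReal_cos, ← Complex.ofReal_sin] at h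
  set c := Real.cos (ccwAngle u w)
  set t := Real.sin (ccwAngle u w)
  have hr := congrArg Complex.re h
  have hi := congrArg Complex.im h
  simp [toC] at hr hi
  have hn : 0 < u.1 ^ 2 + u.2 ^ 2 := by
    by_contra hc
    apply hu
    exact Prod.ext (by show u.1 = 0; nlinarith [sq_nonneg u.1, sq_nonneg u.2]) (by show u.2 = 0; nlinarith [sq_nonneg u.1, sq_nonneg u.2])
  refine ⟨s * (u.1 ^ 2 + u.2 ^ 2), by positivity, ?_, ?_⟩
  · unfold dot2; rw [hr, hi]; ring
  · unfold crs; rw [hr, hi]; ring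

lemma ccw_lt {u w : ℝ × ℝ} (hu : u ≠ 0) (hw : w ≠ 0) : ccwAngle u w < Real.pi ↔ 0 < crs u w := by
  obtain ⟨r, hr, -, hs⟩ := ccw_trig hu hw
  obtain ⟨h1, h2⟩ := ccw_rng u w
  have hpi := Real.pi_pos
  rw [← hs]
  constructor
  · intro h; exact mul_pos hr (Real.sin_pos_of_pos_of_lt_pi h1 h)
  · intro h
    by_contra hc
    have h3 : 0 < Real.sin (ccwAngle u w) := (pos_iff_pos_of_mul_pos h).1 hr
    have : Real.sin (ccwAngle u w) = Real.sin (ccwAngle u w - 2 * Real.pi) := (Real.sin_sub_two_pi _).symm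
    rw [this] at h3
    have := Real.sin_nonpos_of_nonpos_of_neg_pi_le (x := ccwAngle u w - 2 * Real.pi) (by linarith) (by linarith)
    linarith

lemma ccw_pi_lt {u w : ℝ × ℝ} (hu : u ≠ 0) (hw : w ≠ 0) (h : crs u w < 0) : Real.pi < ccwAngle u w ∧ ccwAngle u w < 2 * Real.pi := by
  obtain ⟨r, hr, -, hs⟩ := ccw_trig hu hw
  obtain ⟨h1, h2⟩ := ccw_rng u w
  rw [← hs] at h
  have h3 : Real.sin (ccwAngle u w) < 0 := by
    by_contra hc
    have := mul_nonneg hr.le (not_lt.1 hc)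
    linarith
  constructor
  · by_contra hc
    have := Real.sin_nonneg_of_nonneg_of_le_pi h1.le (not_lt.1 hc)
    linarith
  · refine lt_of_le_of_ne h2 fun e => ?_
    rw [e, Real.sin_two_pi] at h3; exact lt_irrefl _ h3

lemma ccw_self {u : ℝ × ℝ} (hu : u ≠ 0) : ccwAngle u u = 2 * Real.pi := by
  have h1 := toC_ne hu
  unfold ccwAngle
  change (if 0 < Complex.arg (toC u / toC u) then Complex.arg (toC u / toC u) else Complex.arg (toC u / toC u) + 2 * Real.pi) = _
  rw [div_self h1]; simp

lemma exp_eq_of_rng {x y : ℝ} (hx : 0 < x) (hx' : x ≤ 2 * Real.pi) (hy : 0 < y) (hy' : y ≤ 2 * Real.pi)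
    (h : Complex.exp (x * Complex.I) = Complex.exp (y * Complex.I)) : x = y := by
  have hpi := Real.pi_pos
  obtain ⟨n, hn⟩ := Complex.exp_eq_exp_iff_exists_int.1 h
  have hn' : (x : ℂ) = y + n * (2 * Real.pi) := by
    have : Complex.I * x = Complex.I * (y + n * (2 * Real.pi)) := by linear_combination hn
    exact mul_left_cancel₀ Complex.I_ne_zero this
  have hr : x = y + n * (2 * Real.pi) := by exact_mod_cast hn'
  have h1 : (n : ℝ) < 1 := by nlinarith
  have h2 : (-1 : ℝ) < n := by nlinarith
  have h3 : n = 0 := by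
    have a : n < 1 := by exact_mod_cast h1
    have b : -1 < n := by exact_mod_cast h2
    omega
  rw [hr, h3]; simp

lemma ccw_add {a b c : ℝ × ℝ} (ha : a ≠ 0) (hb : b ≠ 0) (hc : c ≠ 0) :
    ccwAngle b c = ccwAngle a c - ccwAngle a b + (if ccwAngle a c ≤ ccwAngle a b then 2 * Real.pi else 0) := by
  have hpi := Real.pi_pos
  obtain ⟨h1, h2⟩ := ccw_rng a b
  obtain ⟨h3, h4⟩ := ccw_rng a c
  obtain ⟨h5, h6⟩ := ccw_rng b c
  have ea := ccw_exp (w := b) ha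
  have eb := ccw_exp (w := c) ha
  have ec := ccw_exp (w := c) hb
  have na := toC_ne ha
  have nb := toC_ne hb
  have nc := toC_ne hc
  have key : Complex.exp ((ccwAngle b c : ℝ) * Complex.I) * Complex.exp ((ccwAngle a b : ℝ) * Complex.I)
      = Complex.exp ((ccwAngle a c : ℝ) * Complex.I) := by
    set x := Complex.exp ((ccwAngle b c : ℝ) * Complex.I)
    set y := Complex.exp ((ccwAngle a b : ℝ) * Complex.I)
    set z := Complex.exp ((ccwAngle a c : ℝ) * Complex.I)
    have n1 : ‖toC c / toC a‖ = ‖toC b / toC a‖ * ‖toC c / toC b‖ := by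
      rw [← norm_mul]; congr 1; field_simp
    have n2 : (‖toC b / toC a‖ : ℂ) ≠ 0 := by exact_mod_cast (norm_pos_iff.2 (div_ne_zero nb na)).ne'
    have n3 : (‖toC c / toC b‖ : ℂ) ≠ 0 := by exact_mod_cast (norm_pos_iff.2 (div_ne_zero nc nb)).ne'
    replace ec := eb.symm.trans ec
    rw [n1] at ec
    push_cast at ec ea
    have hm : toC a * ‖toC b / toC a‖ * ‖toC c / toC b‖ ≠ 0 := mul_ne_zero (mul_ne_zero na n2) n3
    apply mul_left_cancel₀ hm
    linear_combination (-(‖toC c / toC b‖ : ℂ) * x) * ea - ec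
  refine exp_eq_of_rng h5 h6 ?_ ?_ ?_
  · split_ifs with h <;> linarith
  · split_ifs with h <;> linarith
  · have e1 : Complex.exp (((ccwAngle a c - ccwAngle a b + (if ccwAngle a c ≤ ccwAngle a b then 2 * Real.pi else 0) : ℝ) : ℂ) * Complex.I)
      = Complex.exp ((ccwAngle a c : ℝ) * Complex.I) * Complex.exp (-((ccwAngle a b : ℝ) * Complex.I)) := by
      rw [← Complex.exp_add]
      split_ifs with h
      · push_cast
        have : ((ccwAngle a c : ℂ) - ccwAngle a b + 2 * Real.pi) * Complex.I = (ccwAngle a c * Complex.I + -(ccwAngle a b * Complex.I)) + 2 * Real.pi * Complex.I := by ring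
        rw [this, Complex.exp_add _ (2 * (Real.pi : ℂ) * Complex.I), Complex.exp_two_pi_mul_I, mul_one]
      · push_cast; congr 1; ring
    rw [e1, ← key, mul_assoc, ← Complex.exp_add, add_neg_cancel, Complex.exp_zero, mul_one]


lemma crs_oo {V : Type} (p : V → ℝ × ℝ) (x y z : V) : crs (p y - p x) (p z - p x) = oo p x y z := rfl

lemma seg_pt {V : Type} {p : V → ℝ × ℝ} {a b : V} {P : ℝ × ℝ} (h : P ∈ segment ℝ (p a) (p b)) :
    ∃ t : ℝ, 0 ≤ t ∧ t ≤ 1 ∧ P.1 = (p a).1 + t * ((p b).1 - (p a).1) ∧ P.2 = (p a).2 + t * ((p b).2 - (p a).2) := by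
  rw [segment_eq_image'] at h
  obtain ⟨t, ⟨h0, h1⟩, rfl⟩ := h
  exact ⟨t, h0, h1, rfl, rfl⟩

lemma seg_self {V : Type} {p : V → ℝ × ℝ} {a b c : V} (h : oo p a b c ≠ 0) {P : ℝ × ℝ}
    (h1 : P ∈ segment ℝ (p a) (p b)) (h2 : P ∈ segment ℝ (p a) (p c)) : P = p a := by
  obtain ⟨t, -, -, t1, t2⟩ := seg_pt h1
  obtain ⟨s, -, -, s1, s2⟩ := seg_pt h2
  have e1 : t * ((p b).1 - (p a).1) = s * ((p c).1 - (p a).1) := by linarith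
  have e2 : t * ((p b).2 - (p a).2) = s * ((p c).2 - (p a).2) := by linarith
  have : t * oo p a b c = 0 := by unfold oo; linear_combination ((p c).2 - (p a).2) * e1 - ((p c).1 - (p a).1) * e2
  have ht : t = 0 := (mul_eq_zero.1 this).resolve_right h
  rw [ht] at t1 t2
  exact Prod.ext (by linarith) (by linarith)

lemma seg_cross {V : Type} {p : V → ℝ × ℝ} {a b c d : V} (h1 : oo p a b c ≠ 0) (h2 : oo p a b d ≠ 0) {P : ℝ × ℝ}
    (hab : P ∈ segment ℝ (p a) (p b)) (hcd : P ∈ segment ℝ (p c) (p d)) : oo p a b c * oo p a b d < 0 := by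
  obtain ⟨t, -, -, t1, t2⟩ := seg_pt hab
  obtain ⟨s, s0, s3, s1, s2⟩ := seg_pt hcd
  have key : (1 - s) * oo p a b c + s * oo p a b d = 0 := by
    unfold oo
    linear_combination -((p b).1 - (p a).1) * (s2 - t2) + ((p b).2 - (p a).2) * (s1 - t1)
  have h3 : s * (oo p a b c * oo p a b d) = - ((1 - s) * (oo p a b c) ^ 2) := by linear_combination oo p a b c * key
  have h4 := sq_pos_of_ne_zero h1
  by_contra hc
  rw [not_lt] at hc
  have h5 : 0 ≤ s * (oo p a b c * oo p a b d) := mul_nonneg s0 hc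
  have h6 : (1 - s) = 0 := by nlinarith
  have : oo p a b d = 0 := by rw [h6] at key; have : s = 1 := by linarith
                              rw [this] at key; linarith
  exact h2 this

lemma mem_pair_image {V : Type} (p : V → ℝ × ℝ) {a : V} {S T : Set V} (h1 : a ∈ S) (h2 : a ∈ T) : p a ∈ p '' (S ∩ T) :=
  ⟨a, ⟨h1, h2⟩, rfl⟩

namespace PlaneEmb
variable {V : Type} {G : SimpleGraph V} (E : PlaneEmb G) [Fintype V] [DecidableEq V] [DecidableRel G.Adj]

lemma nonCrossing_of {p : V → ℝ × ℝ} (W : E.toPM.WReal p) : NonCrossing G p := by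
  refine ⟨?_, ?_⟩
  · rintro a b c d hab hcd hne P ⟨h1, h2⟩
    by_cases e1 : a = c
    · subst e1
      have : b ≠ d := by rintro rfl; exact hne rfl
      rw [seg_self (W.gp a b d hab.ne hcd.ne this) h1 h2]
      exact mem_pair_image p (by simp) (by simp)
    by_cases e2 : a = d
    · subst e2
      have : b ≠ c := by rintro rfl; exact hne (Set.pair_comm _ _)
      rw [segment_symm ℝ (p c)] at h2
      rw [seg_self (W.gp a b c hab.ne e1 this) h1 h2]
      exact mem_pair_image p (by simp) (by simp)
    by_cases e3 : b = c
    · subst e3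
      rw [segment_symm ℝ (p a)] at h1
      rw [seg_self (W.gp b a d hab.ne.symm hcd.ne e2) h1 h2]
      exact mem_pair_image p (by simp) (by simp)
    by_cases e4 : b = d
    · subst e4
      rw [segment_symm ℝ (p a)] at h1
      rw [segment_symm ℝ (p c)] at h2
      rw [seg_self (W.gp b a c hab.ne.symm hcd.ne.symm e1) h1 h2]
      exact mem_pair_image p (by simp) (by simp)
    exact absurd ⟨seg_cross (W.gp a b c hab.ne e1 e3) (W.gp a b d hab.ne e2 e4) h1 h2,
      seg_cross (W.gp c d a hcd.ne (Ne.symm e1) (Ne.symm e2)) (W.gp c d b hcd.ne (Ne.symm e3) (Ne.symm e4)) h2 h1⟩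
      (W.nc (⟨(a, b), hab⟩ : G.Dart) (⟨(c, d), hcd⟩ : G.Dart) e1 e2 e3 e4)
  · intro x a b hab h1 h2 h
    obtain ⟨t, -, -, t1, t2⟩ := seg_pt h
    apply W.gp a b x hab.ne h1.symm h2.symm
    unfold oo; rw [t1, t2]; ring

lemma genPos_of {p : V → ℝ × ℝ} (W : E.toPM.WReal p) : GenPos p := by
  intro u v w h1 h2 h3 hc
  apply W.gp u v w h1 h2 h3
  obtain ⟨z, hz⟩ := (collinear_iff_of_mem (p₀ := p u) (by simp)).1 hc
  obtain ⟨r, hr⟩ := hz (p v) (by simp)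
  obtain ⟨s, hs⟩ := hz (p w) (by simp)
  unfold oo
  rw [hr, hs]; simp; ring

lemma sum_angles {p : V → ℝ × ℝ} (hinj : Function.Injective p) {v : V}
    (gp : ∀ d e : G.Dart, d.fst = v → e.fst = v → d ≠ e → oo p v d.snd e.snd ≠ 0)
    (ord : ∀ d e : G.Dart, d.fst = v → e.fst = v → d ≠ e → E.rot d ≠ e → E.rot d ≠ d → C3 p v d.snd (E.rot d).snd e.snd)
    {ds : G.Dart} (hds : ds.fst = v) :
    ∑ d ∈ Finset.univ.filter (fun d : G.Dart => d.fst = v), dartAngle E p d = 2 * Real.pi := by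
  have hpi := Real.pi_pos
  have nz : ∀ d : G.Dart, p d.snd - p d.fst ≠ 0 := fun d e => d.adj.ne (hinj (sub_eq_zero.1 e)).symm
  set θ : G.Dart → ℝ := fun d => ccwAngle (p ds.snd - p ds.fst) (p d.snd - p d.fst) with hθ
  have hA : ∀ d, dartAngle E p d = θ (E.rot d) - θ d + (if θ (E.rot d) ≤ θ d then 2 * Real.pi else 0) := fun d =>
    ccw_add (nz ds) (nz d) (nz _)
  have rng : ∀ d, 0 < θ d ∧ θ d ≤ 2 * Real.pi := fun d => ccw_rng _ _
  have hs : θ ds = 2 * Real.pi := ccw_self (nz ds)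
  have htrig : ∀ d : G.Dart, d.fst = v → ∃ r, 0 < r ∧ r * Real.sin (θ d) = oo p v ds.snd d.snd := by
    intro d h
    obtain ⟨r, hr, -, h2⟩ := ccw_trig (nz ds) (nz d)
    refine ⟨r, hr, ?_⟩
    rw [h2, ← crs_oo, hds, h]
  have lt2 : ∀ d : G.Dart, d.fst = v → d ≠ ds → θ d < 2 * Real.pi := by
    intro d h1 h2
    refine lt_of_le_of_ne (rng d).2 fun e => ?_
    obtain ⟨r, hr, h3⟩ := htrig d h1
    rw [e, Real.sin_two_pi, mul_zero] at h3
    exact gp ds d hds h1 (Ne.symm h2) h3.symm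
  have hcr : ∀ d e : G.Dart, d.fst = v → e.fst = v → 0 < oo p v d.snd e.snd → 0 < θ e - θ d ∧ θ e - θ d < Real.pi ∨ θ e - θ d < - Real.pi := by
    intro d e h1 h2 h
    have e1 : crs (p d.snd - p d.fst) (p e.snd - p e.fst) = oo p v d.snd e.snd := by rw [h1, h2]; rfl
    rw [← e1, ← ccw_lt (nz d) (nz e), ccw_add (nz ds) (nz d) (nz e)] at h
    change θ e - θ d + (if θ e ≤ θ d then 2 * Real.pi else 0) < Real.pi at h
    split_ifs at h with k
    · right; linarith
    · left; constructor <;> linarith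
  have wrap : ∀ d : G.Dart, d.fst = v → (θ (E.rot d) ≤ θ d ↔ d = ds) := by
    intro d hd
    constructor
    · intro h
      by_contra hne
      have hr := (E.rot_fst d).trans hd
      have r1 := rng d
      have r2 := rng (E.rot d)
      have r3 := lt2 d hd hne
      by_cases k : E.rot d = ds
      · rw [k, hs] at h; linarith
      · have kk : E.rot d ≠ d := by
          intro e
          apply hne
          exact (E.rot_closed (fun x => x = d) (fun x hx => by rw [hx, e]) (hd.trans hds.symm) rfl).symm
        rcases ord d ds hd hds hne k kk with ⟨a, b⟩ | ⟨a, b⟩ | ⟨a, b⟩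
        · rcases hcr _ _ hd hr a with c | c <;> rcases hcr _ _ hr hds b with f | f <;> linarith
        · rcases hcr _ _ hr hds a with c | c <;> rcases hcr _ _ hds hd b with f | f <;> linarith
        · rcases hcr _ _ hds hd a with c | c <;> rcases hcr _ _ hd hr b with f | f <;> linarith
    · rintro rfl; rw [hs]; exact (rng _).2
  simp only [hA]
  rw [Finset.sum_add_distrib, Finset.sum_sub_distrib]
  have e1 : ∑ d ∈ Finset.univ.filter (fun d : G.Dart => d.fst = v), θ (E.rot d) = ∑ d ∈ Finset.univ.filter (fun d : G.Dart => d.fst = v), θ d := by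
    rw [Finset.sum_filter, Finset.sum_filter, ← Equiv.sum_comp E.rot (fun d : G.Dart => if d.fst = v then θ d else 0)]
    simp only [E.rot_fst]
  rw [e1, sub_self, zero_add, Finset.sum_congr rfl (fun d hd => if_congr (wrap d (Finset.mem_filter.1 hd).2) rfl rfl),
    Finset.sum_ite_eq' _ ds]
  exact if_pos (by simp [hds])

theorem toStretch {p : V → ℝ × ℝ} (W : E.toPM.WReal p) : StretchesToPT G E p := by
  have hpi := Real.pi_pos
  have nz : ∀ d : G.Dart, p d.snd - p d.fst ≠ 0 := fun d e => d.adj.ne (W.inj (sub_eq_zero.1 e)).symm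
  have dne : ∀ d e : G.Dart, d.fst = e.fst → d ≠ e → d.snd ≠ e.snd := fun d e h1 h2 h3 =>
    h2 (SimpleGraph.Dart.ext _ _ (Prod.ext h1 h3))
  have gp : ∀ d e : G.Dart, d.fst = e.fst → d ≠ e → oo p d.fst d.snd e.snd ≠ 0 := fun d e h1 h2 =>
    W.gp _ _ _ d.adj.ne (by rw [h1]; exact e.adj.ne) (dne d e h1 h2)
  have hsm : ∀ d : G.Dart, E.toPM.small p d.symm ↔ 0 < oo p d.fst d.snd (E.rot d).snd := by
    intro d
    show 0 < oo p d.symm.symm.fst d.symm.fst (E.rot d.symm.symm).snd ↔ _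
    rw [SimpleGraph.Dart.symm_symm]; exact Iff.rfl
  have hang : ∀ d : G.Dart, dartAngle E p d < Real.pi ↔ 0 < oo p d.fst d.snd (E.rot d).snd := by
    intro d
    unfold dartAngle
    rw [ccw_lt (nz d) (nz _), E.rot_fst]; exact Iff.rfl
  have hang' : ∀ d : G.Dart, ¬ (0 < oo p d.fst d.snd (E.rot d).snd) → Real.pi < dartAngle E p d := by
    intro d h
    by_cases k : E.rot d = d
    · unfold dartAngle; rw [k, ccw_self (nz d)]; linarith
    · have h1 := gp d (E.rot d) (E.rot_fst d).symm (Ne.symm k)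
      refine (ccw_pi_lt (nz d) (nz _) ?_).1
      rw [E.rot_fst]
      exact lt_of_le_of_ne (not_lt.1 h) h1
  have hsum : ∀ v : V, (∃ d : G.Dart, d.fst = v) →
    ∑ d ∈ Finset.univ.filter (fun d : G.Dart => d.fst = v), dartAngle E p d = 2 * Real.pi := by
    rintro v ⟨ds, hds⟩
    refine E.sum_angles W.inj ?_ ?_ hds
    · intro d e h1 h2; have := gp d e (h1.trans h2.symm); rwa [h1] at this
    · intro d e h1 h2 h3 h4 h5
      have hsg : E.toPM.sg d = E.rot d := by
        show E.rot d.symm.symm = _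
        rw [SimpleGraph.Dart.symm_symm]
      have := W.ord d e (h1.trans h2.symm) (dne d e (h1.trans h2.symm) h3)
        (by rw [hsg]; exact dne _ _ ((E.rot_fst d).trans (h1.trans h2.symm)) h4)
        (by rw [hsg]; exact dne _ _ (E.rot_fst d) h5)
      rw [hsg] at this
      rw [← h1]; exact this
  refine ⟨fun d => ¬ E.toPM.small p d.symm, ⟨?_, ?_, ?_⟩, ⟨W.inj, E.nonCrossing_of W, hsum⟩, E.genPos_of W, ?_⟩
  · intro F hF
    obtain ⟨d0, rfl⟩ := Quotient.exists_rep F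
    have h2 : E.phi (E.phi d0) ≠ d0 := by
      intro e
      apply hF
      have e1 : E.phi d0 = d0.symm := by
        refine SimpleGraph.Dart.ext _ _ (Prod.ext (E.rot_fst _) ?_)
        have := congrArg (fun d : G.Dart => d.fst) e
        exact (E.rot_fst (E.phi d0).symm).symm.trans this
      have e2 : E.rot d0 = d0 := by
        rw [e1, phi_apply, SimpleGraph.Dart.symm_symm] at e; exact e
      have e3 : E.rot d0.symm = d0.symm := e1
      obtain ⟨d', hd'⟩ := Quotient.exists_rep E.outer
      have := E.all_dart (fun d => d = d0 ∨ d = d0.symm) (by rintro x (rfl | rfl); exact Or.inl e2; exact Or.inr e3)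
        (by rintro x (rfl | rfl); exact Or.inr rfl; exact Or.inl (SimpleGraph.Dart.symm_symm _)) (d := d0) (Or.inl rfl) d'
      rw [← hd']
      rcases this with rfl | rfl
      · rfl
      · exact (e1 ▸ E.dartFace_phi d0).symm
    have h3 := W.cnt d0 hF h2
    rw [← h3]
    have : {e | Cyc E.toPM.ph d0 e ∧ E.toPM.small p e} = SimpleGraph.Dart.symm '' {d : G.Dart | E.angleFace d = E.dartFace d0 ∧ ¬ ¬ E.toPM.small p d.symm} := by
      ext e
      have hcy : Cyc E.toPM.ph d0 e ↔ E.dartFace e = E.dartFace d0 := by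
        constructor
        · intro h; exact h (fun t => E.dartFace t = E.dartFace d0) (fun t ht => (E.dartFace_phi t).trans ht) rfl
        · intro h
          obtain ⟨n, rfl⟩ := (E.dartFace_eq.1 h.symm).exists_nat_pow_eq
          clear h
          induction n with
          | zero => exact Cyc.refl _ _
          | succ n ih => rw [pow_succ']; exact ih.step
      constructor
      · rintro ⟨a, b⟩
        refine ⟨e.symm, ⟨?_, ?_⟩, SimpleGraph.Dart.symm_symm _⟩
        · show E.dartFace e.symm.symm = _
          rw [SimpleGraph.Dart.symm_symm]; exact hcy.1 a
        · rw [SimpleGraph.Dart.symm_symm]; exact not_not.2 b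
      · rintro ⟨d, ⟨a, b⟩, rfl⟩
        exact ⟨hcy.2 a, not_not.1 b⟩
    rw [this, Nat.card_image_of_injective SimpleGraph.Dart.symm_involutive.injective]
    rfl
  · intro d h; exact W.outs d.symm h
  · intro d d' h1 h2 h3
    by_contra hne
    rw [hsm] at h1 h2
    have a1 := hang' d h1
    have a2 := hang' d' h2
    have h4 := hsum d.fst ⟨d, rfl⟩
    have h5 : ∑ e ∈ {d, d'}, dartAngle E p e ≤ ∑ e ∈ Finset.univ.filter (fun e : G.Dart => e.fst = d.fst), dartAngle E p e := by
      refine Finset.sum_le_sum_of_subset_of_nonneg ?_ (fun e _ _ => (ccw_rng _ _).1.le)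
      intro e he
      rw [Finset.mem_insert, Finset.mem_singleton] at he
      rcases he with rfl | rfl
      · exact Finset.mem_filter.2 ⟨Finset.mem_univ _, rfl⟩
      · exact Finset.mem_filter.2 ⟨Finset.mem_univ _, h3.symm⟩
    rw [Finset.sum_pair hne] at h5
    linarith
  · intro d
    show (¬ E.toPM.small p d.symm → Real.pi < dartAngle E p d) ∧ (¬ ¬ E.toPM.small p d.symm → dartAngle E p d < Real.pi)
    rw [hsm]
    exact ⟨hang' d, fun h => (hang d).2 (not_not.1 h)⟩

end PlaneEmb


/-! ### rigidity matrices -/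
section rigid
open Classical
open Cardinal in
lemma exists_generic (V : Type) [Fintype V] : ∃ p : V → ℝ × ℝ, GenericConf p := by
  obtain ⟨s, hs⟩ := exists_isTranscendenceBasis ℚ ℝ
  have hinf : s.Infinite := by
    intro hf
    have : Finite s := hf
    haveI := hs.isAlgebraic
    have h1 := Algebra.IsAlgebraic.cardinalMk_le_max (Algebra.adjoin ℚ (Set.range ((↑) : s → ℝ))) ℝ
    have h2 := Algebra.cardinalMk_adjoin_le ℚ (Set.range ((↑) : s → ℝ))
    have h3 : #(Algebra.adjoin ℚ (Set.range ((↑) : s → ℝ))) ≤ ℵ₀ := by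
      refine h2.trans (max_le (max_le ?_ ?_) le_rfl)
      · exact Cardinal.mk_le_aleph0
      · exact Cardinal.mk_le_aleph0
    have h4 := h1.trans (max_le h3 le_rfl)
    rw [Cardinal.mk_real] at h4
    exact absurd Cardinal.aleph0_lt_continuum (not_lt.2 h4)
  haveI := hinf.to_subtype
  obtain ⟨f⟩ : Nonempty ((V ⊕ V) ↪ s) := by
    rw [← Cardinal.le_def]
    exact (Cardinal.mk_le_aleph0).trans (Cardinal.aleph0_le_mk s)
  refine ⟨fun v => (f (Sum.inl v), f (Sum.inr v)), ?_⟩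
  have := hs.1.comp f f.injective
  unfold GenericConf
  convert this using 1
  ext x
  cases x <;> rfl

variable {V : Type} [Fintype V]

/-- row of the rigidity matrix -/
noncomputable def rrow {R : Type} [CommRing R] (c : V ⊕ V → R) : Sym2 V → V ⊕ V → R :=
  Sym2.lift ⟨fun u v => Sum.elim
      (fun w => (c (Sum.inl u) - c (Sum.inl v)) * ((if w = u then 1 else 0) - (if w = v then 1 else 0)))
      (fun w => (c (Sum.inr u) - c (Sum.inr v)) * ((if w = u then 1 else 0) - (if w = v then 1 else 0))), by
    intro u v
    ext (w | w) <;> simp <;> ring⟩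

lemma rrow_dot (c x : V ⊕ V → ℝ) (u v : V) : rrow c s(u, v) ⬝ᵥ x =
    (c (Sum.inl u) - c (Sum.inl v)) * (x (Sum.inl u) - x (Sum.inl v)) + (c (Sum.inr u) - c (Sum.inr v)) * (x (Sum.inr u) - x (Sum.inr v)) := by
  simp only [rrow, Sym2.lift_mk, dotProduct, Fintype.sum_sum_type, Sum.elim_inl, Sum.elim_inr]
  simp only [mul_assoc, ← Finset.mul_sum, sub_mul, Finset.sum_sub_distrib]
  simp

lemma rrow_map {R S : Type} [CommRing R] [CommRing S] (f : R →+* S) (c : V ⊕ V → R) (e : Sym2 V) (i : V ⊕ V) :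
    f (rrow c e i) = rrow (fun j => f (c j)) e i := by
  induction e using Sym2.ind with
  | _ u v =>
    rcases i with w | w <;> simp [rrow, apply_ite f]

/-- the rigidity matrix on a family of pairs -/
noncomputable def rmat {R : Type} [CommRing R] {ι : Type} (c : V ⊕ V → R) (e : ι → Sym2 V) : Matrix ι (V ⊕ V) R :=
  Matrix.of fun i => rrow c (e i)

lemma rank_ker {ι : Type} [Fintype ι] (A : Matrix ι (V ⊕ V) ℝ) :
    A.rank + Module.finrank ℝ (LinearMap.ker A.mulVecLin) = 2 * Fintype.card V := by
  have := LinearMap.finrank_range_add_finrank_ker A.mulVecLin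
  rw [Module.finrank_fintype_fun_eq_card, Fintype.card_sum] at this
  rw [two_mul]; exact this

/-- trivial on `X`, arbitrary outside -/
noncomputable def trivMap (c : V ⊕ V → ℝ) (X : Finset V) :
    ((ℝ × ℝ × ℝ) × ({v // v ∉ X} → ℝ × ℝ)) →ₗ[ℝ] (V ⊕ V → ℝ) where
  toFun z := Sum.elim
    (fun v => if h : v ∈ X then - z.1.1 * c (Sum.inr v) + z.1.2.1 else (z.2 ⟨v, h⟩).1)
    (fun v => if h : v ∈ X then z.1.1 * c (Sum.inl v) + z.1.2.2 else (z.2 ⟨v, h⟩).2)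
  map_add' a b := by
    ext (v | v) <;> by_cases h : v ∈ X <;> simp [h] <;> ring
  map_smul' r a := by
    ext (v | v) <;> by_cases h : v ∈ X <;> simp [h] <;> ring

lemma trivMap_inj (c : V ⊕ V → ℝ) (X : Finset V) {u v : V} (hu : u ∈ X) (hv : v ∈ X)
    (h : c (Sum.inl u) ≠ c (Sum.inl v) ∨ c (Sum.inr u) ≠ c (Sum.inr v)) : Function.Injective (trivMap c X) := by
  rw [← LinearMap.ker_eq_bot, LinearMap.ker_eq_bot']
  rintro ⟨⟨a, s, t⟩, z⟩ hz
  have e1 := congrFun hz (Sum.inl u)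
  have e2 := congrFun hz (Sum.inl v)
  have e3 := congrFun hz (Sum.inr u)
  have e4 := congrFun hz (Sum.inr v)
  simp [trivMap, hu, hv] at e1 e2 e3 e4
  have ha : a = 0 := by
    rcases h with h | h
    · have : a * (c (Sum.inl u) - c (Sum.inl v)) = 0 := by linarith
      exact (mul_eq_zero.1 this).resolve_right (sub_ne_zero.2 h)
    · have : a * (c (Sum.inr u) - c (Sum.inr v)) = 0 := by linarith
      exact (mul_eq_zero.1 this).resolve_right (sub_ne_zero.2 h)
  subst ha
  have hs : s = 0 := by linarith
  have ht : t = 0 := by linarith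
  have hz0 : z = 0 := by
    funext ⟨w, hw⟩
    have f1 := congrFun hz (Sum.inl w)
    have f2 := congrFun hz (Sum.inr w)
    simp [trivMap, hw] at f1 f2
    exact Prod.ext f1 f2
  rw [hs, ht, hz0]; rfl

lemma trivMap_ker (c : V ⊕ V → ℝ) (X : Finset V) {ι : Type} [Fintype ι] (e : ι → Sym2 V) (he : ∀ i, ∀ x ∈ e i, x ∈ X) :
    LinearMap.range (trivMap c X) ≤ LinearMap.ker (rmat c e).mulVecLin := by
  rintro _ ⟨z, rfl⟩
  rw [LinearMap.mem_ker]
  funext i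
  change rrow c (e i) ⬝ᵥ _ = 0
  have h := he i
  revert h
  induction e i using Sym2.ind with
  | _ u v =>
    intro h
    have h1 := h u (Sym2.mem_mk_left _ _)
    have h2 := h v (Sym2.mem_mk_right _ _)
    rw [rrow_dot]
    simp [trivMap, h1, h2]
    ring

lemma trivMap_rank (c : V ⊕ V → ℝ) (hc : ∀ u v, u ≠ v → c (Sum.inl u) ≠ c (Sum.inl v) ∨ c (Sum.inr u) ≠ c (Sum.inr v))
    (X : Finset V) (hX : 2 ≤ X.card) : Module.finrank ℝ (LinearMap.range (trivMap c X)) + 2 * X.card = 3 + 2 * Fintype.card V := by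
  obtain ⟨u, hu, v, hv, huv⟩ := Finset.one_lt_card.1 hX
  rw [LinearMap.finrank_range_of_inj (trivMap_inj c X hu hv (hc u v huv))]
  have : Fintype.card {v // v ∉ X} = Fintype.card V - X.card := by
    rw [Fintype.card_subtype_compl]; simp
  have h2 := Finset.card_le_univ X
  simp [Module.finrank_pi_fintype, this]
  omega

lemma rmat_rank_le (c : V ⊕ V → ℝ) (hc : ∀ u v, u ≠ v → c (Sum.inl u) ≠ c (Sum.inl v) ∨ c (Sum.inr u) ≠ c (Sum.inr v))
    (X : Finset V) (hX : 2 ≤ X.card) {ι : Type} [Fintype ι] (e : ι → Sym2 V) (he : ∀ i, ∀ x ∈ e i, x ∈ X) :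
    (rmat c e).rank + 3 ≤ 2 * X.card := by
  have h1 := Submodule.finrank_mono (trivMap_ker c X e he)
  have h2 := trivMap_rank c hc X hX
  have h3 := rank_ker (rmat c e)
  omega

/-- coordinates -/
def cc (p : V → ℝ × ℝ) : V ⊕ V → ℝ := Sum.elim (fun v => (p v).1) (fun v => (p v).2)

lemma cc_inj {p : V → ℝ × ℝ} (hp : Function.Injective p) (u v : V) (h : u ≠ v) :
    cc p (Sum.inl u) ≠ cc p (Sum.inl v) ∨ cc p (Sum.inr u) ≠ cc p (Sum.inr v) := by
  by_contra! hh
  exact h (hp (Prod.ext hh.1 hh.2))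

lemma GenericConf.inj {p : V → ℝ × ℝ} (h : GenericConf p) : Function.Injective p := by
  intro u v e
  have := AlgebraicIndependent.injective h (a₁ := Sum.inl u) (a₂ := Sum.inl v) (by simp [e])
  simpa using this

lemma mem_ker_iff (G : SimpleGraph V) (p q : V → ℝ × ℝ) :
    cc q ∈ LinearMap.ker (rmat (cc p) (Subtype.val : G.edgeSet → Sym2 V)).mulVecLin ↔ IsInfMotion G p q := by
  rw [LinearMap.mem_ker]
  constructor
  · intro h u v huv
    have := congrFun h ⟨s(u, v), huv⟩
    change rrow (cc p) s(u, v) ⬝ᵥ _ = 0 at this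
    rw [rrow_dot] at this
    exact this
  · intro h
    funext ⟨e, he⟩
    change rrow (cc p) e ⬝ᵥ _ = 0
    induction e using Sym2.ind with
    | _ u v => rw [rrow_dot]; exact h u v he

lemma mem_triv_iff (p q : V → ℝ × ℝ) :
    cc q ∈ LinearMap.range (trivMap (cc p) Finset.univ) ↔ IsTrivialMotion p q := by
  constructor
  · rintro ⟨⟨⟨a, s, t⟩, z⟩, h⟩
    refine ⟨a, (s, t), fun v => ?_⟩
    have h1 := congrFun h (Sum.inl v)
    have h2 := congrFun h (Sum.inr v)
    simp [trivMap, cc] at h1 h2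
    refine Prod.ext ?_ ?_ <;> simp [rot90] <;> linarith
  · rintro ⟨a, t, h⟩
    refine ⟨⟨⟨a, t.1, t.2⟩, 0⟩, ?_⟩
    ext (v | v) <;> simp [trivMap, cc, h v, rot90]

lemma cc_surj (x : V ⊕ V → ℝ) : ∃ q, cc q = x :=
  ⟨fun v => (x (Sum.inl v), x (Sum.inr v)), by ext (v | v) <;> rfl⟩

lemma exists_laman (G : SimpleGraph V) (h2 : 2 ≤ Fintype.card V) (hG : GenRigid G) :
    ∃ L : Finset (Sym2 V), (∀ e ∈ L, e ∈ G.edgeSet) ∧ LamanSet L := by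
  classical
  obtain ⟨p, hp⟩ := exists_generic V
  have hc := cc_inj hp.inj
  have hr := hG p hp
  set A := rmat (cc p) (Subtype.val : G.edgeSet → Sym2 V) with hA
  have hk : LinearMap.ker A.mulVecLin ≤ LinearMap.range (trivMap (cc p) Finset.univ) := by
    intro x hx
    obtain ⟨q, rfl⟩ := cc_surj x
    exact (mem_triv_iff p q).2 (hr q ((mem_ker_iff G p q).1 hx))
  have h3 := Submodule.finrank_mono hk
  have h4 := trivMap_rank (cc p) hc Finset.univ (by simpa using h2)
  have h5 := rank_ker A
  rw [Finset.card_univ] at h4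
  obtain ⟨κ, a, ha, hspan, hli⟩ := exists_linearIndependent' ℝ A.row
  haveI : Finite κ := Finite.of_injective a ha
  haveI := Fintype.ofFinite κ
  have hrank : A.rank = Fintype.card κ := by
    rw [Matrix.rank_eq_finrank_span_row, ← hspan, finrank_span_eq_card hli]
  set f : κ → Sym2 V := fun k => (a k).1 with hf
  have hfi : Function.Injective f := Subtype.val_injective.comp ha
  have hL : (Finset.univ.image f).card = Fintype.card κ := Finset.card_image_of_injective _ hfi
  have hmem : ∀ e ∈ Finset.univ.image f, e ∈ G.edgeSet := by
    intro e he
    obtain ⟨k, -, rfl⟩ := Finset.mem_image.1 he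
    exact (a k).2
  have hsp : Sparse (Finset.univ.image f) := by
    refine ⟨fun e he => G.not_isDiag_of_mem_edgeSet (hmem e he), fun X hX => ?_⟩
    set K := {k : κ // ∀ x ∈ f k, x ∈ X}
    have h6 := rmat_rank_le (cc p) hc X hX (fun k : K => f k.1) (fun k => k.2)
    have h7 : (rmat (cc p) (fun k : K => f k.1)).rank = Fintype.card K :=
      LinearIndependent.rank_matrix (hli.comp (Subtype.val : K → κ) Subtype.val_injective)
    have h8 : ii (Finset.univ.image f) X ≤ Fintype.card K := by
      rw [← Finset.card_univ, ii]
      refine (Finset.card_le_card (t := Finset.univ.image (fun k : K => f k.1)) ?_).trans Finset.card_image_le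
      intro e he
      replace he : e ∈ Finset.univ.image f ∧ ∀ x ∈ e, x ∈ X := (@Finset.mem_filter _ _ (_) _ _).1 he
      obtain ⟨k, -, rfl⟩ := Finset.mem_image.1 he.1
      exact Finset.mem_image.2 ⟨⟨k, he.2⟩, Finset.mem_univ _, rfl⟩
    omega
  refine ⟨_, hmem, hsp, ?_⟩
  have h9 := rmat_rank_le (cc p) hc Finset.univ (by simpa using h2) (Subtype.val : G.edgeSet → Sym2 V) (fun _ _ _ => Finset.mem_univ _)
  rw [Finset.card_univ] at h9
  change A.rank + 3 ≤ _ at h9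
  omega

/-- maximal rank at one placement implies generic rigidity -/
lemma genRigid_of_rank (G : SimpleGraph V) (h2 : 2 ≤ Fintype.card V) (p : V → ℝ × ℝ)
    (hr : 2 * Fintype.card V ≤ (rmat (cc p) (Subtype.val : G.edgeSet → Sym2 V)).rank + 3) : GenRigid G := by
  classical
  intro p' hp'
  set A := rmat (cc p) (Subtype.val : G.edgeSet → Sym2 V) with hA
  obtain ⟨κ, a, ha, hspan, hli⟩ := exists_linearIndependent' ℝ A.row
  haveI : Finite κ := Finite.of_injective a ha
  haveI := Fintype.ofFinite κ
  have hrank : A.rank = Fintype.card κ := by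
    rw [Matrix.rank_eq_finrank_span_row, ← hspan, finrank_span_eq_card hli]
  set f : κ → Sym2 V := fun k => (a k).1 with hf
  let B : Matrix κ (V ⊕ V) (MvPolynomial (V ⊕ V) ℚ) := rmat MvPolynomial.X f
  let P := (B * B.transpose).det
  have hev : ∀ c : V ⊕ V → ℝ, MvPolynomial.aeval c P = (rmat c f * (rmat c f).transpose).det := by
    intro c
    have := (MvPolynomial.aeval (R := ℚ) c).toRingHom.map_det (B * B.transpose)
    change MvPolynomial.aeval c P = _ at this
    rw [this]
    congr 1
    have hB : B.map (MvPolynomial.aeval (R := ℚ) c).toRingHom = rmat c f := by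
      ext i j
      change (MvPolynomial.aeval (R := ℚ) c).toRingHom (rrow MvPolynomial.X (f i) j) = rrow c (f i) j
      rw [rrow_map]
      simp
    rw [RingHom.mapMatrix_apply, Matrix.map_mul, Matrix.transpose_map, hB]
  have hP : P ≠ 0 := by
    intro h0
    have h1 := hev (cc p)
    rw [h0, map_zero] at h1
    obtain ⟨w, hw, hw2⟩ := Matrix.exists_vecMul_eq_zero_iff.2 h1.symm
    have h3 : Matrix.vecMul w (rmat (cc p) f) = 0 := by
      rw [← Matrix.vecMul_vecMul] at hw2
      have : Matrix.vecMul w (rmat (cc p) f) ⬝ᵥ Matrix.vecMul w (rmat (cc p) f) = 0 := by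
        have h4 := congrArg (fun z => z ⬝ᵥ w) hw2
        simp only [zero_dotProduct, Matrix.vecMul_transpose] at h4
        rw [← Matrix.vecMul_transpose, ← Matrix.dotProduct_mulVec, Matrix.mulVec_transpose] at h4
        exact h4
      exact dotProduct_self_eq_zero.1 this
    apply hw
    have h5 := Fintype.linearIndependent_iff.1 hli w (by
      rw [← h3]
      ext j
      simp [Matrix.vecMul, dotProduct, rmat, A, hf])
    exact funext h5
  have hne : MvPolynomial.aeval (cc p') P ≠ 0 := by
    intro h
    exact hP (hp'.eq_zero_of_aeval_eq_zero P h)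
  rw [hev] at hne
  have hc := cc_inj hp'.inj
  set A' := rmat (cc p') (Subtype.val : G.edgeSet → Sym2 V) with hA'
  have hli' : LinearIndependent ℝ (rmat (cc p') f).row := by
    rw [Fintype.linearIndependent_iff]
    intro w hw
    by_contra hh
    apply hne
    refine Matrix.exists_vecMul_eq_zero_iff.1 ⟨w, fun h => hh (fun i => congrFun h i), ?_⟩
    rw [← Matrix.vecMul_vecMul]
    have : Matrix.vecMul w (rmat (cc p') f) = 0 := by
      rw [← hw]
      ext j
      simp [Matrix.vecMul, dotProduct]
    rw [this, Matrix.zero_vecMul]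
  have hr' : Fintype.card κ ≤ A'.rank := by
    rw [← LinearIndependent.rank_matrix hli', Matrix.rank_eq_finrank_span_row, Matrix.rank_eq_finrank_span_row]
    refine Submodule.finrank_mono (Submodule.span_mono ?_)
    rintro _ ⟨k, rfl⟩
    exact ⟨a k, rfl⟩
  have h5 := rank_ker A'
  have h4 := trivMap_rank (cc p') hc Finset.univ (by simpa using h2)
  rw [Finset.card_univ] at h4
  have heq := Submodule.eq_of_le_of_finrank_le (trivMap_ker (cc p') Finset.univ (Subtype.val : G.edgeSet → Sym2 V)
    (fun _ _ _ => Finset.mem_univ _)) (by change Module.finrank ℝ (LinearMap.ker A'.mulVecLin) ≤ _; omega)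
  intro q hq
  rw [← mem_triv_iff, heq, mem_ker_iff]
  exact hq
end rigid


/-! ### the maximum principle for pseudo-triangles -/
lemma maxp_coef {a b ρ x y : ℝ} (ha : 0 ≤ a) (hb : 0 ≤ b) (hρ : 0 < ρ) (h : a + b + ρ < Real.pi)
    (h1 : - x * Real.sin (a + ρ) + y * Real.sin b ≤ 0) (h2 : 0 ≤ - x * Real.sin a + y * Real.sin (b + ρ)) :
    0 ≤ x ∧ 0 ≤ y := by
  have sa := Real.sin_nonneg_of_nonneg_of_le_pi ha (by linarith)
  have sb := Real.sin_nonneg_of_nonneg_of_le_pi hb (by linarith)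
  have sa2 := Real.sin_pos_of_pos_of_lt_pi (x := a + ρ) (by linarith) (by linarith)
  have sb2 := Real.sin_pos_of_pos_of_lt_pi (x := b + ρ) (by linarith) (by linarith)
  have key : Real.sin a * Real.sin b < Real.sin (a + ρ) * Real.sin (b + ρ) := by
    have s1 := Real.sin_pos_of_pos_of_lt_pi hρ (by linarith)
    have s2 := Real.sin_pos_of_pos_of_lt_pi (x := a + b + ρ) (by linarith) h
    have e : Real.sin (a + ρ) * Real.sin (b + ρ) - Real.sin a * Real.sin b = Real.sin ρ * Real.sin (a + b + ρ) := by
      rw [show a + b + ρ = a + (b + ρ) by ring]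
      simp only [Real.sin_add, Real.cos_add]
      have := Real.sin_sq_add_cos_sq ρ
      linear_combination (Real.sin a * Real.sin b) * this
    nlinarith
  have hx : 0 ≤ x := by
    by_contra! hx
    have hy : y * Real.sin b < 0 := by nlinarith
    have hy : y < 0 := by
      by_contra! hh
      nlinarith [mul_nonneg hh sb]
    nlinarith [mul_nonneg (neg_nonneg.2 hx.le) (neg_nonneg.2 hy.le), mul_nonneg sa sb, mul_pos sa2 sb2,
      mul_pos (neg_pos.2 hx) sa2, mul_pos (neg_pos.2 hy) sb2, mul_nonneg (neg_pos.2 hx).le sa, mul_nonneg (neg_pos.2 hy).le sb]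
  refine ⟨hx, ?_⟩
  by_contra! hy
  nlinarith [mul_nonneg hx sa]

lemma maxp_seq {t i1 i2 i3 : ℕ} (h12 : i1 < i2) (h23 : i2 < i3) (h3 : i3 < t) (P : ℕ → ℝ × ℝ) (ψ l : ℕ → ℝ)
    (hl : ∀ i, 0 < l i) (hP1 : ∀ i, (P (i + 1)).1 = (P i).1 + l i * Real.cos (ψ i))
    (hP2 : ∀ i, (P (i + 1)).2 = (P i).2 - l i * Real.sin (ψ i)) (hcl : P (t + 1) = P 0)
    (hlt : ∀ i, ψ (i + 1) < ψ i + Real.pi)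
    (hdec : ∀ i < t, i ≠ i1 → i ≠ i2 → i ≠ i3 → ψ (i + 1) ≤ ψ i) {ρ : ℝ} (hρ : 0 < ρ)
    (hend : ψ t = ψ 0 + 2 * Real.pi + ρ) {x y : ℝ} (hxy : ¬ (x = 0 ∧ y = 0))
    (h0 : x * (P 1).1 + y * (P 1).2 ≤ x * (P 0).1 + y * (P 0).2)
    (h1 : x * (P t).1 + y * (P t).2 ≤ x * (P 0).1 + y * (P 0).2) :
    x * (P 0).1 + y * (P 0).2 < x * (P (i2 + 1)).1 + y * (P (i2 + 1)).2 := by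
  have mono : ∀ a b, a ≤ b → b ≤ t → (∀ i, a ≤ i → i < b → i ≠ i1 ∧ i ≠ i2 ∧ i ≠ i3) → ψ b ≤ ψ a := by
    intro a b hab
    induction b, hab using Nat.le_induction with
    | base => intro _ _; exact le_rfl
    | succ b hab ih =>
      intro hb h
      obtain ⟨n1, n2, n3⟩ := h b hab (Nat.lt_succ_self b)
      exact (hdec b hb n1 n2 n3).trans (ih (by omega) (fun i hi hi2 => h i hi (by omega)))
  have m1 : ∀ i ≤ i1, ψ i ≤ ψ 0 ∧ ψ i1 ≤ ψ i := fun i hi =>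
    ⟨mono 0 i (by omega) (by omega) (by omega), mono i i1 (by omega) (by omega) (by omega)⟩
  have m2 : ∀ i, i1 < i → i ≤ i2 → ψ i ≤ ψ (i1 + 1) ∧ ψ i2 ≤ ψ i := fun i hi hi' =>
    ⟨mono _ i (by omega) (by omega) (by omega), mono i i2 (by omega) (by omega) (by omega)⟩
  have m3 : ∀ i, i2 < i → i ≤ i3 → ψ i ≤ ψ (i2 + 1) ∧ ψ i3 ≤ ψ i := fun i hi hi' =>
    ⟨mono _ i (by omega) (by omega) (by omega), mono i i3 (by omega) (by omega) (by omega)⟩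
  have m4 : ∀ i, i3 < i → i ≤ t → ψ i ≤ ψ (i3 + 1) ∧ ψ t ≤ ψ i := fun i hi hi' =>
    ⟨mono _ i (by omega) (by omega) (by omega), mono i t (by omega) (by omega) (by omega)⟩
  have q1 := (m1 0 (by omega)).2
  have q2 := (m2 i2 h12 le_rfl).1
  have q3 := (m3 i3 h23 le_rfl).1
  have q4 := (m4 t h3 le_rfl).1
  have j1 := hlt i1
  have j2 := hlt i2
  have j3 := hlt i3
  set f : ℝ → ℝ × ℝ → ℝ := fun β v => - v.2 * Real.cos β - v.1 * Real.sin β with hf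
  have hstep : ∀ β i, f β (P (i + 1)) = f β (P i) + l i * Real.sin (ψ i - β) := by
    intro β i
    simp only [hf, hP1, hP2, Real.sin_sub]
    ring
  set B := ψ i1 with hB
  set A := ψ (i3 + 1) with hA
  have fB : f B (P 0) < f B (P (i2 + 1)) := by
    have : ∀ n ≤ i2, f B (P 0) ≤ f B (P n) := by
      intro n
      induction n with
      | zero => intro _; exact le_rfl
      | succ n ih =>
        intro hn
        refine (ih (by omega)).trans ?_
        rw [hstep]
        have : 0 ≤ Real.sin (ψ n - B) := by
          by_cases hc : n ≤ i1
          · obtain ⟨a, b⟩ := m1 n hc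
            exact Real.sin_nonneg_of_nonneg_of_le_pi (by linarith) (by linarith)
          · obtain ⟨a, b⟩ := m2 n (by omega) (by omega)
            exact Real.sin_nonneg_of_nonneg_of_le_pi (by linarith) (by linarith)
        nlinarith [hl n]
    refine (this i2 le_rfl).trans_lt ?_
    rw [hstep]
    have : 0 < Real.sin (ψ i2 - B) := Real.sin_pos_of_pos_of_lt_pi (by linarith) (by linarith)
    nlinarith [hl i2]
  have fA : f A (P 0) < f A (P (i2 + 1)) := by
    have : ∀ n, i2 + 2 ≤ n → n ≤ t + 1 → f A (P n) ≤ f A (P (i2 + 2)) := by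
      intro n hn
      induction n, hn using Nat.le_induction with
      | base => intro _; exact le_rfl
      | succ n hn ih =>
        intro hn2
        refine le_trans ?_ (ih (by omega))
        rw [hstep]
        have : 0 ≤ Real.sin (A - ψ n) := by
          by_cases hc : n ≤ i3
          · obtain ⟨a, b⟩ := m3 n (by omega) hc
            exact Real.sin_nonneg_of_nonneg_of_le_pi (by linarith) (by linarith)
          · obtain ⟨a, b⟩ := m4 n (by omega) (by omega)
            exact Real.sin_nonneg_of_nonneg_of_le_pi (by linarith) (by linarith)
        rw [show ψ n - A = -(A - ψ n) by ring, Real.sin_neg]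
        nlinarith [hl n]
    have h := this (t + 1) (by omega) le_rfl
    rw [hcl] at h
    refine h.trans_lt ?_
    rw [show i2 + 2 = (i2 + 1) + 1 from rfl, hstep]
    have q := (m3 (i2 + 1) (by omega) h23).2
    have : 0 < Real.sin (A - ψ (i2 + 1)) := Real.sin_pos_of_pos_of_lt_pi (by linarith) (by linarith)
    rw [show ψ (i2 + 1) - A = -(A - ψ (i2 + 1)) by ring, Real.sin_neg]
    nlinarith [hl (i2 + 1)]
  have hs : 0 < Real.sin (A - B) := by
    have : 0 < Real.sin (A - 2 * Real.pi - B) := Real.sin_pos_of_pos_of_lt_pi (by linarith) (by linarith)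
    rwa [show A - 2 * Real.pi - B = A - B - 2 * Real.pi by ring, Real.sin_sub_two_pi] at this
  -- write the functional as a combination
  obtain ⟨u, w, huw⟩ : ∃ u w : ℝ, ∀ v : ℝ × ℝ, x * v.1 + y * v.2 = u * f A v + w * f B v := by
    refine ⟨(y * Real.sin B - x * Real.cos B) / Real.sin (A - B), (x * Real.cos A - y * Real.sin A) / Real.sin (A - B), fun v => ?_⟩
    rw [div_mul_eq_mul_div, div_mul_eq_mul_div, ← add_div, eq_div_iff hs.ne', Real.sin_sub]
    simp only [hf]
    ring
  rw [huw, huw] at h0 h1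
  rw [huw, huw]
  have e0 := hstep A 0
  have e1 := hstep B 0
  have e2 := hstep A t
  have e3 := hstep B t
  rw [hcl] at e2 e3
  have c : 0 ≤ u ∧ 0 ≤ w := by
    refine maxp_coef (a := A - 2 * Real.pi - ψ 0 - ρ) (b := ψ 0 - B) (ρ := ρ) (by linarith) (by linarith) hρ (by linarith) ?_ ?_
    · rw [show A - 2 * Real.pi - ψ 0 - ρ + ρ = - (ψ 0 - A) - 2 * Real.pi by ring, Real.sin_sub_two_pi, Real.sin_neg]
      rw [zero_add] at e0 e1
      rw [e0, e1] at h0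
      have := hl 0
      by_contra! hh
      nlinarith
    · rw [show A - 2 * Real.pi - ψ 0 - ρ = - (ψ t - A) by rw [hend]; ring, Real.sin_neg,
        show ψ 0 - B + ρ = ψ t - B - 2 * Real.pi by rw [hend]; ring, Real.sin_sub_two_pi]
      rw [e2, e3] at h1
      have := hl t
      by_contra! hh
      nlinarith
  rcases c.1.lt_or_eq with h | h
  · linarith [mul_lt_mul_of_pos_left fA h, mul_le_mul_of_nonneg_left fB.le c.2]
  · rcases c.2.lt_or_eq with h' | h'
    · linarith [mul_lt_mul_of_pos_left fB h', mul_le_mul_of_nonneg_left fA.le c.1]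
    · exfalso
      apply hxy
      have a1 := huw (1, 0)
      have a2 := huw (0, 1)
      rw [← h, ← h'] at a1 a2
      simp at a1 a2
      exact ⟨a1, a2⟩


namespace PlaneEmb
section pt
open Classical
variable {V : Type} [Fintype V] [DecidableEq V] {G : SimpleGraph V} [DecidableRel G.Adj] (E : PlaneEmb G)
  {p : V → ℝ × ℝ} {big : G.Dart → Prop}

/-- clockwise turn of the face walk after the dart `d` -/
noncomputable def kap (p : V → ℝ × ℝ) (d : G.Dart) : ℝ := Real.pi - dartAngle E p d.symm

/-- unit direction of a dart -/
noncomputable def udir (p : V → ℝ × ℝ) (d : G.Dart) : ℂ := toC (p d.snd - p d.fst) / (‖toC (p d.snd - p d.fst)‖ : ℝ)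

lemma kap_exp (hp : Function.Injective p) (d : G.Dart) :
    udir p (E.phi d) = udir p d * Complex.exp (-(E.kap p d : ℝ) * Complex.I) := by
  have nz : ∀ d : G.Dart, p d.snd - p d.fst ≠ 0 := fun d e => d.adj.ne (hp (sub_eq_zero.1 e)).symm
  have h := ccw_exp (w := p (E.phi d).snd - p (E.phi d).fst) (nz d.symm)
  have n1 := toC_ne (nz d)
  have n2 := toC_ne (nz (E.phi d))
  have hA : ccwAngle (p d.symm.snd - p d.symm.fst) (p (E.phi d).snd - p (E.phi d).fst) = Real.pi - E.kap p d := by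
    unfold kap dartAngle; rw [phi_apply]; ring
  have hneg : toC (p d.symm.snd - p d.symm.fst) = - toC (p d.snd - p d.fst) := by
    apply Complex.ext <;> simp [toC]
  rw [hA, hneg, norm_div, norm_neg] at h
  have he : Complex.exp (((Real.pi - E.kap p d : ℝ) : ℂ) * Complex.I) = - Complex.exp (-(E.kap p d : ℝ) * Complex.I) := by
    rw [Complex.ofReal_sub, sub_mul, sub_eq_add_neg, Complex.exp_add, Complex.exp_pi_mul_I, ← neg_mul]; ring
  rw [he] at h
  unfold udir
  have m1 : ((‖toC (p d.snd - p d.fst)‖ : ℝ) : ℂ) ≠ 0 := by exact_mod_cast (norm_pos_iff.2 n1).ne'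
  have m2 : ((‖toC (p (E.phi d).snd - p (E.phi d).fst)‖ : ℝ) : ℂ) ≠ 0 := by exact_mod_cast (norm_pos_iff.2 n2).ne'
  rw [div_eq_iff m2]
  conv_lhs => rw [h]
  rw [Complex.ofReal_div]
  field_simp

/-- darts on a face -/
noncomputable def fd (F : E.Face) : Finset G.Dart := Finset.univ.filter (fun d => E.dartFace d = F)

lemma mem_fd {F : E.Face} {d : G.Dart} : d ∈ E.fd F ↔ E.dartFace d = F := by simp [fd]

lemma face_int (hp : Function.Injective p) (F : E.Face) : ∃ n : ℤ, ∑ d ∈ E.fd F, E.kap p d = n * (2 * Real.pi) := by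
  have h1 : ∏ d ∈ E.fd F, udir p (E.phi d) = ∏ d ∈ E.fd F, udir p d := by
    refine Finset.prod_bij (fun d _ => E.phi d) (fun d hd => ?_) (fun a _ b _ h => E.phi.injective h) (fun d hd => ?_) (fun _ _ => rfl)
    · rw [mem_fd] at hd ⊢; rw [dartFace_phi, hd]
    · refine ⟨E.phi.symm d, ?_, E.phi.apply_symm_apply d⟩
      rw [mem_fd] at hd ⊢; rw [← dartFace_phi, E.phi.apply_symm_apply, hd]
  have h0 : ∏ d ∈ E.fd F, udir p d ≠ 0 := by
    refine Finset.prod_ne_zero_iff.2 fun d _ => ?_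
    have n1 := toC_ne (u := p d.snd - p d.fst) (fun e => d.adj.ne (hp (sub_eq_zero.1 e)).symm)
    exact div_ne_zero n1 (by exact_mod_cast (norm_pos_iff.2 n1).ne')
  simp only [E.kap_exp hp, Finset.prod_mul_distrib] at h1
  rw [mul_eq_left₀ h0, ← Complex.exp_sum, Complex.exp_eq_one_iff] at h1
  obtain ⟨n, hn⟩ := h1
  refine ⟨-n, ?_⟩
  rw [← Finset.sum_mul, Finset.sum_neg_distrib, ← Complex.ofReal_sum] at hn
  have h2 := congrArg Complex.im hn
  simp at h2
  push_cast
  linarith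

variable (hC : IsCPTLabelling E big) (hS : Stretches G E big p)
include hS in
lemma kap_sign (d : G.Dart) : E.kap p d < Real.pi ∧ (big d.symm → E.kap p d < 0) ∧ (¬ big d.symm → 0 < E.kap p d) := by
  have h := hS.2.2 d.symm
  have h2 := (ccw_rng (p d.symm.snd - p d.symm.fst) (p (E.rot d.symm).snd - p (E.rot d.symm).fst)).1
  change 0 < dartAngle E p d.symm at h2
  unfold kap
  exact ⟨by linarith, fun hb => by linarith [h.1 hb], fun hb => by linarith [h.2 hb]⟩

include hC in
lemma small_card {F : E.Face} (hF : F ≠ E.outer) : ((E.fd F).filter (fun d => ¬ big d.symm)).card = 3 := by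
  rw [← hC.bounded_small F hF, ← Nat.card_eq_finsetCard]
  refine Nat.card_congr (Equiv.subtypeEquiv (dartSymmPerm G) fun d => ?_)
  rw [Finset.mem_filter, mem_fd]
  change _ ↔ E.dartFace d.symm.symm = F ∧ ¬ big d.symm
  rw [SimpleGraph.Dart.symm_symm]

include hC in
lemma outer_big' {d : G.Dart} (h : E.dartFace d = E.outer) : big d.symm := by
  apply hC.outer_big
  change E.dartFace d.symm.symm = _
  rw [SimpleGraph.Dart.symm_symm, h]

lemma card_darts : (Fintype.card G.Dart : ℤ) = 2 * (Nat.card G.edgeSet : ℤ) := by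
  rw [SimpleGraph.dart_card_eq_twice_card_edges, Nat.card_eq_fintype_card, ← SimpleGraph.edgeFinset_card]
  push_cast; rfl

include hC hS in
lemma face_sum {F : E.Face} (hF : F ≠ E.outer) : ∑ d ∈ E.fd F, E.kap p d = 2 * Real.pi := by
  have hpi := Real.pi_pos
  set u : E.Face → ℝ := fun F => (if F = E.outer then -(2 * Real.pi) else 2 * Real.pi) - ∑ d ∈ E.fd F, E.kap p d with hu
  have h0 : ∀ F, 0 ≤ u F := by
    intro F
    obtain ⟨n, hn⟩ := E.face_int hS.1.1 F
    simp only [hu]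
    split_ifs with h
    · have : ∑ d ∈ E.fd F, E.kap p d < 0 := by
        refine Finset.sum_neg (fun d hd => (E.kap_sign hS d).2.1 (E.outer_big' hC ((E.mem_fd.1 hd).trans h))) ?_
        obtain ⟨d, hd⟩ := Quotient.exists_rep F
        exact ⟨d, E.mem_fd.2 hd⟩
      rw [hn] at this ⊢
      have hn0 : (n : ℝ) < 0 := by by_contra! hh; nlinarith
      have : (n : ℝ) ≤ -1 := by exact_mod_cast Int.le_sub_one_of_lt (by exact_mod_cast hn0 : n < 0)
      nlinarith
    · have h3 := E.small_card hC h
      have : ∑ d ∈ E.fd F, E.kap p d < 3 * Real.pi := by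
        rw [← Finset.sum_filter_add_sum_filter_not _ (fun d : G.Dart => ¬ big d.symm)]
        have a1 : ∑ d ∈ (E.fd F).filter (fun d => ¬ big d.symm), E.kap p d < ∑ d ∈ (E.fd F).filter (fun d => ¬ big d.symm), Real.pi :=
          Finset.sum_lt_sum_of_nonempty (Finset.card_pos.1 (by rw [h3]; norm_num)) (fun d _ => (E.kap_sign hS d).1)
        rw [Finset.sum_const, h3] at a1
        have a2 : ∑ d ∈ (E.fd F).filter (fun d => ¬ ¬ big d.symm), E.kap p d ≤ 0 :=
          Finset.sum_nonpos fun d hd => ((E.kap_sign hS d).2.1 (not_not.1 (Finset.mem_filter.1 hd).2)).le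
        simp only [nsmul_eq_mul] at a1
        push_cast at a1
        linarith
      rw [hn] at this ⊢
      have hn0 : (n : ℝ) < 2 := by by_contra! hh; nlinarith
      have : (n : ℝ) ≤ 1 := by exact_mod_cast Int.le_sub_one_of_lt (by exact_mod_cast hn0 : n < 2)
      nlinarith
  have htot : ∑ F, u F = 0 := by
    simp only [hu]
    rw [Finset.sum_sub_distrib]
    have e1 : ∑ F : E.Face, ∑ d ∈ E.fd F, E.kap p d = ∑ d, E.kap p d := Finset.sum_fiberwise _ _ _
    have e2 : ∑ d, E.kap p d = Fintype.card G.Dart * Real.pi - ∑ d, dartAngle E p d := by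
      rw [← Equiv.sum_comp (dartSymmPerm G) (dartAngle E p)]
      simp [kap, Finset.sum_sub_distrib]
      rfl
    have e3 : ∑ d, dartAngle E p d = Fintype.card V * (2 * Real.pi) := by
      rw [← Finset.sum_fiberwise Finset.univ (fun d : G.Dart => d.fst), Finset.sum_congr rfl (fun v _ => hS.1.2.2 v (E.has_dart v))]
      simp
    have e4 : ∑ F : E.Face, (if F = E.outer then -(2 * Real.pi) else 2 * Real.pi) = (Fintype.card E.Face - 2) * (2 * Real.pi) := by
      have : ∀ F : E.Face, (if F = E.outer then -(2 * Real.pi) else 2 * Real.pi) = 2 * Real.pi - (if F = E.outer then 4 * Real.pi else 0) := by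
        intro F; split_ifs <;> ring
      simp only [this, Finset.sum_sub_distrib, Finset.sum_ite_eq', Finset.mem_univ, if_true, Finset.sum_const, Finset.card_univ, nsmul_eq_mul]
      ring
    have e5 := E.euler
    rw [Nat.card_eq_fintype_card, Nat.card_eq_fintype_card (α := E.Face)] at e5
    have e6 := card_darts (G := G)
    have e7 : (Fintype.card G.Dart : ℝ) = 2 * (Nat.card G.edgeSet : ℝ) := by exact_mod_cast e6
    have e8 : (Fintype.card V : ℝ) + Fintype.card E.Face = Nat.card G.edgeSet + 2 := by exact_mod_cast e5
    rw [e1, e2, e3, e4, e7]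
    linear_combination (2 * Real.pi) * e8
  have := (Finset.sum_eq_zero_iff_of_nonneg (fun F _ => h0 F)).1 htot F (Finset.mem_univ _)
  simp only [hu, if_neg hF] at this
  linarith

include hC in
lemma card_nonpointed : (Fintype.card {v // ¬ PointedVx big v} : ℤ) + 2 * Fintype.card V = Nat.card G.edgeSet + 3 := by
  have e5 := E.euler
  rw [Nat.card_eq_fintype_card, Nat.card_eq_fintype_card (α := E.Face)] at e5
  have e6 := card_darts (G := G)
  have c1 : Fintype.card {v // ¬ PointedVx big v} + Fintype.card {v // PointedVx big v} = Fintype.card V := by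
    have := Fintype.card_subtype_compl (PointedVx big)
    have := Fintype.card_subtype_le (PointedVx big)
    omega
  have c2 : Fintype.card {v // PointedVx big v} = (Finset.univ.filter (fun d : G.Dart => big d.symm)).card := by
    rw [← Fintype.card_coe]
    symm
    refine Fintype.card_of_bijective (f := fun d => ⟨d.1.snd, d.1.symm, (Finset.mem_filter.1 d.2).2, rfl⟩) ⟨?_, ?_⟩
    · rintro ⟨a, ha⟩ ⟨b, hb⟩ h
      have := hC.one_big a.symm b.symm (Finset.mem_filter.1 ha).2 (Finset.mem_filter.1 hb).2 (congrArg Subtype.val h)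
      exact Subtype.ext (SimpleGraph.Dart.symm_involutive.injective this)
    · rintro ⟨v, d, hd, rfl⟩
      exact ⟨⟨d.symm, Finset.mem_filter.2 ⟨Finset.mem_univ _, by rwa [SimpleGraph.Dart.symm_symm]⟩⟩, rfl⟩
  have c3 : (Finset.univ.filter (fun d : G.Dart => big d.symm)).card + (Finset.univ.filter (fun d : G.Dart => ¬ big d.symm)).card
      = Fintype.card G.Dart := Finset.card_filter_add_card_filter_not _
  have c4 : (Finset.univ.filter (fun d : G.Dart => ¬ big d.symm)).card + 3 = 3 * Fintype.card E.Face := by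
    rw [Finset.card_eq_sum_card_fiberwise (f := E.dartFace) (t := Finset.univ) (fun _ _ => Finset.mem_coe.2 (Finset.mem_univ _))]
    have : ∀ F : E.Face, ((Finset.univ.filter (fun d : G.Dart => ¬ big d.symm)).filter (fun d => E.dartFace d = F)).card + (if F = E.outer then 3 else 0) = 3 := by
      intro F
      split_ifs with h
      · rw [Finset.card_eq_zero.2]
        rw [Finset.filter_eq_empty_iff]
        intro d hd hdF
        exact (Finset.mem_filter.1 hd).2 (E.outer_big' hC (hdF.trans h))
      · rw [← E.small_card hC h, add_zero]
        congr 1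
        ext d
        simp only [Finset.mem_filter, Finset.mem_univ, true_and, mem_fd]
        exact and_comm
    have h := Finset.sum_congr (rfl : (Finset.univ : Finset E.Face) = _) (fun F _ => this F)
    rw [Finset.sum_add_distrib] at h
    simp at h
    omega
  omega

include hC hS in
theorem maxp {d : G.Dart} (hb : big d) (hF : E.dartFace d.symm ≠ E.outer) {x y : ℝ} (hxy : ¬ (x = 0 ∧ y = 0)) :
    ∃ e : G.Dart, E.dartFace e = E.dartFace d.symm ∧
      x * (p d.fst).1 + y * (p d.fst).2 < x * (p e.fst).1 + y * (p e.fst).2 := by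
  have hp := hS.1.1
  set D : ℕ → G.Dart := fun i => E.phi^[i] (E.rot d) with hD
  have D0 : D 0 = E.rot d := rfl
  have Ds : ∀ i, D (i + 1) = E.phi (D i) := fun i => Function.iterate_succ_apply' _ _ _
  have hphi : E.phi d.symm = E.rot d := by rw [phi_apply, SimpleGraph.Dart.symm_symm]
  have hDF : ∀ i, E.dartFace (D i) = E.dartFace d.symm := by
    intro i
    induction i with
    | zero => rw [D0, ← hphi, dartFace_phi]
    | succ i ih => rw [Ds, dartFace_phi, ih]
  obtain ⟨t, ht⟩ : ∃ t, Function.minimalPeriod E.phi (E.rot d) = t + 1 :=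
    ⟨_, (Nat.succ_pred_eq_of_pos (Function.minimalPeriod_pos_of_mem_periodicPts
      (E.phi.injective.mem_periodicPts _))).symm⟩
  have hper : D (t + 1) = D 0 := by
    rw [← ht]; exact Function.iterate_minimalPeriod
  have Dt : D t = d.symm := by
    apply E.phi.injective
    rw [← Ds, hper, hphi, D0]
  have hinj : Set.InjOn D (Finset.range (t + 1) : Set ℕ) := by
    have := Function.iterate_injOn_Iio_minimalPeriod (f := E.phi) (x := E.rot d)
    rw [ht] at this
    intro a ha b hb h
    exact this (by simpa using ha) (by simpa using hb) h
  have himg : (Finset.range (t + 1)).image D = E.fd (E.dartFace d.symm) := by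
    ext e
    rw [mem_fd, Finset.mem_image]
    constructor
    · rintro ⟨i, -, rfl⟩; exact hDF i
    · intro he
      have h1 : E.phi.SameCycle (E.rot d) e := E.dartFace_eq.1 (by rw [he, ← hphi, dartFace_phi])
      obtain ⟨n, -, -, hn⟩ := h1.exists_pow_eq''
      refine ⟨n % (t + 1), Finset.mem_range.2 (Nat.mod_lt _ (Nat.succ_pos t)), ?_⟩
      rw [← hn, ← ht]
      simp only [hD]
      rw [Function.iterate_mod_minimalPeriod_eq, Equiv.Perm.iterate_eq_pow]
  have hsum : ∑ i ∈ Finset.range (t + 1), E.kap p (D i) = 2 * Real.pi := by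
    rw [← Finset.sum_image (f := fun e => E.kap p e) hinj, himg, E.face_sum hC hS hF]
  have hcard : ((Finset.range (t + 1)).filter (fun i => ¬ big (D i).symm)).card = 3 := by
    rw [← E.small_card hC hF, ← himg, Finset.filter_image, Finset.card_image_of_injOn]
    exact hinj.mono (fun i hi => (Finset.mem_filter.1 hi).1)
  set S := (Finset.range (t + 1)).filter (fun i => ¬ big (D i).symm) with hSdef
  have hmem : ∀ j, S.orderEmbOfFin hcard j ∈ S := fun j => Finset.orderEmbOfFin_mem S hcard j
  have hlast : ∀ j, S.orderEmbOfFin hcard j < t := by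
    intro j
    obtain ⟨h1, h2⟩ := Finset.mem_filter.1 (hmem j)
    have : S.orderEmbOfFin hcard j ≠ t := by
      intro h
      rw [h, Dt, SimpleGraph.Dart.symm_symm] at h2
      exact h2 hb
    have := Finset.mem_range.1 h1
    omega
  set ψ : ℕ → ℝ := fun i => - Complex.arg (udir p (D 0)) + ∑ j ∈ Finset.range i, E.kap p (D j) with hψ
  have ψs : ∀ i, ψ (i + 1) = ψ i + E.kap p (D i) := fun i => by simp only [hψ, Finset.sum_range_succ]; ring
  have nz : ∀ d : G.Dart, toC (p d.snd - p d.fst) ≠ 0 := fun d => toC_ne fun e => d.adj.ne (hp (sub_eq_zero.1 e)).symm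
  have hdir : ∀ i, udir p (D i) = Complex.exp (((-ψ i : ℝ) : ℂ) * Complex.I) := by
    intro i
    induction i with
    | zero =>
      have h1 : ‖udir p (D 0)‖ = 1 := by
        unfold udir
        rw [norm_div, Complex.norm_real, norm_norm, div_self (norm_ne_zero_iff.2 (nz _))]
      have := Complex.norm_mul_exp_arg_mul_I (udir p (D 0))
      rw [h1, Complex.ofReal_one, one_mul] at this
      rw [← this]
      simp [hψ]
    | succ i ih =>
      rw [Ds, E.kap_exp hp, ih, ← Complex.exp_add, ψs]
      congr 1
      push_cast; ring
  set l : ℕ → ℝ := fun i => ‖toC (p (D i).snd - p (D i).fst)‖ with hl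
  have hvec : ∀ i, toC (p (D i).snd - p (D i).fst) = (l i : ℂ) * Complex.exp (((-ψ i : ℝ) : ℂ) * Complex.I) := by
    intro i
    rw [← hdir]
    unfold udir
    rw [mul_div_cancel₀]
    exact_mod_cast norm_ne_zero_iff.2 (nz (D i))
  have hfst : ∀ i, (D (i + 1)).fst = (D i).snd := fun i => by rw [Ds]; exact E.rot_fst _
  have ρ0 : E.kap p (D t) < 0 := (E.kap_sign hS _).2.1 (by rw [Dt, SimpleGraph.Dart.symm_symm]; exact hb)
  have hd0 : (D 0).fst = d.fst := E.rot_fst d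
  by_cases k1 : x * (p (D 1).fst).1 + y * (p (D 1).fst).2 ≤ x * (p (D 0).fst).1 + y * (p (D 0).fst).2
  swap
  · exact ⟨D 1, hDF 1, by rw [← hd0]; exact not_le.1 k1⟩
  by_cases k2 : x * (p (D t).fst).1 + y * (p (D t).fst).2 ≤ x * (p (D 0).fst).1 + y * (p (D 0).fst).2
  swap
  · exact ⟨D t, hDF t, by rw [← hd0]; exact not_le.1 k2⟩
  refine ⟨_, hDF (S.orderEmbOfFin hcard 1 + 1), ?_⟩
  rw [← hd0]
  refine maxp_seq (t := t) (i1 := S.orderEmbOfFin hcard 0) (i2 := S.orderEmbOfFin hcard 1) (i3 := S.orderEmbOfFin hcard 2)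
    ((S.orderEmbOfFin hcard).strictMono (by decide)) ((S.orderEmbOfFin hcard).strictMono (by decide)) (hlast 2)
    (fun i => p (D i).fst) ψ l (fun i => norm_pos_iff.2 (nz _)) ?_ ?_ (by rw [hper]) ?_ ?_ (ρ := - E.kap p (D t)) (by linarith) ?_ hxy k1 k2
  · intro i
    have := congrArg Complex.re (hvec i)
    rw [Complex.re_ofReal_mul, Complex.exp_ofReal_mul_I_re, Real.cos_neg] at this
    simp only [toC, Prod.fst_sub] at this
    simp only [hfst]
    linarith
  · intro i
    have := congrArg Complex.im (hvec i)
    rw [Complex.im_ofReal_mul, Complex.exp_ofReal_mul_I_im, Real.sin_neg] at this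
    simp only [toC, Prod.snd_sub] at this
    simp only [hfst]
    linarith
  · intro i
    rw [ψs]
    linarith [(E.kap_sign hS (D i)).1]
  · intro i hi n1 n2 n3
    rw [ψs]
    by_cases hbi : big (D i).symm
    · linarith [(E.kap_sign hS (D i)).2.1 hbi]
    · exfalso
      have hiS : i ∈ S := Finset.mem_filter.2 ⟨Finset.mem_range.2 (by omega), hbi⟩
      have : i ∈ Set.range (S.orderEmbOfFin hcard) := by
        rw [Finset.range_orderEmbOfFin]; exact hiS
      obtain ⟨j, rfl⟩ := this
      fin_cases j
      · exact n1 rfl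
      · exact n2 rfl
      · exact n3 rfl
  · rw [Finset.sum_range_succ] at hsum
    simp only [hψ, Finset.sum_range_zero]
    linarith
end pt
end PlaneEmb


namespace PlaneEmb
section lift
open Classical
variable {V : Type} [Fintype V] [DecidableEq V] {G : SimpleGraph V} [DecidableRel G.Adj] (E : PlaneEmb G)
  (p : V → ℝ × ℝ) {big : G.Dart → Prop}

/-- value of an affine function -/
def ev (c : ℝ × ℝ × ℝ) (P : ℝ × ℝ) : ℝ := c.1 * P.1 + c.2.1 * P.2 + c.2.2

/-- affine function vanishing along a dart -/
def nrm (d : G.Dart) : ℝ × ℝ × ℝ := ((p d.snd).2 - (p d.fst).2, -((p d.snd).1 - (p d.fst).1),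
  -((p d.fst).1 * (p d.snd).2 - (p d.fst).2 * (p d.snd).1))

/-- stresses together with liftings -/
def lifts : Submodule ℝ ((G.edgeSet → ℝ) × (E.Face → ℝ × ℝ × ℝ)) where
  carrier := {z | z.2 E.outer = 0 ∧ ∀ d : G.Dart, z.2 (E.dartFace d) - z.2 (E.dartFace d.symm) = z.1 ⟨d.edge, d.edge_mem⟩ • nrm p d}
  add_mem' := by
    rintro a b ⟨ha, ha'⟩ ⟨hb, hb'⟩
    refine ⟨by simp [ha, hb], fun d => ?_⟩
    simp only [Prod.snd_add, Prod.fst_add, Pi.add_apply, add_smul, ← ha', ← hb']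
    abel
  zero_mem' := ⟨rfl, fun d => by simp⟩
  smul_mem' := by
    rintro r a ⟨ha, ha'⟩
    refine ⟨by simp [ha], fun d => ?_⟩
    simp only [Prod.smul_snd, Prod.smul_fst, Pi.smul_apply, smul_assoc, ← ha', smul_sub]

lemma stress_dart {ω : G.edgeSet → ℝ} (hω : Matrix.vecMul ω (rmat (cc p) (Subtype.val : G.edgeSet → Sym2 V)) = 0)
    (v : V) : (∑ d : G.Dart, if d.fst = v then ω ⟨d.edge, d.edge_mem⟩ * ((p d.snd).1 - (p d.fst).1) else 0) = 0 ∧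
      (∑ d : G.Dart, if d.fst = v then ω ⟨d.edge, d.edge_mem⟩ * ((p d.snd).2 - (p d.fst).2) else 0) = 0 := by
  have key : ∀ f : V → ℝ, (∑ d : G.Dart, if d.fst = v then ω ⟨d.edge, d.edge_mem⟩ * (f d.snd - f d.fst) else 0) =
      ∑ e : G.edgeSet, ω e * Sym2.lift ⟨fun u w => - ((f u - f w) * ((if v = u then 1 else 0) - (if v = w then 1 else 0))), by
        intro u w; ring⟩ e.1 := by
    intro f
    rw [← Finset.sum_fiberwise Finset.univ (fun d : G.Dart => (⟨d.edge, d.edge_mem⟩ : G.edgeSet))]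
    refine Finset.sum_congr rfl ?_
    rintro ⟨e, he⟩ -
    induction e using Sym2.ind with
    | _ u w =>
      have huw : G.Adj u w := he
      have : Finset.univ.filter (fun d : G.Dart => (⟨d.edge, d.edge_mem⟩ : G.edgeSet) = ⟨s(u, w), he⟩) =
          {⟨(u, w), huw⟩, (⟨(u, w), huw⟩ : G.Dart).symm} := by
        ext d
        rw [Finset.mem_filter, Finset.mem_insert, Finset.mem_singleton, Subtype.mk_eq_mk]
        simp only [Finset.mem_univ, true_and]
        exact SimpleGraph.dart_edge_eq_iff d ⟨(u, w), huw⟩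
      rw [this, Finset.sum_pair (SimpleGraph.Dart.symm_ne _).symm]
      have hs : ∀ h, (⟨(⟨(u, w), huw⟩ : G.Dart).symm.edge, h⟩ : G.edgeSet) = ⟨s(u, w), he⟩ := fun h => Subtype.ext (SimpleGraph.Dart.edge_symm _)
      rw [hs]
      change (if u = v then ω ⟨s(u, w), he⟩ * (f w - f u) else 0) + (if w = v then ω ⟨s(u, w), he⟩ * (f u - f w) else 0) = _
      simp only [Sym2.lift_mk, eq_comm (a := u) (b := v), eq_comm (a := w) (b := v)]
      split_ifs <;> ring
  constructor
  · rw [key fun v => (p v).1]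
    have h := congrFun hω (Sum.inl v)
    simp only [Matrix.vecMul, dotProduct, Pi.zero_apply] at h
    refine neg_eq_zero.1 (Eq.trans ?_ h)
    rw [← Finset.sum_neg_distrib]
    refine Finset.sum_congr rfl ?_
    rintro ⟨e, he⟩ -
    induction e using Sym2.ind with
    | _ u w =>
      simp [rmat, rrow, cc]
      left; left; congr
  · rw [key fun v => (p v).2]
    have h := congrFun hω (Sum.inr v)
    simp only [Matrix.vecMul, dotProduct, Pi.zero_apply] at h
    refine neg_eq_zero.1 (Eq.trans ?_ h)
    rw [← Finset.sum_neg_distrib]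
    refine Finset.sum_congr rfl ?_
    rintro ⟨e, he⟩ -
    induction e using Sym2.ind with
    | _ u w =>
      simp [rmat, rrow, cc]
      left; left; congr

lemma exists_lift {ω : G.edgeSet → ℝ} (hω : Matrix.vecMul ω (rmat (cc p) (Subtype.val : G.edgeSet → Sym2 V)) = 0) :
    ∃ z ∈ lifts E p, z.1 = ω := by
  have hsym : ∀ d : G.Dart, ω ⟨d.symm.edge, d.symm.edge_mem⟩ = ω ⟨d.edge, d.edge_mem⟩ := fun d => by
    congr 1; exact Subtype.ext (SimpleGraph.Dart.edge_symm d)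
  have hv := stress_dart p hω
  obtain ⟨g1, h1⟩ := E.emb_exact (a := fun d => ω ⟨d.edge, d.edge_mem⟩ * (nrm p d).1)
    (fun d => by rw [hsym]; simp [nrm]; ring) (fun v => (hv v).2)
  obtain ⟨g2, h2⟩ := E.emb_exact (a := fun d => ω ⟨d.edge, d.edge_mem⟩ * (nrm p d).2.1)
    (fun d => by rw [hsym]; simp [nrm]; ring) (fun v => by
      refine neg_eq_zero.1 (Eq.trans ?_ (hv v).1)
      rw [← Finset.sum_neg_distrib]
      refine Finset.sum_congr rfl fun d _ => ?_
      split_ifs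
      · simp only [nrm]; ring
      · simp)
  obtain ⟨g3, h3⟩ := E.emb_exact (a := fun d => ω ⟨d.edge, d.edge_mem⟩ * (nrm p d).2.2)
    (fun d => by rw [hsym]; simp [nrm]; ring) (fun v => by
      have e1 := (hv v).1
      have e2 := (hv v).2
      have : ∀ d : G.Dart, (if d.fst = v then ω ⟨d.edge, d.edge_mem⟩ * (nrm p d).2.2 else 0) =
          (p v).2 * (if d.fst = v then ω ⟨d.edge, d.edge_mem⟩ * ((p d.snd).1 - (p d.fst).1) else 0) -
          (p v).1 * (if d.fst = v then ω ⟨d.edge, d.edge_mem⟩ * ((p d.snd).2 - (p d.fst).2) else 0) := by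
        intro d
        split_ifs with h
        · rw [← h]; simp only [nrm]; ring
        · ring
      rw [Finset.sum_congr rfl (fun d _ => this d), Finset.sum_sub_distrib, ← Finset.mul_sum, ← Finset.mul_sum, e1, e2]
      ring)
  refine ⟨(ω, fun F => (g1 F - g1 E.outer, g2 F - g2 E.outer, g3 F - g3 E.outer)), ⟨by simp, fun d => ?_⟩, rfl⟩
  refine Prod.ext ?_ (Prod.ext ?_ ?_)
  · simpa using (h1 d).symm
  · simpa using (h2 d).symm
  · simpa using (h3 d).symm

/-- height of a vertex -/
noncomputable def hgt (g : E.Face → ℝ × ℝ × ℝ) (v : V) : ℝ := ev (g (E.dartFace (E.has_dart v).choose)) (p v)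

lemma hgt_eq {z} (hz : z ∈ lifts E p) (d : G.Dart) : ev (z.2 (E.dartFace d)) (p d.fst) = hgt E p z.2 d.fst := by
  refine E.rot_closed (fun e => ev (z.2 (E.dartFace e)) (p e.fst) = hgt E p z.2 e.fst) (fun e he => ?_)
    (E.has_dart d.fst).choose_spec ?_
  · rw [E.rot_fst, ← he]
    have h1 := hz.2 e
    have h2 : E.dartFace (E.rot e) = E.dartFace e.symm := by
      rw [← E.dartFace_phi e.symm, phi_apply, SimpleGraph.Dart.symm_symm]
    rw [h2, ← sub_eq_zero]
    rw [sub_eq_iff_eq_add] at h1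
    rw [h1]
    simp [ev, nrm]
    ring
  · rw [(E.has_dart d.fst).choose_spec]; rfl

variable {p}
variable (hC : IsCPTLabelling E big) (hS : Stretches G E big p)
include hC hS

lemma hgt_nonpos {z} (hz : z ∈ lifts E p) (h0 : ∀ v, ¬ PointedVx big v → hgt E p z.2 v = 0) (w : V) : hgt E p z.2 w ≤ 0 := by
  by_contra! hw
  obtain ⟨m, -, hm⟩ := Finset.exists_max_image Finset.univ (hgt E p z.2) ⟨w, Finset.mem_univ _⟩
  obtain ⟨v, hv, hvx⟩ := Finset.exists_max_image (Finset.univ.filter (fun v => hgt E p z.2 v = hgt E p z.2 m)) (fun v => (p v).1)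
    ⟨m, by simp⟩
  replace hv := (Finset.mem_filter.1 hv).2
  have hpos : 0 < hgt E p z.2 v := by rw [hv]; exact hw.trans_le (hm w (Finset.mem_univ _))
  obtain ⟨d, hd, rfl⟩ : PointedVx big v := by
    by_contra h; exact hpos.ne' (h0 v h)
  have hFv : ev (z.2 (E.dartFace d.symm)) (p d.fst) = hgt E p z.2 d.fst := by
    have := hgt_eq E p hz (E.rot d)
    rwa [E.rot_fst, ← d.symm_symm, ← phi_apply, dartFace_phi, d.symm_symm] at this
  have hF : E.dartFace d.symm ≠ E.outer := by
    intro h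
    rw [h, hz.1] at hFv
    simp [ev] at hFv
    linarith
  by_cases hc : (z.2 (E.dartFace d.symm)).1 = 0 ∧ (z.2 (E.dartFace d.symm)).2.1 = 0
  · obtain ⟨e, he, hlt⟩ := E.maxp hC hS hd hF (x := 1) (y := 0) (by simp)
    have h1 := hgt_eq E p hz e
    rw [he] at h1
    have h2 : hgt E p z.2 e.fst = hgt E p z.2 m := by
      rw [← h1, ← hv, ← hFv]; simp [ev, hc.1, hc.2]
    have := hvx e.fst (Finset.mem_filter.2 ⟨Finset.mem_univ _, h2⟩)
    linarith
  · obtain ⟨e, he, hlt⟩ := E.maxp hC hS hd hF hc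
    have h1 := hgt_eq E p hz e
    rw [he] at h1
    have h2 := hm e.fst (Finset.mem_univ _)
    rw [← h1, ← hv, ← hFv] at h2
    simp only [ev] at h2
    linarith

lemma lift_zero {z} (hz : z ∈ lifts E p) (h0 : ∀ v, ¬ PointedVx big v → hgt E p z.2 v = 0) : z = 0 := by
  have nz : ∀ d : G.Dart, p d.snd - p d.fst ≠ 0 := fun d e => d.adj.ne (hS.1.1 (sub_eq_zero.1 e)).symm
  have hneg : ∀ v, hgt E p (-z).2 v = - hgt E p z.2 v := fun v => by
    simp [hgt, ev]; ring
  have hh : ∀ v, hgt E p z.2 v = 0 := by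
    intro v
    have h1 := hgt_nonpos E hC hS hz h0 v
    have h2 := hgt_nonpos E hC hS (neg_mem hz) (fun u hu => by rw [hneg, h0 u hu, neg_zero]) v
    rw [hneg] at h2
    linarith
  have hg : ∀ F, z.2 F = 0 := by
    intro F
    by_cases hF : F = E.outer
    · rw [hF, hz.1]
    · have h3 := E.small_card hC hF
      obtain ⟨d, hd⟩ := Finset.card_pos.1 (by rw [h3]; norm_num)
      obtain ⟨hdF, hdb⟩ := Finset.mem_filter.1 hd
      rw [mem_fd] at hdF
      have hcr := (ccw_lt (nz d.symm) (nz (E.rot d.symm))).1 ((hS.2.2 d.symm).2 hdb)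
      have e1 := hgt_eq E p hz d
      have e2 := hgt_eq E p hz (E.phi d)
      have e3 := hgt_eq E p hz (E.phi (E.phi d))
      rw [dartFace_phi] at e2
      rw [dartFace_phi, dartFace_phi] at e3
      simp only [hh, hdF, phi_apply, E.rot_fst] at e1 e2 e3
      change ev _ (p d.snd) = 0 at e2
      change ev _ (p (E.rot d.symm).snd) = 0 at e3
      rw [E.rot_fst] at hcr
      change 0 < crs (p d.fst - p d.snd) (p (E.rot d.symm).snd - p d.snd) at hcr
      simp only [ev, crs, Prod.fst_sub, Prod.snd_sub] at e1 e2 e3 hcr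
      generalize z.2 F = c at *
      have k1 : c.1 * (((p d.fst).1 - (p d.snd).1) * ((p (E.rot d.symm).snd).2 - (p d.snd).2) -
          ((p d.fst).2 - (p d.snd).2) * ((p (E.rot d.symm).snd).1 - (p d.snd).1)) = 0 := by
        linear_combination (e1 - e2) * ((p (E.rot d.symm).snd).2 - (p d.snd).2) - (e3 - e2) * ((p d.fst).2 - (p d.snd).2)
      have k2 : c.2.1 * (((p d.fst).1 - (p d.snd).1) * ((p (E.rot d.symm).snd).2 - (p d.snd).2) -
          ((p d.fst).2 - (p d.snd).2) * ((p (E.rot d.symm).snd).1 - (p d.snd).1)) = 0 := by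
        linear_combination (e3 - e2) * ((p d.fst).1 - (p d.snd).1) - (e1 - e2) * ((p (E.rot d.symm).snd).1 - (p d.snd).1)
      have c1 := (mul_eq_zero.1 k1).resolve_right hcr.ne'
      have c2 := (mul_eq_zero.1 k2).resolve_right hcr.ne'
      rw [c1, c2] at e1
      refine Prod.ext c1 (Prod.ext c2 ?_)
      change c.2.2 = 0
      linarith
  refine Prod.ext ?_ (funext hg)
  funext ⟨e, he⟩
  induction e using Sym2.ind with
  | _ u w =>
    have h := hz.2 ⟨(u, w), he⟩
    rw [hg, hg, sub_zero] at h
    by_contra hne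
    have h4 := (smul_eq_zero.1 h.symm).resolve_left hne
    have h5 := nz ⟨(u, w), he⟩
    apply h5
    have a1 := congrArg (fun t => t.1) h4
    have a2 := congrArg (fun t => t.2.1) h4
    simp only [nrm, Prod.fst_zero, Prod.snd_zero, neg_eq_zero] at a1 a2
    exact Prod.ext a2 a1

theorem pt_rigid : GenRigid G := by
  have h2 : 2 ≤ Fintype.card V := by
    obtain ⟨d, -⟩ := Quotient.exists_rep E.outer
    exact Fintype.one_lt_card_iff.2 ⟨d.fst, d.snd, d.adj.ne⟩
  refine genRigid_of_rank G h2 p ?_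
  set A := rmat (cc p) (Subtype.val : G.edgeSet → Sym2 V) with hA
  let Λ : lifts E p →ₗ[ℝ] ({v // ¬ PointedVx big v} → ℝ) :=
    { toFun := fun z v => hgt E p z.1.2 v.1
      map_add' := fun a b => by funext v; simp [hgt, ev]; ring
      map_smul' := fun r a => by funext v; simp [hgt, ev]; ring }
  have hinj : Function.Injective Λ := by
    rw [← LinearMap.ker_eq_bot, LinearMap.ker_eq_bot']
    intro z hz
    exact Subtype.ext (lift_zero E hC hS z.2 (fun v hv => congrFun hz ⟨v, hv⟩))
  have c1 := LinearMap.finrank_le_finrank_of_injective hinj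
  rw [Module.finrank_fintype_fun_eq_card] at c1
  have c2 : LinearMap.ker A.transpose.mulVecLin ≤ (lifts E p).map (LinearMap.fst ℝ _ _) := by
    intro ω hω
    have hω' : Matrix.vecMul ω A = 0 := by
      rw [← Matrix.mulVec_transpose]; exact hω
    obtain ⟨z, hz, rfl⟩ := exists_lift E p hω'
    exact ⟨z, hz, rfl⟩
  have c3 := (Submodule.finrank_mono c2).trans (Submodule.finrank_map_le _ _)
  have c4 := LinearMap.finrank_range_add_finrank_ker A.transpose.mulVecLin
  rw [Module.finrank_fintype_fun_eq_card] at c4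
  change A.transpose.rank + _ = _ at c4
  rw [Matrix.rank_transpose] at c4
  have c5 := E.card_nonpointed hC
  rw [← Nat.card_eq_fintype_card (α := {x // x ∈ G.edgeSet})] at c4
  change _ = Nat.card G.edgeSet at c4
  omega
end lift
end PlaneEmb

theorem planar_and_genRigid_iff_graph_of_pseudoTriangulation
    {V : Type} [Fintype V] [DecidableEq V] (G : SimpleGraph V) [DecidableRel G.Adj] :
    (Nonempty (PlaneEmb G) ∧ GenRigid G) ↔
      ∃ (E : PlaneEmb G) (p : V → ℝ × ℝ), StretchesToPT G E p := by
  constructor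
  · rintro ⟨⟨E⟩, hR⟩
    have h2 : 2 ≤ Fintype.card V := by
      obtain ⟨d, -⟩ := Quotient.exists_rep E.outer
      exact Fintype.one_lt_card_iff.2 ⟨d.fst, d.snd, d.adj.ne⟩
    obtain ⟨L, hL, hLam⟩ := exists_laman G h2 hR
    have hL' : L ⊆ E.toPM.edges := by
      intro e he
      have h := hL e he
      clear he
      induction e using Sym2.ind with
      | _ u w => exact E.toPM.mem_edges.2 ⟨⟨(u, w), h⟩, rfl⟩
    obtain ⟨p, W⟩ := PM.realize _ E.toPM E.toPM_simple L hL' hLam rfl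
    exact ⟨E, p, E.toStretch W⟩
  · rintro ⟨E, p, big, hC, hS⟩
    exact ⟨⟨E⟩, E.pt_rigid hC hS⟩
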